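/- Let {u^ν} be a sequence of strong solutions of the incompressible Navier–Stokes equations on 𝕋³ with viscosities ν on [0,T], uniformly bounded in ν (as ν → 0) in L³((0,T); B^α_{3,∞}(𝕋³)) ∩ L^∞((0,T); H^β(𝕋³)) with α > 2/3 and β > 1/2. Then: (i) there exists at least one subsequence {u^{ν_k}} converging strongly in L³(𝕋³×(0,T)) to a limit u; (ii) for any such strong limit u, the convergence u^{ν_k} → u holds in L³((0,T); B^{α−θ}_{3,∞}(𝕋³)) ∩ L^∞((0,T); H^{β−θ}(𝕋³)) for every θ > 0; and (iii) any such limit u is a functional vorticity solution of the Euler equations which conserves the global helicity ℋ(t) = ⟨ω(·,t), u(·,t)⟩ for almost every time. -/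

import Mathlib

open MeasureTheory Filter Topology Complex
open scoped ENNReal Real NNReal

noncomputable section

namespace PaperHelicity

/-! Spatial points: we model the torus `𝕋³` by ℤ³-periodic functions on
Euclidean space `ℝ³`, with the cube `[0,1)³` as fundamental domain. -/

abbrev Vec : Type := EuclideanSpace ℝ (Fin 3)

/-- The integer lattice `ℤ³`. -/
abbrev Lat : Type := Fin 3 → ℤ

/-- Embedding of the lattice into space. -/
def latv (n : Lat) : Vec := (WithLp.equiv 2 (Fin 3 → ℝ)).symm fun i => (n i : ℝ)

/-- A fundamental domain for the torus. -/
def cube : Set Vec := {x : Vec | ∀ i, 0 ≤ x i ∧ x i < 1}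

/-- The measure on the torus: Lebesgue measure restricted to the fundamental domain. -/
def μT : Measure Vec := volume.restrict cube

/-- Lebesgue measure on the time interval `(0,T)`. -/
def tIoo (T : ℝ) : Measure ℝ := volume.restrict (Set.Ioo 0 T)

/-- ℤ³-periodicity. -/
def Per {E : Type*} (f : Vec → E) : Prop := ∀ (x : Vec) (n : Lat), f (x + latv n) = f x

/-- The Fourier character `e^{2πi n·x}`. -/
def chr (n : Lat) (x : Vec) : ℂ :=
  Complex.exp (2 * Real.pi * Complex.I * (∑ i, (n i : ℂ) * (x i : ℂ)))

/-- Fourier coefficient on the torus. -/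
def fc (f : Vec → ℂ) (n : Lat) : ℂ := ∫ x in cube, f x * (starRingEnd ℂ) (chr n x)

/-- Euclidean norm of a lattice point. -/
def latNorm (n : Lat) : ℝ := Real.sqrt (∑ i, ((n i : ℝ)) ^ 2)

def latSq (n : Lat) : ℝ := ∑ i, ((n i : ℝ)) ^ 2

/-- Squared Sobolev `H^s` norm of a (periodic distribution given by its) Fourier
coefficient sequence. -/
def sobSqC (s : ℝ) (c : Lat → ℂ) : ℝ≥0∞ :=
  ∑' n : Lat, ENNReal.ofReal ((1 + latNorm n ^ 2) ^ s * ‖c n‖ ^ 2)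

def HsNormC (s : ℝ) (c : Lat → ℂ) : ℝ≥0∞ := sobSqC s c ^ (1/2 : ℝ)

def HsNorm (s : ℝ) (f : Vec → ℂ) : ℝ≥0∞ := HsNormC s (fc f)

/-- `H^s` norm of an `ℝ³`-valued field. -/
def HsNormV (s : ℝ) (u : Vec → Vec) : ℝ≥0∞ := ∑ j : Fin 3, HsNorm s fun x => (u x j : ℂ)

/-- The `j`-th dyadic shell in frequency space. -/
def shell (j : ℕ) : Set Lat := {n | (2:ℝ) ^ j ≤ latNorm n ∧ latNorm n < (2:ℝ) ^ (j + 1)}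

/-- Littlewood-Paley block of a coefficient sequence (a finite trigonometric sum). -/
def lpBlockC (j : ℕ) (c : Lat → ℂ) (x : Vec) : ℂ :=
  ∑' n : Lat, (shell j).indicator (fun m => c m * chr m x) n

/-- Low-frequency Littlewood-Paley block. -/
def lpLowC (c : Lat → ℂ) (x : Vec) : ℂ :=
  ∑' n : Lat, ({m : Lat | latNorm m < 1}).indicator (fun m => c m * chr m x) n

/-- Besov `B^s_{p,q}` norm of a coefficient sequence, via Littlewood-Paley decomposition. -/
def besovC (s : ℝ) (p q : ℝ≥0∞) (c : Lat → ℂ) : ℝ≥0∞ :=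
  eLpNorm (lpLowC c) p μT +
    if q = ∞ then ⨆ j : ℕ, ENNReal.ofReal ((2:ℝ) ^ (s * (j:ℝ))) * eLpNorm (lpBlockC j c) p μT
    else (∑' j : ℕ, (ENNReal.ofReal ((2:ℝ) ^ (s * (j:ℝ))) * eLpNorm (lpBlockC j c) p μT)
      ^ q.toReal) ^ (1 / q.toReal)

def besov (s : ℝ) (p q : ℝ≥0∞) (f : Vec → ℂ) : ℝ≥0∞ := besovC s p q (fc f)

def besovV (s : ℝ) (p q : ℝ≥0∞) (u : Vec → Vec) : ℝ≥0∞ :=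
  ∑ j : Fin 3, besov s p q fun x => (u x j : ℂ)

/-- Reconstruction of a function from its Fourier coefficients. -/
def recon (c : Lat → ℂ) (x : Vec) : ℂ := ∑' n : Lat, c n * chr n x

/-- The `L^r((0,T))` norm (in time) of a nonnegative quantity. -/
def timeNorm (r : ℝ≥0∞) (T : ℝ) (F : ℝ → ℝ≥0∞) : ℝ≥0∞ :=
  if r = ∞ then essSup F (tIoo T)
  else (∫⁻ t, F t ^ r.toReal ∂tIoo T) ^ (1 / r.toReal)

/-- Spatial partial derivative in the `i`-th coordinate direction. -/
def pd {E : Type*} [NormedAddCommGroup E] [NormedSpace ℝ E] (i : Fin 3) (g : Vec → E)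
    (x : Vec) : E :=
  fderiv ℝ g x (EuclideanSpace.single i (1:ℝ))

/-- Time derivative of a time-dependent field. -/
def tderiv {E : Type*} [NormedAddCommGroup E] [NormedSpace ℝ E] (f : ℝ → Vec → E)
    (t : ℝ) (x : Vec) : E :=
  deriv (fun s => f s x) t

/-- Laplacian. -/
def lap (g : Vec → ℝ) (x : Vec) : ℝ := ∑ i, pd i (fun y => pd i g y) x

/-- Test functions on `𝕋³ × (0,T)`: smooth, ℤ³-periodic in space, compactly supported
in time inside `(0,T)`. -/
structure TestFun (T : ℝ) (E : Type*) [NormedAddCommGroup E] [NormedSpace ℝ E] where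
  f : ℝ → Vec → E
  smooth : ContDiff ℝ (⊤ : ℕ∞) (Function.uncurry f)
  periodic : ∀ t, Per (f t)
  compactIn : ∃ a b : ℝ, 0 < a ∧ b < T ∧ ∀ t, t ∉ Set.Icc a b → f t = 0

/-- Purely spatial test functions on `𝕋³`. -/
structure SpTest (E : Type*) [NormedAddCommGroup E] [NormedSpace ℝ E] where
  f : Vec → E
  smooth : ContDiff ℝ (⊤ : ℕ∞) f
  periodic : Per f

/-- A divergence-free (vector-valued) test function. -/
def DivFreeT {T : ℝ} (ζ : TestFun T Vec) : Prop :=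
  ∀ t x, ∑ i, pd i (fun y => ζ.f t y i) x = 0

/-- A time-dependent field is weakly divergence free. -/
def WeakDivFree (T : ℝ) (u : ℝ → Vec → Vec) : Prop :=
  ∀ φ : TestFun T ℝ,
    (∫ t in Set.Ioo 0 T, ∫ x in cube, ∑ i, u t x i * pd i (φ.f t) x) = 0

def eulerIntegrand (u : ℝ → Vec → Vec) (ζ ζt : ℝ → Vec → Vec) (t : ℝ) : ℝ :=
  ∫ x in cube,
    ((∑ j, u t x j * ζt t x j) + ∑ i, ∑ j, u t x i * u t x j * pd i (fun y => ζ t y j) x)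

/-- `u` is a weak solution of the incompressible Euler equations (standard sense). -/
def EulerWeak (T : ℝ) (u : ℝ → Vec → Vec) : Prop :=
  ∀ ζ : TestFun T Vec, DivFreeT ζ →
    (∫ t in Set.Ioo 0 T, eulerIntegrand u ζ.f (tderiv ζ.f) t) = 0

/-- Fourier coefficients of the vorticity `ω = ∇ × u` (a distribution). -/
def curlC (u : Vec → Vec) (n : Lat) (j : Fin 3) : ℂ :=
  2 * Real.pi * Complex.I *
    ((n (j + 1) : ℂ) * fc (fun x => (u x (j + 2) : ℂ)) n -
     (n (j + 2) : ℂ) * fc (fun x => (u x (j + 1) : ℂ)) n)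

def ωC (u : Vec → Vec) (j : Fin 3) : Lat → ℂ := fun n => curlC u n j

def uC (u : Vec → Vec) (i : Fin 3) : Vec → ℂ := fun x => (u x i : ℂ)

/-- Duality pairing of a periodic distribution (given by its Fourier coefficients)
with a function. -/
def dpair (c : Lat → ℂ) (g : Vec → ℂ) : ℂ := ∑' n : Lat, c n * fc g (-n)

/-- The integrand (in time) of the weak vorticity formulation, with the nonlinearity
interpreted by duality/paraproducts: `⟨ω, ∂ₜψ⟩ + ⟨u⊗ω - ω⊗u, ∇ψ⟩`. -/
def vortIntegrand (u : Vec → Vec) (ψ ψt : Vec → Vec) : ℂ :=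
  (∑ j, dpair (ωC u j) fun x => (ψt x j : ℂ)) +
    ∑ i, ∑ j,
      (dpair (ωC u j) (fun x => ((u x i * pd i (fun y => ψ y j) x : ℝ) : ℂ)) -
       dpair (ωC u i) (fun x => ((u x j * pd i (fun y => ψ y j) x : ℝ) : ℂ)))

/-- The weak (paraproduct) formulation of the vorticity equation. -/
def VortWeak (T : ℝ) (u : ℝ → Vec → Vec) : Prop :=
  ∀ ψ : TestFun T Vec,
    (∫ t in Set.Ioo 0 T, vortIntegrand (u t) (ψ.f t) (tderiv ψ.f t)) = 0

/-- `(u, ω)` (with `ω = ∇ × u` determined by `u`) is a functional vorticity solution of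
the Euler equations. -/
def IsFVS (T : ℝ) (u : ℝ → Vec → Vec) : Prop :=
  Measurable (Function.uncurry u) ∧ (∀ t, Per (u t)) ∧
    (∃ ε > 0, timeNorm ∞ T (fun t => HsNormV (1/2 + ε) (u t)) < ∞) ∧
    WeakDivFree T u ∧ VortWeak T u

/-- A standard radial smooth compactly supported mollifier of total mass one. -/
structure Mollifier where
  φ : Vec → ℝ
  smooth : ContDiff ℝ (⊤ : ℕ∞) φ
  cpt : HasCompactSupport φ
  nonneg : ∀ x, 0 ≤ φ x
  radial : ∀ x y : Vec, ‖x‖ = ‖y‖ → φ x = φ y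
  mass : (∫ x : Vec, φ x) = 1

/-- The rescaled mollifier `φ_ε`. -/
def mscale (m : Mollifier) (ε : ℝ) (x : Vec) : ℝ := (ε ^ 3)⁻¹ * m.φ (ε⁻¹ • x)

/-- Increment `δu(ξ;x) = u(x+ξ) - u(x)`. -/
def du (u : Vec → Vec) (ξ x : Vec) : Vec := u (x + ξ) - u x

/-- The pairing `⟨δu (δω · δu), φ⟩` (`k`-th component), with `δω` interpreted by duality. -/
def defPair1 (u : Vec → Vec) (φ : Vec → ℝ) (ξ : Vec) (k : Fin 3) : ℂ :=
  ∑ j, dpair (ωC u j) fun x =>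
    ((du u (-ξ) x k * du u (-ξ) x j * φ (x - ξ) - du u ξ x k * du u ξ x j * φ x : ℝ) : ℂ)

/-- The pairing `⟨δω |δu|², φ⟩` (`k`-th component), with `δω` interpreted by duality. -/
def defPair2 (u : Vec → Vec) (φ : Vec → ℝ) (ξ : Vec) (k : Fin 3) : ℂ :=
  dpair (ωC u k) fun x =>
    (((∑ j, du u (-ξ) x j ^ 2) * φ (x - ξ) - (∑ j, du u ξ x j ^ 2) * φ x : ℝ) : ℂ)

/-- `⟨D_{1,ε}(u,ω), φ⟩ = ∫ ∇φ_ε(ξ) · ⟨δu (δω·δu), φ⟩ dξ`. -/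
def D1pair (m : Mollifier) (ε : ℝ) (u : Vec → Vec) (φ : Vec → ℝ) : ℂ :=
  ∫ ξ : Vec, ∑ k, ((pd k (mscale m ε) ξ : ℝ) : ℂ) * defPair1 u φ ξ k

/-- `⟨D_{2,ε}(u,ω), φ⟩ = ∫ ∇φ_ε(ξ) · ⟨δω |δu|², φ⟩ dξ`. -/
def D2pair (m : Mollifier) (ε : ℝ) (u : Vec → Vec) (φ : Vec → ℝ) : ℂ :=
  ∫ ξ : Vec, ∑ k, ((pd k (mscale m ε) ξ : ℝ) : ℂ) * defPair2 u φ ξ k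

/-- The local terms of the helicity balance, paired with a test function:
`-⟨2ωu, ∂ₜφ⟩ + ⟨2∇·(pω) + ∇·(2(u·ω)u - |u|²ω), φ⟩`. -/
def helLocal (u : Vec → Vec) (p : Vec → ℝ) (φt φ : Vec → ℝ) : ℂ :=
  -2 * (∑ j, dpair (ωC u j) fun x => ((u x j * φt x : ℝ) : ℂ))
    - 2 * (∑ j, dpair (ωC u j) fun x => ((p x * pd j φ x : ℝ) : ℂ))
    - 2 * (∑ i, ∑ j, dpair (ωC u i) fun x => ((u x i * u x j * pd j φ x : ℝ) : ℂ))
    + ∑ j, dpair (ωC u j) fun x => (((∑ i, u x i ^ 2) * pd j φ x : ℝ) : ℂ)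

/-- `p` is the pressure associated with `u`: `-Δp = (∇⊗∇):(u⊗u)`, `∫ p = 0` (in Fourier form). -/
def PressureOf (u : Vec → Vec) (p : Vec → ℝ) : Prop :=
  fc (fun x => (p x : ℂ)) 0 = 0 ∧
    ∀ n : Lat,
      ((4 * Real.pi ^ 2 * latSq n : ℝ) : ℂ) * fc (fun x => (p x : ℂ)) n =
        ∑ i, ∑ j, (2 * Real.pi * Complex.I * (n i : ℂ)) * (2 * Real.pi * Complex.I * (n j : ℂ)) *
          fc (fun x => ((u x i * u x j : ℝ) : ℂ)) n

/-- The helicity `⟨ω, u⟩` at a fixed time (an `H^{-1/2} × H^{1/2}` duality pairing). -/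
def hel (u : Vec → Vec) : ℂ := ∑ j, dpair (ωC u j) (uC u j)

end PaperHelicity

namespace PaperHelicity

/-! ### Mollification in Fourier form, explicit mollified defect terms -/

/-- The Fourier transform of the rescaled mollifier at the lattice frequency `n`. -/
def molHat (m : Mollifier) (ε : ℝ) (n : Lat) : ℂ :=
  ∫ ξ : Vec, (mscale m ε ξ : ℂ) * (starRingEnd ℂ) (chr n ξ)

/-- Mollified reconstruction of a periodic distribution: `(T * φ_ε)(x)`. -/
def reconMol (m : Mollifier) (ε : ℝ) (c : Lat → ℂ) (x : Vec) : ℂ :=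
  ∑' n : Lat, c n * molHat m ε n * chr n x

/-- Fourier coefficients of the (para)product of a distribution and a function. -/
def pprodC (c : Lat → ℂ) (g : Vec → ℂ) (n : Lat) : ℂ := ∑' k : Lat, c k * fc g (n - k)

/-- Mollification of a function: `(g * φ_ε)(x)`. -/
def conv (m : Mollifier) (ε : ℝ) (g : Vec → ℝ) (x : Vec) : ℝ :=
  ∫ y : Vec, mscale m ε y * g (x - y)

/-- `⟨D_{1,ε}(u,ω), φ⟩` where `D_{1,ε} = -∇·((ω·u)u)^ε + u·∇(ω·u)^ε + u·(∇·(u⊗ω)^ε)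
+ ω·(∇·(u⊗u)^ε) - u⊗ω:∇u^ε - u⊗u:∇ω^ε` (products interpreted as paraproducts). -/
def D1explicit (m : Mollifier) (ε : ℝ) (u : Vec → Vec) (φ : Vec → ℝ) : ℂ :=
  (∑ i, ∑ j, dpair (ωC u i) fun x => uC u i x * uC u j x * ((pd j (conv m ε φ) x : ℝ) : ℂ))
  + (∫ x in cube,
      (∑ i, uC u i x * pd i (reconMol m ε fun n => ∑ j, pprodC (ωC u j) (uC u j) n) x)
        * ((φ x : ℝ) : ℂ))
  + (∫ x in cube,
      (∑ i, ∑ j, uC u j x * pd i (reconMol m ε (pprodC (ωC u j) (uC u i))) x) * ((φ x : ℝ) : ℂ))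
  + (∑ j, dpair (ωC u j) fun x =>
      (∑ i, pd i (reconMol m ε (fc fun y => uC u i y * uC u j y)) x) * ((φ x : ℝ) : ℂ))
  - (∑ i, ∑ j, dpair (ωC u j) fun x =>
      uC u i x * pd i (reconMol m ε (fc (uC u j))) x * ((φ x : ℝ) : ℂ))
  - (∫ x in cube,
      (∑ i, ∑ j, uC u i x * uC u j x * pd i (reconMol m ε (ωC u j)) x) * ((φ x : ℝ) : ℂ))

/-- `⟨D_{2,ε}(u,ω), φ⟩` where `D_{2,ε} = -∇·(|u|²ω)^ε + ω·∇(|u|²)^ε + 2u·(∇·(ω⊗u)^ε)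
- 2ω⊗u:∇u^ε` (products interpreted as paraproducts). -/
def D2explicit (m : Mollifier) (ε : ℝ) (u : Vec → Vec) (φ : Vec → ℝ) : ℂ :=
  (∑ j, dpair (ωC u j) fun x =>
      (((∑ i, u x i ^ 2) : ℝ) : ℂ) * ((pd j (conv m ε φ) x : ℝ) : ℂ))
  + (∑ j, dpair (ωC u j) fun x =>
      pd j (reconMol m ε (fc fun y => (((∑ i, u y i ^ 2) : ℝ) : ℂ))) x * ((φ x : ℝ) : ℂ))
  + 2 * (∫ x in cube,
      (∑ i, ∑ j, uC u j x * pd i (reconMol m ε (pprodC (ωC u i) (uC u j))) x) * ((φ x : ℝ) : ℂ))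
  - 2 * (∑ i, ∑ j, dpair (ωC u i) fun x =>
      uC u j x * pd i (reconMol m ε (fc (uC u j))) x * ((φ x : ℝ) : ℂ))

/-! ### Navier-Stokes -/

/-- A strong solution of the incompressible Navier-Stokes equations with viscosity `ν`
on `[0,T]`. -/
def IsStrongNS (ν T : ℝ) (u : ℝ → Vec → Vec) : Prop :=
  (∀ t, Per (u t)) ∧ (∀ t ∈ Set.Icc 0 T, ContDiff ℝ (⊤ : ℕ∞) (u t)) ∧
    (∀ t ∈ Set.Icc 0 T, ∀ x : Vec, ∑ i, pd i (fun y => u t y i) x = 0) ∧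
    ∃ p : ℝ → Vec → ℝ, (∀ t, Per (p t)) ∧ (∀ t ∈ Set.Icc 0 T, ContDiff ℝ (⊤ : ℕ∞) (p t)) ∧
      ∀ t ∈ Set.Ioo 0 T, ∀ x : Vec, ∀ j,
        HasDerivAt (fun s => u s x j)
          (ν * (∑ i, pd i (fun y => pd i (fun z => u t z j) y) x)
            - (∑ i, u t x i * pd i (fun y => u t y j) x) - pd j (p t) x) t

/-- Convergence in `L³(𝕋³ × (0,T))`. -/
def L3conv (T : ℝ) (w : ℕ → ℝ → Vec → Vec) (v : ℝ → Vec → Vec) : Prop :=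
  Tendsto (fun k => ∫⁻ t, (∫⁻ x, (‖w k t x - v t x‖₊ : ℝ≥0∞) ^ (3:ℝ) ∂μT) ∂tIoo T)
    atTop (𝓝 0)

/-! ### Spherical averages (third-order structure functions) -/

def mkVec (a b c : ℝ) : Vec := (WithLp.equiv 2 (Fin 3 → ℝ)).symm ![a, b, c]

/-- Parametrization of the unit sphere `𝕊²`. -/
def sphMap (θ ϕ : ℝ) : Vec :=
  mkVec (Real.sin θ * Real.cos ϕ) (Real.sin θ * Real.sin ϕ) (Real.cos θ)

/-- The pairing `⟨(δu(ζ)·dir)(δω(ζ)·δu(ζ)), φ⟩`, with `δω` interpreted by duality. -/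
def spIncr1 (u : Vec → Vec) (φ : Vec → ℝ) (ζ dir : Vec) : ℂ :=
  ∑ j, dpair (ωC u j) fun x =>
    (((∑ k, du u ζ (x - ζ) k * dir k) * du u ζ (x - ζ) j * φ (x - ζ)
        - (∑ k, du u ζ x k * dir k) * du u ζ x j * φ x : ℝ) : ℂ)

/-- The pairing `⟨(δω(ζ)·dir)|δu(ζ)|², φ⟩`, with `δω` interpreted by duality. -/
def spIncr2 (u : Vec → Vec) (φ : Vec → ℝ) (ζ dir : Vec) : ℂ :=
  ∑ j, ((dir j : ℝ) : ℂ) * dpair (ωC u j) fun x =>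
    (((∑ k, du u ζ (x - ζ) k ^ 2) * φ (x - ζ) - (∑ k, du u ζ x k ^ 2) * φ x : ℝ) : ℂ)

/-- `⟨S₁(u,ω,r), φ⟩`: the spherical average of the first third-order structure function,
paired with a test function (surface measure on `𝕊²`, total mass `4π`). -/
def S1pair (u : Vec → Vec) (φ : Vec → ℝ) (r : ℝ) : ℂ :=
  ∫ θ in (0:ℝ)..Real.pi, ∫ ϕ in (0:ℝ)..(2 * Real.pi),
    ((Real.sin θ : ℝ) : ℂ) * spIncr1 u φ (r • sphMap θ ϕ) (sphMap θ ϕ)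

/-- `⟨S₂(u,ω,r), φ⟩`. -/
def S2pair (u : Vec → Vec) (φ : Vec → ℝ) (r : ℝ) : ℂ :=
  ∫ θ in (0:ℝ)..Real.pi, ∫ ϕ in (0:ℝ)..(2 * Real.pi),
    ((Real.sin θ : ℝ) : ℂ) * spIncr2 u φ (r • sphMap θ ϕ) (sphMap θ ϕ)

/-! ### MHD -/

def dotV (a b : Vec) : ℝ := ∑ j, a j * b j

/-- `(a ⊗ b) : ∇ψ` at the point `x`. -/
def advPair (a b : Vec → Vec) (ψ : Vec → Vec) (x : Vec) : ℝ :=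
  ∑ i, ∑ j, a x i * b x j * pd i (fun y => ψ y j) x

/-- Weak solution of the ideal MHD equations (with divergence-free magnetic field as
part of the definition). -/
def MHDWeakDF (T : ℝ) (u B : ℝ → Vec → Vec) : Prop :=
  (∀ ψ : TestFun T Vec, DivFreeT ψ →
    (∫ t in Set.Ioo 0 T, ∫ x in cube,
      (dotV (u t x) (tderiv ψ.f t x) + advPair (u t) (u t) (ψ.f t) x
        - advPair (B t) (B t) (ψ.f t) x)) = 0) ∧
  (∀ ψ : TestFun T Vec, DivFreeT ψ →
    (∫ t in Set.Ioo 0 T, ∫ x in cube,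
      (dotV (B t x) (tderiv ψ.f t x) + advPair (u t) (B t) (ψ.f t) x
        - advPair (B t) (u t) (ψ.f t) x)) = 0) ∧
  WeakDivFree T u ∧ WeakDivFree T B

/-- `dB` is the weak divergence of `B`. -/
def WeakDiv (T : ℝ) (B : ℝ → Vec → Vec) (dB : ℝ → Vec → ℝ) : Prop :=
  ∀ φ : TestFun T ℝ,
    (∫ t in Set.Ioo 0 T, ∫ x in cube,
      (dB t x * φ.f t x + ∑ j, B t x j * pd j (φ.f t) x)) = 0

/-- Weak solution of the ideal MHD equations in the generalized sense allowing
`∇·B ≠ 0` (Definition 8.1 of the paper). -/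
def IdealMHDWeak (T : ℝ) (u B : ℝ → Vec → Vec) (dB : ℝ → Vec → ℝ) : Prop :=
  Measurable (Function.uncurry u) ∧ Measurable (Function.uncurry B) ∧
  Measurable (Function.uncurry dB) ∧
  (∀ t, Per (u t)) ∧ (∀ t, Per (B t)) ∧ (∀ t, Per (dB t)) ∧
  timeNorm ∞ T (fun t => eLpNorm (u t) 2 μT) < ∞ ∧
  timeNorm ∞ T (fun t => eLpNorm (B t) 2 μT) < ∞ ∧
  timeNorm ∞ T (fun t => eLpNorm (dB t) 2 μT) < ∞ ∧
  WeakDiv T B dB ∧ WeakDivFree T u ∧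
  (∀ ψ : TestFun T Vec, DivFreeT ψ →
    (∫ t in Set.Ioo 0 T, ∫ x in cube,
      (dotV (u t x) (tderiv ψ.f t x) + advPair (u t) (u t) (ψ.f t) x
        - advPair (B t) (B t) (ψ.f t) x - dB t x * dotV (B t x) (ψ.f t x))) = 0) ∧
  (∀ ψ : TestFun T Vec, DivFreeT ψ →
    (∫ t in Set.Ioo 0 T, ∫ x in cube,
      (dotV (B t x) (tderiv ψ.f t x) + advPair (u t) (B t) (ψ.f t) x
        - advPair (B t) (u t) (ψ.f t) x - dB t x * dotV (u t x) (ψ.f t x))) = 0)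

/-- Leray-Hopf weak solution of the viscous and resistive MHD equations in the
generalized sense allowing `∇·B ≠ 0` (Definition 8.4 of the paper). The viscous
terms `-νᵢ ∇v : ∇ψ` are written in the equivalent form `νᵢ v · Δψ`. -/
def LerayHopfMHD (ν₁ ν₂ T : ℝ) (u₀ B₀ : Vec → Vec) (u B : ℝ → Vec → Vec)
    (dB : ℝ → Vec → ℝ) : Prop :=
  Measurable (Function.uncurry u) ∧ Measurable (Function.uncurry B) ∧
  Measurable (Function.uncurry dB) ∧
  (∀ t, Per (u t)) ∧ (∀ t, Per (B t)) ∧ (∀ t, Per (dB t)) ∧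
  timeNorm ∞ T (fun t => eLpNorm (u t) 2 μT) < ∞ ∧
  timeNorm ∞ T (fun t => eLpNorm (B t) 2 μT) < ∞ ∧
  timeNorm ∞ T (fun t => eLpNorm (dB t) 2 μT) < ∞ ∧
  timeNorm 2 T (fun t => HsNormV 1 (u t)) < ∞ ∧
  timeNorm 2 T (fun t => HsNormV 1 (B t)) < ∞ ∧
  timeNorm 2 T (fun t => HsNorm 1 fun x => (dB t x : ℂ)) < ∞ ∧
  WeakDiv T B dB ∧ WeakDivFree T u ∧
  (∀ ψ : TestFun T Vec, DivFreeT ψ →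
    (∫ t in Set.Ioo 0 T, ∫ x in cube,
      (dotV (u t x) (tderiv ψ.f t x) + ν₁ * (∑ j, u t x j * lap (fun y => ψ.f t y j) x)
        + advPair (u t) (u t) (ψ.f t) x - advPair (B t) (B t) (ψ.f t) x
        - dB t x * dotV (B t x) (ψ.f t x))) = 0) ∧
  (∀ ψ : TestFun T Vec, DivFreeT ψ →
    (∫ t in Set.Ioo 0 T, ∫ x in cube,
      (dotV (B t x) (tderiv ψ.f t x) + ν₂ * (∑ j, B t x j * lap (fun y => ψ.f t y j) x)
        + advPair (u t) (B t) (ψ.f t) x - advPair (B t) (u t) (ψ.f t) x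
        - dB t x * dotV (u t x) (ψ.f t x))) = 0) ∧
  Tendsto (fun t => eLpNorm (fun x => u t x - u₀ x) 2 μT) (𝓝[>] 0) (𝓝 0) ∧
  Tendsto (fun t => eLpNorm (fun x => B t x - B₀ x) 2 μT) (𝓝[>] 0) (𝓝 0)

/-! ### Magnetic helicity -/

/-- Fourier coefficients of the divergence-free vector potential `A = ∇×(-Δ)⁻¹B`,
computed from the Fourier coefficients of `B`. -/
def vecPotC (c : Fin 3 → Lat → ℂ) (n : Lat) (j : Fin 3) : ℂ :=
  if n = 0 then 0 else
    Complex.I * ((n (j + 1) : ℂ) * c (j + 2) n - (n (j + 2) : ℂ) * c (j + 1) n) /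
      (2 * Real.pi * (latSq n : ℂ))

def fcV (B : Vec → Vec) (j : Fin 3) : Lat → ℂ := fc fun x => (B x j : ℂ)

/-- The magnetic helicity `∫ A·B dx` of a square-integrable magnetic field,
in Parseval form. -/
def magHel (B : Vec → Vec) : ℂ :=
  ∑' n : Lat, ∑ j, vecPotC (fcV B) n j * (starRingEnd ℂ) (fcV B j n)

/-- The magnetic helicity `⟨B, A⟩` of a magnetic field given as a distribution via its
Fourier coefficients (duality pairing). -/
def magHelC (c : Fin 3 → Lat → ℂ) : ℂ :=
  ∑' n : Lat, ∑ j, c j n * vecPotC c (-n) j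

/-! ### Kinematic dynamo -/

/-- `k`-th component of the curl of a (test) vector field. -/
def curlF (ψ : Vec → Vec) (k : Fin 3) (x : Vec) : ℝ :=
  pd (k + 1) (fun y => ψ y (k + 2)) x - pd (k + 2) (fun y => ψ y (k + 1)) x

/-- Functional weak solution of the kinematic dynamo equation: the magnetic field is
given by its Fourier coefficients `c`, the velocity `u` is given, and
`∫⟨B,∂ₜψ⟩ - ∫⟨B×u, ∇×ψ⟩ = 0` with `B×u` interpreted as a paraproduct; moreover `B` is
weakly divergence-free. -/
def DynamoWeak (T : ℝ) (u : ℝ → Vec → Vec) (c : ℝ → Fin 3 → Lat → ℂ) : Prop :=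
  (∀ ψ : TestFun T Vec,
    (∫ t in Set.Ioo 0 T,
      ((∑ j, dpair (c t j) fun x => (tderiv ψ.f t x j : ℂ)) -
        ∑ j, dpair (c t j) fun x =>
          ((u t x (j + 1) * curlF (ψ.f t) (j + 2) x
            - u t x (j + 2) * curlF (ψ.f t) (j + 1) x : ℝ) : ℂ))) = 0) ∧
  (∀ φ : TestFun T ℝ,
    (∫ t in Set.Ioo 0 T, ∑ j, dpair (c t j) fun x => ((pd j (φ.f t) x : ℝ) : ℂ)) = 0)

end PaperHelicity

namespace PaperHelicity

section

/-! ### Basic facts on the torus -/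

/-- The weight `1 + |k|²`. -/
def wt (k : Lat) : ℝ := 1 + latNorm k ^ 2

lemma latNorm_nonneg (k : Lat) : 0 ≤ latNorm k := Real.sqrt_nonneg _

lemma latNorm_sq (k : Lat) : latNorm k ^ 2 = ∑ i, ((k i : ℝ)) ^ 2 :=
  Real.sq_sqrt (by positivity)

lemma one_le_wt (k : Lat) : 1 ≤ wt k := by
  unfold wt; nlinarith [sq_nonneg (latNorm k)]

lemma wt_pos (k : Lat) : 0 < wt k := lt_of_lt_of_le one_pos (one_le_wt k)

lemma wt_neg (k : Lat) : wt (-k) = wt k := by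
  simp [wt, latNorm_sq]

lemma latNorm_neg (k : Lat) : latNorm (-k) = latNorm k := by
  simp [latNorm]

lemma latv_apply (n : Lat) (i : Fin 3) : latv n i = (n i : ℝ) := rfl

lemma latNorm_eq_norm (k : Lat) : latNorm k = ‖latv k‖ := by
  rw [EuclideanSpace.norm_eq]; simp [latNorm, latv_apply]

lemma latv_add (k l : Lat) : latv (k + l) = latv k + latv l := by
  ext i; simp [latv_apply]

lemma latNorm_add_le (k l : Lat) : latNorm (k + l) ≤ latNorm k + latNorm l := by
  simp only [latNorm_eq_norm, latv_add]; exact norm_add_le _ _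

lemma abs_le_latNorm (k : Lat) (i : Fin 3) : |(k i : ℝ)| ≤ latNorm k := by
  unfold latNorm
  rw [← Real.sqrt_sq_eq_abs]
  exact Real.sqrt_le_sqrt (Finset.single_le_sum (f := fun i => ((k i : ℝ)) ^ 2)
    (fun _ _ => sq_nonneg _) (Finset.mem_univ i))

lemma latNorm_le_wt_half (k : Lat) : latNorm k ≤ wt k ^ (1/2 : ℝ) := by
  rw [← Real.sqrt_eq_rpow]
  apply Real.le_sqrt_of_sq_le
  unfold wt; linarith

lemma latNorm_zero_or (k : Lat) : k = 0 ∨ 1 ≤ latNorm k := by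
  by_cases h : k = 0
  · left; exact h
  · right
    have : ∃ i, k i ≠ 0 := by
      by_contra hc; push Not at hc; exact h (funext hc)
    obtain ⟨i, hi⟩ := this
    refine le_trans ?_ (abs_le_latNorm k i)
    exact_mod_cast Int.one_le_abs hi

lemma latNorm_zero : latNorm 0 = 0 := by simp [latNorm]

lemma latNorm_lt_one (k : Lat) : latNorm k < 1 ↔ k = 0 := by
  constructor
  · intro h
    rcases latNorm_zero_or k with h' | h'
    · exact h'
    · linarith
  · rintro rfl; simp [latNorm_zero]

lemma summable_int_rpow {r : ℝ} (hr : 1/2 < r) :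
    Summable fun n : ℤ => (1 + (n:ℝ)^2) ^ (-r) := by
  have h1 : Summable fun n : ℤ => |(n:ℝ)| ^ (-(2*r)) :=
    Real.summable_abs_int_rpow (by linarith)
  refine Summable.of_norm_bounded_eventually (g := fun n : ℤ => |(n:ℝ)| ^ (-(2*r))) h1 ?_
  have : ({0} : Set ℤ)ᶜ ∈ (cofinite : Filter ℤ) := (Set.finite_singleton 0).compl_mem_cofinite
  filter_upwards [this] with n hn
  have hn : n ≠ 0 := by simpa using hn
  have hp : 0 < |(n:ℝ)| := by positivity
  rw [Real.norm_of_nonneg (by positivity), show -(2*r) = 2 * (-r) by ring, Real.rpow_mul hp.le]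
  apply Real.rpow_le_rpow_of_nonpos (by positivity)
  · norm_cast; simp
  · linarith

lemma summable_wt {r : ℝ} (hr : 3/2 < r) : Summable fun k : Lat => wt k ^ (-r) := by
  have h1 := summable_int_rpow (r := r/3) (by linarith)
  have h2 : Summable fun k : Lat => ∏ i, (1 + (k i:ℝ)^2) ^ (-(r/3)) := by
    have h3 := h1.mul_of_nonneg (h1.mul_of_nonneg h1 (fun n => by positivity)
      (fun n => by positivity)) (fun n => by positivity) (fun n => by
        simp only [Pi.zero_apply]; positivity)
    let e : Lat → ℤ × ℤ × ℤ := fun k => (k 0, k 1, k 2)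
    have he : Function.Injective e := by
      intro a b hab
      simp only [e, Prod.mk.injEq] at hab
      ext i; fin_cases i <;> simp [hab]
    have := h3.comp_injective he
    refine this.congr fun k => ?_
    simp [e, Fin.prod_univ_three, mul_assoc]
  refine Summable.of_nonneg_of_le (fun k => by have := wt_pos k; positivity) (fun k => ?_) h2
  have hw : 0 < wt k := wt_pos k
  have : wt k ^ (-r) = ∏ i : Fin 3, wt k ^ (-(r/3)) := by
    rw [Finset.prod_const, ← Real.rpow_natCast, ← Real.rpow_mul hw.le]
    congr 1; simp
  rw [this]
  apply Finset.prod_le_prod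
  · intro i _; positivity
  · intro i _
    apply Real.rpow_le_rpow_of_nonpos (by positivity)
    · unfold wt; rw [latNorm_sq]
      have := Finset.single_le_sum (f := fun i => ((k i : ℝ)) ^ 2)
        (fun _ _ => sq_nonneg _) (Finset.mem_univ i)
      linarith
    · linarith

lemma chr_norm (n : Lat) (x : Vec) : ‖chr n x‖ = 1 := by
  have : (2 * Real.pi * Complex.I * (∑ i, (n i : ℂ) * (x i : ℂ)))
      = ((2 * Real.pi * ∑ i, (n i : ℝ) * x i : ℝ) : ℂ) * Complex.I := by
    push_cast; ring
  rw [chr, this, Complex.norm_exp_ofReal_mul_I]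

lemma chr_ne_zero (n : Lat) (x : Vec) : chr n x ≠ 0 := Complex.exp_ne_zero _

lemma chr_add (m n : Lat) (x : Vec) : chr (m + n) x = chr m x * chr n x := by
  rw [chr, chr, chr, ← Complex.exp_add]; congr 1
  simp only [Pi.add_apply, Int.cast_add, add_mul, Finset.sum_add_distrib]; ring

lemma chr_zero (x : Vec) : chr 0 x = 1 := by simp [chr]

lemma chr_shift (n : Lat) (x y : Vec) : chr n (x + y) = chr n x * chr n y := by
  rw [chr, chr, chr, ← Complex.exp_add]; congr 1
  simp only [PiLp.add_apply, Complex.ofReal_add, mul_add, Finset.sum_add_distrib]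

lemma chr_conj (n : Lat) (x : Vec) : (starRingEnd ℂ) (chr n x) = chr (-n) x := by
  have h : chr (-n) x * chr n x = 1 := by rw [← chr_add]; simp [chr_zero]
  have h2 : (starRingEnd ℂ) (chr n x) * chr n x = 1 := by
    rw [mul_comm, Complex.mul_conj, Complex.normSq_eq_norm_sq, chr_norm]; simp
  exact mul_right_cancel₀ (chr_ne_zero n x) (h2.trans h.symm)

lemma chr_neg (n : Lat) (x : Vec) : chr n (-x) = chr (-n) x := by
  simp [chr]

lemma chr_latv (n m : Lat) : chr n (latv m) = 1 := by
  rw [chr]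
  have : (2 * Real.pi * Complex.I * (∑ i, (n i : ℂ) * ((latv m) i : ℂ)))
      = ((∑ i, n i * m i : ℤ) : ℂ) * (2 * Real.pi * Complex.I) := by
    simp only [latv_apply]; push_cast; ring
  rw [this, Complex.exp_int_mul_two_pi_mul_I]

lemma chr_per (n : Lat) : Per (chr n) := by
  intro x m; rw [chr_shift, chr_latv, mul_one]

lemma chr_contDiff (n : Lat) {N : WithTop ℕ∞} : ContDiff ℝ N (chr n) := by
  unfold chr
  apply ContDiff.cexp
  apply ContDiff.mul contDiff_const
  apply ContDiff.sum
  intro i _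
  apply ContDiff.mul contDiff_const
  exact Complex.ofRealCLM.contDiff.comp (EuclideanSpace.proj (𝕜 := ℝ) i).contDiff

lemma chr_continuous (n : Lat) : Continuous (chr n) := (chr_contDiff n (N := 0)).continuous

lemma measurableSet_cube : MeasurableSet cube := by
  unfold cube
  simp only [Set.ofPred_forall]
  refine MeasurableSet.iInter fun i => ?_
  have hm : Measurable fun x : Vec => x i := (EuclideanSpace.proj (𝕜 := ℝ) i).continuous.measurable
  exact (measurableSet_le measurable_const hm).inter (measurableSet_lt hm measurable_const)

/-- Descent of a function on space to the torus. -/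
def desc {E : Type*} (f : Vec → E) (z : UnitAddTorus (Fin 3)) : E :=
  f (WithLp.toLp 2 fun i => ((AddCircle.equivIco 1 0 (z i) : Set.Ico (0:ℝ) (0+1)) : ℝ))

lemma desc_coe {E : Type*} {f : Vec → E} (hf : Per f) (x : Fin 3 → ℝ) :
    desc f (fun i => (x i : UnitAddCircle)) = f (WithLp.toLp 2 x) := by
  unfold desc
  have : ∀ i, ∃ m : ℤ, ((AddCircle.equivIco 1 0 (x i : UnitAddCircle) : Set.Ico (0:ℝ) (0+1)) : ℝ)
      = x i + m := by
    intro i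
    rw [AddCircle.coe_equivIco_mk_apply]
    refine ⟨-⌊x i⌋, ?_⟩
    simp only [zero_add, div_one, sub_zero, mul_one, one_mul, Int.cast_neg]
    rw [← sub_eq_add_neg, Int.self_sub_floor]
    try simp [toIcoMod_zero_one]
  choose m hm using this
  rw [← hf (WithLp.toLp 2 x) m]
  congr 1
  ext i
  simp [hm, latv_apply]

/-- shifted (half-open) cubes -/
def cubeS (a : Vec) : Set Vec := {x | ∀ i, x i ∈ Set.Ioc (a i) (a i + 1)}

lemma toLp_preim (a : Vec) : (WithLp.toLp 2 : (Fin 3 → ℝ) → Vec) ⁻¹' cubeS a =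
    {x : Fin 3 → ℝ | ∀ i, x i ∈ Set.Ioc (a i) (a i + 1)} := rfl

lemma cube_ae_eq : (cube : Set Vec) =ᵐ[volume] cubeS 0 := by
  have hE : MeasurableEmbedding (WithLp.toLp 2 : (Fin 3 → ℝ) → Vec) :=
    (MeasurableEquiv.toLp 2 (Fin 3 → ℝ)).measurableEmbedding
  have hmp := EuclideanSpace.volume_preserving_symm_measurableEquiv_toLp (Fin 3)
  have h1 : (Set.univ.pi fun _ : Fin 3 => Set.Ico (0:ℝ) 1)
      =ᵐ[volume] (Set.univ.pi fun _ : Fin 3 => Set.Ioc (0:ℝ) 1) := by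
    apply Measure.ae_eq_set_pi
    intro i _
    exact Ico_ae_eq_Ioc
  have h2 := hmp.quasiMeasurePreserving.ae_eq_comp h1
  have e1 : ((MeasurableEquiv.toLp 2 (Fin 3 → ℝ)).symm ⁻¹'
    (Set.univ.pi fun _ : Fin 3 => Set.Ico (0:ℝ) 1)) = cube := by
    ext x; simp [cube, Set.mem_pi]
  have e2 : ((MeasurableEquiv.toLp 2 (Fin 3 → ℝ)).symm ⁻¹'
    (Set.univ.pi fun _ : Fin 3 => Set.Ioc (0:ℝ) 1)) = cubeS 0 := by
    ext x; simp [cubeS, Set.mem_pi]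
  rw [← e1, ← e2]
  exact h2

lemma integral_cubeS {E : Type*} [NormedAddCommGroup E] [NormedSpace ℝ E] {f : Vec → E}
    (hf : Per f) (a b : Vec) : ∫ x in cubeS a, f x = ∫ x in cubeS b, f x := by
  have h := (UnitAddTorus.integral_preimage (desc f) (fun i => a i)).symm.trans
    (UnitAddTorus.integral_preimage (desc f) (fun i => b i))
  simp only [desc_coe hf] at h
  have hmp := (EuclideanSpace.volume_preserving_symm_measurableEquiv_toLp (Fin 3)).symm
  have h1 := hmp.setIntegral_preimage_emb (MeasurableEquiv.measurableEmbedding _) f (cubeS a)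
  have h2 := hmp.setIntegral_preimage_emb (MeasurableEquiv.measurableEmbedding _) f (cubeS b)
  rw [← h1, ← h2]; exact h

lemma lintegral_cubeS {f : Vec → ℝ≥0∞}
    (hf : Per f) (a b : Vec) : ∫⁻ x in cubeS a, f x = ∫⁻ x in cubeS b, f x := by
  have h := (UnitAddTorus.lintegral_preimage (desc f) (fun i => a i)).symm.trans
    (UnitAddTorus.lintegral_preimage (desc f) (fun i => b i))
  simp only [desc_coe hf] at h
  have hmp := (EuclideanSpace.volume_preserving_symm_measurableEquiv_toLp (Fin 3)).symm
  have h1 := hmp.setLIntegral_comp_preimage_emb (MeasurableEquiv.measurableEmbedding _) f (cubeS a)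
  have h2 := hmp.setLIntegral_comp_preimage_emb (MeasurableEquiv.measurableEmbedding _) f (cubeS b)
  rw [← h1, ← h2]; exact h

lemma preim_cubeS (y : Vec) : cubeS 0 = (fun x => x + y) ⁻¹' cubeS y := by
  ext x
  simp only [cubeS, Set.mem_setOf_eq, Set.mem_preimage, Set.mem_Ioc, PiLp.add_apply, PiLp.zero_apply]
  refine forall_congr' fun i => ?_
  constructor <;> rintro ⟨h1, h2⟩ <;> constructor <;> linarith

lemma integral_cube_shift {E : Type*} [NormedAddCommGroup E] [NormedSpace ℝ E] {f : Vec → E}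
    (hf : Per f) (y : Vec) : ∫ x in cube, f (x + y) = ∫ x in cube, f x := by
  rw [setIntegral_congr_set cube_ae_eq, setIntegral_congr_set cube_ae_eq, integral_cubeS hf 0 y]
  have := (measurePreserving_add_right (volume : Measure Vec) y).setIntegral_preimage_emb
    (measurableEmbedding_addRight y) f (cubeS y)
  rw [← this, ← preim_cubeS]

lemma lintegral_cube_shift {f : Vec → ℝ≥0∞}
    (hf : Per f) (y : Vec) : ∫⁻ x, f (x + y) ∂μT = ∫⁻ x, f x ∂μT := by
  unfold μT
  rw [setLIntegral_congr cube_ae_eq, setLIntegral_congr cube_ae_eq, lintegral_cubeS hf 0 y]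
  have := (measurePreserving_add_right (volume : Measure Vec) y).setLIntegral_comp_preimage_emb
    (measurableEmbedding_addRight y) f (cubeS y)
  rw [← this, ← preim_cubeS]

lemma volume_cube : volume cube = 1 := by
  have hmp := EuclideanSpace.volume_preserving_symm_measurableEquiv_toLp (Fin 3)
  have e1 : ((MeasurableEquiv.toLp 2 (Fin 3 → ℝ)).symm ⁻¹'
    (Set.univ.pi fun _ : Fin 3 => Set.Ico (0:ℝ) 1)) = cube := by
    ext x; simp [cube, Set.mem_pi]
  rw [← e1, hmp.measure_preimage_equiv, volume_pi_pi]
  simp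

instance : IsProbabilityMeasure μT := ⟨by simp [μT, volume_cube]⟩

instance (T : ℝ) : IsFiniteMeasure (tIoo T) := by unfold tIoo; infer_instance

end

section

/-! ### Smooth periodic functions and Fourier series -/

/-- Smooth periodic functions. -/
structure Sm (f : Vec → ℂ) : Prop where
  smooth : ContDiff ℝ (⊤ : ℕ∞) f
  per : Per f

lemma exists_rep (x : Vec) : ∃ n : Lat, x + latv n ∈ cube := by
  refine ⟨fun i => -⌊x i⌋, fun i => ?_⟩
  simp only [PiLp.add_apply, latv_apply, Int.cast_neg]
  constructor
  · linarith [Int.floor_le (x i)]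
  · linarith [Int.lt_floor_add_one (x i)]

lemma cube_sub_compact : ∃ K : Set Vec, IsCompact K ∧ cube ⊆ K := by
  refine ⟨Metric.closedBall 0 2, isCompact_closedBall 0 2, fun x hx => ?_⟩
  rw [mem_closedBall_zero_iff, EuclideanSpace.norm_eq, Real.sqrt_le_left (by norm_num)]
  have : ∀ i, ‖x i‖ ^ 2 ≤ 1 := fun i => by
    rw [Real.norm_eq_abs, sq_abs]; nlinarith [(hx i).1, (hx i).2]
  rw [Fin.sum_univ_three]; linarith [this 0, this 1, this 2]

lemma per_bounded {E : Type*} [NormedAddCommGroup E] {f : Vec → E} (hc : Continuous f)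
    (hp : Per f) : ∃ C : ℝ, 0 ≤ C ∧ ∀ x, ‖f x‖ ≤ C := by
  obtain ⟨K, hK, hsub⟩ := cube_sub_compact
  obtain ⟨C, hC⟩ := hK.exists_bound_of_continuousOn hc.continuousOn
  refine ⟨max C 0, le_max_right _ _, fun x => ?_⟩
  obtain ⟨n, hn⟩ := exists_rep x
  rw [← hp x n]
  exact (hC _ (hsub hn)).trans (le_max_left _ _)

lemma per_integrable {E : Type*} [NormedAddCommGroup E] {f : Vec → E} (hc : Continuous f)
    (hp : Per f) : Integrable f μT := by
  obtain ⟨C, -, hC⟩ := per_bounded hc hp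
  exact Integrable.of_bound hc.aestronglyMeasurable C (ae_of_all _ hC)

namespace Sm

variable {f g : Vec → ℂ}

lemma continuous (hf : Sm f) : Continuous f := hf.smooth.continuous

lemma differentiable (hf : Sm f) : Differentiable ℝ f :=
  hf.smooth.differentiable (by simp)

lemma integrable (hf : Sm f) : Integrable f μT := per_integrable hf.continuous hf.per

lemma add (hf : Sm f) (hg : Sm g) : Sm (fun x => f x + g x) :=
  ⟨hf.smooth.add hg.smooth, fun x n => by simp only [hf.per x n, hg.per x n]⟩

lemma sub (hf : Sm f) (hg : Sm g) : Sm (fun x => f x - g x) :=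
  ⟨hf.smooth.sub hg.smooth, fun x n => by simp only [hf.per x n, hg.per x n]⟩

lemma mul (hf : Sm f) (hg : Sm g) : Sm (fun x => f x * g x) :=
  ⟨hf.smooth.mul hg.smooth, fun x n => by simp only [hf.per x n, hg.per x n]⟩

lemma const (c : ℂ) : Sm (fun _ => c) := ⟨contDiff_const, fun _ _ => rfl⟩

lemma const_mul (c : ℂ) (hf : Sm f) : Sm (fun x => c * f x) := (Sm.const c).mul hf

lemma sum {ι : Type*} (s : Finset ι) {F : ι → Vec → ℂ} (h : ∀ i ∈ s, Sm (F i)) :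
    Sm (fun x => ∑ i ∈ s, F i x) :=
  ⟨ContDiff.sum fun i hi => (h i hi).smooth,
    fun x n => Finset.sum_congr rfl fun i hi => (h i hi).per x n⟩

lemma chr (n : Lat) : Sm (chr n) := ⟨chr_contDiff n, chr_per n⟩

end Sm

lemma Per.fderiv {E : Type*} [NormedAddCommGroup E] [NormedSpace ℝ E] {f : Vec → E}
    (hf : Per f) : Per (fderiv ℝ f) := by
  intro x n
  have : f = fun y => f (y + latv n) := by ext y; rw [hf]
  conv_rhs => rw [this]
  rw [fderiv_comp_add_right]

lemma Per.pd {E : Type*} [NormedAddCommGroup E] [NormedSpace ℝ E] {f : Vec → E}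
    (hf : Per f) (i : Fin 3) : Per (pd i f) := by
  intro x n; unfold PaperHelicity.pd; rw [hf.fderiv x n]

lemma contDiff_pd {E : Type*} [NormedAddCommGroup E] [NormedSpace ℝ E] {f : Vec → E}
    (hf : ContDiff ℝ (⊤ : ℕ∞) f) (i : Fin 3) : ContDiff ℝ (⊤ : ℕ∞) (pd i f) := by
  unfold PaperHelicity.pd
  exact (hf.fderiv_right (m := (⊤ : ℕ∞)) (by simp)).clm_apply contDiff_const

lemma Sm.pd {f : Vec → ℂ} (hf : Sm f) (i : Fin 3) : Sm (pd i f) :=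
  ⟨contDiff_pd hf.smooth i, hf.per.pd i⟩

lemma pd_mul {f g : Vec → ℂ} {x : Vec} (hf : DifferentiableAt ℝ f x)
    (hg : DifferentiableAt ℝ g x) (i : Fin 3) :
    pd i (fun y => f y * g y) x = pd i f x * g x + f x * pd i g x := by
  unfold pd; rw [fderiv_fun_mul hf hg]
  simp only [add_apply, smul_apply, smul_eq_mul]; ring

lemma pd_ofReal {f : Vec → ℝ} {x : Vec} (hf : DifferentiableAt ℝ f x) (i : Fin 3) :
    pd i (fun y => (f y : ℂ)) x = ((pd i f x : ℝ) : ℂ) := by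
  unfold pd
  have := (Complex.ofRealCLM.hasFDerivAt.comp x hf.hasFDerivAt).fderiv
  have h2 : (fun y => (f y : ℂ)) = (⇑Complex.ofRealCLM ∘ f) := rfl
  rw [h2, this]; simp

lemma pd_chr (n : Lat) (i : Fin 3) (x : Vec) :
    pd i (chr n) x = 2 * Real.pi * Complex.I * (n i : ℂ) * chr n x := by
  unfold pd
  have h1 : HasFDerivAt (fun x : Vec => 2 * Real.pi * Complex.I * (∑ i, (n i : ℂ) * (x i : ℂ)))
      ((2 * Real.pi * Complex.I) • (∑ i, (n i : ℂ) •
        (Complex.ofRealCLM.comp (EuclideanSpace.proj (𝕜 := ℝ) i) : Vec →L[ℝ] ℂ))) x := by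
    apply HasFDerivAt.const_mul
    apply HasFDerivAt.fun_sum
    intro i _
    apply HasFDerivAt.const_mul
    exact (Complex.ofRealCLM.comp (EuclideanSpace.proj (𝕜 := ℝ) i) : Vec →L[ℝ] ℂ).hasFDerivAt
  have h2 := h1.cexp.fderiv
  have h3 : (chr n) = fun x : Vec =>
    Complex.exp (2 * Real.pi * Complex.I * (∑ i, (n i : ℂ) * (x i : ℂ))) := rfl
  rw [h3, h2]
  simp only [smul_apply, sum_apply,
    ContinuousLinearMap.comp_apply, smul_eq_mul]
  have h4 : ∑ j, (n j : ℂ) * Complex.ofRealCLM ((EuclideanSpace.proj (𝕜 := ℝ) j)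
      (EuclideanSpace.single i (1:ℝ))) = (n i : ℂ) := by
    rw [Finset.sum_eq_single i]
    · simp
    · intro j _ hj; simp [hj]
    · simp
  rw [h4]; ring

lemma hasDerivAt_line {E : Type*} [NormedAddCommGroup E] [NormedSpace ℝ E] {f : Vec → E}
    {x v : Vec} {s : ℝ} (hf : DifferentiableAt ℝ f (x + s • v)) :
    HasDerivAt (fun s : ℝ => f (x + s • v)) (fderiv ℝ f (x + s • v) v) s := by
  have h1 : HasDerivAt (fun s : ℝ => x + s • v) v s := by
    simpa using ((hasDerivAt_id s).smul_const v).const_add x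
  exact hf.hasFDerivAt.comp_hasDerivAt s h1

lemma integral_pd {f : Vec → ℂ} (hf : Sm f) (i : Fin 3) : ∫ x in cube, pd i f x = 0 := by
  set e : Vec := EuclideanSpace.single i (1:ℝ)
  obtain ⟨C, -, hC⟩ := per_bounded (hf.pd i).continuous (hf.pd i).per
  have hc : ∀ s : ℝ, Continuous fun x : Vec => f (x + s • e) := fun s =>
    hf.continuous.comp (continuous_id.add continuous_const)
  have h := hasDerivAt_integral_of_dominated_loc_of_deriv_le (μ := μT) (s := Set.univ)
    (F := fun (s : ℝ) (x : Vec) => f (x + s • e)) (x₀ := (0:ℝ))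
    (F' := fun s x => pd i f (x + s • e)) (bound := fun _ => C) Filter.univ_mem
    (Eventually.of_forall fun s => (hc s).aestronglyMeasurable)
    (by simpa using hf.integrable)
    (by simpa using (hf.pd i).continuous.aestronglyMeasurable)
    (ae_of_all _ fun x s _ => hC _) (integrable_const C)
    (ae_of_all _ fun x s _ => hasDerivAt_line (hf.differentiable _))
  have h2 := h.2
  have h3 : (fun s : ℝ => ∫ x, f (x + s • e) ∂μT) = fun _ => ∫ x, f x ∂μT := by
    ext s; exact integral_cube_shift hf.per _
  rw [h3] at h2
  have := h2.unique (hasDerivAt_const _ _)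
  simp only [zero_smul, add_zero] at this
  exact this

lemma fc_def (f : Vec → ℂ) (n : Lat) : fc f n = ∫ x, f x * chr (-n) x ∂μT := by
  simp only [fc, chr_conj]; rfl

lemma fc_pd {f : Vec → ℂ} (hf : Sm f) (i : Fin 3) (n : Lat) :
    fc (pd i f) n = 2 * Real.pi * Complex.I * (n i : ℂ) * fc f n := by
  have h := integral_pd (hf.mul (Sm.chr (-n))) i
  have h2 : ∀ x, pd i (fun y => f y * chr (-n) y) x = pd i f x * chr (-n) x -
      2 * Real.pi * Complex.I * (n i : ℂ) * (f x * chr (-n) x) := by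
    intro x
    rw [pd_mul (hf.differentiable x) ((Sm.chr _).differentiable x), pd_chr]
    simp only [Pi.neg_apply, Int.cast_neg]; ring
  simp only [h2] at h
  rw [integral_sub, integral_const_mul] at h
  · rw [fc_def, fc_def]; exact sub_eq_zero.mp h
  · exact ((hf.pd i).mul (Sm.chr _)).integrable
  · exact ((hf.mul (Sm.chr _)).integrable).const_mul _

lemma fc_norm_le {f : Vec → ℂ} {C : ℝ} (hC : ∀ x, ‖f x‖ ≤ C) (n : Lat) : ‖fc f n‖ ≤ C := by
  rw [fc_def]
  have := norm_integral_le_of_norm_le_const (μ := μT) (f := fun x => f x * chr (-n) x) (C := C)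
    (ae_of_all _ fun x => by rw [norm_mul, chr_norm, mul_one]; exact hC x)
  simpa using this

lemma mulchr_integrable {f : Vec → ℂ} (hf : Integrable f μT) (n : Lat) :
    Integrable (fun x => f x * chr n x) μT :=
  hf.mul_bdd (chr_continuous n).aestronglyMeasurable (c := 1)
    (ae_of_all _ fun x => (chr_norm n x).le)

lemma fc_add {f g : Vec → ℂ} (hf : Integrable f μT) (hg : Integrable g μT) (n : Lat) :
    fc (fun x => f x + g x) n = fc f n + fc g n := by
  simp only [fc_def, add_mul]
  exact integral_add (mulchr_integrable hf _) (mulchr_integrable hg _)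

lemma fc_sub {f g : Vec → ℂ} (hf : Integrable f μT) (hg : Integrable g μT) (n : Lat) :
    fc (fun x => f x - g x) n = fc f n - fc g n := by
  simp only [fc_def, sub_mul]
  exact integral_sub (mulchr_integrable hf _) (mulchr_integrable hg _)

lemma fc_const_mul (c : ℂ) (f : Vec → ℂ) (n : Lat) :
    fc (fun x => c * f x) n = c * fc f n := by
  simp only [fc_def, mul_assoc]
  exact integral_const_mul _ _

lemma fc_sum {ι : Type*} (s : Finset ι) {F : ι → Vec → ℂ} (h : ∀ i ∈ s, Integrable (F i) μT)
    (n : Lat) : fc (fun x => ∑ i ∈ s, F i x) n = ∑ i ∈ s, fc (F i) n := by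
  simp only [fc_def, Finset.sum_mul]
  exact integral_finsetSum s fun i hi => mulchr_integrable (h i hi) _

/-- `1 - Δ/(4π²)`. -/
def Lop (f : Vec → ℂ) (x : Vec) : ℂ := f x - ((4 * Real.pi ^ 2 : ℝ) : ℂ)⁻¹ * ∑ i, pd i (pd i f) x

lemma Sm.Lop {f : Vec → ℂ} (hf : Sm f) : Sm (Lop f) :=
  hf.sub (Sm.const_mul _ (Sm.sum _ fun i _ => (hf.pd i).pd i))

lemma fc_Lop {f : Vec → ℂ} (hf : Sm f) (n : Lat) : fc (Lop f) n = (wt n : ℂ) * fc f n := by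
  have h1 : Sm (fun x => ∑ i, PaperHelicity.pd i (PaperHelicity.pd i f) x) :=
    Sm.sum _ fun i _ => (hf.pd i).pd i
  have : PaperHelicity.Lop f = fun x => f x - ((4 * Real.pi ^ 2 : ℝ) : ℂ)⁻¹ *
    ∑ i, PaperHelicity.pd i (PaperHelicity.pd i f) x := rfl
  rw [this, fc_sub hf.integrable (Sm.const_mul _ h1).integrable, fc_const_mul,
    fc_sum _ fun i _ => ((hf.pd i).pd i).integrable]
  simp only [fc_pd (hf.pd _), fc_pd hf]
  have hpi : (Real.pi : ℂ) ≠ 0 := by exact_mod_cast Real.pi_ne_zero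
  have hw : (wt n : ℂ) = 1 + ∑ i, (n i : ℂ) ^ 2 := by
    unfold wt; rw [latNorm_sq]; push_cast; rfl
  have hs : ∑ i, (2 * Real.pi * Complex.I * (n i : ℂ) * (2 * Real.pi * Complex.I * (n i : ℂ) * fc f n))
      = - (4 * Real.pi ^ 2) * (∑ i, (n i : ℂ) ^ 2) * fc f n := by
    rw [Finset.mul_sum, Finset.sum_mul]
    refine Finset.sum_congr rfl fun i _ => ?_
    linear_combination (4 * Real.pi ^ 2 * (n i : ℂ) ^ 2 * fc f n) * Complex.I_sq
  rw [hs, hw]; push_cast; field_simp; ring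

lemma fc_decay {f : Vec → ℂ} (hf : Sm f) (K : ℕ) :
    ∃ C : ℝ, 0 ≤ C ∧ ∀ n, ‖fc f n‖ ≤ C * (wt n ^ K)⁻¹ := by
  have key : ∀ K : ℕ, Sm (Lop^[K] f) ∧ ∀ n, fc (Lop^[K] f) n = (wt n : ℂ) ^ K * fc f n := by
    intro K
    induction K with
    | zero => exact ⟨hf, fun n => by simp⟩
    | succ K ih =>
      rw [Function.iterate_succ_apply']
      refine ⟨ih.1.Lop, fun n => ?_⟩
      rw [fc_Lop ih.1, ih.2, pow_succ]; ring
  obtain ⟨C, hC0, hC⟩ := per_bounded (key K).1.continuous (key K).1.per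
  refine ⟨C, hC0, fun n => ?_⟩
  have h1 := fc_norm_le hC n
  rw [(key K).2, norm_mul, norm_pow, Complex.norm_real, Real.norm_of_nonneg (wt_pos n).le] at h1
  rw [← div_eq_mul_inv, le_div_iff₀ (pow_pos (wt_pos n) K)]; linarith

lemma summable_wt_nat {K : ℕ} (hK : 2 ≤ K) : Summable fun k : Lat => (wt k ^ K)⁻¹ := by
  have := summable_wt (r := K) (by
    have : (2:ℝ) ≤ K := by exact_mod_cast hK
    linarith)
  refine this.congr fun k => ?_
  rw [Real.rpow_neg (wt_pos k).le, Real.rpow_natCast]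

lemma fc_summable_wt {f : Vec → ℂ} (hf : Sm f) (K : ℕ) :
    Summable fun n => wt n ^ K * ‖fc f n‖ := by
  obtain ⟨C, hC0, hC⟩ := fc_decay hf (K + 2)
  refine Summable.of_nonneg_of_le (fun n => by have := wt_pos n; positivity) (fun n => ?_)
    ((summable_wt_nat (K := 2) le_rfl).mul_left C)
  have hw := wt_pos n
  calc wt n ^ K * ‖fc f n‖ ≤ wt n ^ K * (C * (wt n ^ (K+2))⁻¹) := by gcongr; exact hC n
    _ = C * (wt n ^ 2)⁻¹ := by field_simp; ring

lemma fc_summable {f : Vec → ℂ} (hf : Sm f) : Summable fun n => ‖fc f n‖ := by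
  simpa using fc_summable_wt hf 0

lemma mFourier_coe (n : Lat) (x : Fin 3 → ℝ) :
    UnitAddTorus.mFourier n (fun i => (x i : UnitAddCircle)) = chr n (WithLp.toLp 2 x) := by
  simp only [UnitAddTorus.mFourier, ContinuousMap.coe_mk, fourier_coe_apply, chr]
  rw [← Complex.exp_sum]; congr 1
  rw [Finset.mul_sum]; refine Finset.sum_congr rfl fun i _ => ?_
  simp; ring

lemma desc_continuous {f : Vec → ℂ} (hc : Continuous f) (hp : Per f) : Continuous (desc f) := by
  have hq : IsOpenQuotientMap (fun (x : Fin 3 → ℝ) => (fun i => (x i : UnitAddCircle) :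
      UnitAddTorus (Fin 3))) :=
    IsOpenQuotientMap.piMap (f := fun _ (x : ℝ) => (x : UnitAddCircle)) fun i =>
      QuotientAddGroup.isOpenQuotientMap_mk
  rw [hq.isQuotientMap.continuous_iff]
  have : desc f ∘ (fun (x : Fin 3 → ℝ) => (fun i => (x i : UnitAddCircle) :
      UnitAddTorus (Fin 3))) = f ∘ (WithLp.toLp 2) := by
    ext x; exact desc_coe hp x
  rw [this]
  exact hc.comp (PiLp.continuous_toLp 2 _)

lemma mFourierCoeff_desc {f : Vec → ℂ} (hp : Per f) (n : Lat) :
    UnitAddTorus.mFourierCoeff (desc f) n = fc f n := by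
  rw [UnitAddTorus.mFourierCoeff_eq_integral _ n 0]
  simp only [desc_coe hp, mFourier_coe]
  rw [fc_def, μT, setIntegral_congr_set cube_ae_eq]
  have hmp := (EuclideanSpace.volume_preserving_symm_measurableEquiv_toLp (Fin 3)).symm
  have h1 := hmp.setIntegral_preimage_emb (MeasurableEquiv.measurableEmbedding _)
    (fun x => f x * chr (-n) x) (cubeS 0)
  rw [← h1]
  simp only [smul_eq_mul, mul_comm]
  rfl

lemma hasSum_fourier {f : Vec → ℂ} (hf : Sm f) (x : Vec) :
    HasSum (fun n => fc f n * chr n x) (f x) := by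
  let F : C(UnitAddTorus (Fin 3), ℂ) := ⟨desc f, desc_continuous hf.continuous hf.per⟩
  have hF : ∀ n, UnitAddTorus.mFourierCoeff F n = fc f n := fun n => mFourierCoeff_desc hf.per n
  have hs : Summable (UnitAddTorus.mFourierCoeff F) := by
    have h1 : UnitAddTorus.mFourierCoeff F = fc f := funext hF
    rw [h1]; exact (fc_summable hf).of_norm
  have := UnitAddTorus.hasSum_mFourier_series_apply_of_summable hs (fun i => (x i : UnitAddCircle))
  simp only [hF, mFourier_coe, smul_eq_mul] at this
  convert this
  exact (desc_coe hf.per (fun i => x i)).symm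

/-- Parseval with one factor an absolutely convergent Fourier series. -/
lemma hasSum_parseval_series {a : Lat → ℂ} (ha : Summable fun n => ‖a n‖) {f g : Vec → ℂ}
    (hf : ∀ x, HasSum (fun n => a n * chr n x) (f x))
    (hg : Integrable g μT) : HasSum (fun n => a n * fc g (-n)) (∫ x, f x * g x ∂μT) := by
  have h := hasSum_integral_of_summable_integral_norm (μ := μT)
    (F := fun n x => a n * (g x * chr n x))
    (fun n => (mulchr_integrable hg n).const_mul _) (by
      have : ∀ n, ∫ x, ‖a n * (g x * chr n x)‖ ∂μT = ‖a n‖ * ∫ x, ‖g x‖ ∂μT := by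
        intro n
        simp only [norm_mul, chr_norm, mul_one]
        exact integral_const_mul _ _
      simp only [this]
      exact ha.mul_right _)
  have e1 : ∀ n, ∫ x, a n * (g x * chr n x) ∂μT = a n * fc g (-n) := by
    intro n; rw [integral_const_mul, fc_def, neg_neg]
  simp only [e1] at h
  have e2 : ∫ x, f x * g x ∂μT = ∫ x, ∑' n, a n * (g x * chr n x) ∂μT := by
    refine integral_congr_ae (ae_of_all _ fun x => ?_)
    simp only
    rw [← ((hf x).mul_right (g x)).tsum_eq]
    refine tsum_congr fun n => ?_
    ring
  rw [e2]; exact h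

lemma hasSum_parseval {f g : Vec → ℂ} (hf : Sm f) (hg : Integrable g μT) :
    HasSum (fun n => fc f n * fc g (-n)) (∫ x, f x * g x ∂μT) :=
  hasSum_parseval_series (fc_summable hf) (hasSum_fourier hf) hg

lemma fc_mulchr (g : Vec → ℂ) (m n : Lat) : fc (fun x => g x * chr m x) n = fc g (n - m) := by
  have h : m + -n = -(n - m) := by abel
  simp only [fc_def, mul_assoc, ← chr_add, h]

lemma hasSum_fc_mul {f g : Vec → ℂ} (hf : Sm f) (hg : Integrable g μT) (k : Lat) :
    HasSum (fun n => fc f n * fc g (k - n)) (fc (fun x => f x * g x) k) := by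
  have h := hasSum_parseval hf (mulchr_integrable hg (-k))
  simp only [fc_mulchr] at h
  convert h using 1
  · ext n; congr 2; abel
  · rw [fc_def]; simp only [mul_assoc]

end

section

/-! ### Weighted sequence inequalities -/

lemma wt_split (k m : Lat) : wt k ≤ 4 * wt m ∨ wt k ≤ 4 * wt (k - m) := by
  have h : latNorm k ≤ latNorm m + latNorm (k - m) := by
    have := latNorm_add_le m (k - m); rwa [add_sub_cancel] at this
  have h0 := latNorm_nonneg k
  have h1 := latNorm_nonneg m
  have h2 := latNorm_nonneg (k - m)
  unfold wt
  rcases le_total (latNorm m) (latNorm (k-m)) with h3 | h3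
  · right; nlinarith
  · left; nlinarith

lemma cs_sum {ι : Type*} {f g : ι → ℝ} {A B : ℝ} (hA : 0 ≤ A) (hB : 0 ≤ B)
    (hf0 : ∀ i, 0 ≤ f i) (hg0 : ∀ i, 0 ≤ g i)
    (hf : ∀ s : Finset ι, ∑ i ∈ s, f i ^ 2 ≤ A ^ 2)
    (hg : ∀ s : Finset ι, ∑ i ∈ s, g i ^ 2 ≤ B ^ 2) :
    Summable (fun i => f i * g i) ∧ ∑' i, f i * g i ≤ A * B := by
  have h : ∀ s : Finset ι, ∑ i ∈ s, f i * g i ≤ A * B := by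
    intro s
    have h1 := Finset.sum_mul_sq_le_sq_mul_sq s f g
    have h2 : (∑ i ∈ s, f i ^ 2) * ∑ i ∈ s, g i ^ 2 ≤ A ^ 2 * B ^ 2 := by
      gcongr
      · exact hf s
      · exact hg s
    refine abs_le_of_sq_le_sq' ?_ (by positivity) |>.2
    rw [mul_pow]; linarith
  have hs := summable_of_sum_le (fun i => mul_nonneg (hf0 i) (hg0 i)) h
  exact ⟨hs, hs.tsum_le_of_sum_le h⟩

/-- Finite-sum formulation of a Sobolev bound for coefficients. -/
def HB (β M : ℝ) (c : Lat → ℂ) : Prop :=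
  ∀ s : Finset Lat, ∑ k ∈ s, wt k ^ β * ‖c k‖ ^ 2 ≤ M ^ 2

lemma HB.mono {β β' M : ℝ} {c : Lat → ℂ} (h : HB β M c) (hb : β' ≤ β) : HB β' M c := by
  intro s
  refine le_trans (Finset.sum_le_sum fun k _ => ?_) (h s)
  gcongr
  exact one_le_wt k

lemma HB.monoM {β M M' : ℝ} {c : Lat → ℂ} (h : HB β M c) (hM0 : 0 ≤ M) (hM : M ≤ M') :
    HB β M' c := fun s => (h s).trans (by gcongr)

lemma HB.sq {β M : ℝ} {c : Lat → ℂ} (h : HB β M c) (s : Finset Lat) :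
    ∑ k ∈ s, (wt k ^ (β/2) * ‖c k‖) ^ 2 ≤ M ^ 2 := by
  refine le_trans (le_of_eq ?_) (h s)
  refine Finset.sum_congr rfl fun k _ => ?_
  rw [mul_pow, ← Real.rpow_natCast, ← Real.rpow_mul (wt_pos k).le]; norm_num

lemma HB.sq0 {β M : ℝ} {c : Lat → ℂ} (h : HB β M c) (hb : 0 ≤ β) (s : Finset Lat) :
    ∑ k ∈ s, ‖c k‖ ^ 2 ≤ M ^ 2 := by
  have := (h.mono hb) s
  simpa using this

lemma HB.summable {β M : ℝ} {c : Lat → ℂ} (h : HB β M c) :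
    Summable fun k => wt k ^ β * ‖c k‖ ^ 2 :=
  summable_of_sum_le (fun k => by have := wt_pos k; positivity) h

lemma HB.tsum_le {β M : ℝ} {c : Lat → ℂ} (h : HB β M c) :
    ∑' k, wt k ^ β * ‖c k‖ ^ 2 ≤ M ^ 2 := h.summable.tsum_le_of_sum_le h

lemma HB.pt {β M : ℝ} {c : Lat → ℂ} (h : HB β M c) (hM : 0 ≤ M) (k : Lat) :
    wt k ^ (β/2) * ‖c k‖ ≤ M := by
  have := h.sq {k}
  rw [Finset.sum_singleton] at this
  exact (abs_le_of_sq_le_sq' this hM).2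

lemma HB.pt0 {β M : ℝ} {c : Lat → ℂ} (h : HB β M c) (hb : 0 ≤ β) (hM : 0 ≤ M) (k : Lat) :
    ‖c k‖ ≤ M := by
  have := (h.mono hb).pt hM k
  simpa using this

lemma sum_shift_le {f : Lat → ℝ} {B : ℝ} (h : ∀ s : Finset Lat, ∑ k ∈ s, f k ≤ B) (k : Lat)
    (s : Finset Lat) : ∑ m ∈ s, f (k - m) ≤ B := by
  have hinj : Function.Injective fun m : Lat => k - m := fun a b hab => sub_right_injective hab
  have := h (s.map ⟨_, hinj⟩)
  rwa [Finset.sum_map] at this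

lemma q_basic {β M N : ℝ} {c d : Lat → ℂ} (hc : HB β M c) (hd : HB β N d) (hb : 0 ≤ β) (hM : 0 ≤ M)
    (hN : 0 ≤ N)
    (k : Lat) : Summable (fun m => ‖c m‖ * ‖d (k - m)‖) ∧ ∑' m, ‖c m‖ * ‖d (k - m)‖ ≤ M * N :=
  cs_sum hM hN (fun _ => norm_nonneg _) (fun _ => norm_nonneg _) (hc.sq0 hb)
    (sum_shift_le (f := fun k => ‖d k‖ ^ 2) (hd.sq0 hb) k)

lemma wt_neg_le {k m : Lat} (h : wt k ≤ 4 * wt m) {s : ℝ} (hs : 0 ≤ s) :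
    wt m ^ (-s) ≤ 4 ^ s * wt k ^ (-s) := by
  have h1 := wt_pos k
  have h2 := wt_pos m
  rw [Real.rpow_neg h2.le, Real.rpow_neg h1.le, ← div_eq_mul_inv, inv_eq_one_div,
    div_le_div_iff₀ (by positivity) (by positivity), one_mul, ← Real.mul_rpow (by norm_num) h2.le]
  gcongr

lemma q_first {β M : ℝ} {c d : Lat → ℂ} (hc : HB β M c) (hd : HB β M d) (hb : 0 ≤ β) (hM : 0 ≤ M)
    (k : Lat) : ∑' m, ‖c m‖ * ‖d (k - m)‖ ≤ 2 * 4 ^ (β/2) * M ^ 2 * wt k ^ (-(β/2)) := by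
  obtain ⟨s1, t1⟩ := cs_sum hM hM (fun m => by have := wt_pos m; positivity)
    (fun _ => norm_nonneg _) hc.sq
    (sum_shift_le (f := fun k => ‖d k‖ ^ 2) (hd.sq0 hb) k)
  obtain ⟨s2, t2⟩ := cs_sum hM hM (fun _ => norm_nonneg _)
    (fun m => by have := wt_pos (k - m); positivity) (hc.sq0 hb)
    (sum_shift_le (f := fun k => (wt k ^ (β/2) * ‖d k‖) ^ 2) hd.sq k)
  have hk := wt_pos k
  set D := 4 ^ (β/2) * wt k ^ (-(β/2)) with hD
  have hD0 : 0 ≤ D := by positivity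
  have hpt : ∀ m, ‖c m‖ * ‖d (k - m)‖ ≤ D * (wt m ^ (β/2) * ‖c m‖ * ‖d (k-m)‖ +
      ‖c m‖ * (wt (k-m) ^ (β/2) * ‖d (k-m)‖)) := by
    intro m
    have hm := wt_pos m
    have hkm := wt_pos (k - m)
    rcases wt_split k m with h | h
    · have h1 := wt_neg_le h (s := β/2) (by linarith)
      have h2 : (1:ℝ) ≤ D * wt m ^ (β/2) := by
        rw [Real.rpow_neg hm.le] at h1
        rwa [inv_le_iff_one_le_mul₀ (by positivity)] at h1
      calc ‖c m‖ * ‖d (k - m)‖ = 1 * (‖c m‖ * ‖d (k - m)‖) := by ring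
        _ ≤ (D * wt m ^ (β/2)) * (‖c m‖ * ‖d (k - m)‖) := by gcongr
        _ = D * (wt m ^ (β/2) * ‖c m‖ * ‖d (k-m)‖ + 0) := by ring
        _ ≤ _ := by gcongr; positivity
    · have h1 := wt_neg_le h (s := β/2) (by linarith)
      have h2 : (1:ℝ) ≤ D * wt (k-m) ^ (β/2) := by
        rw [Real.rpow_neg hkm.le] at h1
        rwa [inv_le_iff_one_le_mul₀ (by positivity)] at h1
      calc ‖c m‖ * ‖d (k - m)‖ = 1 * (‖c m‖ * ‖d (k - m)‖) := by ring
        _ ≤ (D * wt (k-m) ^ (β/2)) * (‖c m‖ * ‖d (k - m)‖) := by gcongr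
        _ = D * (0 + ‖c m‖ * (wt (k-m) ^ (β/2) * ‖d (k-m)‖)) := by ring
        _ ≤ _ := by gcongr; positivity
  calc ∑' m, ‖c m‖ * ‖d (k - m)‖ ≤ ∑' m, D * (wt m ^ (β/2) * ‖c m‖ * ‖d (k-m)‖ +
      ‖c m‖ * (wt (k-m) ^ (β/2) * ‖d (k-m)‖)) :=
        (q_basic hc hd hb hM hM k).1.tsum_le_tsum hpt ((s1.add s2).mul_left D)
    _ = D * (∑' m, wt m ^ (β/2) * ‖c m‖ * ‖d (k-m)‖ +
        ∑' m, ‖c m‖ * (wt (k-m) ^ (β/2) * ‖d (k-m)‖)) := by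
          rw [tsum_mul_left, s1.tsum_add s2]
    _ ≤ D * (M * M + M * M) := by gcongr
    _ = _ := by rw [hD]; ring

/-- `∑ wt^{-r}`. -/
def Swt (r : ℝ) : ℝ := ∑' k : Lat, wt k ^ (-r)

lemma Swt_nonneg (r : ℝ) : 0 ≤ Swt r := tsum_nonneg fun k => by have := wt_pos k; positivity

lemma conv_wt_sum {a b : ℝ} (ha : 0 ≤ a) (hb : 0 ≤ b) (hab : 3/2 < a + b) (k : Lat)
    (s : Finset Lat) : ∑ m ∈ s, wt m ^ (-a) * wt (k - m) ^ (-b) ≤ 2 * Swt (a + b) := by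
  have hpt : ∀ m, wt m ^ (-a) * wt (k - m) ^ (-b) ≤ wt m ^ (-(a+b)) + wt (k-m) ^ (-(a+b)) := by
    intro m
    have hm := wt_pos m
    have hkm := wt_pos (k - m)
    rcases le_total (wt m) (wt (k-m)) with h | h
    · have : wt (k-m) ^ (-b) ≤ wt m ^ (-b) := Real.rpow_le_rpow_of_nonpos hm h (by linarith)
      calc _ ≤ wt m ^ (-a) * wt m ^ (-b) := by gcongr
        _ = wt m ^ (-(a+b)) := by rw [← Real.rpow_add hm]; congr 1; ring
        _ ≤ _ := by have : 0 ≤ wt (k-m) ^ (-(a+b)) := by positivity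
                    linarith
    · have : wt m ^ (-a) ≤ wt (k-m) ^ (-a) := Real.rpow_le_rpow_of_nonpos hkm h (by linarith)
      calc _ ≤ wt (k-m) ^ (-a) * wt (k-m) ^ (-b) := by gcongr
        _ = wt (k-m) ^ (-(a+b)) := by rw [← Real.rpow_add hkm]; congr 1; ring
        _ ≤ _ := by have : 0 ≤ wt m ^ (-(a+b)) := by positivity
                    linarith
  have hS : ∀ s : Finset Lat, ∑ k ∈ s, wt k ^ (-(a+b)) ≤ Swt (a+b) := fun s =>
    (summable_wt hab).sum_le_tsum s fun k _ => by have := wt_pos k; positivity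
  calc _ ≤ ∑ m ∈ s, (wt m ^ (-(a+b)) + wt (k-m) ^ (-(a+b))) := Finset.sum_le_sum fun m _ => hpt m
    _ ≤ Swt (a+b) + Swt (a+b) := by
      rw [Finset.sum_add_distrib]
      exact add_le_add (hS s) (sum_shift_le hS k s)
    _ = _ := by ring

/-- gain step -/
lemma q_half {β M A σ ρ : ℝ} {c d : Lat → ℂ} (hd : HB β M d) (hb : 0 ≤ β)
    (hM : 0 ≤ M) (hA : 0 ≤ A) (hρ : 0 ≤ ρ) (hρβ : 3/2 < 2 * ρ + β)
    (hcA : ∀ k, ‖c k‖ ≤ A * wt k ^ (-σ)) (k : Lat) (hσρ : ρ ≤ σ) :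
    ∃ g : Lat → ℝ, (∀ m, 0 ≤ g m) ∧ Summable g ∧
      ∑' m, g m ≤ A * 4 ^ (σ - ρ) * √(2 * Swt (2 * ρ + β)) * M * wt k ^ (-(σ - ρ)) ∧
      ∀ m, wt k ≤ 4 * wt m → ‖c m‖ * ‖d (k - m)‖ ≤ g m := by
  have hk := wt_pos k
  have hS := Swt_nonneg (2 * ρ + β)
  have h1 := cs_sum (f := fun m => wt m ^ (-ρ) * wt (k-m) ^ (-(β/2)))
    (g := fun m => wt (k-m) ^ (β/2) * ‖d (k-m)‖) (A := √(2 * Swt (2 * ρ + β))) (B := M)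
    (by positivity) hM (fun m => by have := wt_pos m; have := wt_pos (k-m); positivity)
    (fun m => by have := wt_pos m; have := wt_pos (k-m); positivity) (by
      intro s
      rw [Real.sq_sqrt (by positivity)]
      refine le_trans (le_of_eq ?_) (conv_wt_sum (a := 2*ρ) (b := β) (by linarith) hb hρβ k s)
      refine Finset.sum_congr rfl fun m _ => ?_
      have hm := wt_pos m
      have hkm := wt_pos (k - m)
      rw [mul_pow, ← Real.rpow_natCast, ← Real.rpow_natCast, ← Real.rpow_mul hm.le,
        ← Real.rpow_mul hkm.le]; congr 2 <;> push_cast <;> ring)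
    (sum_shift_le (f := fun k => (wt k ^ (β/2) * ‖d k‖) ^ 2) hd.sq k)
  obtain ⟨s1, t1⟩ := h1
  set D := A * 4 ^ (σ - ρ) * wt k ^ (-(σ - ρ)) with hD
  have hD0 : 0 ≤ D := by positivity
  refine ⟨fun m => D * ((wt m ^ (-ρ) * wt (k-m) ^ (-(β/2))) * (wt (k-m) ^ (β/2) * ‖d (k-m)‖)),
    fun m => ?_, s1.mul_left D, ?_, fun m h => ?_⟩
  · have := wt_pos m; have := wt_pos (k-m); positivity
  · rw [tsum_mul_left]
    calc _ ≤ D * (√(2 * Swt (2 * ρ + β)) * M) := by gcongr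
      _ = _ := by rw [hD]; ring
  · have hm := wt_pos m
    have hkm := wt_pos (k - m)
    have e1 : (wt m ^ (-ρ) * wt (k-m) ^ (-(β/2))) * (wt (k-m) ^ (β/2) * ‖d (k-m)‖)
        = wt m ^ (-ρ) * ‖d (k-m)‖ := by
      have : wt (k-m) ^ (-(β/2)) * wt (k-m) ^ (β/2) = 1 := by
        rw [← Real.rpow_add hkm]; simp
      linear_combination wt m ^ (-ρ) * ‖d (k-m)‖ * this
    beta_reduce
    rw [e1]
    have h2 := wt_neg_le h (s := σ - ρ) (by linarith)
    calc ‖c m‖ * ‖d (k - m)‖ ≤ (A * wt m ^ (-σ)) * ‖d (k-m)‖ := by gcongr; exact hcA m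
      _ = A * wt m ^ (-(σ - ρ)) * wt m ^ (-ρ) * ‖d (k-m)‖ := by
        have e2 : wt m ^ (-σ) = wt m ^ (-(σ - ρ)) * wt m ^ (-ρ) := by
          rw [← Real.rpow_add hm]; congr 1; ring
        rw [e2]; ring
      _ ≤ A * (4 ^ (σ - ρ) * wt k ^ (-(σ - ρ))) * wt m ^ (-ρ) * ‖d (k-m)‖ := by gcongr
      _ = _ := by rw [hD]; ring

lemma q_step {β M A σ ρ : ℝ} {c d : Lat → ℂ} (hc : HB β M c) (hd : HB β M d) (hb : 0 ≤ β)
    (hM : 0 ≤ M) (hA : 0 ≤ A) (hρ : 0 ≤ ρ) (hρβ : 3/2 < 2 * ρ + β)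
    (hcA : ∀ k, ‖c k‖ ≤ A * wt k ^ (-σ)) (hdA : ∀ k, ‖d k‖ ≤ A * wt k ^ (-σ)) (hσρ : ρ ≤ σ)
    (k : Lat) :
    ∑' m, ‖c m‖ * ‖d (k - m)‖ ≤
      2 * (A * 4 ^ (σ - ρ) * √(2 * Swt (2 * ρ + β)) * M) * wt k ^ (-(σ - ρ)) := by
  obtain ⟨g, g0, gs, gt, gle⟩ := q_half hd hb hM hA hρ hρβ hcA k hσρ
  obtain ⟨g', g0', gs', gt', gle'⟩ := q_half hc hb hM hA hρ hρβ hdA k hσρ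
  have hinj : Function.Injective fun m : Lat => k - m := fun a b hab => sub_right_injective hab
  have gs2 : Summable fun m => g' (k - m) := gs'.comp_injective hinj
  have e : ∑' m, g' (k - m) = ∑' m, g' m := (Equiv.subLeft k).tsum_eq g'
  calc ∑' m, ‖c m‖ * ‖d (k - m)‖ ≤ ∑' m, (g m + g' (k - m)) := by
        refine (q_basic hc hd hb hM hM k).1.tsum_le_tsum (fun m => ?_) (gs.add gs2)
        rcases wt_split k m with h | h
        · linarith [gle m h, g0' (k - m)]
        · have := gle' (k - m) h
          rw [sub_sub_cancel] at this
          linarith [g0 m, mul_comm ‖c m‖ ‖d (k-m)‖]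
    _ = ∑' m, g m + ∑' m, g' m := by rw [gs.tsum_add gs2, e]
    _ ≤ _ := by linarith

end

section

def tpi : ℂ := 2 * Real.pi * Complex.I

lemma norm_tpi : ‖tpi‖ = 2 * Real.pi := by
  unfold tpi; simp [abs_of_pos Real.pi_pos]

lemma tpi_sq : tpi ^ 2 = -(4 * Real.pi ^ 2) := by
  unfold tpi; rw [mul_pow, Complex.I_sq]; ring

lemma tpi_ne : tpi ≠ 0 := by
  unfold tpi; simp [Real.pi_ne_zero]

lemma tpi_conj : (starRingEnd ℂ) tpi = - tpi := by
  unfold tpi; simp [Complex.conj_ofNat]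

/-- convolution of coefficient sequences -/
def qC (c : Fin 3 → Lat → ℂ) (i j : Fin 3) (k : Lat) : ℂ := ∑' m, c i m * c j (k - m)

def NC (c : Fin 3 → Lat → ℂ) (j : Fin 3) (k : Lat) : ℂ := -∑ i, tpi * (k i : ℂ) * qC c i j k

def FC (ν : ℝ) (c : Fin 3 → Lat → ℂ) (j : Fin 3) (k : Lat) : ℂ :=
  -((4 * Real.pi ^ 2 * ν * latSq k : ℝ) : ℂ) * c j k +
    (NC c j k - (k j : ℂ) * (∑ l, (k l : ℂ) * NC c l k) / (latSq k : ℂ))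

lemma latSq_eq (k : Lat) : latSq k = latNorm k ^ 2 := (latNorm_sq k).symm

lemma latSq_cast (k : Lat) : (latSq k : ℂ) = ∑ i, (k i : ℂ) * (k i : ℂ) := by
  unfold latSq; push_cast; refine Finset.sum_congr rfl fun i _ => by ring

lemma latSq_zero_iff (k : Lat) : latSq k = 0 ↔ k = 0 := by
  rw [latSq_eq]
  constructor
  · intro h
    rcases latNorm_zero_or k with h' | h'
    · exact h'
    · nlinarith
  · rintro rfl; rw [latNorm_zero]; norm_num

structure SmV (u : Vec → Vec) : Prop where
  smooth : ContDiff ℝ (⊤ : ℕ∞) u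
  per : Per u
  div : ∀ x, ∑ i, pd i (fun y => u y i) x = 0

lemma contDiff_comp_coord {u : Vec → Vec} (h : ContDiff ℝ (⊤ : ℕ∞) u) (j : Fin 3) :
    ContDiff ℝ (⊤ : ℕ∞) (fun x => u x j) :=
  (EuclideanSpace.proj (𝕜 := ℝ) j).contDiff.comp h

lemma contDiff_ofReal' {f : Vec → ℝ} (h : ContDiff ℝ (⊤ : ℕ∞) f) :
    ContDiff ℝ (⊤ : ℕ∞) (fun x => (f x : ℂ)) :=
  Complex.ofRealCLM.contDiff.comp h

lemma diffble {E : Type*} [NormedAddCommGroup E] [NormedSpace ℝ E] {f : Vec → E}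
    (h : ContDiff ℝ (⊤ : ℕ∞) f) : Differentiable ℝ f := h.differentiable (by simp)

lemma Sm.ofReal {f : Vec → ℝ} (h : ContDiff ℝ (⊤ : ℕ∞) f) (hp : Per f) :
    Sm (fun x => (f x : ℂ)) :=
  ⟨contDiff_ofReal' h, fun x n => by simp only [hp x n]⟩

lemma Per.coord {u : Vec → Vec} (h : Per u) (j : Fin 3) : Per (fun x => u x j) :=
  fun x n => by simp only [h x n]

lemma SmV.comp {u : Vec → Vec} (h : SmV u) (j : Fin 3) : Sm (uC u j) :=
  Sm.ofReal (contDiff_comp_coord h.smooth j) (h.per.coord j)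

lemma SmV.divC {u : Vec → Vec} (h : SmV u) (x : Vec) : ∑ i, pd i (uC u i) x = 0 := by
  have := h.div x
  have h2 : ∀ i, pd i (uC u i) x = ((pd i (fun y => u y i) x : ℝ) : ℂ) := fun i =>
    pd_ofReal (diffble (contDiff_comp_coord h.smooth i) x) i
  simp only [h2]
  exact_mod_cast this

lemma fcV_eq (u : Vec → Vec) (j : Fin 3) (k : Lat) : fcV u j k = fc (uC u j) k := rfl

lemma SmV.div_fc {u : Vec → Vec} (h : SmV u) (k : Lat) : ∑ j, (k j : ℂ) * fcV u j k = 0 := by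
  have h1 : fc (fun x => ∑ i, pd i (uC u i) x) k = 0 := by
    simp only [h.divC]; simp [fc]
  rw [fc_sum _ fun i _ => ((h.comp i).pd i).integrable] at h1
  simp only [fc_pd (h.comp _)] at h1
  change ∑ i, tpi * (k i : ℂ) * fcV u i k = 0 at h1
  simp only [mul_assoc, ← Finset.mul_sum] at h1
  exact (mul_eq_zero.mp h1).resolve_left tpi_ne

lemma fcV_neg (u : Vec → Vec) (j : Fin 3) (k : Lat) :
    fcV u j (-k) = (starRingEnd ℂ) (fcV u j k) := by
  unfold fcV
  rw [fc_def, fc_def, ← integral_conj]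
  refine integral_congr_ae (ae_of_all _ fun x => ?_)
  simp [chr_conj]

lemma SmV.q {u : Vec → Vec} (h : SmV u) (i j : Fin 3) (k : Lat) :
    fc (fun x => uC u i x * uC u j x) k = qC (fcV u) i j k :=
  ((hasSum_fc_mul (h.comp i) (h.comp j).integrable k).tsum_eq).symm

def Gd (ν : ℝ) (u : Vec → Vec) (p : Vec → ℝ) (j : Fin 3) (x : Vec) : ℝ :=
  ν * (∑ i, pd i (fun y => pd i (fun z => u z j) y) x)
            - (∑ i, u x i * pd i (fun y => u y j) x) - pd j p x

lemma Gd_contDiff {ν : ℝ} {u : Vec → Vec} {p : Vec → ℝ} (hu : ContDiff ℝ (⊤ : ℕ∞) u)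
    (hp : ContDiff ℝ (⊤ : ℕ∞) p) (j : Fin 3) : ContDiff ℝ (⊤ : ℕ∞) (Gd ν u p j) := by
  unfold Gd
  refine ((contDiff_const.mul (ContDiff.sum fun i _ => ?_)).sub
    (ContDiff.sum fun i _ => ?_)).sub (contDiff_pd hp j)
  · exact contDiff_pd (contDiff_pd (contDiff_comp_coord hu j) i) i
  · exact (contDiff_comp_coord hu i).mul (contDiff_pd (contDiff_comp_coord hu j) i)

lemma Gd_per {ν : ℝ} {u : Vec → Vec} {p : Vec → ℝ} (hu : Per u)
    (hp : Per p) (j : Fin 3) : Per (Gd ν u p j) := by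
  intro x n
  unfold Gd
  have h1 : ∀ i, pd i (fun y => pd i (fun z => u z j) y) (x + latv n)
      = pd i (fun y => pd i (fun z => u z j) y) x := fun i => ((hu.coord j).pd i).pd i x n
  have h2 : ∀ i, pd i (fun z => u z j) (x + latv n) = pd i (fun z => u z j) x :=
    fun i => ((hu.coord j).pd i) x n
  simp only [h1, h2, hu x n, hp.pd j x n]

lemma Gd_eq {ν : ℝ} {u : Vec → Vec} {p : Vec → ℝ} (h : SmV u) (hp : ContDiff ℝ (⊤ : ℕ∞) p)
    (j : Fin 3) (x : Vec) :
    ((Gd ν u p j x : ℝ) : ℂ) = (ν : ℂ) * (∑ i, pd i (pd i (uC u j)) x)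
      - (∑ i, pd i (fun y => uC u i y * uC u j y) x) - pd j (fun y => (p y : ℂ)) x := by
  have e1 : ∀ i, pd i (uC u j) = fun x => ((pd i (fun y => u y j) x : ℝ) : ℂ) := fun i => by
    ext x; exact pd_ofReal (diffble (contDiff_comp_coord h.smooth j) x) i
  have e2 : ∀ i, pd i (pd i (uC u j)) x
      = ((pd i (fun y => pd i (fun z => u z j) y) x : ℝ) : ℂ) := fun i => by
    rw [e1]
    exact pd_ofReal (diffble (contDiff_pd (contDiff_comp_coord h.smooth j) i) x) i
  have e3 : ∑ i, pd i (fun y => uC u i y * uC u j y) x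
      = ∑ i, uC u i x * pd i (uC u j) x := by
    have : ∀ i, pd i (fun y => uC u i y * uC u j y) x
        = pd i (uC u i) x * uC u j x + uC u i x * pd i (uC u j) x := fun i =>
      pd_mul ((h.comp i).differentiable x) ((h.comp j).differentiable x) i
    simp only [this, Finset.sum_add_distrib, ← Finset.sum_mul, h.divC, zero_mul, zero_add]
  rw [e3, pd_ofReal (diffble hp x)]
  rw [Finset.sum_congr rfl fun i _ => e2 i]
  simp only [e1]
  unfold Gd uC
  push_cast
  ring

lemma fc_Gd {ν : ℝ} {u : Vec → Vec} {p : Vec → ℝ} (h : SmV u) (hp : ContDiff ℝ (⊤ : ℕ∞) p)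
    (hpp : Per p) (j : Fin 3) (k : Lat) :
    fc (fun x => ((Gd ν u p j x : ℝ) : ℂ)) k =
      -((4 * Real.pi ^ 2 * ν * latSq k : ℝ) : ℂ) * fcV u j k + NC (fcV u) j k
        - tpi * (k j : ℂ) * fc (fun x => (p x : ℂ)) k := by
  have hP : Sm (fun x => (p x : ℂ)) := Sm.ofReal hp hpp
  have hA : Sm (fun x => (ν : ℂ) * (∑ i, pd i (pd i (uC u j)) x)) :=
    Sm.const_mul _ (Sm.sum _ fun i _ => ((h.comp j).pd i).pd i)
  have hB' : ∀ i, Sm (pd i (fun y => uC u i y * uC u j y)) := fun i =>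
    ((h.comp i).mul (h.comp j)).pd i
  have hB : Sm (fun x => ∑ i, pd i (fun y => uC u i y * uC u j y) x) :=
    Sm.sum _ fun i _ => hB' i
  simp only [Gd_eq h hp]
  rw [fc_sub (hA.sub hB).integrable (hP.pd j).integrable, fc_sub hA.integrable hB.integrable,
    fc_const_mul, fc_sum _ fun i _ => (((h.comp j).pd i).pd i).integrable,
    fc_sum _ fun i _ => (hB' i).integrable, fc_pd hP]
  have e1 : ∀ i, fc (pd i (pd i (uC u j))) k
      = -((4 * Real.pi ^ 2 : ℝ) : ℂ) * ((k i : ℂ) * (k i : ℂ)) * fcV u j k := fun i => by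
    rw [fc_pd ((h.comp j).pd i), fc_pd (h.comp j), fcV_eq]
    change tpi * _ * (tpi * _ * _) = _
    have := tpi_sq
    push_cast
    linear_combination (k i : ℂ) * (k i : ℂ) * fc (uC u j) k * this
  have e2 : ∀ i, fc (pd i (fun y => uC u i y * uC u j y)) k
      = tpi * (k i : ℂ) * qC (fcV u) i j k := fun i => by
    rw [fc_pd ((h.comp i).mul (h.comp j)), h.q]; rfl
  simp only [e1, e2]
  rw [← Finset.sum_mul, ← Finset.mul_sum, ← latSq_cast]
  unfold NC tpi
  push_cast
  ring

lemma fc_Gd_FC {ν : ℝ} {u : Vec → Vec} {p : Vec → ℝ} (h : SmV u) (hp : ContDiff ℝ (⊤ : ℕ∞) p)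
    (hpp : Per p)
    (hG : ∀ k : Lat, ∑ j, (k j : ℂ) * fc (fun x => ((Gd ν u p j x : ℝ) : ℂ)) k = 0)
    (j : Fin 3) (k : Lat) :
    fc (fun x => ((Gd ν u p j x : ℝ) : ℂ)) k = FC ν (fcV u) j k := by
  have h1 := hG k
  simp only [fc_Gd h hp hpp] at h1 ⊢
  have h2 := h.div_fc k
  have h3 := latSq_cast k
  rw [Fin.sum_univ_three] at h1 h2 h3
  unfold FC
  by_cases hk : k = 0
  · subst hk; simp [latSq]
  have hk' : (latSq k : ℂ) ≠ 0 := by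
    rw [Ne, Complex.ofReal_eq_zero, latSq_zero_iff]; exact hk
  have h4 : ∑ l, (k l : ℂ) * NC (fcV u) l k
      = tpi * fc (fun x => (p x : ℂ)) k * (latSq k : ℂ) := by
    rw [Fin.sum_univ_three, h3]
    push_cast at h1
    linear_combination h1 + 4 * Real.pi ^ 2 * ν * (latSq k : ℂ) * h2
  rw [h4]
  field_simp
  ring

lemma HB_of_Hs {β M : ℝ} {u : Vec → Vec} (hM : 0 ≤ M) (h : HsNormV β u ≤ ENNReal.ofReal M)
    (j : Fin 3) : HB β M (fcV u j) := by
  intro s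
  have h1 : HsNorm β (fun x => (u x j : ℂ)) ≤ ENNReal.ofReal M :=
    le_trans (Finset.single_le_sum (f := fun j => HsNorm β (fun x => (u x j : ℂ)))
      (fun _ _ => zero_le) (Finset.mem_univ j)) h
  unfold HsNorm HsNormC at h1
  have h2 : sobSqC β (fc fun x => (u x j : ℂ)) ≤ ENNReal.ofReal (M ^ 2) := by
    have := ENNReal.rpow_le_rpow h1 (z := 2) (by norm_num)
    rw [← ENNReal.rpow_mul] at this
    norm_num at this
    rwa [← ENNReal.ofReal_pow hM] at this
  have h3 := le_trans (ENNReal.sum_le_tsum s) h2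
  rw [← ENNReal.ofReal_sum_of_nonneg (fun k _ => by have := wt_pos k; unfold wt at this; positivity)]
    at h3
  exact (ENNReal.ofReal_le_ofReal_iff (by positivity)).mp h3

lemma Hs_of_HB {β M : ℝ} {f : Vec → ℂ} (hM : 0 ≤ M) (h : HB β M (fc f)) :
    HsNorm β f ≤ ENNReal.ofReal M := by
  unfold HsNorm HsNormC
  have h2 : sobSqC β (fc f) ≤ ENNReal.ofReal (M ^ 2) := by
    unfold sobSqC
    rw [ENNReal.tsum_eq_iSup_sum]
    refine iSup_le fun s => ?_
    rw [← ENNReal.ofReal_sum_of_nonneg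
      (fun k _ => by have := wt_pos k; unfold wt at this; positivity)]
    exact ENNReal.ofReal_le_ofReal (h s)
  calc _ ≤ (ENNReal.ofReal (M ^ 2)) ^ (1/2:ℝ) := by gcongr
    _ = _ := by
      rw [ENNReal.ofReal_rpow_of_nonneg (by positivity) (by norm_num), ← Real.sqrt_eq_rpow,
        Real.sqrt_sq hM]

lemma Hs_of_HBV {β M : ℝ} {u : Vec → Vec} (hM : 0 ≤ M) (h : ∀ j, HB β M (fcV u j)) :
    HsNormV β u ≤ 3 * ENNReal.ofReal M := by
  unfold HsNormV
  calc _ ≤ ∑ j : Fin 3, ENNReal.ofReal M := Finset.sum_le_sum fun j _ => Hs_of_HB hM (h j)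
    _ = _ := by simp

lemma fcV_zero_of_im {u : Vec → Vec} (j : Fin 3) : (fcV u j 0).im = 0 := by
  have := fcV_neg u j 0
  rw [neg_zero] at this
  exact Complex.conj_eq_iff_im.mp this.symm

end

section

lemma qC_norm_le {β M : ℝ} {c : Fin 3 → Lat → ℂ} (h : ∀ j, HB β M (c j)) (hb : 0 ≤ β) (hM : 0 ≤ M)
    (i j : Fin 3) (k : Lat) : ‖qC c i j k‖ ≤ ∑' m, ‖c i m‖ * ‖c j (k - m)‖ := by
  have hs := (q_basic (h i) (h j) hb hM hM k).1
  unfold qC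
  have : (fun m => ‖c i m‖ * ‖c j (k - m)‖) = fun m => ‖c i m * c j (k - m)‖ := by
    ext m; rw [norm_mul]
  rw [this] at hs ⊢
  exact norm_tsum_le_tsum_norm hs

def PC (c : Fin 3 → Lat → ℂ) (j : Fin 3) (k : Lat) : ℂ :=
  NC c j k - (k j : ℂ) * (∑ l, (k l : ℂ) * NC c l k) / (latSq k : ℂ)

lemma FC_eq (ν : ℝ) (c : Fin 3 → Lat → ℂ) (j : Fin 3) (k : Lat) :
    FC ν c j k = -((4 * Real.pi ^ 2 * ν * latSq k : ℝ) : ℂ) * c j k + PC c j k := rfl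

lemma norm_k_le (k : Lat) (j : Fin 3) : ‖(k j : ℂ)‖ ≤ latNorm k := by
  rw [Complex.norm_intCast]; exact abs_le_latNorm k j

lemma NC_le {c : Fin 3 → Lat → ℂ} {k : Lat} {Q : ℝ} (h : ∀ i j, ‖qC c i j k‖ ≤ Q) (j : Fin 3) :
    ‖NC c j k‖ ≤ 6 * Real.pi * latNorm k * Q := by
  unfold NC
  rw [norm_neg]
  calc _ ≤ ∑ i : Fin 3, 2 * Real.pi * latNorm k * Q := by
        refine (norm_sum_le _ _).trans (Finset.sum_le_sum fun i _ => ?_)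
        rw [norm_mul, norm_mul, norm_tpi]
        have := h i j
        have := norm_k_le k i
        have := Real.pi_pos
        have := latNorm_nonneg k
        gcongr
    _ = _ := by simp; ring

lemma PC_le {c : Fin 3 → Lat → ℂ} {k : Lat} {Q : ℝ} (h : ∀ i j, ‖qC c i j k‖ ≤ Q) (j : Fin 3) :
    ‖PC c j k‖ ≤ 24 * Real.pi * latNorm k * Q := by
  have hQ : 0 ≤ Q := (norm_nonneg _).trans (h 0 0)
  have hN := NC_le h
  set B := 6 * Real.pi * latNorm k * Q with hB
  have hk0 := latNorm_nonneg k
  have hB0 : 0 ≤ B := by have := Real.pi_pos; positivity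
  have h1 : ‖(k j : ℂ) * (∑ l, (k l : ℂ) * NC c l k) / (latSq k : ℂ)‖ ≤ 3 * B := by
    rw [norm_div, norm_mul, latSq_eq]
    rcases latNorm_zero_or k with rfl | hk
    · simp [latNorm_zero]; positivity
    have hn : ‖((latNorm k ^ 2 : ℝ) : ℂ)‖ = latNorm k ^ 2 := by
      rw [Complex.norm_real, Real.norm_of_nonneg (by positivity)]
    rw [hn, div_le_iff₀ (by positivity)]
    have h2 : ‖∑ l, (k l : ℂ) * NC c l k‖ ≤ 3 * (latNorm k * B) := by
      refine (norm_sum_le _ _).trans ?_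
      calc _ ≤ ∑ l : Fin 3, latNorm k * B := by
            refine Finset.sum_le_sum fun l _ => ?_
            rw [norm_mul]
            have := norm_k_le k l
            have := hN l
            gcongr
        _ = _ := by simp
    calc _ ≤ latNorm k * (3 * (latNorm k * B)) := by
          have := norm_k_le k j
          gcongr
      _ = _ := by ring
  unfold PC
  calc _ ≤ ‖NC c j k‖ + _ := norm_sub_le _ _
    _ ≤ B + 3 * B := add_le_add (hN j) h1
    _ = _ := by rw [hB]; ring

lemma FC_le {ν β M : ℝ} {c : Fin 3 → Lat → ℂ} (h : ∀ j, HB β M (c j)) (hb : 0 ≤ β) (hM : 0 ≤ M)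
    (hν : 0 ≤ ν)
    (j : Fin 3) (k : Lat) :
    ‖FC ν c j k‖ ≤ 4 * Real.pi ^ 2 * ν * latNorm k ^ 2 * M + 24 * Real.pi * latNorm k * M ^ 2 := by
  rw [FC_eq]
  have hq : ∀ i j, ‖qC c i j k‖ ≤ M ^ 2 := fun i j => by
    rw [pow_two]
    exact (qC_norm_le h hb hM i j k).trans (q_basic (h i) (h j) hb hM hM k).2
  have h1 := PC_le hq j
  refine (norm_add_le _ _).trans (add_le_add ?_ h1)
  rw [norm_mul, norm_neg, Complex.norm_real, latSq_eq, Real.norm_of_nonneg (by positivity)]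
  have := (h j).pt0 hb hM k
  gcongr

lemma duhamel {y h : ℝ → ℂ} {a t l H : ℝ} (hat : a ≤ t) (hl : 0 < l) (hH : 0 ≤ H)
    (hc : ContinuousOn y (Set.Icc a t))
    (hd : ∀ s ∈ Set.Ioo a t, HasDerivAt y (-(l : ℂ) * y s + h s) s)
    (hh : ∀ s ∈ Set.Ioo a t, ‖h s‖ ≤ H) : ‖y t‖ ≤ ‖y a‖ + H / l := by
  rcases eq_or_lt_of_le hat with rfl | hat
  · have : 0 ≤ H / l := by positivity
    linarith
  have key : ∀ a' ∈ Set.Ioo a t, ‖y t‖ ≤ ‖y a'‖ + H / l := by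
    intro a' ha'
    have hz : ∀ s ∈ Set.Ioo a t, HasDerivAt (fun s => (Real.exp (l * s) : ℂ) * y s)
        ((Real.exp (l * s) : ℂ) * h s) s := by
      intro s hs
      have h1 : HasDerivAt (fun s : ℝ => (Real.exp (l * s) : ℂ)) ((Real.exp (l * s) * l : ℝ) : ℂ) s := by
        have : HasDerivAt (fun s : ℝ => Real.exp (l * s)) (Real.exp (l * s) * l) s := by
          simpa using ((hasDerivAt_id s).const_mul l).exp
        exact this.ofReal_comp
      have h2 := h1.mul (hd s hs)
      have e : ((Real.exp (l * s) : ℂ) * h s) = ((Real.exp (l * s) * l : ℝ) : ℂ) * y s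
          + (Real.exp (l * s) : ℂ) * (-(l : ℂ) * y s + h s) := by push_cast; ring
      rw [e]; exact h2
    have hB : ∀ s, HasDerivAt (fun s => Real.exp (l * a') * ‖y a'‖ +
        H / l * (Real.exp (l * s) - Real.exp (l * a'))) (H * Real.exp (l * s)) s := by
      intro s
      have : HasDerivAt (fun s : ℝ => Real.exp (l * s)) (Real.exp (l * s) * l) s := by
        simpa using ((hasDerivAt_id s).const_mul l).exp
      have h2 := ((this.sub_const (Real.exp (l * a'))).const_mul (H / l)).const_add
        (Real.exp (l * a') * ‖y a'‖)
      have e : H * Real.exp (l * s) = H / l * (Real.exp (l * s) * l) := by field_simp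
      rw [e]; exact h2
    have hco : ContinuousOn (fun s => (Real.exp (l * s) : ℂ) * y s) (Set.Icc a' t) := by
      refine ContinuousOn.mul ?_ (hc.mono (Set.Icc_subset_Icc ha'.1.le le_rfl))
      exact (by fun_prop : Continuous fun s : ℝ => (Real.exp (l * s) : ℂ)).continuousOn
    have := image_norm_le_of_norm_deriv_right_le_deriv_boundary hco
      (f' := fun s => (Real.exp (l * s) : ℂ) * h s)
      (fun s hs => (hz s ⟨ha'.1.trans_le hs.1, hs.2⟩).hasDerivWithinAt)
      (B := fun s => Real.exp (l * a') * ‖y a'‖ +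
        H / l * (Real.exp (l * s) - Real.exp (l * a')))
      (B' := fun s => H * Real.exp (l * s))
      (by simp only [sub_self, mul_zero, add_zero]
          rw [norm_mul, Complex.norm_real, Real.norm_of_nonneg (Real.exp_pos _).le])
      hB (fun s hs => by
          rw [norm_mul, Complex.norm_real, Real.norm_of_nonneg (Real.exp_pos _).le, mul_comm]
          have := hh s ⟨ha'.1.trans_le hs.1, hs.2⟩
          gcongr) (x := t) ⟨ha'.2.le, le_rfl⟩
    rw [norm_mul, Complex.norm_real, Real.norm_of_nonneg (Real.exp_pos _).le] at this
    have hE := Real.exp_pos (l * t)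
    have hE' := Real.exp_pos (l * a')
    have hmon : Real.exp (l * a') ≤ Real.exp (l * t) := by
      apply Real.exp_le_exp.mpr; nlinarith [ha'.2]
    have h3 : Real.exp (l * a') * ‖y a'‖ ≤ Real.exp (l * t) * ‖y a'‖ := by gcongr
    have h4 : H / l * (Real.exp (l * t) - Real.exp (l * a')) ≤ H / l * Real.exp (l * t) := by
      gcongr; linarith
    have h5 : Real.exp (l * t) * ‖y t‖ ≤ Real.exp (l * t) * (‖y a'‖ + H / l) := by linarith
    exact le_of_mul_le_mul_left h5 hE
  have hlim : Tendsto (fun a' => ‖y a'‖ + H / l) (𝓝[Set.Ioo a t] a) (𝓝 (‖y a‖ + H / l)) := by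
    have := (hc a ⟨le_rfl, hat.le⟩).mono (Set.Ioo_subset_Icc_self)
    exact (this.norm).add_const _
  have hne : (𝓝[Set.Ioo a t] a).NeBot := by
    rw [← mem_closure_iff_nhdsWithin_neBot, closure_Ioo hat.ne]
    exact ⟨le_rfl, hat.le⟩
  exact ge_of_tendsto hlim (eventually_nhdsWithin_of_forall key)

/-- A trajectory of the Fourier-side Navier-Stokes system. -/
structure Traj (ν β M N a b : ℝ) (c : ℝ → Fin 3 → Lat → ℂ) : Prop where
  cont : ∀ j k, ContinuousOn (fun s => c s j k) (Set.Icc a b)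
  hb : ∀ s ∈ Set.Icc a b, ∀ j, HB β M (c s j)
  ode : ∀ j k, ∀ s ∈ Set.Ioo a b, HasDerivAt (fun s => c s j k) (FC ν (c s) j k) s
  ini0 : ∀ j k, ‖c a j k‖ ≤ N * wt k ^ (-(3:ℝ))

lemma Traj.restrict {ν β M N a b : ℝ} {c : ℝ → Fin 3 → Lat → ℂ} (h : Traj ν β M N a b c) {s : ℝ}
    (hs : s ∈ Set.Icc a b) : Traj ν β M N a s c where
  cont j k := (h.cont j k).mono (Set.Icc_subset_Icc le_rfl hs.2)
  hb r hr := h.hb r ⟨hr.1, hr.2.trans hs.2⟩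
  ode j k r hr := h.ode j k r ⟨hr.1, hr.2.trans_le hs.2⟩
  ini0 := h.ini0

lemma wt_le_two {k : Lat} (hk : 1 ≤ latNorm k) : wt k ^ (1/2:ℝ) ≤ 2 * latNorm k := by
  rw [← Real.sqrt_eq_rpow]
  apply Real.sqrt_le_iff.mpr
  constructor
  · positivity
  · unfold wt; nlinarith

lemma boot_step {ν β M N Q τ r : ℝ} (hν : 0 < ν) (hb : 0 ≤ β) (hM : 0 ≤ M) (hN : 0 ≤ N)
    (hQ : 0 ≤ Q) (hr : r ≤ τ + 1/2) (hr3 : r ≤ 3) {a b : ℝ} {c : ℝ → Fin 3 → Lat → ℂ}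
    (h : Traj ν β M N a b c)
    (hq : ∀ s ∈ Set.Icc a b, ∀ i j k, ‖qC (c s) i j k‖ ≤ Q * wt k ^ (-τ))
    (s : ℝ) (hs : s ∈ Set.Icc a b) (j : Fin 3) (k : Lat) :
    ‖c s j k‖ ≤ (N + M + 12 * Q / (Real.pi * ν)) * wt k ^ (-r) := by
  have hπ := Real.pi_pos
  have hw := wt_pos k
  have hw1 := one_le_wt k
  have hC : 0 ≤ 12 * Q / (Real.pi * ν) := by positivity
  rcases latNorm_zero_or k with rfl | hk
  · have : wt 0 = 1 := by simp [wt, latNorm_zero]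
    rw [this, Real.one_rpow, mul_one]
    have := (h.hb s hs j).pt0 hb hM 0
    linarith
  · have h' := h.restrict hs
    have hk0 : 0 < latNorm k := by linarith
    have := duhamel (y := fun s => c s j k) (h := fun s => PC (c s) j k) (a := a) (t := s)
      (l := 4 * Real.pi ^ 2 * ν * latSq k) (H := 24 * Real.pi * latNorm k * (Q * wt k ^ (-τ)))
      hs.1 (by rw [latSq_eq]; positivity) (by positivity) (h'.cont j k)
      (fun r hr => by have := h'.ode j k r hr; rwa [FC_eq] at this)
      (fun r hr => PC_le (fun i j => hq r ⟨hr.1.le, hr.2.le.trans hs.2⟩ i j k) j)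
    have e1 : 24 * Real.pi * latNorm k * (Q * wt k ^ (-τ)) / (4 * Real.pi ^ 2 * ν * latSq k)
        ≤ 12 * Q / (Real.pi * ν) * wt k ^ (-r) := by
      have h1 := wt_le_two hk
      have h2 : wt k ^ (-τ) ≤ wt k ^ (-r) * wt k ^ (1/2:ℝ) := by
        rw [← Real.rpow_add hw]
        exact Real.rpow_le_rpow_of_exponent_le hw1 (by linarith)
      rw [latSq_eq, div_le_iff₀ (by positivity)]
      have h3 : wt k ^ (-τ) ≤ wt k ^ (-r) * (2 * latNorm k) := h2.trans (by gcongr)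
      calc _ ≤ 24 * Real.pi * latNorm k * (Q * (wt k ^ (-r) * (2 * latNorm k))) := by gcongr
        _ = _ := by field_simp; ring
    have e2 : N * wt k ^ (-(3:ℝ)) ≤ N * wt k ^ (-r) := by
      gcongr
    have e3 : 0 ≤ M * wt k ^ (-r) := by positivity
    have e4 := h.ini0 j k
    calc _ ≤ _ := this
      _ ≤ N * wt k ^ (-r) + M * wt k ^ (-r) + 12 * Q / (Real.pi * ν) * wt k ^ (-r) := by linarith
      _ = _ := by ring

lemma bootstrap {ν β M N : ℝ} (hν : 0 < ν) (hb : 1/2 < β) (hb' : β ≤ 3/4) (hM : 0 ≤ M)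
    (hN : 0 ≤ N) : ∃ A : ℝ, 0 ≤ A ∧ ∀ (a b : ℝ) (c : ℝ → Fin 3 → Lat → ℂ),
      Traj ν β M N a b c → ∀ s ∈ Set.Icc a b, ∀ j k, ‖c s j k‖ ≤ A * wt k ^ (-(3:ℝ)) := by
  set δ := (β - 1/2) / 2 with hδ
  have hδ0 : 0 < δ := by rw [hδ]; linarith
  set ρ := (1 - δ) / 2 with hρ
  have hπ := Real.pi_pos
  have key : ∀ n : ℕ, ∃ A : ℝ, 0 ≤ A ∧ ∀ (a b : ℝ) (c : ℝ → Fin 3 → Lat → ℂ),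
      Traj ν β M N a b c → ∀ s ∈ Set.Icc a b, ∀ j k,
        ‖c s j k‖ ≤ A * wt k ^ (-(min 3 (1/2 + n * (δ/2)))) := by
    intro n
    induction n with
    | zero =>
      refine ⟨N + M + 12 * (2 * 4 ^ (β/2) * M ^ 2) / (Real.pi * ν), by positivity,
        fun a b c h s hs j k => ?_⟩
      refine boot_step hν (by linarith) hM hN (by positivity) (τ := β/2) ?_ (min_le_left _ _) h
        (fun s hs i j k => ?_) s hs j k
      · refine (min_le_right _ _).trans ?_
        simp; linarith
      · exact (qC_norm_le (h.hb s hs) (by linarith) hM i j k).trans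
          (q_first (h.hb s hs i) (h.hb s hs j) (by linarith) hM k)
    | succ n ih =>
      obtain ⟨A, hA, ih⟩ := ih
      set σ := min 3 (1/2 + n * (δ/2)) with hσ
      have hσ1 : 1/2 ≤ σ := by
        rw [hσ]; refine le_min (by norm_num) ?_
        have : 0 ≤ n * (δ/2) := by positivity
        linarith
      refine ⟨N + M + 12 * (2 * (A * 4 ^ (σ - ρ) * √(2 * Swt (2 * ρ + β)) * M)) / (Real.pi * ν),
        by positivity, fun a b c h s hs j k => ?_⟩
      refine boot_step hν (by linarith) hM hN (by positivity) (τ := σ - ρ) ?_ (min_le_left _ _) h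
        (fun s hs i j k => ?_) s hs j k
      · have : σ - ρ + 1/2 = σ + δ/2 := by rw [hρ]; ring
        rw [this, hσ, min_add_add_right 3 (1/2 + n * (δ/2)) (δ/2)|>.symm]
        refine le_min ((min_le_left _ _).trans (by linarith)) ((min_le_right _ _).trans ?_)
        push_cast; linarith
      · exact (qC_norm_le (h.hb s hs) (by linarith) hM i j k).trans
          (q_step (h.hb s hs i) (h.hb s hs j) (by linarith) hM hA (by rw [hρ]; linarith)
            (by rw [hρ]; linarith) (ih a b c h s hs i) (ih a b c h s hs j)
            (by rw [hρ]; linarith) k)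
  obtain ⟨n, hn⟩ := exists_nat_ge (3 / (δ/2))
  obtain ⟨A, hA, h⟩ := key n
  refine ⟨A, hA, ?_⟩
  have : min 3 (1/2 + n * (δ/2)) = 3 := by
    refine min_eq_left ?_
    rw [div_le_iff₀ (by positivity)] at hn
    linarith
  rwa [this] at h

lemma FC_decay {ν β M A : ℝ} (hν : 0 < ν) (hb : 1/2 < β) (hb' : β ≤ 3/4) (hM : 0 ≤ M)
    (hA : 0 ≤ A) : ∃ C : ℝ, 0 ≤ C ∧ ∀ c : Fin 3 → Lat → ℂ, (∀ j, HB β M (c j)) →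
      (∀ j k, ‖c j k‖ ≤ A * wt k ^ (-(3:ℝ))) → ∀ j k, ‖FC ν c j k‖ ≤ C * wt k ^ (-(2:ℝ)) := by
  have hπ := Real.pi_pos
  set Q := 2 * (A * 4 ^ ((3:ℝ) - 1/2) * √(2 * Swt (2 * (1/2) + β)) * M) with hQ
  have hQ0 : 0 ≤ Q := by positivity
  refine ⟨4 * Real.pi ^ 2 * ν * A + 24 * Real.pi * Q, by positivity, fun c h hA' j k => ?_⟩
  have hw := wt_pos k
  have hk0 := latNorm_nonneg k
  have hq : ∀ i j, ‖qC c i j k‖ ≤ Q * wt k ^ (-((3:ℝ) - 1/2)) := fun i j =>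
    (qC_norm_le h (by linarith) hM i j k).trans
      (q_step (h i) (h j) (by linarith) hM hA (by norm_num) (by linarith) (hA' i) (hA' j)
        (by norm_num) k)
  rw [FC_eq]
  have h1 := PC_le hq j
  have h2 : ‖-((4 * Real.pi ^ 2 * ν * latSq k : ℝ) : ℂ) * c j k‖
      ≤ 4 * Real.pi ^ 2 * ν * A * wt k ^ (-(2:ℝ)) := by
    rw [norm_mul, norm_neg, Complex.norm_real, latSq_eq, Real.norm_of_nonneg (by positivity)]
    have e : latNorm k ^ 2 ≤ wt k ^ (1:ℝ) := by rw [Real.rpow_one]; unfold wt; linarith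
    calc _ ≤ 4 * Real.pi ^ 2 * ν * wt k ^ (1:ℝ) * (A * wt k ^ (-(3:ℝ))) := by
          gcongr; exact hA' j k
      _ = 4 * Real.pi ^ 2 * ν * A * (wt k ^ (1:ℝ) * wt k ^ (-(3:ℝ))) := by ring
      _ = _ := by rw [← Real.rpow_add hw]; norm_num
  have h3 : 24 * Real.pi * latNorm k * (Q * wt k ^ (-((3:ℝ) - 1/2)))
      ≤ 24 * Real.pi * Q * wt k ^ (-(2:ℝ)) := by
    have e := latNorm_le_wt_half k
    calc _ ≤ 24 * Real.pi * wt k ^ (1/2:ℝ) * (Q * wt k ^ (-((3:ℝ) - 1/2))) := by gcongr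
      _ = 24 * Real.pi * Q * (wt k ^ (1/2:ℝ) * wt k ^ (-((3:ℝ) - 1/2))) := by ring
      _ = _ := by rw [← Real.rpow_add hw]; norm_num
  calc _ ≤ _ := norm_add_le _ _
    _ ≤ _ := by linarith

end

section

lemma fc_tendsto {ι : Type*} {l : Filter ι} [l.IsCountablyGenerated] {F : ι → Vec → ℂ} {f : Vec → ℂ}
    {C : ℝ} (hF : ∀ᶠ i in l, Sm (F i)) (hC : ∀ᶠ i in l, ∫ x, ‖F i x‖ ^ 2 ∂μT ≤ C) (hf : Sm f)
    (hlim : ∀ x, Tendsto (fun i => F i x) l (𝓝 (f x))) (k : Lat) :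
    Tendsto (fun i => fc (F i) k) l (𝓝 (fc f k)) := by
  obtain ⟨D, hD0, hD⟩ := per_bounded hf.continuous hf.per
  set C' := 2 * |C| + 2 * D ^ 2 with hC'
  have hC0 : 0 ≤ C' := by positivity
  have hnn : ∀ g : Vec → ℂ, Sm g → Integrable (fun x => ‖g x‖ ^ 2) μT := fun g hg =>
    per_integrable (hg.continuous.norm.pow 2) (fun x n => by simp only [hg.per x n])
  rw [Metric.tendsto_nhds]
  intro ε hε
  obtain ⟨K, hK⟩ : ∃ K : ℝ, 0 < K ∧ C' / K < ε / 2 := by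
    refine ⟨2 * C' / ε + 1, by positivity, ?_⟩
    rw [div_lt_iff₀ (by positivity)]
    field_simp
    linarith
  have hmin : Tendsto (fun i => ∫ x, min ‖F i x - f x‖ K ∂μT) l (𝓝 (∫ x, (0:ℝ) ∂μT)) := by
    refine tendsto_integral_filter_of_dominated_convergence (fun _ => K) ?_ ?_
      (integrable_const _) ?_
    · filter_upwards [hF] with i hi
      exact ((hi.continuous.sub hf.continuous).norm.min continuous_const).aestronglyMeasurable
    · refine Eventually.of_forall fun i => ae_of_all _ fun x => ?_
      rw [Real.norm_of_nonneg (le_min (norm_nonneg _) hK.1.le)]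
      exact min_le_right _ _
    · refine ae_of_all _ fun x => ?_
      have h1 : Tendsto (fun i => ‖F i x - f x‖) l (𝓝 0) := by
        have := (hlim x).sub_const (f x)
        rw [sub_self] at this
        simpa using this.norm
      have := h1.min (tendsto_const_nhds (x := K))
      rwa [min_eq_left hK.1.le] at this
  rw [integral_zero] at hmin
  filter_upwards [hF, hC, hmin.eventually (gt_mem_nhds (half_pos hε))] with i hi hCi hmi
  have hd := hi.sub hf
  rw [dist_eq_norm, ← fc_sub hi.integrable hf.integrable, fc_def]
  have hKinv : 0 < K⁻¹ := inv_pos.mpr hK.1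
  calc _ ≤ ∫ x, ‖(F i x - f x) * chr (-k) x‖ ∂μT := norm_integral_le_integral_norm _
    _ ≤ ∫ x, (min ‖F i x - f x‖ K + K⁻¹ * (2 * ‖F i x‖ ^ 2 + 2 * D ^ 2)) ∂μT := by
        refine integral_mono ((hd.mul (Sm.chr _)).integrable.norm) ?_ fun x => ?_
        · refine Integrable.add ?_ ((((hnn _ hi).const_mul 2).add (integrable_const _)).const_mul _)
          exact per_integrable ((hi.continuous.sub hf.continuous).norm.min continuous_const)
            (fun x n => by simp only [hi.per x n, hf.per x n])
        · simp only [norm_mul, chr_norm, mul_one]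
          have h1 := norm_sub_le (F i x) (f x)
          have h2 := hD x
          have h0 := norm_nonneg (F i x - f x)
          have h3 := norm_nonneg (F i x)
          have h4 := norm_nonneg (f x)
          rcases le_total ‖F i x - f x‖ K with h | h
          · rw [min_eq_left h]
            have : 0 ≤ K⁻¹ * (2 * ‖F i x‖ ^ 2 + 2 * D ^ 2) := by positivity
            linarith
          · rw [min_eq_right h]
            have h5 : ‖F i x - f x‖ ^ 2 ≤ 2 * ‖F i x‖ ^ 2 + 2 * D ^ 2 := by
              nlinarith [sq_nonneg (‖F i x‖ - ‖f x‖)]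
            have h6 : ‖F i x - f x‖ ≤ K⁻¹ * ‖F i x - f x‖ ^ 2 := by
              rw [← div_eq_inv_mul, le_div_iff₀ hK.1]; nlinarith
            have h7 : K⁻¹ * ‖F i x - f x‖ ^ 2 ≤ K⁻¹ * (2 * ‖F i x‖ ^ 2 + 2 * D ^ 2) := by gcongr
            linarith [hK.1]
    _ = ∫ x, min ‖F i x - f x‖ K ∂μT + K⁻¹ * (2 * ∫ x, ‖F i x‖ ^ 2 ∂μT + 2 * D ^ 2) := by
        rw [integral_add, integral_const_mul, integral_add, integral_const_mul]
        · simp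
        · exact (hnn _ hi).const_mul 2
        · exact integrable_const _
        · exact per_integrable ((hi.continuous.sub hf.continuous).norm.min continuous_const)
            (fun x n => by simp only [hi.per x n, hf.per x n])
        · exact (((hnn _ hi).const_mul 2).add (integrable_const _)).const_mul _
    _ ≤ ∫ x, min ‖F i x - f x‖ K ∂μT + C' / K := by
        rw [div_eq_inv_mul, hC']
        have : ∫ x, ‖F i x‖ ^ 2 ∂μT ≤ |C| := hCi.trans (le_abs_self _)
        gcongr
    _ < ε := by linarith [hK.2]

lemma sq_integral_le {β M : ℝ} {u : Vec → Vec} (h : SmV u) (hb : 0 ≤ β) (j : Fin 3)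
    (hH : HB β M (fcV u j)) : ∫ x, ‖uC u j x‖ ^ 2 ∂μT ≤ M ^ 2 := by
  have h1 := hasSum_parseval (h.comp j) (h.comp j).integrable
  have e1 : ∀ n, fc (uC u j) n * fc (uC u j) (-n) = ((‖fcV u j n‖ ^ 2 : ℝ) : ℂ) := by
    intro n
    have := fcV_neg u j n
    rw [fcV_eq, fcV_eq] at this
    rw [this, fcV_eq, Complex.mul_conj, Complex.normSq_eq_norm_sq]
  have e2 : ∀ x, uC u j x * uC u j x = ((‖uC u j x‖ ^ 2 : ℝ) : ℂ) := by
    intro x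
    unfold uC
    rw [Complex.norm_real, Real.norm_eq_abs, sq_abs]; push_cast; ring
  simp only [e1, e2] at h1
  have h2 : HasSum (fun n => ‖fcV u j n‖ ^ 2) (∫ x, ‖uC u j x‖ ^ 2 ∂μT) := by exact_mod_cast h1
  exact h2.tsum_eq ▸ h2.summable.tsum_le_of_sum_le (hH.sq0 hb)

structure NS (ν T : ℝ) (u : ℝ → Vec → Vec) (p : ℝ → Vec → ℝ) : Prop where
  sm : ∀ t ∈ Set.Icc 0 T, SmV (u t)
  per : ∀ t, Per (u t)
  ppr : ∀ t, Per (p t)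
  psm : ∀ t ∈ Set.Icc 0 T, ContDiff ℝ (⊤ : ℕ∞) (p t)
  der : ∀ t ∈ Set.Ioo 0 T, ∀ x j, HasDerivAt (fun s => u s x j) (Gd ν (u t) (p t) j x) t

lemma IsStrongNS.ns {ν T : ℝ} {u : ℝ → Vec → Vec} (h : IsStrongNS ν T u) : ∃ p, NS ν T u p := by
  obtain ⟨h1, h2, h3, p, h4, h5, h6⟩ := h
  exact ⟨p, fun t ht => ⟨h2 t ht, h1 t, h3 t ht⟩, h1, h4, h5, h6⟩

lemma HB_closed {ι : Type*} {l : Filter ι} [l.NeBot] {β M : ℝ} {F : ι → Lat → ℂ} {c : Lat → ℂ}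
    (h : ∀ᶠ i in l, HB β M (F i)) (hl : ∀ k, Tendsto (fun i => F i k) l (𝓝 (c k))) : HB β M c := by
  intro s
  have : Tendsto (fun i => ∑ k ∈ s, wt k ^ β * ‖F i k‖ ^ 2) l
      (𝓝 (∑ k ∈ s, wt k ^ β * ‖c k‖ ^ 2)) :=
    tendsto_finsetSum _ fun k _ => (((hl k).norm.pow 2).const_mul _)
  exact le_of_tendsto this (h.mono fun i hi => hi s)

variable {ν T β M : ℝ} {u : ℝ → Vec → Vec} {p : ℝ → Vec → ℝ}

lemma NS.ptwise (h : NS ν T u p) {t : ℝ} (ht : t ∈ Set.Ioo 0 T) (x : Vec) (j : Fin 3) :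
    Tendsto (fun s => uC (u s) j x) (𝓝 t) (𝓝 (uC (u t) j x)) := by
  have := (h.der t ht x j).continuousAt
  exact (Complex.continuous_ofReal.continuousAt.tendsto.comp this.tendsto)

lemma NS.HB_all (h : NS ν T u p) (hb : 0 ≤ β)
    (hae : ∀ᵐ t ∂tIoo T, ∀ j, HB β M (fcV (u t) j)) :
    ∀ t ∈ Set.Ioo 0 T, ∀ j, HB β M (fcV (u t) j) := by
  intro t ht j
  set S := {t | t ∈ Set.Ioo 0 T ∧ ∀ j, HB β M (fcV (u t) j)} with hS
  have hcl : t ∈ closure S := by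
    rw [mem_closure_iff]
    intro o ho hto
    by_contra hne
    rw [Set.not_nonempty_iff_eq_empty] at hne
    have h1 : ∀ s ∈ o ∩ Set.Ioo 0 T, ¬ ∀ j, HB β M (fcV (u s) j) := by
      intro s hs hh
      have : s ∈ o ∩ S := ⟨hs.1, hs.2, hh⟩
      rw [hne] at this; exact this
    have h2 : 0 < volume (o ∩ Set.Ioo 0 T) :=
      (ho.inter isOpen_Ioo).measure_pos volume ⟨t, hto, ht⟩
    unfold tIoo at hae
    rw [ae_restrict_iff' measurableSet_Ioo, ae_iff] at hae
    refine h2.ne' (measure_mono_null (fun s hs => ?_) hae)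
    simp only [Set.mem_ofPred_eq]
    intro hcon
    exact h1 s hs (hcon hs.2)
  have : (𝓝[S] t).NeBot := mem_closure_iff_nhdsWithin_neBot.mp hcl
  have hin : ∀ᶠ s in 𝓝[S] t, s ∈ S := eventually_mem_nhdsWithin
  have hsm : ∀ s ∈ Set.Ioo 0 T, SmV (u s) := fun s hs => h.sm s (Set.Ioo_subset_Icc_self hs)
  refine HB_closed (l := 𝓝[S] t) (F := fun s => fcV (u s) j) (hin.mono fun s hs => hs.2 j)
    fun k => ?_
  exact fc_tendsto (hin.mono fun s hs => (hsm s hs.1).comp j)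
    (hin.mono fun s hs => sq_integral_le (hsm s hs.1) hb j (hs.2 j)) ((hsm t ht).comp j)
    (fun x => (h.ptwise ht x j).mono_left nhdsWithin_le_nhds) k

lemma NS.cont (h : NS ν T u p) (hb : 0 ≤ β)
    (hH : ∀ t ∈ Set.Ioo 0 T, ∀ j, HB β M (fcV (u t) j)) (j : Fin 3) (k : Lat) {t : ℝ}
    (ht : t ∈ Set.Ioo 0 T) : ContinuousAt (fun s => fcV (u s) j k) t := by
  have hin : ∀ᶠ s in 𝓝 t, s ∈ Set.Ioo 0 T := isOpen_Ioo.mem_nhds ht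
  have hsm : ∀ s ∈ Set.Ioo 0 T, SmV (u s) := fun s hs => h.sm s (Set.Ioo_subset_Icc_self hs)
  exact fc_tendsto (hin.mono fun s hs => (hsm s hs).comp j)
    (hin.mono fun s hs => sq_integral_le (hsm s hs) hb j (hH s hs j)) ((hsm t ht).comp j)
    (fun x => (h.ptwise ht x j)) k

/-- pointwise limits of divergence-free smooth fields are divergence free, if smooth -/
lemma div_limit {f : ℕ → Fin 3 → Vec → ℝ} {G : Fin 3 → Vec → ℝ}
    (hf : ∀ n i, ContDiff ℝ (⊤ : ℕ∞) (f n i)) (hG : ∀ i, ContDiff ℝ (⊤ : ℕ∞) (G i))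
    (hdiv : ∀ n x, ∑ i, pd i (f n i) x = 0)
    (hlim : ∀ i x, Tendsto (fun n => f n i x) atTop (𝓝 (G i x))) (x : Vec) :
    ∑ i, pd i (G i) x = 0 := by
  set E : ℕ → Set Vec := fun N => {x | ∀ n i, |f n i x| ≤ N} with hE
  have hcl : ∀ N, IsClosed (E N) := by
    intro N
    simp only [hE, Set.ofPred_forall]
    exact isClosed_iInter fun n => isClosed_iInter fun i =>
      isClosed_le (hf n i).continuous.abs continuous_const
  have hun : ⋃ N, E N = Set.univ := by
    ext x
    simp only [Set.mem_iUnion, Set.mem_univ, iff_true]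
    have hb : ∀ i, ∃ N : ℕ, ∀ n, |f n i x| ≤ N := by
      intro i
      obtain ⟨C, hC⟩ := (hlim i x).abs.bddAbove_range
      obtain ⟨N, hN⟩ := exists_nat_ge C
      exact ⟨N, fun n => (hC ⟨n, rfl⟩).trans hN⟩
    choose N hN using hb
    refine ⟨∑ i, N i, fun n i => (hN i n).trans ?_⟩
    exact_mod_cast Finset.single_le_sum (f := N) (fun _ _ => Nat.zero_le _) (Finset.mem_univ i)
  have hdense := dense_iUnion_interior_of_closed hcl hun
  have hcont : Continuous fun x => ∑ i, pd i (G i) x :=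
    continuous_finsetSum _ fun i _ => (contDiff_pd (hG i) i).continuous
  have hzero : ∀ y ∈ ⋃ N, interior (E N), ∑ i, pd i (G i) y = 0 := by
    intro y hy
    obtain ⟨N, hy⟩ := Set.mem_iUnion.mp hy
    have hae := isOpen_interior.ae_eq_zero_of_integral_contDiff_smul_eq_zero
      (f := fun x => ∑ i, pd i (G i) x) (μ := (volume : Measure Vec)) (U := interior (E N))
      (hcont.locallyIntegrable.locallyIntegrableOn _) (by
        intro g hg hgc hgs
        have hgd : Differentiable ℝ g := diffble hg
        have hpc : ∀ i, HasCompactSupport (pd i g) := fun i => hgc.fderiv_apply ℝ _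
        have ibp : ∀ (F : Fin 3 → Vec → ℝ), (∀ i, ContDiff ℝ (⊤ : ℕ∞) (F i)) →
            ∫ x, g x * ∑ i, pd i (F i) x = -∑ i, ∫ x, pd i g x * F i x := by
          intro F hF
          simp only [Finset.mul_sum]
          have hi : ∀ i, Integrable (fun x => g x * pd i (F i) x) (volume : Measure Vec) := fun i =>
            (hg.continuous.mul (contDiff_pd (hF i) i).continuous).integrable_of_hasCompactSupport
              hgc.mul_right
          rw [integral_finsetSum _ fun i _ => hi i, ← Finset.sum_neg_distrib]
          refine Finset.sum_congr rfl fun i _ => ?_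
          refine integral_mul_fderiv_eq_neg_fderiv_mul_of_integrable ?_ (hi i) ?_
            (fun x _ => hgd x) (fun x _ => diffble (hF i) x)
          · exact ((contDiff_pd hg i).continuous.mul
              (hF i).continuous).integrable_of_hasCompactSupport (hpc i).mul_right
          · exact (hg.continuous.mul (hF i).continuous).integrable_of_hasCompactSupport
              hgc.mul_right
        have e0 : ∀ n, ∑ i, ∫ x, pd i g x * f n i x = 0 := by
          intro n
          have := ibp (f n) (hf n)
          simp only [hdiv, mul_zero, integral_zero] at this
          linarith
        have hl : Tendsto (fun n => ∑ i, ∫ x, pd i g x * f n i x) atTop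
            (𝓝 (∑ i, ∫ x, pd i g x * G i x)) := by
          refine tendsto_finsetSum _ fun i _ => ?_
          refine tendsto_integral_of_dominated_convergence (fun x => N * |pd i g x|) ?_ ?_ ?_ ?_
          · exact fun n => ((contDiff_pd hg i).continuous.mul
              (hf n i).continuous).aestronglyMeasurable
          · exact (((contDiff_pd hg i).continuous.abs).integrable_of_hasCompactSupport
              ((hpc i).norm)).const_mul _
          · intro n
            refine ae_of_all _ fun x => ?_
            rw [norm_mul, Real.norm_eq_abs, Real.norm_eq_abs, mul_comm]
            by_cases hx : x ∈ tsupport g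
            · have := interior_subset (hgs hx) n i
              gcongr
            · have : pd i g x = 0 := by
                unfold pd
                have h0 : fderiv ℝ g x = 0 := by
                  by_contra hne
                  exact hx (support_fderiv_subset ℝ hne)
                rw [h0]; simp
              simp [this]
          · exact ae_of_all _ fun x => (hlim i x).const_mul _
        simp only [e0] at hl
        have h0 := tendsto_nhds_unique hl tendsto_const_nhds
        simp only [smul_eq_mul]
        rw [ibp G hG, h0, neg_zero])
    have hae' : (fun x => ∑ i, pd i (G i) x) =ᵐ[volume.restrict (interior (E N))] fun _ => 0 :=
      (ae_restrict_iff' isOpen_interior.measurableSet).mpr hae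
    exact Measure.eqOn_open_of_ae_eq hae' isOpen_interior hcont.continuousOn
      continuousOn_const hy
  have hcl2 : IsClosed {x | ∑ i, pd i (G i) x = 0} := isClosed_eq hcont continuous_const
  have := hcl2.closure_subset_iff.mpr hzero
  rw [hdense.closure_eq] at this
  exact this (Set.mem_univ x)

lemma NS.divG (h : NS ν T u p) {t : ℝ} (ht : t ∈ Set.Ioo 0 T) (x : Vec) :
    ∑ i, pd i (Gd ν (u t) (p t) i) x = 0 := by
  have htt := Set.Ioo_subset_Icc_self ht
  obtain ⟨n0, hn0⟩ : ∃ n0 : ℕ, ∀ n : ℕ, t + 1 / ((n:ℝ) + n0 + 1) ∈ Set.Icc 0 T := by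
    obtain ⟨n0, hn0⟩ := exists_nat_gt (1 / (T - t))
    refine ⟨n0, fun n => ⟨?_, ?_⟩⟩
    · have : 0 < t := ht.1
      positivity
    · have h1 : 0 < T - t := sub_pos.mpr ht.2
      have h2 : 1 / ((n:ℝ) + n0 + 1) ≤ T - t := by
        rw [div_le_iff₀ (by positivity)]
        rw [div_lt_iff₀ h1] at hn0
        nlinarith [Nat.cast_nonneg (α := ℝ) n]
      linarith
  set r : ℕ → ℝ := fun n => (n:ℝ) + n0 + 1 with hr
  have hr0 : ∀ n, 0 < r n := fun n => by simp only [hr]; positivity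
  refine div_limit (f := fun n i x => r n * (u (t + 1 / r n) x i - u t x i))
    (fun n i => ?_) (fun i => Gd_contDiff (h.sm t htt).smooth (h.psm t htt) i) (fun n x => ?_)
    (fun i x => ?_) x
  · exact contDiff_const.mul ((contDiff_comp_coord (h.sm _ (hn0 n)).smooth i).sub
      (contDiff_comp_coord (h.sm t htt).smooth i))
  · have e : ∀ i, pd i (fun x => r n * (u (t + 1 / r n) x i - u t x i)) x
        = r n * (pd i (fun x => u (t + 1 / r n) x i) x - pd i (fun x => u t x i) x) := by
      intro i
      have d1 := diffble (contDiff_comp_coord (h.sm (t + 1 / r n) (hn0 n)).smooth i) x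
      have d2 := diffble (contDiff_comp_coord (h.sm t htt).smooth i) x
      have h3 : fderiv ℝ (fun x => r n * (u (t + 1 / r n) x i - u t x i)) x = _ :=
        ((d1.hasFDerivAt.sub d2.hasFDerivAt).const_mul (r n)).fderiv
      unfold pd
      rw [h3]
      rfl
    simp only [e]
    rw [← Finset.mul_sum, Finset.sum_sub_distrib, (h.sm t htt).div, (h.sm _ (hn0 n)).div]
    simp
  · have hd := (h.der t ht x i)
    rw [hasDerivAt_iff_tendsto_slope] at hd
    have hseq : Tendsto (fun n => t + 1 / r n) atTop (𝓝[≠] t) := by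
      refine tendsto_nhdsWithin_iff.mpr ⟨?_, Eventually.of_forall fun n => ?_⟩
      · have h1 : Tendsto r atTop atTop := by
          refine tendsto_atTop_mono (fun n => ?_) tendsto_natCast_atTop_atTop
          simp only [hr]
          have := Nat.cast_nonneg (α := ℝ) n0
          linarith
        have h2 : Tendsto (fun n => 1 / r n) atTop (𝓝 0) := by
          simp only [one_div]; exact h1.inv_tendsto_atTop
        simpa using h2.const_add t
      · have := hr0 n
        simp only [Set.mem_compl_iff, Set.mem_singleton_iff]
        intro hcon
        have : 0 < 1 / r n := by positivity
        linarith
    refine (hd.comp hseq).congr fun n => ?_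
    simp only [Function.comp, slope, vsub_eq_sub, smul_eq_mul, add_sub_cancel_left]
    simp

lemma NS.fcG (h : NS ν T u p) {t : ℝ} (ht : t ∈ Set.Ioo 0 T) (j : Fin 3) (k : Lat) :
    fc (fun x => ((Gd ν (u t) (p t) j x : ℝ) : ℂ)) k = FC ν (fcV (u t)) j k := by
  have htt := Set.Ioo_subset_Icc_self ht
  have hsm := fun i => Gd_contDiff (ν := ν) (h.sm t htt).smooth (h.psm t htt) i
  have hS : ∀ i, Sm (fun x => ((Gd ν (u t) (p t) i x : ℝ) : ℂ)) := fun i =>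
    Sm.ofReal (hsm i) (Gd_per (h.per t) (h.ppr t) i)
  refine fc_Gd_FC (h.sm t htt) (h.psm t htt) (h.ppr t) (fun k => ?_) j k
  have h1 : fc (fun x => ∑ i, pd i (fun y => ((Gd ν (u t) (p t) i y : ℝ) : ℂ)) x) k = 0 := by
    have : ∀ x, ∑ i, pd i (fun y => ((Gd ν (u t) (p t) i y : ℝ) : ℂ)) x = 0 := by
      intro x
      have e : ∀ i, pd i (fun y => ((Gd ν (u t) (p t) i y : ℝ) : ℂ)) x
          = ((pd i (Gd ν (u t) (p t) i) x : ℝ) : ℂ) := fun i => pd_ofReal (diffble (hsm i) x) i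
      simp only [e]
      exact_mod_cast h.divG ht x
    simp only [this]; simp [fc]
  rw [fc_sum _ fun i _ => ((hS i).pd i).integrable] at h1
  simp only [fc_pd (hS _)] at h1
  change ∑ i, tpi * (k i : ℂ) * fc (fun x => ((Gd ν (u t) (p t) i x : ℝ) : ℂ)) k = 0 at h1
  simp only [mul_assoc, ← Finset.mul_sum] at h1
  exact (mul_eq_zero.mp h1).resolve_left tpi_ne

end

section

variable {ν T β M : ℝ} {u : ℝ → Vec → Vec} {p : ℝ → Vec → ℝ}

def GLoc (ν : ℝ) (u : ℝ → Vec → Vec) (p : ℝ → Vec → ℝ) (t : ℝ) : Prop :=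
  ∃ C : ℝ, ∀ᶠ s in 𝓝 t, ∀ j x, |Gd ν (u s) (p s) j x| ≤ C

lemma GLoc_open : IsOpen {t | GLoc ν u p t} := by
  rw [isOpen_iff_mem_nhds]
  rintro t ⟨C, hC⟩
  exact (eventually_eventually_nhds.mpr hC).mono fun s hs => ⟨C, hs⟩

lemma NS.hasDeriv_loc (h : NS ν T u p) {t : ℝ} (ht : t ∈ Set.Ioo 0 T) (hl : GLoc ν u p t)
    (j : Fin 3) (k : Lat) :
    HasDerivAt (fun s => fcV (u s) j k) (FC ν (fcV (u t)) j k) t := by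
  obtain ⟨C, hC⟩ := hl
  have hin : ∀ᶠ s in 𝓝 t, s ∈ Set.Ioo 0 T := isOpen_Ioo.mem_nhds ht
  have hsm : ∀ s ∈ Set.Ioo 0 T, SmV (u s) := fun s hs => h.sm s (Set.Ioo_subset_Icc_self hs)
  rw [← h.fcG ht j k]
  have hS : {s | s ∈ Set.Ioo 0 T ∧ ∀ j x, |Gd ν (u s) (p s) j x| ≤ C} ∈ 𝓝 t := hin.and hC
  have htt := Set.Ioo_subset_Icc_self ht
  have hGS : Sm (fun x => ((Gd ν (u t) (p t) j x : ℝ) : ℂ)) :=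
    Sm.ofReal (Gd_contDiff (h.sm t htt).smooth (h.psm t htt) j) (Gd_per (h.per t) (h.ppr t) j)
  have := (hasDerivAt_integral_of_dominated_loc_of_deriv_le (μ := μT)
    (F := fun s x => uC (u s) j x * chr (-k) x)
    (F' := fun s x => ((Gd ν (u s) (p s) j x : ℝ) : ℂ) * chr (-k) x) (x₀ := t)
    (bound := fun _ => C) hS
    (hin.mono fun s hs => (((hsm s hs).comp j).continuous.mul
      (chr_continuous _)).aestronglyMeasurable)
    (((hsm t ht).comp j).mul (Sm.chr _)).integrable
    ((hGS.mul (Sm.chr _)).continuous.aestronglyMeasurable)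
    (ae_of_all _ fun x s hs => by
      rw [norm_mul, chr_norm, mul_one, Complex.norm_real]; exact hs.2 j x)
    (integrable_const _)
    (ae_of_all _ fun x s hs => ((h.der s hs.1 x j).ofReal_comp).mul_const _)).2
  simp only [fcV_eq, fc_def]
  exact this

lemma NS.hasDeriv (h : NS ν T u p) (hν : 0 < ν) (hb : 1/2 < β) (hM : 0 ≤ M)
    (hH : ∀ t ∈ Set.Ioo 0 T, ∀ j, HB β M (fcV (u t) j)) {t : ℝ} (ht : t ∈ Set.Ioo 0 T)
    (j : Fin 3) (k : Lat) :
    HasDerivAt (fun s => fcV (u s) j k) (FC ν (fcV (u t)) j k) t := by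
  set β' := min β (3/4) with hβ'
  have hb' : 1/2 < β' := lt_min hb (by norm_num)
  have hb3 : β' ≤ 3/4 := min_le_right _ _
  have hH' : ∀ t ∈ Set.Ioo 0 T, ∀ j, HB β' M (fcV (u t) j) := fun t ht j =>
    (hH t ht j).mono (min_le_left _ _)
  have hcont : ∀ (j : Fin 3) (k : Lat) {t : ℝ}, t ∈ Set.Ioo 0 T →
      ContinuousAt (fun s => fcV (u s) j k) t := fun j k t ht => h.cont (by linarith) hH' j k ht
  set S : Set ℝ := Set.Ioo 0 T ∩ {t | GLoc ν u p t}ᶜ with hS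
  suffices hemp : ¬ S.Nonempty by
    refine h.hasDeriv_loc ht ?_ j k
    by_contra hcon
    exact hemp ⟨t, ht, hcon⟩
  intro hne
  have hlc : IsLocallyClosed S := isOpen_Ioo.isLocallyClosed.inter
    GLoc_open.isClosed_compl.isLocallyClosed
  have := hlc.locallyCompactSpace
  have : Nonempty S := hne.to_subtype
  set E : ℕ → Set S := fun N => {t | ∀ j k, ‖fcV (u t) j k‖ ≤ N * wt k ^ (-(3:ℝ))} with hE
  have hcl : ∀ N, IsClosed (E N) := by
    intro N
    simp only [hE, Set.ofPred_forall]
    refine isClosed_iInter fun j => isClosed_iInter fun k => isClosed_le ?_ continuous_const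
    refine Continuous.norm ?_
    rw [continuous_iff_continuousAt]
    intro s
    exact (hcont j k s.2.1).comp continuous_subtype_val.continuousAt
  have hdec : ∀ t ∈ Set.Ioo 0 T, ∃ N : ℕ, ∀ j k, ‖fcV (u t) j k‖ ≤ N * wt k ^ (-(3:ℝ)) := by
    intro t ht
    have hsm : SmV (u t) := h.sm t (Set.Ioo_subset_Icc_self ht)
    have : ∀ j, ∃ N : ℕ, ∀ k, ‖fcV (u t) j k‖ ≤ N * wt k ^ (-(3:ℝ)) := by
      intro j
      obtain ⟨C, hC0, hC⟩ := fc_decay (hsm.comp j) 3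
      obtain ⟨N, hN⟩ := exists_nat_ge C
      refine ⟨N, fun k => (hC k).trans ?_⟩
      have hw := wt_pos k
      rw [Real.rpow_neg hw.le]
      have : wt k ^ (3:ℝ) = wt k ^ 3 := by exact_mod_cast Real.rpow_natCast (wt k) 3
      rw [this]
      gcongr
    choose N hN using this
    refine ⟨∑ i, N i, fun j k => (hN j k).trans ?_⟩
    have hw := wt_pos k
    have : N j ≤ ∑ i, N i := Finset.single_le_sum (f := N) (fun _ _ => Nat.zero_le _) (Finset.mem_univ j)
    gcongr
  have hun : ⋃ N, E N = Set.univ := by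
    ext s
    simp only [Set.mem_iUnion, Set.mem_univ, iff_true]
    exact hdec s s.2.1
  obtain ⟨N, s0, hs0⟩ := nonempty_interior_of_iUnion_of_closed hcl hun
  rw [mem_interior_iff_mem_nhds, nhds_subtype_eq_comap, mem_comap] at hs0
  obtain ⟨O, hO, hOE⟩ := hs0
  have hO2 : O ∩ Set.Ioo 0 T ∈ 𝓝 (s0 : ℝ) := inter_mem hO (isOpen_Ioo.mem_nhds s0.2.1)
  obtain ⟨r, hr, hball⟩ := Metric.mem_nhds_iff.mp hO2
  have hOS : ∀ s ∈ O, s ∈ S → ∀ j k, ‖fcV (u s) j k‖ ≤ N * wt k ^ (-(3:ℝ)) := fun s hs hsS =>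
    hOE (show (⟨s, hsS⟩ : S) ∈ _ from hs)
  set a' := (s0 : ℝ) - r/2 with ha'
  set b' := (s0 : ℝ) + r/2 with hb''
  have hin : ∀ s ∈ Set.Icc a' b', s ∈ O ∧ s ∈ Set.Ioo 0 T := by
    intro s hs
    refine hball ?_
    rw [Metric.mem_ball, Real.dist_eq, abs_lt]
    constructor <;> linarith [hs.1, hs.2]
  have ha'm : a' ∈ Set.Icc a' b' := ⟨le_rfl, by linarith⟩
  obtain ⟨N', hN'⟩ := hdec a' (hin a' ha'm).2
  obtain ⟨A, hA0, hA⟩ := bootstrap (N := (N + N' : ℕ)) hν hb' hb3 hM (Nat.cast_nonneg _)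
  obtain ⟨C, hC0, hC⟩ := FC_decay (A := A) hν hb' hb3 hM hA0
  have hbound : ∀ t ∈ Set.Icc a' b', ∀ j k, ‖fcV (u t) j k‖ ≤ A * wt k ^ (-(3:ℝ)) := by
    intro t ht
    set R : Set ℝ := {a'} ∪ (Set.Icc a' t ∩ {t | GLoc ν u p t}ᶜ) with hR
    have hRc : IsCompact R :=
      isCompact_singleton.union (isCompact_Icc.inter_right GLoc_open.isClosed_compl)
    obtain ⟨σ, hσR, hσ⟩ := hRc.exists_isGreatest ⟨a', Or.inl rfl⟩
    have hσI : σ ∈ Set.Icc a' t := by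
      rcases hσR with h1 | h1
      · rw [Set.mem_singleton_iff.mp h1]; exact ⟨le_rfl, ht.1⟩
      · exact h1.1
    have hsub : ∀ s ∈ Set.Icc σ t, s ∈ Set.Icc a' b' := fun s hs =>
      ⟨hσI.1.trans hs.1, hs.2.trans ht.2⟩
    have htr : Traj ν β' M ((N + N' : ℕ) : ℝ) σ t (fun s => fcV (u s)) := by
      refine ⟨fun j k s hs => (hcont j k (hin s (hsub s hs)).2).continuousWithinAt,
        fun s hs => hH' s (hin s (hsub s hs)).2, fun j k s hs => ?_, fun j k => ?_⟩
      · have hs2 := hsub s (Set.Ioo_subset_Icc_self hs)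
        refine h.hasDeriv_loc (hin s hs2).2 ?_ j k
        by_contra hcon
        have : s ≤ σ := hσ (Or.inr ⟨⟨hs2.1, hs.2.le⟩, hcon⟩)
        exact absurd hs.1 (not_lt.mpr this)
      · have hw := wt_pos k
        rcases hσR with h1 | h1
        · rw [Set.mem_singleton_iff.mp h1]
          refine (hN' j k).trans ?_
          gcongr; linarith
        · have hh := hin σ (hsub σ ⟨le_rfl, hσI.2⟩)
          refine (hOS σ hh.1 ⟨hh.2, h1.2⟩ j k).trans ?_
          gcongr; linarith
    exact hA σ t _ htr t ⟨hσI.2, le_rfl⟩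
  refine s0.2.2 ⟨C * Swt 2, ?_⟩
  filter_upwards [Icc_mem_nhds (show a' < s0 by linarith) (show (s0:ℝ) < b' by linarith)] with s hs j x
  have hsT := (hin s hs).2
  have htt := Set.Ioo_subset_Icc_self hsT
  have hGS : Sm (fun x => ((Gd ν (u s) (p s) j x : ℝ) : ℂ)) :=
    Sm.ofReal (Gd_contDiff (h.sm s htt).smooth (h.psm s htt) j) (Gd_per (h.per s) (h.ppr s) j)
  have hsum := hasSum_fourier hGS x
  have hF := hC (fcV (u s)) (hH' s hsT) (hbound s hs) j
  have hs2 : Summable fun k : Lat => C * wt k ^ (-(2:ℝ)) := (summable_wt (by norm_num)).mul_left C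
  have hle : ∀ k, ‖fc (fun x => ((Gd ν (u s) (p s) j x : ℝ) : ℂ)) k * chr k x‖
      ≤ C * wt k ^ (-(2:ℝ)) := by
    intro k
    rw [norm_mul, chr_norm, mul_one, h.fcG hsT]
    exact hF k
  have := tsum_of_norm_bounded hs2.hasSum hle
  rw [hsum.tsum_eq, Complex.norm_real, tsum_mul_left] at this
  exact this

end

section

/-- Bundled data of the uniformly bounded sequence. -/
structure Dat (T α β M B : ℝ) (ν : ℕ → ℝ) (u : ℕ → ℝ → Vec → Vec) : Prop where
  hT : 0 < T
  hα : 2/3 < α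
  hβ : 1/2 < β
  hM : 0 ≤ M
  hB : 0 ≤ B
  hν : ∀ n, 0 < ν n
  hν1 : ∀ n, ν n ≤ B
  hν0 : Tendsto ν atTop (𝓝 0)
  sm : ∀ n, ∀ t ∈ Set.Ioo 0 T, SmV (u n t)
  per : ∀ n t, Per (u n t)
  hb : ∀ n, ∀ t ∈ Set.Ioo 0 T, ∀ j, HB β M (fcV (u n t) j)
  der : ∀ n, ∀ t ∈ Set.Ioo 0 T, ∀ j k, HasDerivAt (fun s => fcV (u n s) j k)
    (FC (ν n) (fcV (u n t)) j k) t
  ptc : ∀ n, ∀ t ∈ Set.Ioo 0 T, ∀ x j, ContinuousAt (fun s => u n s x j) t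
  bes : ∀ n, ∫⁻ t, besovV α 3 ∞ (u n t) ^ (3:ℝ) ∂tIoo T ≤ ENNReal.ofReal B

lemma Dat.subseq {T α β M B : ℝ} {ν : ℕ → ℝ} {u : ℕ → ℝ → Vec → Vec}
    (h : Dat T α β M B ν u) {g : ℕ → ℕ} (hg : StrictMono g) :
    Dat T α β M B (fun n => ν (g n)) (fun n => u (g n)) where
  hT := h.hT
  hα := h.hα
  hβ := h.hβ
  hM := h.hM
  hB := h.hB
  hν n := h.hν _
  hν1 n := h.hν1 _
  hν0 := h.hν0.comp hg.tendsto_atTop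
  sm n := h.sm _
  per n := h.per _
  hb n := h.hb _
  der n := h.der _
  ptc n := h.ptc _
  bes n := h.bes _

lemma mk_dat {T α β : ℝ} (hT : 0 < T) (hα : 2/3 < α) (hβ : 1/2 < β)
    {ν : ℕ → ℝ} (hν : ∀ n, 0 < ν n) (hν0 : Tendsto ν atTop (𝓝 0))
    {u : ℕ → ℝ → Vec → Vec}
    (hsol : ∀ n, IsStrongNS (ν n) T (u n))
    (hbd : ∃ M : ℝ≥0∞, M < ∞ ∧ ∀ n,
      timeNorm 3 T (fun t => besovV α 3 ∞ (u n t)) ≤ M ∧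
      timeNorm ∞ T (fun t => HsNormV β (u n t)) ≤ M) :
    ∃ M B, Dat T α β M B ν u := by
  obtain ⟨M, hM, hbd⟩ := hbd
  obtain ⟨N, hN⟩ := hν0.bddAbove_range
  have hN' : ∀ n, ν n ≤ N := fun n => hN ⟨n, rfl⟩
  have hN0 : 0 ≤ N := (hν 0).le.trans (hN' 0)
  have hMM : ENNReal.ofReal M.toReal = M := ENNReal.ofReal_toReal hM.ne
  have hHB : ∀ n, ∀ t ∈ Set.Ioo 0 T, ∀ j, HB β M.toReal (fcV (u n t) j) := by
    intro n
    obtain ⟨p, hp⟩ := (hsol n).ns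
    refine hp.HB_all (by linarith) ?_
    have h2 := (hbd n).2
    simp only [timeNorm, if_true] at h2
    have := ENNReal.ae_le_essSup (μ := tIoo T) (fun t => HsNormV β (u n t))
    filter_upwards [this] with t ht j
    refine HB_of_Hs ENNReal.toReal_nonneg ?_ j
    rw [hMM]; exact ht.trans h2
  refine ⟨M.toReal, N + (M ^ (3:ℝ)).toReal, hT, hα, hβ, ENNReal.toReal_nonneg, by positivity, hν,
    fun n => (hN' n).trans (by simp), hν0, ?_, fun n => (hsol n).1, hHB, ?_, ?_, ?_⟩
  · intro n t ht
    obtain ⟨p, hp⟩ := (hsol n).ns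
    exact hp.sm t (Set.Ioo_subset_Icc_self ht)
  · intro n t ht j k
    obtain ⟨p, hp⟩ := (hsol n).ns
    exact hp.hasDeriv (hν n) hβ ENNReal.toReal_nonneg (hHB n) ht j k
  · intro n t ht x j
    obtain ⟨p, hp⟩ := (hsol n).ns
    exact (hp.der t ht x j).continuousAt
  · intro n
    have h1 := (hbd n).1
    have h3 : (3:ℝ≥0∞) ≠ ∞ := by norm_num
    simp only [timeNorm, if_neg h3] at h1
    have h4 : (3:ℝ≥0∞).toReal = 3 := by norm_num
    rw [h4] at h1
    have h5 := ENNReal.rpow_le_rpow h1 (show (0:ℝ) ≤ 3 by norm_num)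
    rw [← ENNReal.rpow_mul] at h5
    norm_num at h5
    simp only [ENNReal.rpow_ofNat]
    refine h5.trans ?_
    rw [ENNReal.ofReal_add hN0 ENNReal.toReal_nonneg,
      ENNReal.ofReal_toReal (ENNReal.pow_lt_top hM).ne]
    exact le_add_self

/-- Lipschitz constant of the `k`-th coefficient. -/
def lipK (M B : ℝ) (k : Lat) : ℝ :=
  4 * Real.pi ^ 2 * B * latNorm k ^ 2 * M + 24 * Real.pi * latNorm k * M ^ 2

variable {T α β M B : ℝ} {ν : ℕ → ℝ} {u : ℕ → ℝ → Vec → Vec}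

lemma Dat.lipK_nonneg (h : Dat T α β M B ν u) (k : Lat) : 0 ≤ lipK M B k := by
  have := latNorm_nonneg k
  have := h.hM
  have := h.hB
  unfold lipK
  positivity

lemma Dat.FC_lip (h : Dat T α β M B ν u) (n : ℕ) {t : ℝ} (ht : t ∈ Set.Ioo 0 T) (j : Fin 3)
    (k : Lat) : ‖FC (ν n) (fcV (u n t)) j k‖ ≤ lipK M B k := by
  refine (FC_le (h.hb n t ht) (by linarith [h.hβ]) h.hM (h.hν n).le j k).trans ?_
  have := latNorm_nonneg k
  have := h.hM
  have := h.hν1 n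
  unfold lipK
  gcongr

lemma Dat.lip (h : Dat T α β M B ν u) (n : ℕ) (j : Fin 3) (k : Lat) {s t : ℝ}
    (hs : s ∈ Set.Ioo 0 T) (ht : t ∈ Set.Ioo 0 T) :
    ‖fcV (u n t) j k - fcV (u n s) j k‖ ≤ lipK M B k * |t - s| := by
  have := (convex_Ioo (0:ℝ) T).norm_image_sub_le_of_norm_hasDerivWithin_le
    (f := fun s => fcV (u n s) j k) (C := lipK M B k)
    (fun x hx => (h.der n x hx j k).hasDerivWithinAt) (fun x hx => h.FC_lip n hx j k) hs ht
  simpa using this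

lemma Dat.contOn (h : Dat T α β M B ν u) (n : ℕ) (j : Fin 3) (k : Lat) :
    ContinuousOn (fun s => fcV (u n s) j k) (Set.Ioo 0 T) :=
  fun x hx => (h.der n x hx j k).continuousAt.continuousWithinAt

/-- truncated in time -/
def wI (T : ℝ) (u : ℝ → Vec → Vec) (t : ℝ) (x : Vec) : Vec :=
  (Set.Ioo 0 T).indicator (fun s => u s x) t

lemma Dat.meas_wI (h : Dat T α β M B ν u) (n : ℕ) : Measurable (Function.uncurry (wI T (u n))) := by
  have h1 : Measurable (Function.uncurry fun (x : Vec) (t : ℝ) => wI T (u n) t x) := by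
    refine measurable_uncurry_of_continuous_of_measurable (fun t => ?_) (fun x => ?_)
    · by_cases ht : t ∈ Set.Ioo 0 T
      · simp only [wI, Set.indicator_of_mem ht]
        exact (h.sm n t ht).smooth.continuous
      · simp only [wI, Set.indicator_of_notMem ht]
        exact continuous_const
    · have : ContinuousOn (fun s => u n s x) (Set.Ioo 0 T) := by
        intro t ht
        refine ContinuousAt.continuousWithinAt ?_
        have : ContinuousAt (fun s => WithLp.toLp 2 (fun j => u n s x j)) t :=
          (PiLp.continuous_toLp 2 _).continuousAt.comp
            (continuousAt_pi.mpr fun j => h.ptc n t ht x j)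
        exact this
      have h2 := ContinuousOn.measurable_piecewise (g := (0 : ℝ → Vec)) this
        continuousOn_const measurableSet_Ioo
      rw [Set.piecewise_eq_indicator] at h2
      exact h2
  exact h1.comp measurable_swap

lemma wI_ae : ∀ᵐ t ∂tIoo T, t ∈ Set.Ioo 0 T := ae_restrict_mem measurableSet_Ioo

lemma wI_of_mem {u : ℝ → Vec → Vec} {t : ℝ} (ht : t ∈ Set.Ioo 0 T) : wI T u t = u t := by
  funext x; simp only [wI, Set.indicator_of_mem ht]

lemma Dat.meas_c (h : Dat T α β M B ν u) (n : ℕ) (j : Fin 3) (k : Lat) :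
    AEMeasurable (fun s => fcV (u n s) j k) (tIoo T) :=
  (h.contOn n j k).aemeasurable measurableSet_Ioo

end

section

lemma ball_finite (J : ℕ) : {k : Lat | latNorm k < (2:ℝ) ^ J}.Finite := by
  refine Set.Finite.subset (Fintype.piFinset fun _ : Fin 3 => Finset.Icc (-(2^J : ℤ)) (2^J)).finite_toSet ?_
  intro k hk
  simp only [Set.mem_ofPred_eq] at hk
  simp only [Finset.mem_coe, Fintype.mem_piFinset, Finset.mem_Icc]
  intro i
  have h1 := (abs_le_latNorm k i).trans hk.le
  have h2 : |k i| ≤ 2 ^ J := by exact_mod_cast h1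
  exact abs_le.mp h2

/-- Lattice points of norm less than `2^J`. -/
def FJ (J : ℕ) : Finset Lat := (ball_finite J).toFinset

lemma mem_FJ {J : ℕ} {k : Lat} : k ∈ FJ J ↔ latNorm k < (2:ℝ) ^ J := by
  simp [FJ]

lemma FJ_mono : Monotone FJ := by
  intro a b hab k hk
  rw [mem_FJ] at *
  exact hk.trans_le (pow_le_pow_right₀ (by norm_num) hab)

lemma FJ_tendsto : Tendsto FJ atTop atTop := by
  refine tendsto_atTop_finset_of_monotone FJ_mono fun k => ?_
  obtain ⟨n, hn⟩ := pow_unbounded_of_one_lt (latNorm k) (by norm_num : (1:ℝ) < 2)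
  exact ⟨n, mem_FJ.mpr hn⟩

lemma FJ_zero : FJ 0 = {0} := by
  ext k; rw [mem_FJ, pow_zero, latNorm_lt_one, Finset.mem_singleton]

/-- The dyadic shell as a finset. -/
def shF (j : ℕ) : Finset Lat := FJ (j + 1) \ FJ j

lemma mem_shF {j : ℕ} {k : Lat} : k ∈ shF j ↔ k ∈ shell j := by
  rw [shF, Finset.mem_sdiff, mem_FJ, mem_FJ, not_lt, shell, Set.mem_ofPred_eq, and_comm]

lemma lpBlockC_eq (j : ℕ) (c : Lat → ℂ) (x : Vec) :
    lpBlockC j c x = ∑ k ∈ shF j, c k * chr k x := by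
  rw [lpBlockC, tsum_eq_sum (s := shF j)]
  · refine Finset.sum_congr rfl fun k hk => ?_
    rw [Set.indicator_of_mem (mem_shF.mp hk)]
  · intro k hk
    rw [Set.indicator_of_notMem (fun h => hk (mem_shF.mpr h))]

lemma lpLowC_eq (c : Lat → ℂ) (x : Vec) : lpLowC c x = c 0 := by
  rw [lpLowC, tsum_eq_single 0]
  · rw [Set.indicator_of_mem (by simp [latNorm_zero]), chr_zero, mul_one]
  · intro k hk
    rw [Set.indicator_of_notMem]
    intro h
    exact hk ((latNorm_lt_one k).mp h)

/-- Partial Fourier sums. -/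
def SJ (J : ℕ) (c : Lat → ℂ) (x : Vec) : ℂ := ∑ k ∈ FJ J, c k * chr k x

def AJ (J : ℕ) (c : Lat → ℂ) : ℝ := ∑ k ∈ FJ J, ‖c k‖

lemma AJ_nonneg (J : ℕ) (c : Lat → ℂ) : 0 ≤ AJ J c := Finset.sum_nonneg fun _ _ => norm_nonneg _

lemma SJ_succ (J : ℕ) (c : Lat → ℂ) (x : Vec) : SJ (J + 1) c x = SJ J c x + lpBlockC J c x := by
  rw [lpBlockC_eq, SJ, SJ, shF, add_comm (∑ k ∈ FJ J, _),
    Finset.sum_sdiff (FJ_mono (Nat.le_succ J))]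

lemma SJ_zero (c : Lat → ℂ) (x : Vec) : SJ 0 c x = c 0 := by
  rw [SJ, FJ_zero, Finset.sum_singleton, chr_zero, mul_one]

lemma SJ_add (J N : ℕ) (c : Lat → ℂ) (x : Vec) :
    SJ (J + N) c x = SJ J c x + ∑ j ∈ Finset.range N, lpBlockC (J + j) c x := by
  induction N with
  | zero => simp
  | succ N ih => rw [← add_assoc, SJ_succ, ih, Finset.sum_range_succ, add_assoc]

lemma SJ_tendsto {f : Vec → ℂ} (hf : Sm f) (x : Vec) :
    Tendsto (fun J => SJ J (fc f) x) atTop (𝓝 (f x)) :=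
  (hasSum_fourier hf x).comp FJ_tendsto

lemma trig_Sm (s : Finset Lat) (c : Lat → ℂ) : Sm (fun x => ∑ k ∈ s, c k * chr k x) :=
  Sm.sum _ fun k _ => (Sm.chr k).const_mul _

lemma SJ_Sm (J : ℕ) (c : Lat → ℂ) : Sm (SJ J c) := trig_Sm _ c

lemma lpBlockC_Sm (j : ℕ) (c : Lat → ℂ) : Sm (lpBlockC j c) := by
  have : lpBlockC j c = fun x => ∑ k ∈ shF j, c k * chr k x := funext fun x => lpBlockC_eq j c x
  rw [this]; exact trig_Sm _ c

lemma trig_norm_le (s : Finset Lat) (c : Lat → ℂ) (x : Vec) :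
    ‖∑ k ∈ s, c k * chr k x‖ ≤ ∑ k ∈ s, ‖c k‖ := by
  refine (norm_sum_le _ _).trans (le_of_eq (Finset.sum_congr rfl fun k _ => ?_))
  rw [norm_mul, chr_norm, mul_one]

lemma eLp_le_sup {f : Vec → ℂ} {C : ℝ} (h : ∀ x, ‖f x‖ ≤ C) (p : ℝ≥0∞) :
    eLpNorm f p μT ≤ ENNReal.ofReal C := by
  refine (eLpNorm_le_of_ae_bound (Eventually.of_forall h)).trans ?_
  simp

lemma SJ_eLp (J : ℕ) (c : Lat → ℂ) : eLpNorm (SJ J c) 3 μT ≤ ENNReal.ofReal (AJ J c) :=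
  eLp_le_sup (fun x => trig_norm_le _ c x) _

lemma block_eLp {j J : ℕ} (hj : j < J) (c : Lat → ℂ) :
    eLpNorm (lpBlockC j c) 3 μT ≤ ENNReal.ofReal (AJ J c) := by
  refine eLp_le_sup (fun x => ?_) _
  rw [lpBlockC_eq]
  refine (trig_norm_le _ c x).trans ?_
  refine Finset.sum_le_sum_of_subset_of_nonneg ?_ fun _ _ _ => norm_nonneg _
  exact Finset.sdiff_subset.trans (FJ_mono hj)

lemma low_eLp (J : ℕ) (c : Lat → ℂ) : eLpNorm (lpLowC c) 3 μT ≤ ENNReal.ofReal (AJ J c) := by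
  refine eLp_le_sup (fun x => ?_) _
  rw [lpLowC_eq]
  refine Finset.single_le_sum (f := fun k => ‖c k‖) (fun _ _ => norm_nonneg _) ?_
  exact FJ_mono (Nat.zero_le J) (by simp [FJ_zero])

/-- The besov norm used here. -/
def bes (s : ℝ) (c : Lat → ℂ) : ℝ≥0∞ :=
  eLpNorm (lpLowC c) 3 μT + ⨆ j : ℕ, ENNReal.ofReal ((2:ℝ) ^ (s * (j:ℝ))) * eLpNorm (lpBlockC j c) 3 μT

lemma besovC_eq (s : ℝ) (c : Lat → ℂ) : besovC s 3 ∞ c = bes s c := by simp [besovC, bes]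

lemma besovV_eq (s : ℝ) (u : Vec → Vec) : besovV s 3 ∞ u = ∑ j, bes s (fcV u j) := by
  simp only [besovV, besov, besovC_eq]; rfl

lemma block_le_bes (s : ℝ) (c : Lat → ℂ) (j : ℕ) :
    eLpNorm (lpBlockC j c) 3 μT ≤ ENNReal.ofReal ((2:ℝ) ^ (-s * (j:ℝ))) * bes s c := by
  have h1 : ENNReal.ofReal ((2:ℝ) ^ (s * (j:ℝ))) * eLpNorm (lpBlockC j c) 3 μT ≤ bes s c :=
    (le_iSup (fun j : ℕ => ENNReal.ofReal ((2:ℝ) ^ (s * (j:ℝ))) * eLpNorm (lpBlockC j c) 3 μT) j).trans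
      le_add_self
  calc eLpNorm (lpBlockC j c) 3 μT
      = ENNReal.ofReal ((2:ℝ) ^ (-s * (j:ℝ))) *
        (ENNReal.ofReal ((2:ℝ) ^ (s * (j:ℝ))) * eLpNorm (lpBlockC j c) 3 μT) := by
        rw [← mul_assoc, ← ENNReal.ofReal_mul (by positivity), ← Real.rpow_add (by norm_num)]
        simp
    _ ≤ _ := by gcongr

lemma bes_split {s θ : ℝ} (hs : 0 ≤ s) (hθ : 0 ≤ θ) (J : ℕ) (c : Lat → ℂ) :
    bes (s - θ) c ≤ ENNReal.ofReal (2 * (2:ℝ) ^ (s * J)) * ENNReal.ofReal (AJ J c) +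
      ENNReal.ofReal ((2:ℝ) ^ (-θ * J)) * bes s c := by
  have h2 : ∀ j : ℕ, ENNReal.ofReal ((2:ℝ) ^ ((s - θ) * (j:ℝ))) * eLpNorm (lpBlockC j c) 3 μT ≤
      ENNReal.ofReal ((2:ℝ) ^ (s * J)) * ENNReal.ofReal (AJ J c) +
      ENNReal.ofReal ((2:ℝ) ^ (-θ * J)) * bes s c := by
    intro j
    rcases lt_or_ge j J with hj | hj
    · refine le_trans ?_ le_self_add
      refine mul_le_mul' (ENNReal.ofReal_le_ofReal ?_) (block_eLp hj c)
      refine Real.rpow_le_rpow_of_exponent_le (by norm_num) ?_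
      have : (j:ℝ) ≤ J := by exact_mod_cast hj.le
      have h0 : (0:ℝ) ≤ j := Nat.cast_nonneg j
      nlinarith
    · refine le_trans ?_ le_add_self
      refine (mul_le_mul' le_rfl (block_le_bes s c j)).trans ?_
      rw [← mul_assoc, ← ENNReal.ofReal_mul (by positivity), ← Real.rpow_add (by norm_num)]
      gcongr
      · norm_num
      have : (J:ℝ) ≤ j := by exact_mod_cast hj
      nlinarith
  rw [bes]
  refine (add_le_add (low_eLp J c) (iSup_le h2)).trans ?_
  rw [← add_assoc]
  gcongr
  have h1 : (1:ℝ) ≤ (2:ℝ) ^ (s * J) := Real.one_le_rpow (by norm_num) (by positivity)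
  rw [← ENNReal.ofReal_mul (by positivity), ← ENNReal.ofReal_mul (by positivity),
    ← ENNReal.ofReal_add (AJ_nonneg J c) (mul_nonneg (by positivity) (AJ_nonneg J c))]
  refine ENNReal.ofReal_le_ofReal ?_
  have := AJ_nonneg J c
  nlinarith

/-- Geometric tail constant. -/
def gC (α : ℝ) : ℝ := (1 - (2:ℝ) ^ (-α))⁻¹

lemma geom_bound {α : ℝ} (hα : 0 < α) (N : ℕ) :
    ∑ j ∈ Finset.range N, (2:ℝ) ^ (-α * (j:ℝ)) ≤ gC α := by
  have h1 : (2:ℝ) ^ (-α) < 1 := Real.rpow_lt_one_of_one_lt_of_neg (by norm_num) (by linarith)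
  have h0 : (0:ℝ) ≤ (2:ℝ) ^ (-α) := by positivity
  have e : ∀ j : ℕ, (2:ℝ) ^ (-α * (j:ℝ)) = ((2:ℝ) ^ (-α)) ^ j := fun j => by
    rw [Real.rpow_mul (by norm_num), Real.rpow_natCast]
  simp only [e]
  rw [gC, ← tsum_geometric_of_lt_one h0 h1]
  exact (summable_geometric_of_lt_one h0 h1).sum_le_tsum _ fun _ _ => by positivity

lemma gC_pos {α : ℝ} (hα : 0 < α) : 0 < gC α := by
  have h1 : (2:ℝ) ^ (-α) < 1 := Real.rpow_lt_one_of_one_lt_of_neg (by norm_num) (by linarith)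
  rw [gC, inv_pos]; linarith

lemma L3_split {α : ℝ} (hα : 0 < α) {f : Vec → ℂ} (hf : Sm f) (J : ℕ) :
    eLpNorm f 3 μT ≤ ENNReal.ofReal (AJ J (fc f)) +
      ENNReal.ofReal (gC α * (2:ℝ) ^ (-α * J)) * bes α (fc f) := by
  set c := fc f with hc
  have hb : ∀ N, eLpNorm (SJ (J + N) c) 3 μT ≤ ENNReal.ofReal (AJ J c) +
      ENNReal.ofReal (gC α * (2:ℝ) ^ (-α * J)) * bes α c := by
    intro N
    have e : SJ (J + N) c = SJ J c + ∑ j ∈ Finset.range N, lpBlockC (J + j) c := by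
      funext x; rw [SJ_add]; simp
    rw [e]
    refine (eLpNorm_add_le (SJ_Sm J c).continuous.aestronglyMeasurable
      (Finset.aestronglyMeasurable_sum _ fun j _ =>
        (lpBlockC_Sm _ c).continuous.aestronglyMeasurable) (by norm_num)).trans ?_
    refine add_le_add (SJ_eLp J c) ?_
    refine (eLpNorm_sum_le (fun j _ => (lpBlockC_Sm _ c).continuous.aestronglyMeasurable)
      (by norm_num)).trans ?_
    refine (Finset.sum_le_sum fun j _ => block_le_bes α c (J + j)).trans ?_
    rw [← Finset.sum_mul, ← ENNReal.ofReal_sum_of_nonneg fun _ _ => by positivity]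
    gcongr
    have : ∀ j : ℕ, (2:ℝ) ^ (-α * ((J + j : ℕ):ℝ)) = (2:ℝ) ^ (-α * j) * (2:ℝ) ^ (-α * J) := by
      intro j; rw [← Real.rpow_add (by norm_num)]; push_cast; ring_nf
    simp only [this, ← Finset.sum_mul]
    gcongr
    exact geom_bound hα N
  have hl := Lp.eLpNorm_lim_le_liminf_eLpNorm (p := 3) (μ := μT) (f := fun N => SJ (J + N) c)
    (fun N => (SJ_Sm _ c).continuous.aestronglyMeasurable) f
    (Eventually.of_forall fun x => by
      have := (SJ_tendsto hf x).comp (tendsto_add_atTop_nat J)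
      refine this.congr fun N => ?_
      simp [Function.comp, add_comm, hc])
  refine hl.trans ?_
  refine liminf_le_of_frequently_le' (Frequently.of_forall hb)

end

section

def gB (s : ℝ) (j : ℕ) (c : Lat → ℂ) : ℝ≥0∞ :=
  eLpNorm (lpLowC c) 3 μT + ENNReal.ofReal ((2:ℝ) ^ (s * (j:ℝ))) * eLpNorm (lpBlockC j c) 3 μT

lemma bes_eq_sup (s : ℝ) (c : Lat → ℂ) : bes s c = ⨆ j, gB s j c := by
  rw [bes, ENNReal.add_iSup]; rfl

lemma lpLow_fun (c : Lat → ℂ) : lpLowC c = fun _ => c 0 := funext fun x => lpLowC_eq c x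

lemma lpBlock_fun (j : ℕ) (c : Lat → ℂ) : lpBlockC j c = fun x => ∑ k ∈ shF j, c k * chr k x :=
  funext fun x => lpBlockC_eq j c x

lemma gB_add_le (s : ℝ) (j : ℕ) (c d : Lat → ℂ) : gB s j (c + d) ≤ gB s j c + gB s j d := by
  have e1 : lpLowC (c + d) = lpLowC c + lpLowC d := by
    funext x; simp [lpLowC_eq]
  have e2 : lpBlockC j (c + d) = lpBlockC j c + lpBlockC j d := by
    funext x; simp [lpBlockC_eq, add_mul, Finset.sum_add_distrib]
  have m1 : ∀ c, AEStronglyMeasurable (lpLowC c) μT := fun c => by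
    rw [lpLow_fun]; exact aestronglyMeasurable_const
  have m2 : ∀ c, AEStronglyMeasurable (lpBlockC j c) μT := fun c =>
    (lpBlockC_Sm _ c).continuous.aestronglyMeasurable
  unfold gB
  rw [e1, e2]
  refine (add_le_add (eLpNorm_add_le (m1 c) (m1 d) (by norm_num))
    (mul_le_mul' le_rfl (eLpNorm_add_le (m2 c) (m2 d) (by norm_num)))).trans (le_of_eq ?_)
  ring

lemma bes_add_le (s : ℝ) (c d : Lat → ℂ) : bes s (c + d) ≤ bes s c + bes s d := by
  simp only [bes_eq_sup]
  refine iSup_le fun j => (gB_add_le s j c d).trans ?_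
  exact add_le_add (le_iSup (fun j => gB s j c) j) (le_iSup (fun j => gB s j d) j)

lemma bes_neg (s : ℝ) (c : Lat → ℂ) : bes s (-c) = bes s c := by
  have e1 : lpLowC (-c) = -lpLowC c := by
    funext x; simp [lpLowC_eq]
  have e2 : ∀ j, lpBlockC j (-c) = -lpBlockC j c := by
    intro j; funext x; simp [lpBlockC_eq]
  simp [bes, e1, e2, eLpNorm_neg]

lemma bes_sub_le (s : ℝ) (c d : Lat → ℂ) : bes s (c - d) ≤ bes s c + bes s d := by
  rw [sub_eq_add_neg]
  refine (bes_add_le s c (-d)).trans ?_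
  rw [bes_neg]

lemma AJ_tendsto {c : ℕ → Lat → ℂ} {d : Lat → ℂ} (h : ∀ k, Tendsto (fun n => c n k) atTop (𝓝 (d k)))
    (J : ℕ) : Tendsto (fun n => AJ J (c n - d)) atTop (𝓝 0) := by
  have : Tendsto (fun n => ∑ k ∈ FJ J, ‖c n k - d k‖) atTop (𝓝 (∑ k ∈ FJ J, 0)) := by
    refine tendsto_finsetSum _ fun k _ => ?_
    have := ((h k).sub_const (d k)).norm
    simpa using this
  simpa [AJ] using this

lemma AJ_neg (J : ℕ) (c : Lat → ℂ) : AJ J (-c) = AJ J c := by simp [AJ]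

lemma bes_fatou (s : ℝ) {c : ℕ → Lat → ℂ} {d : Lat → ℂ}
    (h : ∀ k, Tendsto (fun n => c n k) atTop (𝓝 (d k))) :
    bes s d ≤ liminf (fun n => bes s (c n)) atTop := by
  rw [bes_eq_sup s d]
  refine iSup_le fun j => ?_
  have h1 : Tendsto (fun n => gB s j (d - c n)) atTop (𝓝 0) := by
    have hA := AJ_tendsto h (j + 1)
    have hA' : Tendsto (fun n => ENNReal.ofReal (AJ (j+1) (c n - d)) +
        ENNReal.ofReal ((2:ℝ) ^ (s * (j:ℝ))) * ENNReal.ofReal (AJ (j+1) (c n - d))) atTop (𝓝 0) := by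
      have h0 := ENNReal.tendsto_ofReal hA
      rw [ENNReal.ofReal_zero] at h0
      have := h0.add (ENNReal.Tendsto.const_mul h0 (Or.inr (ENNReal.ofReal_ne_top (r := (2:ℝ) ^ (s * (j:ℝ))))))
      simpa using this
    refine tendsto_of_tendsto_of_tendsto_of_le_of_le tendsto_const_nhds hA' (fun _ => zero_le) ?_
    intro n
    have : AJ (j+1) (c n - d) = AJ (j+1) (d - c n) := by rw [← AJ_neg, neg_sub]
    simp only [this]
    exact add_le_add (low_eLp _ _) (mul_le_mul' le_rfl (block_eLp (Nat.lt_succ_self j) _))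
  rw [← ENNReal.liminf_add_of_right_tendsto_zero h1]
  refine le_liminf_of_le (by isBoundedDefault) (Eventually.of_forall fun n => ?_)
  have := gB_add_le s j (c n) (d - c n)
  rw [add_sub_cancel] at this
  refine this.trans (add_le_add ?_ le_rfl)
  beta_reduce
  rw [bes_eq_sup]
  exact le_iSup (fun j => gB s j (c n)) j

lemma eLp3 (f : Vec → ℂ) : eLpNorm f 3 μT = (∫⁻ x, ‖f x‖ₑ ^ (3:ℝ) ∂μT) ^ (1/3 : ℝ) := by
  rw [eLpNorm_eq_lintegral_rpow_enorm_toReal (by norm_num) (by norm_num)]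
  norm_num

lemma eLp3_cube (f : Vec → ℂ) : eLpNorm f 3 μT ^ (3:ℝ) = ∫⁻ x, ‖f x‖ₑ ^ (3:ℝ) ∂μT := by
  rw [eLp3, ← ENNReal.rpow_mul]; norm_num

lemma bes_meas (s : ℝ) {c : ℝ → Lat → ℂ} (h : ∀ k, Measurable fun t => c t k) :
    Measurable fun t => bes s (c t) := by
  have hm : ∀ F : ℝ → Vec → ℂ, Measurable (Function.uncurry F) →
      Measurable fun t => eLpNorm (F t) 3 μT := by
    intro F hF
    simp only [eLp3]
    refine Measurable.pow_const ?_ _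
    exact Measurable.lintegral_prod_right' (f := fun z : ℝ × Vec => ‖F z.1 z.2‖ₑ ^ (3:ℝ))
      ((hF.enorm).pow_const _)
  unfold bes
  refine Measurable.add (hm _ ?_) (Measurable.iSup fun j => ?_)
  · have : (Function.uncurry fun t => lpLowC (c t)) = fun z : ℝ × Vec => c z.1 0 := by
      funext z; simp [Function.uncurry, lpLowC_eq]
    rw [this]; exact (h 0).comp measurable_fst
  · refine Measurable.const_mul (hm _ ?_) _
    have : (Function.uncurry fun t => lpBlockC j (c t)) =
        fun z : ℝ × Vec => ∑ k ∈ shF j, c z.1 k * chr k z.2 := by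
      funext z; simp [Function.uncurry, lpBlockC_eq]
    rw [this]
    exact Finset.measurable_fun_sum _ fun k _ => ((h k).comp measurable_fst).mul
      ((chr_continuous k).measurable.comp measurable_snd)

lemma bes_aemeas (s : ℝ) {c : ℝ → Lat → ℂ} {μ : Measure ℝ} (h : ∀ k, AEMeasurable (fun t => c t k) μ) :
    AEMeasurable (fun t => bes s (c t)) μ := by
  refine ⟨fun t => bes s (fun k => (h k).mk _ t), bes_meas s fun k => (h k).measurable_mk, ?_⟩
  have : ∀ᵐ t ∂μ, ∀ k, c t k = (h k).mk _ t := ae_all_iff.mpr fun k => (h k).ae_eq_mk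
  filter_upwards [this] with t ht
  congr 1
  funext k; exact ht k

/-- Lipschitz plus small in `L³` implies uniformly small. -/
lemma lip_small {T L δ : ℝ} (hT : 0 < T) (hL : 0 ≤ L) (hδ : 0 < δ) :
    ∃ κ : ℝ≥0∞, 0 < κ ∧ ∀ f : ℝ → ℂ,
      (∀ s ∈ Set.Ioo 0 T, ∀ t ∈ Set.Ioo 0 T, ‖f t - f s‖ ≤ L * |t - s|) →
      ∫⁻ t, ‖f t‖ₑ ^ (3:ℝ) ∂tIoo T < κ → ∀ t ∈ Set.Ioo 0 T, ‖f t‖ < δ := by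
  set r := min (T/2) (δ / (2 * (L + 1))) with hr
  have hr0 : 0 < r := lt_min (by linarith) (by positivity)
  refine ⟨ENNReal.ofReal (δ/2) ^ (3:ℝ) * ENNReal.ofReal r, ?_, ?_⟩
  · have : 0 < ENNReal.ofReal (δ/2) := ENNReal.ofReal_pos.mpr (by linarith)
    exact ENNReal.mul_pos (ENNReal.rpow_pos this ENNReal.ofReal_ne_top).ne'
      (ENNReal.ofReal_pos.mpr hr0).ne'
  intro f hf hitg t ht
  by_contra hcon
  push Not at hcon
  refine absurd hitg (not_lt.mpr ?_)
  obtain ⟨a, ha0, ha1, hat⟩ : ∃ a, 0 ≤ a ∧ a + r ≤ T ∧ ∀ s ∈ Set.Ioo a (a + r), |s - t| ≤ r := by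
    have hr2 : r ≤ T/2 := min_le_left _ _
    rcases le_total t (T/2) with h1 | h1
    · refine ⟨t, ht.1.le, by linarith, fun s hs => ?_⟩
      rw [abs_le]; constructor <;> linarith [hs.1, hs.2]
    · refine ⟨t - r, by linarith, by linarith [ht.2], fun s hs => ?_⟩
      rw [abs_le]; constructor <;> linarith [hs.1, hs.2]
  have hsub : Set.Ioo a (a + r) ⊆ Set.Ioo 0 T := fun s hs => ⟨by linarith [hs.1], by linarith [hs.2]⟩
  have hlow : ∀ s ∈ Set.Ioo a (a + r), δ / 2 ≤ ‖f s‖ := by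
    intro s hs
    have h1 := hf t ht s (hsub hs)
    have h2 := hat s hs
    have h3 : L * |s - t| ≤ δ / 2 := by
      have h4 : r ≤ δ / (2 * (L + 1)) := min_le_right _ _
      rw [le_div_iff₀ (by positivity)] at h4
      have : L * |s - t| ≤ L * r := by gcongr
      nlinarith
    have h5 : ‖f t‖ - ‖f s‖ ≤ ‖f s - f t‖ := by rw [norm_sub_rev]; exact norm_sub_norm_le _ _
    linarith
  calc ENNReal.ofReal (δ/2) ^ (3:ℝ) * ENNReal.ofReal r
      = ∫⁻ _ in Set.Ioo a (a + r), ENNReal.ofReal (δ/2) ^ (3:ℝ) := by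
        rw [setLIntegral_const, Real.volume_Ioo]; congr 2; ring
    _ ≤ ∫⁻ s in Set.Ioo a (a + r), ‖f s‖ₑ ^ (3:ℝ) := by
        refine setLIntegral_mono' measurableSet_Ioo fun s hs => ?_
        gcongr
        rw [← ofReal_norm]
        exact ENNReal.ofReal_le_ofReal (hlow s hs)
    _ ≤ _ := lintegral_mono_set hsub

/-- Equi-Lipschitz and convergent at rationals implies uniformly Cauchy. -/
lemma lip_cauchy {T L : ℝ} (hT : 0 < T) (hL : 0 ≤ L) {f : ℕ → ℝ → ℂ}
    (hf : ∀ n, ∀ s ∈ Set.Ioo 0 T, ∀ t ∈ Set.Ioo 0 T, ‖f n t - f n s‖ ≤ L * |t - s|)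
    (hq : ∀ q : ℚ, (q:ℝ) ∈ Set.Ioo 0 T → CauchySeq fun n => f n q) {δ : ℝ} (hδ : 0 < δ) :
    ∃ N, ∀ m ≥ N, ∀ n ≥ N, ∀ t ∈ Set.Ioo 0 T, ‖f m t - f n t‖ < δ := by
  obtain ⟨K, hK⟩ := exists_nat_gt (T * (3 * (L + 1)) / δ)
  have hK0 : 0 < (K:ℝ) := lt_of_le_of_lt (by positivity) hK
  set h := T / K with hh
  have hh0 : 0 < h := by positivity
  have hhK : h * K = T := by rw [hh]; field_simp
  have hLh : L * h ≤ δ / 3 := by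
    rw [div_lt_iff₀ hδ] at hK
    have : T * (3 * (L+1)) / K < δ := by rw [div_lt_iff₀ hK0]; linarith
    have e : T * (3 * (L+1)) / K = 3 * L * h + 3 * h := by rw [hh]; ring
    linarith
  have hex : ∀ i : ℕ, ∃ q : ℚ, (i:ℝ) * h < q ∧ (q:ℝ) < (i + 1) * h := fun i =>
    exists_rat_btwn (by nlinarith)
  choose q hq1 hq2 using hex
  have hqI : ∀ i, i < K → (q i : ℝ) ∈ Set.Ioo 0 T := by
    intro i hi
    refine ⟨lt_of_le_of_lt (by positivity) (hq1 i), (hq2 i).trans_le ?_⟩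
    have : (i:ℝ) + 1 ≤ K := by exact_mod_cast hi
    rw [← hhK, mul_comm h]; gcongr
  have hN : ∀ i, ∃ N, i < K → ∀ m ≥ N, ∀ n ≥ N, ‖f m (q i) - f n (q i)‖ < δ / 3 := by
    intro i
    by_cases hi : i < K
    · obtain ⟨N, hN⟩ := Metric.cauchySeq_iff.mp (hq (q i) (hqI i hi)) (δ/3) (by positivity)
      exact ⟨N, fun _ m hm n hn => by have := hN m hm n hn; rwa [dist_eq_norm] at this⟩
    · exact ⟨0, fun h => absurd h hi⟩
  choose N hN using hN
  refine ⟨(Finset.range K).sup N, fun m hm n hn t ht => ?_⟩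
  set i := ⌊t / h⌋₊ with hi
  have hi1 : (i:ℝ) * h ≤ t := by
    rw [← le_div_iff₀ hh0]; exact Nat.floor_le (by have := ht.1; positivity)
  have hi2 : t < (i + 1) * h := by
    rw [← div_lt_iff₀ hh0]; exact Nat.lt_floor_add_one _
  have hiK : i < K := by
    have : (i:ℝ) * h < K * h := by rw [mul_comm (K:ℝ), hhK]; exact hi1.trans_lt ht.2
    exact_mod_cast lt_of_mul_lt_mul_right this hh0.le
  have hNi : N i ≤ (Finset.range K).sup N := Finset.le_sup (Finset.mem_range.mpr hiK)
  have h1 := hN i hiK m (hNi.trans hm) n (hNi.trans hn)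
  have hd : |t - q i| ≤ h := by
    have := hq1 i
    have := hq2 i
    rw [abs_le]; constructor <;> linarith
  have h2 := hf m _ (hqI i hiK) t ht
  have h3 := hf n _ (hqI i hiK) t ht
  have h4 : L * |t - q i| ≤ L * h := by gcongr
  have e : f m t - f n t = (f m t - f m (q i)) + (f m (q i) - f n (q i)) - (f n t - f n (q i)) := by ring
  rw [e]
  refine (norm_sub_le _ _).trans_lt ?_
  have := norm_add_le (f m t - f m (q i)) (f m (q i) - f n (q i))
  by_cases hL0 : L = 0
  · subst hL0; simp at h2 h3; rw [h3, h2] at *; simp at *; linarith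
  · linarith

end

section

lemma cube_add (a b : ℝ≥0∞) : (a + b) ^ (3:ℝ) ≤ 4 * (a ^ (3:ℝ) + b ^ (3:ℝ)) := by
  have := ENNReal.rpow_add_le_mul_rpow_add_rpow a b (show (1:ℝ) ≤ 3 by norm_num)
  have e : (2:ℝ≥0∞) ^ ((3:ℝ) - 1) = 4 := by norm_num
  rwa [e] at this

lemma cube_sum3 (f : Fin 3 → ℝ≥0∞) : (∑ j, f j) ^ (3:ℝ) ≤ 9 * ∑ j, f j ^ (3:ℝ) := by
  have := ENNReal.rpow_sum_le_const_mul_sum_rpow Finset.univ f (show (1:ℝ) ≤ 3 by norm_num)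
  have e : ((Finset.univ : Finset (Fin 3)).card : ℝ≥0∞) ^ ((3:ℝ) - 1) = 9 := by norm_num
  rwa [e] at this

lemma vec_enorm_le (v : Vec) : ‖v‖ₑ ≤ ∑ j, ‖((v j : ℝ) : ℂ)‖ₑ := by
  have h : ‖v‖ ≤ ∑ j, ‖v j‖ := by
    conv_lhs => rw [← (EuclideanSpace.basisFun (Fin 3) ℝ).sum_repr v]
    refine (norm_sum_le _ _).trans (Finset.sum_le_sum fun j _ => ?_)
    rw [norm_smul]
    simp
  have h2 := ENNReal.ofReal_le_ofReal h
  rw [ofReal_norm, ENNReal.ofReal_sum_of_nonneg (fun _ _ => norm_nonneg _)] at h2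
  refine h2.trans (Finset.sum_le_sum fun j _ => ?_)
  rw [ofReal_norm, ← ofReal_norm, ← ofReal_norm, Complex.norm_real]

lemma coord_enorm_le (v : Vec) (j : Fin 3) : ‖((v j : ℝ) : ℂ)‖ₑ ≤ ‖v‖ₑ := by
  rw [← ofReal_norm, ← ofReal_norm, Complex.norm_real]
  exact ENNReal.ofReal_le_ofReal (PiLp.norm_apply_le v j)

lemma fcV_sub_sm {u v : Vec → Vec} (hu : SmV u) (hv : SmV v) (j : Fin 3) :
    fc (fun x => uC u j x - uC v j x) = fcV u j - fcV v j := by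
  funext k
  rw [Pi.sub_apply, fcV_eq, fcV_eq]
  exact fc_sub (hu.comp j).integrable (hv.comp j).integrable k

lemma slice_est {α : ℝ} (hα : 0 < α) {u v : Vec → Vec} (hu : SmV u) (hv : SmV v) (J : ℕ) {a : ℝ}
    (ha : ∀ j, AJ J (fcV u j - fcV v j) ≤ a) :
    ∫⁻ x, ‖u x - v x‖ₑ ^ (3:ℝ) ∂μT ≤ 108 * ENNReal.ofReal a ^ (3:ℝ) +
      432 * ENNReal.ofReal (gC α * (2:ℝ) ^ (-α * J)) ^ (3:ℝ) *
        (besovV α 3 ∞ u ^ (3:ℝ) + besovV α 3 ∞ v ^ (3:ℝ)) := by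
  set G := ENNReal.ofReal (gC α * (2:ℝ) ^ (-α * J)) with hG
  have h1 : ∀ j : Fin 3, ∫⁻ x, ‖uC u j x - uC v j x‖ₑ ^ (3:ℝ) ∂μT ≤
      4 * ENNReal.ofReal a ^ (3:ℝ) + 16 * G ^ (3:ℝ) *
        (besovV α 3 ∞ u ^ (3:ℝ) + besovV α 3 ∞ v ^ (3:ℝ)) := by
    intro j
    rw [← eLp3_cube (fun x => uC u j x - uC v j x)]
    have hb : ∀ u : Vec → Vec, bes α (fcV u j) ≤ besovV α 3 ∞ u := fun u => by
      rw [besovV_eq]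
      exact Finset.single_le_sum (f := fun j => bes α (fcV u j)) (fun _ _ => zero_le) (Finset.mem_univ j)
    have h2 := L3_split hα ((hu.comp j).sub (hv.comp j)) J
    rw [fcV_sub_sm hu hv] at h2
    have h3 : eLpNorm (fun x => uC u j x - uC v j x) 3 μT ≤
        ENNReal.ofReal a + G * (besovV α 3 ∞ u + besovV α 3 ∞ v) := by
      refine h2.trans ?_
      gcongr
      · exact ha j
      · exact (bes_sub_le _ _ _).trans (add_le_add (hb u) (hb v))
    calc _ ≤ (ENNReal.ofReal a + G * (besovV α 3 ∞ u + besovV α 3 ∞ v)) ^ (3:ℝ) := by gcongr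
      _ ≤ 4 * (ENNReal.ofReal a ^ (3:ℝ) + (G * (besovV α 3 ∞ u + besovV α 3 ∞ v)) ^ (3:ℝ)) := cube_add _ _
      _ ≤ 4 * (ENNReal.ofReal a ^ (3:ℝ) + G ^ (3:ℝ) * (4 * (besovV α 3 ∞ u ^ (3:ℝ) + besovV α 3 ∞ v ^ (3:ℝ)))) := by
        rw [ENNReal.mul_rpow_of_nonneg _ _ (by norm_num)]
        gcongr
        exact cube_add _ _
      _ = _ := by ring
  have hm : ∀ j : Fin 3, Measurable fun x => ‖uC u j x - uC v j x‖ₑ ^ (3:ℝ) := fun j =>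
    ((hu.comp j).sub (hv.comp j)).continuous.measurable.enorm.pow_const _
  calc ∫⁻ x, ‖u x - v x‖ₑ ^ (3:ℝ) ∂μT
      ≤ ∫⁻ x, 9 * ∑ j, ‖uC u j x - uC v j x‖ₑ ^ (3:ℝ) ∂μT := by
        refine lintegral_mono fun x => ?_
        refine le_trans ?_ (cube_sum3 _)
        gcongr
        refine (vec_enorm_le _).trans (le_of_eq ?_)
        refine Finset.sum_congr rfl fun j _ => ?_
        simp [uC]
    _ = 9 * ∑ j, ∫⁻ x, ‖uC u j x - uC v j x‖ₑ ^ (3:ℝ) ∂μT := by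
        rw [lintegral_const_mul _ (Finset.measurable_fun_sum _ fun j _ => hm j),
          lintegral_finsetSum _ fun j _ => hm j]
    _ ≤ 9 * ∑ j : Fin 3, (4 * ENNReal.ofReal a ^ (3:ℝ) + 16 * G ^ (3:ℝ) *
        (besovV α 3 ∞ u ^ (3:ℝ) + besovV α 3 ∞ v ^ (3:ℝ))) := by
        gcongr with j; exact h1 j
    _ = _ := by
        simp only [Finset.sum_const, Finset.card_univ, Fintype.card_fin, nsmul_eq_mul]
        push_cast
        ring

variable {T α β M B : ℝ} {ν : ℕ → ℝ} {u : ℕ → ℝ → Vec → Vec}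

lemma Dat.besm (h : Dat T α β M B ν u) (s : ℝ) (n : ℕ) :
    AEMeasurable (fun t => besovV s 3 ∞ (u n t)) (tIoo T) := by
  simp only [besovV_eq]
  exact Finset.aemeasurable_fun_sum _ fun j _ => bes_aemeas _ fun k => h.meas_c n j k

/-- uniformly Cauchy coefficients -/
def UCy (T : ℝ) (u : ℕ → ℝ → Vec → Vec) : Prop := ∀ (j : Fin 3) (k : Lat) (δ : ℝ), 0 < δ →
  ∃ N, ∀ m ≥ N, ∀ n ≥ N, ∀ t ∈ Set.Ioo 0 T, ‖fcV (u m t) j k - fcV (u n t) j k‖ < δ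

lemma UCy.AJ (h : UCy T u) (J : ℕ) {a : ℝ} (ha : 0 < a) :
    ∃ N, ∀ m ≥ N, ∀ n ≥ N, ∀ t ∈ Set.Ioo 0 T, ∀ j, AJ J (fcV (u m t) j - fcV (u n t) j) ≤ a := by
  set δ := a / ((FJ J).card + 1) with hδ
  have hδ0 : 0 < δ := by positivity
  choose N hN using fun (j : Fin 3) (k : Lat) => h j k δ hδ0
  refine ⟨∑ j, ∑ k ∈ FJ J, N j k, fun m hm n hn t ht j => ?_⟩
  have hle : ∀ k ∈ FJ J, N j k ≤ ∑ j, ∑ k ∈ FJ J, N j k := fun k hk =>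
    (Finset.single_le_sum (f := fun k => N j k) (fun _ _ => Nat.zero_le _) hk).trans
    (Finset.single_le_sum (f := fun j => ∑ k ∈ FJ J, N j k) (fun _ _ => Nat.zero_le _) (Finset.mem_univ j))
  calc PaperHelicity.AJ J (fcV (u m t) j - fcV (u n t) j) ≤ ∑ k ∈ FJ J, δ :=
        Finset.sum_le_sum fun k hk => (hN j k m ((hle k hk).trans hm) n ((hle k hk).trans hn) t ht).le
    _ = (FJ J).card * δ := by simp
    _ ≤ ((FJ J).card + 1) * δ := by gcongr; linarith
    _ = a := by rw [hδ]; field_simp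

lemma Dat.E_cauchy (h : Dat T α β M B ν u) (hc : UCy T u) {ε : ℝ} (hε : 0 < ε) :
    ∃ N, ∀ m ≥ N, ∀ n ≥ N,
      ∫⁻ t, (∫⁻ x, ‖u m t x - u n t x‖ₑ ^ (3:ℝ) ∂μT) ∂tIoo T ≤ ENNReal.ofReal ε := by
  have hα : 0 < α := by linarith [h.hα]
  have hg := gC_pos hα
  have hB := h.hB
  have hT := h.hT
  -- choose J
  have hJ : ∃ J : ℕ, 864 * (gC α * (2:ℝ) ^ (-α * (J:ℝ))) ^ 3 * B ≤ ε / 2 := by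
    have h1 : Tendsto (fun J : ℕ => 864 * (gC α * (2:ℝ) ^ (-α * (J:ℝ))) ^ 3 * B) atTop
        (𝓝 (864 * (gC α * 0) ^ 3 * B)) := by
      refine ((Tendsto.pow (Tendsto.const_mul _ ?_) 3).const_mul _).mul_const _
      have e : ∀ j : ℕ, (2:ℝ) ^ (-α * (j:ℝ)) = ((2:ℝ) ^ (-α)) ^ j := fun j => by
        rw [Real.rpow_mul (by norm_num), Real.rpow_natCast]
      simp only [e]
      exact tendsto_pow_atTop_nhds_zero_of_lt_one (by positivity)
        (Real.rpow_lt_one_of_one_lt_of_neg (by norm_num) (by linarith))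
    have h2 : (864 * (gC α * 0) ^ 3 * B) < ε / 2 := by simp; linarith
    obtain ⟨J, hJ⟩ := (h1.eventually (gt_mem_nhds h2)).exists
    exact ⟨J, hJ.le⟩
  obtain ⟨J, hJ⟩ := hJ
  set G := gC α * (2:ℝ) ^ (-α * (J:ℝ)) with hG
  have hG0 : 0 ≤ G := by positivity
  clear_value G
  obtain ⟨a, ha, ha2⟩ : ∃ a : ℝ, 0 < a ∧ 108 * a ^ 3 * T ≤ ε / 2 := by
    refine ⟨min 1 (ε / (216 * T)), by positivity, ?_⟩
    set a := min 1 (ε / (216 * T))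
    have ha0 : 0 < a := by positivity
    have ha1 : a ≤ 1 := min_le_left _ _
    have : a ^ 3 ≤ ε / (216 * T) := (pow_le_of_le_one ha0.le ha1 (by norm_num)).trans (min_le_right _ _)
    calc 108 * a ^ 3 * T ≤ 108 * (ε / (216 * T)) * T := by gcongr
      _ = ε / 2 := by field_simp; ring
  obtain ⟨N, hN⟩ := hc.AJ J ha
  refine ⟨N, fun m hm n hn => ?_⟩
  have hmm := fun n => (h.besm α n).pow_const (3:ℝ)
  calc ∫⁻ t, (∫⁻ x, ‖u m t x - u n t x‖ₑ ^ (3:ℝ) ∂μT) ∂tIoo T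
      ≤ ∫⁻ t, (108 * ENNReal.ofReal a ^ (3:ℝ) + 432 * ENNReal.ofReal G ^ (3:ℝ) *
        (besovV α 3 ∞ (u m t) ^ (3:ℝ) + besovV α 3 ∞ (u n t) ^ (3:ℝ))) ∂tIoo T := by
        refine lintegral_mono_ae ?_
        filter_upwards [wI_ae] with t ht
        rw [hG]
        exact slice_est hα (h.sm m t ht) (h.sm n t ht) J (hN m hm n hn t ht)
    _ = 108 * ENNReal.ofReal a ^ (3:ℝ) * ENNReal.ofReal T + 432 * ENNReal.ofReal G ^ (3:ℝ) *
        (∫⁻ t, besovV α 3 ∞ (u m t) ^ (3:ℝ) ∂tIoo T + ∫⁻ t, besovV α 3 ∞ (u n t) ^ (3:ℝ) ∂tIoo T) := by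
        rw [lintegral_add_left measurable_const, lintegral_const, lintegral_const_mul'',
          lintegral_add_left' (hmm m)]
        · simp [tIoo]
        · exact (hmm m).add (hmm n)
    _ ≤ 108 * ENNReal.ofReal a ^ (3:ℝ) * ENNReal.ofReal T + 432 * ENNReal.ofReal G ^ (3:ℝ) *
        (ENNReal.ofReal B + ENNReal.ofReal B) := by
        gcongr
        · exact h.bes m
        · exact h.bes n
    _ = ENNReal.ofReal (108 * a ^ 3 * T + 432 * G ^ 3 * (B + B)) := by
        rw [ENNReal.ofReal_add (by positivity) (by positivity), ENNReal.ofReal_mul (by positivity),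
          ENNReal.ofReal_mul (by positivity), ENNReal.ofReal_mul (by positivity),
          ENNReal.ofReal_mul (by positivity), ENNReal.ofReal_pow ha.le, ENNReal.ofReal_pow hG0,
          ENNReal.ofReal_add hB hB]
        norm_num
    _ ≤ ENNReal.ofReal ε := ENNReal.ofReal_le_ofReal (by nlinarith)

end

section

lemma lp_complete {X : Type*} [MeasurableSpace X] {μ : Measure X} {f : ℕ → X → Vec}
    (hf : ∀ n, MemLp (f n) 3 μ)
    (hc : ∀ ε : ℝ, 0 < ε → ∃ N, ∀ m ≥ N, ∀ n ≥ N,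
      ∫⁻ x, ‖f m x - f n x‖ₑ ^ (3:ℝ) ∂μ ≤ ENNReal.ofReal ε) :
    ∃ g : X → Vec, Measurable g ∧
      Tendsto (fun n => ∫⁻ x, ‖f n x - g x‖ₑ ^ (3:ℝ) ∂μ) atTop (𝓝 0) := by
  have : Fact ((1:ℝ≥0∞) ≤ 3) := ⟨by norm_num⟩
  have e : ∀ F : X → Vec, eLpNorm F 3 μ = (∫⁻ x, ‖F x‖ₑ ^ (3:ℝ) ∂μ) ^ (1/3 : ℝ) := fun F => by
    rw [eLpNorm_eq_lintegral_rpow_enorm_toReal (by norm_num) (by norm_num)]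
    norm_num
  have e3 : ∀ F : X → Vec, eLpNorm F 3 μ ^ (3:ℝ) = ∫⁻ x, ‖F x‖ₑ ^ (3:ℝ) ∂μ := fun F => by
    rw [e, ← ENNReal.rpow_mul]; norm_num
  have hC : CauchySeq fun n => (hf n).toLp (f n) := by
    rw [Metric.cauchySeq_iff]
    intro ε hε
    obtain ⟨N, hN⟩ := hc ((ε/2) ^ 3) (by positivity)
    refine ⟨N, fun m hm n hn => ?_⟩
    rw [Lp.dist_def]
    have h1 : eLpNorm (⇑((hf m).toLp (f m)) - ⇑((hf n).toLp (f n))) 3 μ = eLpNorm (f m - f n) 3 μ :=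
      eLpNorm_congr_ae ((hf m).coeFn_toLp.sub (hf n).coeFn_toLp)
    rw [h1]
    have h2 : eLpNorm (f m - f n) 3 μ ≤ ENNReal.ofReal (ε/2) := by
      rw [e]
      have := ENNReal.rpow_le_rpow (hN m hm n hn) (show (0:ℝ) ≤ 1/3 by norm_num)
      refine this.trans (le_of_eq ?_)
      rw [ENNReal.ofReal_pow (by positivity), ← ENNReal.rpow_natCast, ← ENNReal.rpow_mul]
      norm_num
    have := ENNReal.toReal_mono ENNReal.ofReal_ne_top h2
    rw [ENNReal.toReal_ofReal (by positivity)] at this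
    linarith
  obtain ⟨L, hL⟩ := cauchySeq_tendsto_of_complete hC
  rw [Lp.tendsto_Lp_iff_tendsto_eLpNorm'] at hL
  refine ⟨L, (Lp.stronglyMeasurable L).measurable, ?_⟩
  have h3 : Tendsto (fun n => eLpNorm (f n - ⇑L) 3 μ) atTop (𝓝 0) := by
    refine hL.congr fun n => ?_
    exact eLpNorm_congr_ae ((hf n).coeFn_toLp.sub (ae_eq_refl _))
  have h4 := h3.ennrpow_const 3
  simp only [e3] at h4
  simpa using h4

/-- coordinatewise fractional part -/
def frv (x : Vec) : Vec := WithLp.toLp 2 fun i => Int.fract (x i)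

lemma frv_measurable : Measurable frv := by
  refine (WithLp.measurable_toLp 2 _).comp (measurable_pi_lambda _ fun i => ?_)
  exact measurable_fract.comp (by fun_prop)

lemma frv_add (x : Vec) (n : Lat) : frv (x + latv n) = frv x := by
  unfold frv
  congr 1
  funext i
  simp [latv_apply]

lemma frv_cube {x : Vec} (hx : x ∈ cube) : frv x = x := by
  ext i
  simp only [frv]
  exact Int.fract_eq_self.mpr (hx i)

variable {T α β M B : ℝ} {ν : ℕ → ℝ} {u : ℕ → ℝ → Vec → Vec}

lemma Dat.exists_sub (h : Dat T α β M B ν u) : ∃ g : ℕ → ℕ, StrictMono g ∧ UCy T (fun n => u (g n)) := by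
  classical
  let z : ℕ → (ℚ × Fin 3 × Lat → ℂ) := fun n p =>
    if (p.1 : ℝ) ∈ Set.Ioo 0 T then fcV (u n p.1) p.2.1 p.2.2 else 0
  have hz : ∀ n, z n ∈ Set.univ.pi fun _ => Metric.closedBall (0:ℂ) M := by
    intro n p _
    simp only [z, mem_closedBall_zero_iff]
    split_ifs with hp
    · exact (h.hb n _ hp _).pt0 (by linarith [h.hβ]) h.hM _
    · simpa using h.hM
  have hcp : IsCompact (Set.univ.pi fun _ : ℚ × Fin 3 × Lat => Metric.closedBall (0:ℂ) M) :=
    isCompact_univ_pi fun _ => isCompact_closedBall _ _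
  obtain ⟨a, -, g, hg, hga⟩ := hcp.tendsto_subseq hz
  refine ⟨g, hg, fun j k δ hδ => ?_⟩
  refine lip_cauchy (f := fun n t => fcV (u (g n) t) j k) h.hT (h.lipK_nonneg k)
    (fun n s hs t ht => h.lip (g n) j k hs ht) (fun q hq => ?_) hδ
  have := (tendsto_pi_nhds.mp hga (q, j, k)).cauchySeq
  refine cast ?_ this
  congr 1
  funext n
  simp only [Function.comp, z, if_pos hq]

lemma Dat.part_i (h : Dat T α β M B ν u) : ∃ g : ℕ → ℕ, StrictMono g ∧ ∃ v : ℝ → Vec → Vec,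
      Measurable (Function.uncurry v) ∧ (∀ t, Per (v t)) ∧ L3conv T (fun j => u (g j)) v := by
  obtain ⟨g0, hg0, hU⟩ := h.exists_sub
  have h' := h.subseq hg0
  obtain ⟨N, hN⟩ := h'.E_cauchy hU one_pos
  let w : ℕ → ℝ → Vec → Vec := fun n => wI T (u (g0 (N + n)))
  have hwm : ∀ n, Measurable (Function.uncurry (w n)) := fun n => h'.meas_wI _
  let f : ℕ → ℝ × Vec → Vec := fun n p => Function.uncurry (w n) p - Function.uncurry (w 0) p
  have hfm : ∀ n, Measurable (f n) := fun n => (hwm n).sub (hwm 0)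
  have hE : ∀ F : ℝ × Vec → Vec, Measurable F → ∫⁻ p, ‖F p‖ₑ ^ (3:ℝ) ∂((tIoo T).prod μT) =
      ∫⁻ t, ∫⁻ x, ‖F (t, x)‖ₑ ^ (3:ℝ) ∂μT ∂tIoo T := fun F hF =>
    lintegral_prod _ (hF.enorm.pow_const _).aemeasurable
  have hdiff : ∀ m n, ∫⁻ p, ‖f m p - f n p‖ₑ ^ (3:ℝ) ∂((tIoo T).prod μT) =
      ∫⁻ t, (∫⁻ x, ‖u (g0 (N + m)) t x - u (g0 (N + n)) t x‖ₑ ^ (3:ℝ) ∂μT) ∂tIoo T := by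
    intro m n
    rw [hE (fun p => f m p - f n p) ((hfm m).sub (hfm n))]
    refine lintegral_congr_ae ?_
    filter_upwards [wI_ae] with t ht
    simp only [f, w, Function.uncurry, wI_of_mem ht, sub_sub_sub_cancel_right]
  have hf0 : ∀ p, f 0 p = 0 := fun p => by simp [f]
  have hL : ∀ n, MemLp (f n) 3 ((tIoo T).prod μT) := by
    intro n
    refine ⟨(hfm n).aestronglyMeasurable, ?_⟩
    rw [eLpNorm_lt_top_iff_lintegral_rpow_enorm_lt_top (by norm_num) (by norm_num)]
    have h1 := hdiff n 0
    simp only [hf0, sub_zero] at h1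
    have e3 : (3:ℝ≥0∞).toReal = 3 := by norm_num
    rw [e3, h1]
    exact (hN _ (by simp) _ (by simp)).trans_lt ENNReal.ofReal_lt_top
  obtain ⟨G, hG, hGt⟩ := lp_complete hL (fun ε hε => by
    obtain ⟨N', hN'⟩ := h'.E_cauchy hU hε
    refine ⟨N', fun m hm n hn => ?_⟩
    rw [hdiff]
    exact hN' _ (by omega) _ (by omega))
  let v : ℝ → Vec → Vec := fun t x => G (t, frv x) + Function.uncurry (w 0) (t, frv x)
  refine ⟨fun n => g0 (N + n), hg0.comp (strictMono_id.const_add N), v, ?_, ?_, ?_⟩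
  · exact (hG.add (hwm 0)).comp (measurable_fst.prodMk (frv_measurable.comp measurable_snd))
  · intro t x n
    simp only [v, frv_add]
  · unfold L3conv
    refine hGt.congr fun n => ?_
    rw [hE (fun p => f n p - G p) ((hfm n).sub hG)]
    refine lintegral_congr_ae ?_
    filter_upwards [wI_ae] with t ht
    refine lintegral_congr_ae ?_
    filter_upwards [ae_restrict_mem measurableSet_cube] with x hx
    simp only [v, f, w, Function.uncurry, wI_of_mem ht, frv_cube hx]
    rw [← enorm_eq_nnnorm]
    congr 2
    abel

end

section

lemma fc_cube_le {f : Vec → ℂ} (hf : AEStronglyMeasurable f μT) (k : Lat) :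
    ‖fc f k‖ₑ ^ (3:ℝ) ≤ ∫⁻ x, ‖f x‖ₑ ^ (3:ℝ) ∂μT := by
  rw [← eLp3_cube]
  refine ENNReal.rpow_le_rpow ?_ (by norm_num)
  refine le_trans ?_ (eLpNorm_le_eLpNorm_of_exponent_le (p := 1) (by norm_num) hf)
  rw [eLpNorm_one_eq_lintegral_enorm, fc_def]
  refine (enorm_integral_le_lintegral_enorm _).trans (lintegral_mono fun x => ?_)
  rw [enorm_mul]
  have : ‖chr (-k) x‖ₑ = 1 := by rw [← ofReal_norm, chr_norm]; simp
  rw [this, mul_one]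

lemma Dat.dm {T α β M B : ℝ} {ν : ℕ → ℝ} {u : ℕ → ℝ → Vec → Vec} (h : Dat T α β M B ν u)
    {v : ℝ → Vec → Vec} (hv : Measurable (Function.uncurry v)) (n : ℕ) :
    AEMeasurable (fun t => ∫⁻ x, ‖u n t x - v t x‖ₑ ^ (3:ℝ) ∂μT) (tIoo T) := by
  refine ⟨fun t => ∫⁻ x, ‖wI T (u n) t x - v t x‖ₑ ^ (3:ℝ) ∂μT, ?_, ?_⟩
  · exact Measurable.lintegral_prod_right' (f := fun p : ℝ × Vec =>
      ‖wI T (u n) p.1 p.2 - v p.1 p.2‖ₑ ^ (3:ℝ)) (((h.meas_wI n).sub hv).enorm.pow_const _)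
  · filter_upwards [wI_ae] with t ht
    rw [wI_of_mem ht]

/-- Properties of the limit -/
structure Lim (T α β M B : ℝ) (ν : ℕ → ℝ) (u : ℕ → ℝ → Vec → Vec) (v : ℝ → Vec → Vec)
    (c : ℝ → Fin 3 → Lat → ℂ) : Prop where
  dat : Dat T α β M B ν u
  meas : Measurable (Function.uncurry v)
  per : ∀ t, Per (v t)
  unif : ∀ j k, ∀ δ : ℝ, 0 < δ → ∃ N, ∀ n ≥ N, ∀ t ∈ Set.Ioo 0 T, ‖fcV (u n t) j k - c t j k‖ ≤ δ
  ae : ∀ᵐ t ∂tIoo T, MemLp (v t) 3 μT ∧ fcV (v t) = c t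

lemma MemLp.coordC {f : Vec → Vec} (h : MemLp f 3 μT) (j : Fin 3) : MemLp (uC f j) 3 μT := by
  refine h.mono ?_ (Eventually.of_forall fun x => ?_)
  · have h1 : AEStronglyMeasurable (fun x => f x j) μT :=
      (EuclideanSpace.proj (𝕜 := ℝ) j).continuous.comp_aestronglyMeasurable h.1
    exact Complex.continuous_ofReal.comp_aestronglyMeasurable h1
  · rw [uC, Complex.norm_real]
    exact PiLp.norm_apply_le (f x) j

lemma Dat.lim {T α β M B : ℝ} {ν : ℕ → ℝ} {u : ℕ → ℝ → Vec → Vec} (h : Dat T α β M B ν u)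
    {v : ℝ → Vec → Vec} (hv : Measurable (Function.uncurry v)) (hp : ∀ t, Per (v t))
    (hL : L3conv T u v) : ∃ c, Lim T α β M B ν u v c := by
  set d : ℕ → ℝ → ℝ≥0∞ := fun n t => ∫⁻ x, ‖u n t x - v t x‖ₑ ^ (3:ℝ) ∂μT with hd
  have hL' : Tendsto (fun n => ∫⁻ t, d n t ∂tIoo T) atTop (𝓝 0) := hL
  have hvt : ∀ t, Measurable (v t) := fun t => hv.comp (measurable_const.prodMk measurable_id)
  have hvj : ∀ t j, Measurable (uC (v t) j) := fun t j => by
    have : Measurable fun x => v t x j := (EuclideanSpace.proj (𝕜 := ℝ) j).continuous.measurable.comp (hvt t)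
    exact Complex.measurable_ofReal.comp this
  have hcm : ∀ n m t, t ∈ Set.Ioo 0 T → ∀ j k,
      ‖fcV (u n t) j k - fcV (u m t) j k‖ₑ ^ (3:ℝ) ≤ 4 * (d n t + d m t) := by
    intro n m t ht j k
    have hn := h.sm n t ht
    have hm := h.sm m t ht
    have e : fcV (u n t) j k - fcV (u m t) j k = fc (fun x => uC (u n t) j x - uC (u m t) j x) k := by
      rw [fcV_sub_sm hn hm]; rfl
    rw [e]
    refine (fc_cube_le ((hn.comp j).sub (hm.comp j)).continuous.aestronglyMeasurable k).trans ?_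
    have e2 : d n t + d m t = ∫⁻ x, (‖u n t x - v t x‖ₑ ^ (3:ℝ) + ‖u m t x - v t x‖ₑ ^ (3:ℝ)) ∂μT := by
      exact (lintegral_add_left (f := fun x => ‖u n t x - v t x‖ₑ ^ (3:ℝ))
        ((hn.smooth.continuous.measurable.sub (hvt t)).enorm.pow_const _) _).symm
    rw [e2, ← lintegral_const_mul' _ _ (by norm_num)]
    refine lintegral_mono fun x => ?_
    refine le_trans ?_ (cube_add _ _)
    gcongr
    have : ‖uC (u n t) j x - uC (u m t) j x‖ₑ ≤ ‖u n t x - u m t x‖ₑ := by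
      have := coord_enorm_le (u n t x - u m t x) j
      simpa [uC] using this
    refine this.trans ?_
    have e3 : u n t x - u m t x = (u n t x - v t x) + -(u m t x - v t x) := by abel
    rw [e3]
    refine (enorm_add_le _ _).trans ?_
    rw [enorm_neg]
  have hU : UCy T u := by
    intro j k δ hδ
    obtain ⟨κ, hκ, hs⟩ := lip_small (L := 2 * lipK M B k) h.hT (by linarith [h.lipK_nonneg k]) hδ
    have hev : ∀ᶠ n in atTop, 16 * ∫⁻ t, d n t ∂tIoo T < κ := by
      have := ENNReal.Tendsto.const_mul (a := 16) hL' (Or.inr (by norm_num))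
      rw [mul_zero] at this
      exact this.eventually (gt_mem_nhds hκ)
    obtain ⟨N, hN⟩ := eventually_atTop.mp hev
    refine ⟨N, fun m hm n hn => ?_⟩
    refine hs (fun t => fcV (u m t) j k - fcV (u n t) j k) ?_ ?_
    · intro s hs t ht
      have h1 := h.lip m j k hs ht
      have h2 := h.lip n j k hs ht
      calc _ = ‖(fcV (u m t) j k - fcV (u m s) j k) - (fcV (u n t) j k - fcV (u n s) j k)‖ := by
            congr 1; ring
        _ ≤ _ := (norm_sub_le _ _).trans (by linarith)
    · have hle : ∫⁻ t, ‖fcV (u m t) j k - fcV (u n t) j k‖ₑ ^ (3:ℝ) ∂tIoo T ≤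
          4 * (∫⁻ t, d m t ∂tIoo T + ∫⁻ t, d n t ∂tIoo T) := by
        rw [← lintegral_add_left' (h.dm hv m), ← lintegral_const_mul' _ _ (by norm_num)]
        refine lintegral_mono_ae ?_
        filter_upwards [wI_ae] with t ht
        exact hcm m n t ht j k
      refine hle.trans_lt ?_
      set X := ∫⁻ t, d m t ∂tIoo T
      set Y := ∫⁻ t, d n t ∂tIoo T
      have hX : 16 * X < κ := hN m hm
      have hY : 16 * Y < κ := hN n hn
      rcases le_total X Y with hXY | hXY
      · calc 4 * (X + Y) ≤ 4 * (Y + Y) := by gcongr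
          _ = 8 * Y := by ring
          _ ≤ 16 * Y := by gcongr; norm_num
          _ < κ := hY
      · calc 4 * (X + Y) ≤ 4 * (X + X) := by gcongr
          _ = 8 * X := by ring
          _ ≤ 16 * X := by gcongr; norm_num
          _ < κ := hX
  have hex : ∀ (t : ℝ) (j : Fin 3) (k : Lat), ∃ z : ℂ, t ∈ Set.Ioo 0 T →
      Tendsto (fun n => fcV (u n t) j k) atTop (𝓝 z) := by
    intro t j k
    by_cases ht : t ∈ Set.Ioo 0 T
    · have hC : CauchySeq fun n => fcV (u n t) j k := by
        rw [Metric.cauchySeq_iff]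
        intro ε hε
        obtain ⟨N, hN⟩ := hU j k ε hε
        exact ⟨N, fun m hm n hn => by rw [dist_eq_norm]; exact hN m hm n hn t ht⟩
      obtain ⟨z, hz⟩ := cauchySeq_tendsto_of_complete hC
      exact ⟨z, fun _ => hz⟩
    · exact ⟨0, fun h => absurd h ht⟩
  choose c hc using hex
  refine ⟨c, h, hv, hp, ?_, ?_⟩
  · intro j k δ hδ
    obtain ⟨N, hN⟩ := hU j k δ hδ
    refine ⟨N, fun n hn t ht => ?_⟩
    refine le_of_tendsto ((tendsto_const_nhds (x := fcV (u n t) j k)).sub (hc t j k ht)).norm ?_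
    filter_upwards [eventually_ge_atTop N] with m hm
    exact (hN n hn m hm t ht).le
  · have h0 : ∫⁻ t, liminf (fun n => d n t) atTop ∂tIoo T = 0 := by
      refine le_antisymm ((lintegral_liminf_le' fun n => h.dm hv n).trans ?_) zero_le
      rw [hL'.liminf_eq]
    have hmm : AEMeasurable (fun t => liminf (fun n => d n t) atTop) (tIoo T) := by
      refine ⟨fun t => liminf (fun n => (h.dm hv n).mk _ t) atTop,
        Measurable.liminf fun n => (h.dm hv n).measurable_mk, ?_⟩
      have : ∀ᵐ t ∂tIoo T, ∀ n, d n t = (h.dm hv n).mk _ t := ae_all_iff.mpr fun n => (h.dm hv n).ae_eq_mk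
      filter_upwards [this] with t ht
      simp only [ht]
    rw [lintegral_eq_zero_iff' hmm] at h0
    filter_upwards [h0, wI_ae] with t h0 ht
    simp only [Pi.zero_apply] at h0
    have hfr : ∀ ε : ℝ≥0∞, 0 < ε → ∃ᶠ n in atTop, d n t < ε := fun ε hε =>
      frequently_lt_of_liminf_lt (by isBoundedDefault) (by rw [h0]; exact hε)
    have hML : MemLp (v t) 3 μT := by
      obtain ⟨n, hn⟩ := (hfr 1 (by norm_num)).exists
      have h1 : MemLp (fun x => u n t x - v t x) 3 μT := by
        refine ⟨((h.sm n t ht).smooth.continuous.measurable.sub (hvt t)).aestronglyMeasurable, ?_⟩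
        rw [eLpNorm_lt_top_iff_lintegral_rpow_enorm_lt_top (by norm_num) (by norm_num)]
        have e3 : (3:ℝ≥0∞).toReal = 3 := by norm_num
        rw [e3]
        exact hn.trans (by norm_num)
      have h2 : MemLp (u n t) 3 μT := by
        obtain ⟨C, hC⟩ := per_bounded (h.sm n t ht).smooth.continuous (h.sm n t ht).per
        exact MemLp.of_bound (h.sm n t ht).smooth.continuous.aestronglyMeasurable C
          (Eventually.of_forall hC.2)
      have := h2.sub h1
      refine (memLp_congr_ae (Eventually.of_forall fun x => ?_)).mp this
      simp
    refine ⟨hML, ?_⟩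
    funext j k
    have hbd : ∀ n, ‖fcV (u n t) j k - fcV (v t) j k‖ₑ ^ (3:ℝ) ≤ d n t := by
      intro n
      have hn := h.sm n t ht
      have e : fcV (u n t) j k - fcV (v t) j k = fc (fun x => uC (u n t) j x - uC (v t) j x) k :=
        (fc_sub (hn.comp j).integrable ((MemLp.coordC hML j).integrable (by norm_num)) k).symm
      rw [e]
      refine (fc_cube_le ((hn.comp j).continuous.measurable.sub (hvj t j)).aestronglyMeasurable k).trans ?_
      refine lintegral_mono fun x => ?_
      gcongr
      have := coord_enorm_le (u n t x - v t x) j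
      simpa [uC] using this
    have hsub : ∀ ε : ℝ, 0 < ε → ‖c t j k - fcV (v t) j k‖ ≤ 2 * ε := by
      intro ε hε
      have h1 : ∀ᶠ n in atTop, ‖fcV (u n t) j k - c t j k‖ < ε := by
        have := (tendsto_iff_norm_sub_tendsto_zero.mp (hc t j k ht))
        exact this.eventually (gt_mem_nhds hε)
      obtain ⟨n, hn1, hn2⟩ := ((hfr (ENNReal.ofReal (ε ^ 3)) (by positivity)).and_eventually h1).exists
      have h3 : ‖fcV (u n t) j k - fcV (v t) j k‖ ≤ ε := by
        have h4 := (hbd n).trans hn1.le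
        rw [ENNReal.ofReal_pow hε.le, ← ENNReal.rpow_ofNat,
          ENNReal.rpow_le_rpow_iff (by norm_num), ← ofReal_norm,
          ENNReal.ofReal_le_ofReal_iff hε.le] at h4
        exact h4
      calc _ = ‖(fcV (u n t) j k - fcV (v t) j k) - (fcV (u n t) j k - c t j k)‖ := by congr 1; ring
        _ ≤ _ := (norm_sub_le _ _).trans (by linarith)
    have : ‖c t j k - fcV (v t) j k‖ ≤ 0 := by
      refine le_of_forall_pos_le_add fun ε hε => ?_
      have := hsub (ε/2) (by positivity)
      linarith
    have := norm_le_zero_iff.mp this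
    exact (sub_eq_zero.mp this).symm

end

section

variable {T α β M B : ℝ} {ν : ℕ → ℝ} {u : ℕ → ℝ → Vec → Vec} {v : ℝ → Vec → Vec}
  {c : ℝ → Fin 3 → Lat → ℂ}

lemma Lim.tendsto (h : Lim T α β M B ν u v c) {t : ℝ} (ht : t ∈ Set.Ioo 0 T) (j : Fin 3) (k : Lat) :
    Tendsto (fun n => fcV (u n t) j k) atTop (𝓝 (c t j k)) := by
  rw [Metric.tendsto_atTop]
  intro ε hε
  obtain ⟨N, hN⟩ := h.unif j k (ε/2) (by positivity)
  refine ⟨N, fun n hn => ?_⟩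
  rw [dist_eq_norm]
  linarith [hN n hn t ht]

lemma Lim.hb (h : Lim T α β M B ν u v c) {t : ℝ} (ht : t ∈ Set.Ioo 0 T) (j : Fin 3) :
    HB β M (c t j) :=
  HB_closed (l := atTop) (F := fun n => fcV (u n t) j)
    (Eventually.of_forall fun n => h.dat.hb n t ht j) (fun k => h.tendsto ht j k)

lemma Lim.div (h : Lim T α β M B ν u v c) {t : ℝ} (ht : t ∈ Set.Ioo 0 T) (k : Lat) :
    ∑ j, (k j : ℂ) * c t j k = 0 := by
  have h1 : Tendsto (fun n => ∑ j, (k j : ℂ) * fcV (u n t) j k) atTop (𝓝 (∑ j, (k j : ℂ) * c t j k)) :=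
    tendsto_finsetSum _ fun j _ => (h.tendsto ht j k).const_mul _
  have h2 : ∀ n, ∑ j, (k j : ℂ) * fcV (u n t) j k = 0 := fun n => (h.dat.sm n t ht).div_fc k
  simp only [h2] at h1
  exact (tendsto_nhds_unique h1 tendsto_const_nhds)

lemma Lim.neg (h : Lim T α β M B ν u v c) {t : ℝ} (ht : t ∈ Set.Ioo 0 T) (j : Fin 3) (k : Lat) :
    c t j (-k) = (starRingEnd ℂ) (c t j k) := by
  have h1 := h.tendsto ht j (-k)
  simp only [fcV_neg] at h1
  exact tendsto_nhds_unique h1 ((Complex.continuous_conj.tendsto _).comp (h.tendsto ht j k))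

lemma Lim.lip (h : Lim T α β M B ν u v c) {s t : ℝ} (hs : s ∈ Set.Ioo 0 T) (ht : t ∈ Set.Ioo 0 T)
    (j : Fin 3) (k : Lat) : ‖c t j k - c s j k‖ ≤ lipK M B k * |t - s| :=
  le_of_tendsto ((h.tendsto ht j k).sub (h.tendsto hs j k)).norm
    (Eventually.of_forall fun n => h.dat.lip n j k hs ht)

lemma Lim.contOn (h : Lim T α β M B ν u v c) (j : Fin 3) (k : Lat) :
    ContinuousOn (fun t => c t j k) (Set.Ioo 0 T) := by
  have : LipschitzOnWith (Real.toNNReal (lipK M B k)) (fun t => c t j k) (Set.Ioo 0 T) := by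
    refine LipschitzOnWith.of_dist_le_mul fun s hs t ht => ?_
    rw [dist_eq_norm, Real.coe_toNNReal _ (h.dat.lipK_nonneg k)]
    exact h.lip ht hs j k
  exact this.continuousOn

lemma Lim.meas_c (h : Lim T α β M B ν u v c) (j : Fin 3) (k : Lat) :
    AEMeasurable (fun t => c t j k) (tIoo T) :=
  (h.contOn j k).aemeasurable measurableSet_Ioo

lemma Lim.AJ (h : Lim T α β M B ν u v c) (J : ℕ) {a : ℝ} (ha : 0 < a) :
    ∃ N, ∀ n ≥ N, ∀ t ∈ Set.Ioo 0 T, ∀ j, AJ J (fcV (u n t) j - c t j) ≤ a := by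
  set δ := a / ((FJ J).card + 1) with hδ
  have hδ0 : 0 < δ := by positivity
  choose N hN using fun (j : Fin 3) (k : Lat) => h.unif j k δ hδ0
  refine ⟨∑ j, ∑ k ∈ FJ J, N j k, fun n hn t ht j => ?_⟩
  have hle : ∀ k ∈ FJ J, N j k ≤ ∑ j, ∑ k ∈ FJ J, N j k := fun k hk =>
    (Finset.single_le_sum (f := fun k => N j k) (fun _ _ => Nat.zero_le _) hk).trans
    (Finset.single_le_sum (f := fun j => ∑ k ∈ FJ J, N j k) (fun _ _ => Nat.zero_le _) (Finset.mem_univ j))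
  calc PaperHelicity.AJ J (fcV (u n t) j - c t j) ≤ ∑ k ∈ FJ J, δ :=
        Finset.sum_le_sum fun k hk => hN j k n ((hle k hk).trans hn) t ht
    _ = (FJ J).card * δ := by simp
    _ ≤ ((FJ J).card + 1) * δ := by gcongr; linarith
    _ = a := by rw [hδ]; field_simp

lemma Lim.fc_sub (h : Lim T α β M B ν u v c) : ∀ᵐ t ∂tIoo T, t ∈ Set.Ioo 0 T ∧
    MemLp (v t) 3 μT ∧ fcV (v t) = c t ∧
    ∀ n j, fcV (fun x => u n t x - v t x) j = fcV (u n t) j - c t j := by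
  filter_upwards [h.ae, wI_ae] with t ht htI
  refine ⟨htI, ht.1, ht.2, fun n j => ?_⟩
  rw [← ht.2]
  funext k
  rw [Pi.sub_apply, fcV_eq, fcV_eq, fcV_eq,
    ← PaperHelicity.fc_sub ((h.dat.sm n t htI).comp j).integrable ((MemLp.coordC ht.1 j).integrable (by norm_num))]
  congr 1
  funext x
  simp [uC]

lemma HB.sub {β M : ℝ} {c d : Lat → ℂ} (hc : HB β M c) (hd : HB β M d) : HB β (2 * M) (c - d) := by
  intro s
  calc ∑ k ∈ s, wt k ^ β * ‖(c - d) k‖ ^ 2 ≤ ∑ k ∈ s, (2 * (wt k ^ β * ‖c k‖ ^ 2) + 2 * (wt k ^ β * ‖d k‖ ^ 2)) := by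
        refine Finset.sum_le_sum fun k _ => ?_
        have h1 : ‖(c - d) k‖ ≤ ‖c k‖ + ‖d k‖ := norm_sub_le _ _
        have h2 : ‖(c - d) k‖ ^ 2 ≤ 2 * ‖c k‖ ^ 2 + 2 * ‖d k‖ ^ 2 := by
          nlinarith [norm_nonneg ((c - d) k), norm_nonneg (c k), norm_nonneg (d k), sq_nonneg (‖c k‖ - ‖d k‖)]
        have h3 : 0 ≤ wt k ^ β := by have := wt_pos k; positivity
        nlinarith
    _ ≤ (2 * M) ^ 2 := by
        rw [Finset.sum_add_distrib, ← Finset.mul_sum, ← Finset.mul_sum]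
        nlinarith [hc s, hd s]

lemma high_wt {θ : ℝ} (hθ : 0 < θ) {J : ℕ} {k : Lat} (hk : k ∉ FJ J) :
    wt k ^ (-θ) ≤ (2:ℝ) ^ (-θ * J) := by
  rw [mem_FJ] at hk
  push Not at hk
  have h1 : (2:ℝ) ^ J ≤ wt k := by
    have : (1:ℝ) ≤ (2:ℝ) ^ J := one_le_pow₀ (by norm_num)
    unfold wt; nlinarith
  rw [mul_comm, Real.rpow_mul (by norm_num), Real.rpow_natCast]
  exact Real.rpow_le_rpow_of_nonpos (by positivity) h1 (by linarith)

lemma pow_small {θ : ℝ} (hθ : 0 < θ) (C : ℝ) {ε : ℝ} (hε : 0 < ε) :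
    ∃ J : ℕ, C * (2:ℝ) ^ (-θ * J) ≤ ε := by
  have h1 : Tendsto (fun J : ℕ => C * (2:ℝ) ^ (-θ * (J:ℝ))) atTop (𝓝 (C * 0)) := by
    refine Tendsto.const_mul _ ?_
    have e : ∀ j : ℕ, (2:ℝ) ^ (-θ * (j:ℝ)) = ((2:ℝ) ^ (-θ)) ^ j := fun j => by
      rw [Real.rpow_mul (by norm_num), Real.rpow_natCast]
    simp only [e]
    exact tendsto_pow_atTop_nhds_zero_of_lt_one (by positivity)
      (Real.rpow_lt_one_of_one_lt_of_neg (by norm_num) (by linarith))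
  rw [mul_zero] at h1
  obtain ⟨J, hJ⟩ := (h1.eventually (gt_mem_nhds hε)).exists
  exact ⟨J, hJ.le⟩

lemma Lim.hs_unif (h : Lim T α β M B ν u v c) {θ : ℝ} (hθ : 0 < θ) {ε : ℝ} (hε : 0 < ε) :
    ∃ N, ∀ n ≥ N, ∀ t ∈ Set.Ioo 0 T, ∀ j, HB (β - θ) ε (fcV (u n t) j - c t j) := by
  obtain ⟨J, hJ⟩ := pow_small hθ ((2 * M) ^ 2) (show 0 < ε ^ 2 / 2 by positivity)
  set W := ∑ k ∈ FJ J, wt k ^ (β - θ) with hW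
  have hW0 : 0 ≤ W := Finset.sum_nonneg fun k _ => by have := wt_pos k; positivity
  obtain ⟨N, hN⟩ := h.AJ J (show 0 < ε / (2 * (W + 1)) by positivity)
  refine ⟨N, fun n hn t ht j s => ?_⟩
  set d := fcV (u n t) j - c t j with hd
  have hd2 : HB β (2 * M) d := (h.dat.hb n t ht j).sub (h.hb ht j)
  set a := ε / (2 * (W + 1)) with ha
  have ha0 : 0 < a := by positivity
  have hsmall : ∀ k ∈ FJ J, ‖d k‖ ≤ a := fun k hk =>
    (Finset.single_le_sum (f := fun k => ‖d k‖) (fun _ _ => norm_nonneg _) hk).trans (hN n hn t ht j)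
  have hpt : ∀ k, wt k ^ (β - θ) * ‖d k‖ ^ 2 ≤
      (if k ∈ FJ J then wt k ^ (β - θ) * a ^ 2 else 0) + (2:ℝ) ^ (-θ * J) * (wt k ^ β * ‖d k‖ ^ 2) := by
    intro k
    have hw := wt_pos k
    by_cases hk : k ∈ FJ J
    · rw [if_pos hk]
      have := hsmall k hk
      have h1 : wt k ^ (β - θ) * ‖d k‖ ^ 2 ≤ wt k ^ (β - θ) * a ^ 2 := by gcongr
      have h2 : 0 ≤ (2:ℝ) ^ (-θ * J) * (wt k ^ β * ‖d k‖ ^ 2) := by positivity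
      linarith
    · rw [if_neg hk, zero_add, sub_eq_add_neg, add_comm, Real.rpow_add hw, mul_assoc]
      gcongr
      exact high_wt hθ hk
  calc ∑ k ∈ s, wt k ^ (β - θ) * ‖d k‖ ^ 2
      ≤ ∑ k ∈ s, ((if k ∈ FJ J then wt k ^ (β - θ) * a ^ 2 else 0) +
          (2:ℝ) ^ (-θ * J) * (wt k ^ β * ‖d k‖ ^ 2)) := Finset.sum_le_sum fun k _ => hpt k
    _ ≤ W * a ^ 2 + (2:ℝ) ^ (-θ * J) * (2 * M) ^ 2 := by
        rw [Finset.sum_add_distrib, ← Finset.mul_sum]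
        refine add_le_add ?_ (mul_le_mul_of_nonneg_left (hd2 s) (by positivity))
        rw [← Finset.sum_filter, hW, Finset.sum_mul]
        refine Finset.sum_le_sum_of_subset_of_nonneg (fun k hk => (Finset.mem_filter.mp hk).2) ?_
        intro k _ _
        exact mul_nonneg (Real.rpow_nonneg (wt_pos k).le _) (sq_nonneg _)
    _ ≤ ε ^ 2 / 2 + ε ^ 2 / 2 := by
        refine add_le_add ?_ (by linarith)
        clear_value W
        rw [ha, div_pow]
        rw [mul_div_assoc', div_le_div_iff₀ (by positivity) (by positivity)]
        have : 0 ≤ ε ^ 2 := by positivity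
        nlinarith [mul_nonneg this hW0, mul_nonneg this (mul_nonneg hW0 hW0)]
    _ = ε ^ 2 := by ring

lemma Lim.conv_hs (h : Lim T α β M B ν u v c) {θ : ℝ} (hθ : 0 < θ) :
    Tendsto (fun n => timeNorm ∞ T fun t => HsNormV (β - θ) fun x => u n t x - v t x) atTop (𝓝 0) := by
  rw [ENNReal.tendsto_atTop_zero]
  intro ε hε
  obtain ⟨δ, hδ0, hδ⟩ : ∃ δ : ℝ, 0 < δ ∧ 3 * ENNReal.ofReal δ ≤ ε := by
    by_cases hε' : ε = ∞
    · exact ⟨1, one_pos, by rw [hε']; exact le_top⟩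
    · refine ⟨ε.toReal / 3, by have := ENNReal.toReal_pos hε.ne' hε'; positivity, ?_⟩
      rw [show (3:ℝ≥0∞) = ENNReal.ofReal 3 by norm_num, ← ENNReal.ofReal_mul (by norm_num),
        mul_div_cancel₀ _ (by norm_num), ENNReal.ofReal_toReal hε']
  obtain ⟨N, hN⟩ := h.hs_unif hθ hδ0
  refine ⟨N, fun n hn => ?_⟩
  simp only [timeNorm, if_true]
  refine essSup_le_of_ae_le _ ?_
  filter_upwards [h.fc_sub] with t ht
  refine le_trans (Hs_of_HBV hδ0.le fun j => ?_) hδ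
  rw [ht.2.2.2 n j]
  exact hN n hn t ht.1 j

lemma Lim.bes_c (h : Lim T α β M B ν u v c) (j : Fin 3) :
    ∫⁻ t, bes α (c t j) ^ (3:ℝ) ∂tIoo T ≤ ENNReal.ofReal B := by
  have hm : ∀ n, AEMeasurable (fun t => bes α (fcV (u n t) j) ^ (3:ℝ)) (tIoo T) := fun n =>
    (bes_aemeas _ fun k => h.dat.meas_c n j k).pow_const _
  calc ∫⁻ t, bes α (c t j) ^ (3:ℝ) ∂tIoo T
      ≤ ∫⁻ t, liminf (fun n => bes α (fcV (u n t) j) ^ (3:ℝ)) atTop ∂tIoo T := by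
        refine lintegral_mono_ae ?_
        filter_upwards [wI_ae] with t ht
        have h1 := bes_fatou α (c := fun n => fcV (u n t) j) (fun k => h.tendsto ht j k)
        have h2 := (ENNReal.monotone_rpow_of_nonneg (show (0:ℝ) ≤ 3 by norm_num)).map_liminf_of_continuousAt
          (F := atTop) (fun n => bes α (fcV (u n t) j)) ENNReal.continuous_rpow_const.continuousAt
        have h3 := ENNReal.rpow_le_rpow h1 (show (0:ℝ) ≤ 3 by norm_num)
        exact h3.trans h2.le
    _ ≤ liminf (fun n => ∫⁻ t, bes α (fcV (u n t) j) ^ (3:ℝ) ∂tIoo T) atTop := lintegral_liminf_le' hm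
    _ ≤ liminf (fun _ : ℕ => ENNReal.ofReal B) atTop := by
        refine liminf_le_liminf (Eventually.of_forall fun n => ?_)
        refine le_trans (lintegral_mono fun t => ?_) (h.dat.bes n)
        gcongr
        rw [besovV_eq]
        exact Finset.single_le_sum (f := fun j => bes α (fcV (u n t) j)) (fun _ _ => zero_le) (Finset.mem_univ j)
    _ = _ := by simp

lemma Lim.conv_bes (h : Lim T α β M B ν u v c) {θ : ℝ} (hθ : 0 < θ) :
    Tendsto (fun n => timeNorm 3 T fun t => besovV (α - θ) 3 ∞ fun x => u n t x - v t x) atTop (𝓝 0) := by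
  have hα : 0 < α := by linarith [h.dat.hα]
  have hB := h.dat.hB
  have hT := h.dat.hT
  have key : ∀ ε : ℝ, 0 < ε → ∃ N, ∀ n ≥ N, ∫⁻ t, (besovV (α - θ) 3 ∞ fun x => u n t x - v t x) ^ (3:ℝ) ∂tIoo T
      ≤ ENNReal.ofReal ε := by
    intro ε hε
    obtain ⟨J, hJ⟩ := pow_small (show 0 < 3 * θ by positivity) (448 * B) (show 0 < ε / 2 by positivity)
    set P := (2:ℝ) ^ (-θ * J) with hP
    have hP0 : 0 < P := by positivity
    have hP3 : (2:ℝ) ^ (-(3 * θ) * J) = P ^ 3 := by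
      rw [hP, ← Real.rpow_natCast, ← Real.rpow_mul (by norm_num)]; congr 1; push_cast; ring
    rw [hP3] at hJ
    set Q := 2 * (2:ℝ) ^ (α * J) with hQ
    have hQ0 : 0 < Q := by positivity
    clear_value P Q
    obtain ⟨a, ha, ha2⟩ : ∃ a : ℝ, 0 < a ∧ 108 * (Q * a) ^ 3 * T ≤ ε / 2 := by
      set b := min 1 (ε / (216 * T)) with hb
      have hb0 : 0 < b := by positivity
      have hb1 : b ≤ 1 := min_le_left _ _
      refine ⟨b / Q, by positivity, ?_⟩
      rw [mul_div_cancel₀ _ hQ0.ne']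
      have : b ^ 3 ≤ ε / (216 * T) := (pow_le_of_le_one hb0.le hb1 (by norm_num)).trans (min_le_right _ _)
      calc 108 * b ^ 3 * T ≤ 108 * (ε / (216 * T)) * T := by gcongr
        _ = ε / 2 := by field_simp; ring
    obtain ⟨N, hN⟩ := h.AJ J ha
    refine ⟨N, fun n hn => ?_⟩
    have hm1 := (h.dat.besm α n).pow_const (3:ℝ)
    have hm2 : ∀ j, AEMeasurable (fun t => bes α (c t j) ^ (3:ℝ)) (tIoo T) := fun j =>
      (bes_aemeas _ fun k => h.meas_c j k).pow_const _
    calc _ ≤ ∫⁻ t, (108 * ENNReal.ofReal (Q * a) ^ (3:ℝ) + 16 * ENNReal.ofReal P ^ (3:ℝ) *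
          (besovV α 3 ∞ (u n t) ^ (3:ℝ) + 9 * ∑ j, bes α (c t j) ^ (3:ℝ))) ∂tIoo T := by
          refine lintegral_mono_ae ?_
          filter_upwards [h.fc_sub] with t ht
          have h1 : (besovV (α - θ) 3 ∞ fun x => u n t x - v t x) ≤ 3 * ENNReal.ofReal (Q * a) +
              ENNReal.ofReal P * (besovV α 3 ∞ (u n t) + ∑ j, bes α (c t j)) := by
            rw [besovV_eq, besovV_eq]
            calc ∑ j, bes (α - θ) (fcV (fun x => u n t x - v t x) j) ≤ ∑ j : Fin 3, (ENNReal.ofReal (Q * a) +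
                  ENNReal.ofReal P * (bes α (fcV (u n t) j) + bes α (c t j))) := by
                  refine Finset.sum_le_sum fun j _ => ?_
                  rw [ht.2.2.2 n j]
                  refine (bes_split hα.le hθ.le J _).trans ?_
                  rw [← hQ, ← hP, ENNReal.ofReal_mul hQ0.le]
                  gcongr
                  · exact hN n hn t ht.1 j
                  · exact bes_sub_le _ _ _
              _ = _ := by
                  rw [Finset.sum_add_distrib, ← Finset.mul_sum, Finset.sum_add_distrib]
                  simp
          calc _ ≤ (3 * ENNReal.ofReal (Q * a) +
              ENNReal.ofReal P * (besovV α 3 ∞ (u n t) + ∑ j, bes α (c t j))) ^ (3:ℝ) := by gcongr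
            _ ≤ 4 * ((3 * ENNReal.ofReal (Q * a)) ^ (3:ℝ) +
              (ENNReal.ofReal P * (besovV α 3 ∞ (u n t) + ∑ j, bes α (c t j))) ^ (3:ℝ)) := cube_add _ _
            _ ≤ 4 * (27 * ENNReal.ofReal (Q * a) ^ (3:ℝ) + ENNReal.ofReal P ^ (3:ℝ) *
                (4 * (besovV α 3 ∞ (u n t) ^ (3:ℝ) + 9 * ∑ j, bes α (c t j) ^ (3:ℝ)))) := by
                rw [ENNReal.mul_rpow_of_nonneg _ _ (by norm_num), ENNReal.mul_rpow_of_nonneg _ _ (by norm_num)]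
                gcongr
                · norm_num
                · refine (cube_add _ _).trans ?_
                  gcongr
                  exact cube_sum3 _
            _ = _ := by ring
      _ = 108 * ENNReal.ofReal (Q * a) ^ (3:ℝ) * ENNReal.ofReal T + 16 * ENNReal.ofReal P ^ (3:ℝ) *
          (∫⁻ t, besovV α 3 ∞ (u n t) ^ (3:ℝ) ∂tIoo T + 9 * ∑ j, ∫⁻ t, bes α (c t j) ^ (3:ℝ) ∂tIoo T) := by
          have hm3 : AEMeasurable (fun t => 9 * ∑ j, bes α (c t j) ^ (3:ℝ)) (tIoo T) :=
            (Finset.aemeasurable_fun_sum _ fun j _ => hm2 j).const_mul _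
          rw [lintegral_add_left measurable_const, lintegral_const, lintegral_const_mul'',
            lintegral_add_left' hm1, lintegral_const_mul'' _ (Finset.aemeasurable_fun_sum _ fun j _ => hm2 j),
            lintegral_finsetSum' _ fun j _ => hm2 j]
          · simp [tIoo]
          · exact hm1.add hm3
      _ ≤ 108 * ENNReal.ofReal (Q * a) ^ (3:ℝ) * ENNReal.ofReal T + 16 * ENNReal.ofReal P ^ (3:ℝ) *
          (ENNReal.ofReal B + 9 * ∑ j : Fin 3, ENNReal.ofReal B) := by
          gcongr
          · exact h.dat.bes n
          · exact h.bes_c _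
      _ = ENNReal.ofReal (108 * (Q * a) ^ 3 * T + 16 * P ^ 3 * (B + 27 * B)) := by
          have hA0 : 0 ≤ Q * a := by positivity
          generalize Q * a = A at hA0 ⊢
          rw [ENNReal.ofReal_add (by positivity) (by positivity), ENNReal.ofReal_mul (by positivity),
            ENNReal.ofReal_mul (by positivity), ENNReal.ofReal_mul (q := B + 27 * B) (by positivity),
            ENNReal.ofReal_mul (p := 16) (by positivity), ENNReal.ofReal_pow (by positivity), ENNReal.ofReal_pow hP0.le,
            ENNReal.ofReal_add hB (by positivity), ENNReal.ofReal_mul (p := 27) (by positivity)]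
          norm_num
          ring
      _ ≤ ENNReal.ofReal ε := ENNReal.ofReal_le_ofReal (by nlinarith)
  have h3 : Tendsto (fun n => ∫⁻ t, (besovV (α - θ) 3 ∞ fun x => u n t x - v t x) ^ (3:ℝ) ∂tIoo T) atTop (𝓝 0) := by
    rw [ENNReal.tendsto_atTop_zero]
    intro ε hε
    by_cases hε' : ε = ∞
    · exact ⟨0, fun n _ => by rw [hε']; exact le_top⟩
    · obtain ⟨N, hN⟩ := key ε.toReal (ENNReal.toReal_pos hε.ne' hε')
      rw [ENNReal.ofReal_toReal hε'] at hN
      exact ⟨N, hN⟩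
  have h4 := h3.ennrpow_const (1/3)
  rw [ENNReal.zero_rpow_of_pos (by norm_num)] at h4
  refine h4.congr fun n => ?_
  have e3 : (3:ℝ≥0∞).toReal = 3 := by norm_num
  have h33 : (3:ℝ≥0∞) ≠ ∞ := by norm_num
  simp only [timeNorm, if_neg h33, e3]

end

section

/-- Complex test functions on the torus times an interval. -/
structure TS (T : ℝ) (F : ℝ → Vec → ℂ) : Prop where
  smooth : ContDiff ℝ (⊤ : ℕ∞) (Function.uncurry F)
  per : ∀ t, Per (F t)
  supp : ∃ a b : ℝ, 0 < a ∧ b < T ∧ ∀ t, t ∉ Set.Icc a b → F t = 0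

lemma TS.sm {T : ℝ} {F : ℝ → Vec → ℂ} (h : TS T F) (t : ℝ) : Sm (F t) :=
  ⟨h.smooth.comp (contDiff_const.prodMk contDiff_id), h.per t⟩

lemma TS.pd {T : ℝ} {F : ℝ → Vec → ℂ} (h : TS T F) (i : Fin 3) : TS T (fun t => pd i (F t)) where
  smooth := by
    have h1 : ContDiff ℝ (⊤ : ℕ∞) (Function.uncurry fun (p : ℝ × Vec) (y : Vec) => F p.1 y) :=
      h.smooth.comp ((contDiff_fst.comp contDiff_fst).prodMk contDiff_snd)
    exact ContDiff.fderiv_apply (m := (⊤ : ℕ∞)) (n := (⊤ : ℕ∞)) h1 contDiff_snd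
      (contDiff_const (c := EuclideanSpace.single i (1:ℝ))) (by simp)
  per t := (h.per t).pd i
  supp := by
    obtain ⟨a, b, ha, hb, hab⟩ := h.supp
    refine ⟨a, b, ha, hb, fun t ht => ?_⟩
    rw [hab t ht]; funext x
    simp [PaperHelicity.pd]

lemma TS.td {T : ℝ} {F : ℝ → Vec → ℂ} (h : TS T F) : TS T (tderiv F) where
  smooth := by
    have h1 : ContDiff ℝ (⊤ : ℕ∞) (Function.uncurry fun (p : ℝ × Vec) (s : ℝ) => F s p.2) :=
      h.smooth.comp (contDiff_snd.prodMk (contDiff_snd.comp contDiff_fst))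
    have h2 := ContDiff.fderiv_apply (m := (⊤ : ℕ∞)) (n := (⊤ : ℕ∞)) h1 contDiff_fst
      (contDiff_const (c := (1:ℝ))) (by simp)
    exact h2
  per t := by
    intro x n
    have : (fun s => F s (x + latv n)) = fun s => F s x := by funext s; exact h.per s x n
    simp only [tderiv, this]
  supp := by
    obtain ⟨a, b, ha, hb, hab⟩ := h.supp
    refine ⟨a, b, ha, hb, fun t ht => ?_⟩
    funext x
    have : (fun s => F s x) =ᶠ[𝓝 t] fun _ => 0 := by
      filter_upwards [isClosed_Icc.isOpen_compl.mem_nhds ht] with s hs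
      rw [hab s hs]; rfl
    simp only [tderiv, this.deriv_eq]; simp

lemma TS.bdd {T : ℝ} {F : ℝ → Vec → ℂ} (h : TS T F) : ∃ C : ℝ, 0 ≤ C ∧ ∀ t x, ‖F t x‖ ≤ C := by
  obtain ⟨a, b, ha, hb, hab⟩ := h.supp
  obtain ⟨K, hK, hcK⟩ := cube_sub_compact
  obtain ⟨C, hC⟩ := (isCompact_Icc (a := a) (b := b) |>.prod hK).exists_bound_of_continuousOn
    h.smooth.continuous.continuousOn
  refine ⟨max C 0, le_max_right _ _, fun t x => ?_⟩
  by_cases ht : t ∈ Set.Icc a b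
  · obtain ⟨n, hn⟩ := exists_rep x
    rw [← h.per t x n]
    exact (hC (t, x + latv n) ⟨ht, hcK hn⟩).trans (le_max_left _ _)
  · rw [hab t ht]; simp

lemma TS.Lop {T : ℝ} {F : ℝ → Vec → ℂ} (h : TS T F) : TS T (fun t => Lop (F t)) where
  smooth := by
    have h1 : ∀ i, ContDiff ℝ (⊤ : ℕ∞)
      (Function.uncurry fun t => PaperHelicity.pd i (PaperHelicity.pd i (F t))) :=
      fun i => ((h.pd i).pd i).smooth
    exact h.smooth.sub (contDiff_const.mul (ContDiff.sum fun i _ => h1 i))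
  per t := (h.sm t).Lop.per
  supp := by
    obtain ⟨a, b, ha, hb, hab⟩ := h.supp
    refine ⟨a, b, ha, hb, fun t ht => ?_⟩
    rw [hab t ht]; funext x
    have h0 : ∀ i : Fin 3, PaperHelicity.pd i (0 : Vec → ℂ) = 0 := fun i => by
      funext y; simp [PaperHelicity.pd]
    simp [h0, PaperHelicity.Lop]

lemma TS.decay {T : ℝ} {F : ℝ → Vec → ℂ} (h : TS T F) (K : ℕ) :
    ∃ C : ℝ, 0 ≤ C ∧ ∀ t n, ‖fc (F t) n‖ ≤ C * (wt n ^ K)⁻¹ := by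
  induction K generalizing F with
  | zero =>
    obtain ⟨C, hC, hb⟩ := h.bdd
    exact ⟨C, hC, fun t n => by simpa using fc_norm_le (hb t) n⟩
  | succ K ih =>
    obtain ⟨C, hC, hb⟩ := ih h.Lop
    refine ⟨C, hC, fun t n => ?_⟩
    have := hb t n
    rw [fc_Lop (h.sm t), norm_mul, Complex.norm_real, Real.norm_of_nonneg (wt_pos n).le] at this
    have hw := wt_pos n
    rw [pow_succ, mul_inv, ← mul_assoc, ← div_eq_mul_inv, le_div_iff₀ hw]
    linarith

lemma TS.hasDeriv {T : ℝ} {F : ℝ → Vec → ℂ} (h : TS T F) (n : Lat) (t : ℝ) :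
    HasDerivAt (fun s => fc (F s) n) (fc (tderiv F t) n) t := by
  obtain ⟨C, hC, hb⟩ := h.td.bdd
  simp only [fc_def]
  have hd : ∀ s x, HasDerivAt (fun s => F s x) (tderiv F s x) s := by
    intro s x
    have : Differentiable ℝ (fun s => F s x) :=
      (h.smooth.comp (contDiff_id.prodMk contDiff_const)).differentiable (by simp)
    exact (this s).hasDerivAt
  refine (hasDerivAt_integral_of_dominated_loc_of_deriv_le (bound := fun _ => C)
    (F' := fun s x => tderiv F s x * chr (-n) x) (Filter.univ_mem) ?_ ?_ ?_ ?_ ?_ ?_).2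
  · exact Eventually.of_forall fun s => (mulchr_integrable (h.sm s).integrable _).1
  · exact mulchr_integrable (h.sm t).integrable _
  · exact (mulchr_integrable (h.td.sm t).integrable _).1
  · exact Eventually.of_forall fun x s _ => by rw [norm_mul, chr_norm, mul_one]; exact hb s x
  · exact integrable_const _
  · exact Eventually.of_forall fun x s _ => (hd s x).mul_const _

lemma TestFun.ts {T : ℝ} (ψ : TestFun T Vec) (j : Fin 3) : TS T (fun t x => (ψ.f t x j : ℂ)) where
  smooth := Complex.ofRealCLM.contDiff.comp
    ((EuclideanSpace.proj (𝕜 := ℝ) j).contDiff.comp ψ.smooth)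
  per t := fun x n => by beta_reduce; rw [ψ.periodic t x n]
  supp := by
    obtain ⟨a, b, ha, hb, hab⟩ := ψ.compactIn
    refine ⟨a, b, ha, hb, fun t ht => ?_⟩
    rw [hab t ht]; funext x; simp

lemma TestFun.td {T : ℝ} (ψ : TestFun T Vec) (j : Fin 3) (t : ℝ) :
    (fun x => ((tderiv ψ.f t x j : ℝ) : ℂ)) = tderiv (fun t x => (ψ.f t x j : ℂ)) t := by
  funext x
  have hd : HasDerivAt (fun s => ψ.f s x) (tderiv ψ.f t x) t := by
    have : Differentiable ℝ (fun s => ψ.f s x) :=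
      (ψ.smooth.comp (contDiff_id.prodMk contDiff_const)).differentiable (by simp)
    exact (this t).hasDerivAt
  have h2 := (EuclideanSpace.proj (𝕜 := ℝ) j).hasFDerivAt.comp_hasDerivAt t hd
  exact (HasDerivAt.ofReal_comp h2).deriv.symm

lemma TestFun.tsR {T : ℝ} (ψ : TestFun T ℝ) : TS T (fun t x => (ψ.f t x : ℂ)) where
  smooth := Complex.ofRealCLM.contDiff.comp ψ.smooth
  per t := fun x n => by beta_reduce; rw [ψ.periodic t x n]
  supp := by
    obtain ⟨a, b, ha, hb, hab⟩ := ψ.compactIn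
    refine ⟨a, b, ha, hb, fun t ht => ?_⟩
    rw [hab t ht]; funext x; simp

end

section

lemma wt_peetre (k n : Lat) : wt n ≤ 2 * wt (k - n) * wt k := by
  have h := latNorm_add_le k (-(k - n))
  rw [latNorm_neg, show k + -(k - n) = n by abel] at h
  unfold wt
  have := latNorm_nonneg n; have := latNorm_nonneg k; have := latNorm_nonneg (k - n)
  nlinarith [sq_nonneg (latNorm k - latNorm (k - n)), mul_nonneg (sq_nonneg (latNorm k)) (sq_nonneg (latNorm (k-n)))]

lemma wt_half_le (k n : Lat) : wt n ^ (1/2:ℝ) ≤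
    2 * wt k * (wt n ^ (1/4:ℝ) * wt (k - n) ^ (1/4:ℝ)) := by
  have h1 := wt_peetre k n
  have hn := wt_pos n; have hk := wt_pos k; have hm := wt_pos (k - n)
  have e : wt n ^ (1/2:ℝ) = wt n ^ (1/4:ℝ) * wt n ^ (1/4:ℝ) := by
    rw [← Real.rpow_add hn]; norm_num
  have h2 : wt n ^ (1/4:ℝ) ≤ 2 * wt k * wt (k - n) ^ (1/4:ℝ) := by
    calc wt n ^ (1/4:ℝ) ≤ (2 * wt (k - n) * wt k) ^ (1/4:ℝ) := by gcongr
      _ = 2 ^ (1/4:ℝ) * wt (k - n) ^ (1/4:ℝ) * wt k ^ (1/4:ℝ) := by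
        rw [Real.mul_rpow (by positivity) (by positivity), Real.mul_rpow (by positivity) (by positivity)]
      _ ≤ 2 * wt (k - n) ^ (1/4:ℝ) * wt k := by
        gcongr
        · exact Real.rpow_le_self_of_one_le (by norm_num) (by norm_num)
        · exact Real.rpow_le_self_of_one_le (one_le_wt k) (by norm_num)
      _ = _ := by ring
  rw [e]
  have : 0 ≤ wt n ^ (1/4:ℝ) := by positivity
  nlinarith

lemma HB.quart {M : ℝ} {c : Lat → ℂ} (h : HB (1/2) M c) :
    HB 0 M (fun n => ((wt n ^ (1/4:ℝ) : ℝ) : ℂ) * c n) := by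
  intro s
  refine le_trans (le_of_eq (Finset.sum_congr rfl fun n _ => ?_)) (h s)
  have hn := wt_pos n
  rw [norm_mul, Complex.norm_real, Real.norm_of_nonneg (by positivity), mul_pow, Real.rpow_zero,
    one_mul, ← Real.rpow_natCast, ← Real.rpow_mul hn.le]
  norm_num

/-- The absolutely convergent trilinear sum. -/
lemma tri_summable {M : ℝ} (hM : 0 ≤ M) {c d P : Lat → ℂ} (hc : HB (1/2) M c) (hd : HB (1/2) M d)
    (hP : Summable fun l => wt l * ‖P l‖) :
    Summable fun p : Lat × Lat => wt p.2 ^ (1/2:ℝ) * ‖c p.2‖ * ‖P p.1‖ * ‖d (-p.1 - p.2)‖ := by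
  have key : Summable fun p : Lat × Lat => 2 * (wt p.1 * ‖P p.1‖) *
      (‖((wt p.2 ^ (1/4:ℝ) : ℝ) : ℂ) * c p.2‖ *
        ‖((wt (-p.1 - p.2) ^ (1/4:ℝ) : ℝ) : ℂ) * d (-p.1 - p.2)‖) := by
    have q := fun l => q_basic hc.quart hd.quart le_rfl hM hM (-l)
    refine (summable_prod_of_nonneg ?_).2 ⟨fun l => ?_, ?_⟩
    · intro p; have := wt_pos p.1; positivity
    · exact (q l).1.mul_left (2 * (wt l * ‖P l‖))
    · refine Summable.of_nonneg_of_le (fun l => tsum_nonneg fun n => ?_) (fun l => ?_)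
        ((hP.mul_left 2).mul_right (M * M))
      · have := wt_pos l; positivity
      · dsimp only
        rw [tsum_mul_left]
        have := wt_pos l
        have := (q l).2
        gcongr
  refine Summable.of_nonneg_of_le (fun p => ?_) (fun p => ?_) key
  · have := wt_pos p.2; positivity
  · have h1 := wt_half_le (-p.1) p.2
    rw [wt_neg] at h1
    have hn := wt_pos p.2; have hm := wt_pos (-p.1 - p.2)
    rw [norm_mul, norm_mul, Complex.norm_real, Complex.norm_real,
      Real.norm_of_nonneg (by positivity), Real.norm_of_nonneg (by positivity)]
    calc _ ≤ 2 * wt p.1 * (wt p.2 ^ (1/4:ℝ) * wt (-p.1 - p.2) ^ (1/4:ℝ)) * ‖c p.2‖ * ‖P p.1‖ *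
        ‖d (-p.1 - p.2)‖ := by gcongr
      _ = _ := by ring

/-- curl of a coefficient sequence (without the factor `2πi`). -/
def crs (n : Lat) (a : Fin 3 → ℂ) (j : Fin 3) : ℂ :=
  (n (j+1) : ℂ) * a (j+2) - (n (j+2) : ℂ) * a (j+1)

lemma ωC_eq (v : Vec → Vec) (j : Fin 3) (n : Lat) :
    ωC v j n = tpi * crs n (fun i => fcV v i n) j := rfl

lemma crs_norm (n : Lat) (a : Fin 3 → ℂ) (j : Fin 3) :
    ‖crs n a j‖ ≤ wt n ^ (1/2:ℝ) * (‖a (j+2)‖ + ‖a (j+1)‖) := by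
  have h1 := (norm_k_le n (j+1)).trans (latNorm_le_wt_half n)
  have h2 := (norm_k_le n (j+2)).trans (latNorm_le_wt_half n)
  unfold crs
  calc _ ≤ ‖(n (j+1) : ℂ)‖ * ‖a (j+2)‖ + ‖(n (j+2) : ℂ)‖ * ‖a (j+1)‖ := by
        refine (norm_sub_le _ _).trans ?_; rw [norm_mul, norm_mul]
    _ ≤ wt n ^ (1/2:ℝ) * ‖a (j+2)‖ + wt n ^ (1/2:ℝ) * ‖a (j+1)‖ := by gcongr
    _ = _ := by ring

lemma dpair_hasSum {M : ℝ} (hM : 0 ≤ M) {v : Vec → Vec} (hv : MemLp v 3 μT)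
    (hb : ∀ j, HB (1/2) M (fcV v j)) {g : Vec → ℝ} (hg : Sm (fun x => (g x : ℂ))) (i j : Fin 3) :
    HasSum (fun p : Lat × Lat => tpi * crs p.2 (fun i => fcV v i p.2) j *
      (fc (fun x => (g x : ℂ)) p.1 * fcV v i (-p.1 - p.2)))
      (dpair (ωC v j) (fun x => ((v x i * g x : ℝ) : ℂ))) := by
  set P := fc (fun x => (g x : ℂ)) with hPdef
  have hP : Summable fun l => wt l * ‖P l‖ := by simpa using fc_summable_wt hg 1
  have hvi : Integrable (uC v i) μT := (PaperHelicity.MemLp.coordC hv i).integrable (by norm_num)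
  have hs : Summable (fun p : Lat × Lat => tpi * crs p.2 (fun i => fcV v i p.2) j *
      (P p.1 * fcV v i (-p.1 - p.2))) := by
    refine Summable.of_norm_bounded (((tri_summable hM (hb (j+2)) (hb i) hP).add
      (tri_summable hM (hb (j+1)) (hb i) hP)).mul_left (2 * Real.pi)) fun p => ?_
    rw [norm_mul, norm_mul, norm_mul, norm_tpi]
    have := crs_norm p.2 (fun i => fcV v i p.2) j
    calc _ ≤ 2 * Real.pi * (wt p.2 ^ (1/2:ℝ) * (‖fcV v (j+2) p.2‖ + ‖fcV v (j+1) p.2‖)) *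
        (‖P p.1‖ * ‖fcV v i (-p.1 - p.2)‖) := by gcongr
      _ = _ := by ring
  have h1 : ∀ n, HasSum (fun l => tpi * crs n (fun i => fcV v i n) j *
      (P l * fcV v i (-l - n))) (ωC v j n * fc (fun x => ((v x i * g x : ℝ) : ℂ)) (-n)) := by
    intro n
    have := (hasSum_fc_mul hg hvi (-n)).mul_left (ωC v j n)
    have e1 : (fun x => ((g x : ℂ)) * uC v i x) = (fun x => ((v x i * g x : ℝ) : ℂ)) := by
      funext x; simp only [uC]; push_cast; ring
    rw [e1] at this
    have e2 : (fun l => tpi * crs n (fun i => fcV v i n) j * (P l * fcV v i (-l - n))) =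
        fun l => ωC v j n * (fc (fun x => (g x : ℂ)) l * fc (uC v i) (-n - l)) := by
      funext l
      rw [ωC_eq, fcV_eq, show -n - l = -l - n by abel]
    rw [e2]; exact this
  have h2 := hs.prod_symm.hasSum
  have h3 := h2.prod_fiberwise h1
  have h4 : dpair (ωC v j) (fun x => ((v x i * g x : ℝ) : ℂ)) = _ := h3.tsum_eq
  rw [h4]
  exact (Equiv.prodComm Lat Lat).hasSum_iff.1 h2

end

section

/-- The Fourier side of the weak vorticity formulation. -/
def Zf (c p pt : Fin 3 → Lat → ℂ) (l : Lat) : ℂ :=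
  ∑ j, (c j (-l) * (tpi * crs l (fun i => pt i l) j) + PC c j (-l) * (tpi * crs l (fun i => p i l) j))

lemma crs_orth (l : Lat) (a : Fin 3 → ℂ) : ∑ j, (l j : ℂ) * crs l a j = 0 := by
  simp only [crs, Fin.sum_univ_three, show (0:Fin 3)+1=1 from rfl, show (0:Fin 3)+2=2 from rfl,
    show (1:Fin 3)+1=2 from rfl, show (1:Fin 3)+2=0 from rfl, show (2:Fin 3)+1=0 from rfl,
    show (2:Fin 3)+2=1 from rfl]
  ring

lemma PC_crs (c : Fin 3 → Lat → ℂ) (l : Lat) (a : Fin 3 → ℂ) :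
    ∑ j, PC c j (-l) * (tpi * crs l a j) = ∑ j, NC c j (-l) * (tpi * crs l a j) := by
  have h := crs_orth l a
  have : ∀ j, PC c j (-l) * (tpi * crs l a j) = NC c j (-l) * (tpi * crs l a j) +
      (tpi * (∑ m, ((-l) m : ℂ) * NC c m (-l)) / (latSq (-l) : ℂ)) * ((l j : ℂ) * crs l a j) := by
    intro j
    unfold PC
    simp only [Pi.neg_apply]
    push_cast
    ring
  rw [Finset.sum_congr rfl fun j _ => this j, Finset.sum_add_distrib, ← Finset.mul_sum, h, mul_zero,
    add_zero]

lemma sym_alg (l n m : Lat) (hm : m = -l - n) (a b p : Fin 3 → ℂ)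
    (h1 : ∑ j, (n j : ℂ) * a j = 0) (h2 : ∑ j, (m j : ℂ) * b j = 0) :
    (∑ i, ∑ j, (tpi * crs n a j * (tpi * (l i : ℂ) * p j * b i) -
        tpi * crs n a i * (tpi * (l i : ℂ) * p j * b j))) +
      (∑ i, ∑ j, (tpi * crs m b j * (tpi * (l i : ℂ) * p j * a i) -
        tpi * crs m b i * (tpi * (l i : ℂ) * p j * a j))) =
    (∑ i, ∑ j, a i * (tpi * (l i : ℂ) * (tpi * crs l p j)) * b j) +
      (∑ i, ∑ j, b i * (tpi * (l i : ℂ) * (tpi * crs l p j)) * a j) := by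
  subst hm
  simp only [crs, Fin.sum_univ_three, show (0:Fin 3)+1=1 from rfl, show (0:Fin 3)+2=2 from rfl,
    show (1:Fin 3)+1=2 from rfl, show (1:Fin 3)+2=0 from rfl, show (2:Fin 3)+1=0 from rfl,
    show (2:Fin 3)+2=1 from rfl, Pi.sub_apply, Pi.neg_apply, Int.cast_sub, Int.cast_neg] at h1 h2 ⊢
  linear_combination tpi ^ 2 * (a 0 * ((l 1 : ℂ) * p 2 - l 2 * p 1) + a 1 * ((l 2 : ℂ) * p 0 - l 0 * p 2)
    + a 2 * ((l 0 : ℂ) * p 1 - l 1 * p 0)) * h2 +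
    tpi ^ 2 * (b 0 * ((l 1 : ℂ) * p 2 - l 2 * p 1) + b 1 * ((l 2 : ℂ) * p 0 - l 0 * p 2)
    + b 2 * ((l 0 : ℂ) * p 1 - l 1 * p 0)) * h1

def curlS (Ψ : Fin 3 → Vec → ℂ) (j : Fin 3) (x : Vec) : ℂ :=
  pd (j+1) (Ψ (j+2)) x - pd (j+2) (Ψ (j+1)) x

lemma curlS_sm {Ψ : Fin 3 → Vec → ℂ} (h : ∀ j, Sm (Ψ j)) (j : Fin 3) : Sm (curlS Ψ j) :=
  ((h _).pd _).sub ((h _).pd _)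

lemma fc_pd' {f : Vec → ℂ} (hf : Sm f) (i : Fin 3) (n : Lat) :
    fc (pd i f) n = tpi * (n i : ℂ) * fc f n := fc_pd hf i n

lemma fc_curlS {Ψ : Fin 3 → Vec → ℂ} (h : ∀ j, Sm (Ψ j)) (j : Fin 3) (l : Lat) :
    fc (curlS Ψ j) l = tpi * crs l (fun i => fc (Ψ i) l) j := by
  unfold curlS
  rw [fc_sub ((h _).pd _).integrable ((h _).pd _).integrable, fc_pd' (h _), fc_pd' (h _)]
  unfold crs; ring

lemma crs_neg (l : Lat) (a q : Fin 3 → ℂ) :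
    ∑ j, tpi * crs (-l) a j * q j = ∑ j, a j * (tpi * crs l q j) := by
  simp only [crs, Fin.sum_univ_three, show (0:Fin 3)+1=1 from rfl, show (0:Fin 3)+2=2 from rfl,
    show (1:Fin 3)+1=2 from rfl, show (1:Fin 3)+2=0 from rfl, show (2:Fin 3)+1=0 from rfl,
    show (2:Fin 3)+2=1 from rfl, Pi.neg_apply, Int.cast_neg]
  ring

lemma lin_hasSum {M : ℝ} (hM : 0 ≤ M) {v : Vec → Vec}
    (hb : ∀ j, HB (1/2) M (fcV v j)) {Ψ : Fin 3 → Vec → ℂ} (h : ∀ j, Sm (Ψ j)) :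
    HasSum (fun l => ∑ j, fcV v j (-l) * (tpi * crs l (fun i => fc (Ψ i) l) j))
      (∑ j, dpair (ωC v j) (Ψ j)) := by
  have h1 : ∀ j, HasSum (fun l => tpi * crs (-l) (fun i => fcV v i (-l)) j * fc (Ψ j) l)
      (dpair (ωC v j) (Ψ j)) := by
    intro j
    have hs : Summable fun n => ωC v j n * fc (Ψ j) (-n) := by
      have h2 := (fc_summable_wt (h j) 1).mul_left (2 * Real.pi * (M + M))
      have h3 := (Equiv.neg Lat).summable_iff.2 h2
      refine Summable.of_norm_bounded h3 fun n => ?_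
      rw [ωC_eq, norm_mul, norm_mul, norm_tpi]
      have := crs_norm n (fun i => fcV v i n) j
      have h5 : wt n ^ (1/2:ℝ) ≤ wt n :=
        Real.rpow_le_self_of_one_le (one_le_wt n) (by norm_num)
      have h6 := (hb (j+2)).pt0 (by norm_num) hM n
      have h7 := (hb (j+1)).pt0 (by norm_num) hM n
      have hn := wt_pos n
      simp only [Function.comp, Equiv.neg_apply, wt_neg, pow_one]
      calc _ ≤ 2 * Real.pi * (wt n ^ (1/2:ℝ) * (‖fcV v (j+2) n‖ + ‖fcV v (j+1) n‖)) *
            ‖fc (Ψ j) (-n)‖ := by gcongr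
        _ ≤ 2 * Real.pi * (wt n * (M + M)) * ‖fc (Ψ j) (-n)‖ := by gcongr
        _ = _ := by ring
    have h4 := (Equiv.neg Lat).hasSum_iff.2 hs.hasSum
    have e : (fun l => tpi * crs (-l) (fun i => fcV v i (-l)) j * fc (Ψ j) l) =
        (fun n => ωC v j n * fc (Ψ j) (-n)) ∘ (Equiv.neg Lat) := by
      funext l
      simp only [Function.comp, Equiv.neg_apply, neg_neg]
      rfl
    rw [e]; exact h4
  have h2 := hasSum_sum (s := Finset.univ) fun j _ => h1 j
  simpa only [crs_neg] using h2

def sg : Lat × Lat ≃ Lat × Lat where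
  toFun p := (p.1, -p.1 - p.2)
  invFun p := (p.1, -p.1 - p.2)
  left_inv p := by ext <;> simp
  right_inv p := by ext <;> simp

lemma nonlin_hasSum {M : ℝ} (hM : 0 ≤ M) {v : Vec → Vec} (hv : MemLp v 3 μT)
    (hb : ∀ j, HB (1/2) M (fcV v j)) (hdiv : ∀ k, ∑ j, (k j : ℂ) * fcV v j k = 0)
    {ψ : Vec → Vec} (hψ : ContDiff ℝ (⊤ : ℕ∞) ψ) (hψp : Per ψ) :
    HasSum (fun l => ∑ j, PC (fcV v) j (-l) * (tpi * crs l (fun i => fcV ψ i l) j))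
      (∑ i, ∑ j,
      (dpair (ωC v j) (fun x => ((v x i * pd i (fun y => ψ y j) x : ℝ) : ℂ)) -
       dpair (ωC v i) (fun x => ((v x j * pd i (fun y => ψ y j) x : ℝ) : ℂ)))) := by
  have hS : ∀ j, Sm (uC ψ j) := fun j => Sm.ofReal (contDiff_comp_coord hψ j) (hψp.coord j)
  have epd : ∀ i j, (fun x => ((pd i (fun y => ψ y j) x : ℝ) : ℂ)) = pd i (uC ψ j) := by
    intro i j; funext x
    exact (pd_ofReal (diffble (contDiff_comp_coord hψ j) x) i).symm
  have hSp : ∀ i j, Sm (fun x => ((pd i (fun y => ψ y j) x : ℝ) : ℂ)) := by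
    intro i j; rw [epd]; exact (hS j).pd i
  have efc : ∀ i j l, fc (fun x => ((pd i (fun y => ψ y j) x : ℝ) : ℂ)) l =
      tpi * (l i : ℂ) * fcV ψ j l := by
    intro i j l; rw [epd, fc_pd' (hS j)]; rfl
  have hF := hasSum_sum (s := (Finset.univ : Finset (Fin 3))) fun i _ =>
    hasSum_sum (s := (Finset.univ : Finset (Fin 3))) fun j _ =>
      (dpair_hasSum hM hv hb (hSp i j) i j).sub (dpair_hasSum hM hv hb (hSp i j) j i)
  simp only [efc] at hF
  set F : Lat × Lat → ℂ := fun p => ∑ i, ∑ j,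
      (tpi * crs p.2 (fun i => fcV v i p.2) j * (tpi * (p.1 i : ℂ) * fcV ψ j p.1 *
          fcV v i (-p.1 - p.2)) -
        tpi * crs p.2 (fun i => fcV v i p.2) i * (tpi * (p.1 i : ℂ) * fcV ψ j p.1 *
          fcV v j (-p.1 - p.2))) with hFdef
  change HasSum F _ at hF
  set R := ∑ i, ∑ j,
      (dpair (ωC v j) (fun x => ((v x i * pd i (fun y => ψ y j) x : ℝ) : ℂ)) -
       dpair (ωC v i) (fun x => ((v x j * pd i (fun y => ψ y j) x : ℝ) : ℂ))) with hR
  clear_value R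
  set P : Fin 3 → Fin 3 → Lat → ℂ := fun i j l => tpi * (l i : ℂ) * (tpi * crs l (fun i => fcV ψ i l) j)
    with hP
  have hPs : ∀ i j, Summable fun l => wt l * ‖P i j l‖ := by
    intro i j
    have := fc_summable_wt ((curlS_sm hS j).pd i) 1
    simp only [fc_pd' (curlS_sm hS j), fc_curlS hS, pow_one] at this
    exact this
  set G : Lat × Lat → ℂ := fun p => ∑ i, ∑ j, fcV v i p.2 * P i j p.1 * fcV v j (-p.1 - p.2) with hG
  have hGs : Summable G := by
    refine summable_sum fun i _ => summable_sum fun j _ => ?_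
    refine Summable.of_norm_bounded (tri_summable hM (hb i) (hb j) (hPs i j)) fun p => ?_
    rw [norm_mul, norm_mul]
    have h1 : 1 ≤ wt p.2 ^ (1/2:ℝ) := Real.one_le_rpow (one_le_wt _) (by norm_num)
    gcongr
    exact le_mul_of_one_le_left (norm_nonneg _) h1
  have hsym : ∀ p, F p + F (sg p) = G p + G (sg p) := by
    rintro ⟨l, n⟩
    have e : -l - (-l - n) = n := by abel
    have := sym_alg l n (-l - n) rfl (fun i => fcV v i n) (fun i => fcV v i (-l - n))
      (fun i => fcV ψ i l) (hdiv n) (hdiv _)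
    simp only [hFdef, hG, hP, sg, Equiv.coe_fn_mk, e]
    exact this
  have hF2 := hF.add (sg.hasSum_iff.2 hF)
  have hG2 := hGs.hasSum.add (sg.hasSum_iff.2 hGs.hasSum)
  have e1 : (fun p => F p + (F ∘ sg) p) = fun p => G p + (G ∘ sg) p := funext hsym
  rw [e1] at hF2
  have e2 := hF2.unique hG2
  have e3 : R = ∑' p, G p := by linear_combination e2 / 2
  rw [e3]
  have hq : ∀ i j l, HasSum (fun n => fcV v i n * P i j l * fcV v j (-l - n))
      (P i j l * qC (fcV v) i j (-l)) := by
    intro i j l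
    have h1 : Summable fun n => fcV v i n * fcV v j (-l - n) := by
      refine Summable.of_norm ?_
      simp only [norm_mul]
      exact (q_basic (hb i) (hb j) (by norm_num) hM hM (-l)).1
    have h2 := h1.hasSum.mul_left (P i j l)
    have e : (fun n => fcV v i n * P i j l * fcV v j (-l - n)) =
      fun n => P i j l * (fcV v i n * fcV v j (-l - n)) := by funext n; ring
    rw [e]; exact h2
  have h5 := hGs.hasSum.prod_fiberwise (g := fun l => ∑ i, ∑ j, P i j l * qC (fcV v) i j (-l))
    fun l => hasSum_sum fun i _ => hasSum_sum fun j _ => hq i j l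
  have e4 : (fun l => ∑ j, PC (fcV v) j (-l) * (tpi * crs l (fun i => fcV ψ i l) j)) =
      fun l => ∑ i, ∑ j, P i j l * qC (fcV v) i j (-l) := by
    funext l
    rw [PC_crs, Finset.sum_comm]
    refine Finset.sum_congr rfl fun j _ => ?_
    unfold NC
    rw [neg_mul, Finset.sum_mul, ← Finset.sum_neg_distrib]
    refine Finset.sum_congr rfl fun i _ => ?_
    simp only [hP, Pi.neg_apply]
    push_cast
    ring
  rw [e4]
  exact h5

lemma vort_hasSum {M : ℝ} (hM : 0 ≤ M) {v : Vec → Vec} (hv : MemLp v 3 μT)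
    (hb : ∀ j, HB (1/2) M (fcV v j)) (hdiv : ∀ k, ∑ j, (k j : ℂ) * fcV v j k = 0)
    {ψ ψt : Vec → Vec} (hψ : ContDiff ℝ (⊤ : ℕ∞) ψ) (hψp : Per ψ)
    (ht : ∀ j, Sm (uC ψt j)) :
    HasSum (Zf (fcV v) (fcV ψ) (fcV ψt)) (vortIntegrand v ψ ψt) := by
  have := (lin_hasSum hM hb ht).add (nonlin_hasSum hM hv hb hdiv hψ hψp)
  have e : Zf (fcV v) (fcV ψ) (fcV ψt) = fun l =>
      (∑ j, fcV v j (-l) * (tpi * crs l (fun i => fc (uC ψt i) l) j)) +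
      ∑ j, PC (fcV v) j (-l) * (tpi * crs l (fun i => fcV ψ i l) j) := by
    funext l; unfold Zf; rw [Finset.sum_add_distrib]; rfl
  rw [e]
  exact this

end

section

section
variable {T α β M B : ℝ} {ν : ℕ → ℝ} {u : ℕ → ℝ → Vec → Vec} {v : ℝ → Vec → Vec}
  {c : ℝ → Fin 3 → Lat → ℂ} {F : Fin 3 → ℝ → Vec → ℂ}

lemma TS.curl (h : ∀ j, TS T (F j)) (j : Fin 3) : TS T (fun t => curlS (fun i => F i t) j) where
  smooth := ((h _).pd _).smooth.sub ((h _).pd _).smooth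
  per t := (curlS_sm (fun i => (h i).sm t) j).per
  supp := by
    obtain ⟨a, b, ha, hb, hab⟩ := ((h (j+2)).pd (j+1)).supp
    obtain ⟨a', b', ha', hb', hab'⟩ := ((h (j+1)).pd (j+2)).supp
    refine ⟨min a a', max b b', lt_min ha ha', max_lt hb hb', fun t ht => ?_⟩
    have h1 := hab t fun h => ht ⟨(min_le_left _ _).trans h.1, h.2.trans (le_max_left _ _)⟩
    have h2 := hab' t fun h => ht ⟨(min_le_right _ _).trans h.1, h.2.trans (le_max_right _ _)⟩
    funext x
    simp only [curlS]
    rw [show PaperHelicity.pd (j+1) (F (j+2) t) x = 0 from congrFun h1 x,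
      show PaperHelicity.pd (j+2) (F (j+1) t) x = 0 from congrFun h2 x]
    simp

lemma qC_bd {c : Fin 3 → Lat → ℂ} (hβ : 0 ≤ β) (hM : 0 ≤ M) (h : ∀ j, HB β M (c j)) (i j : Fin 3)
    (k : Lat) : ‖qC c i j k‖ ≤ M * M :=
  (qC_norm_le h hβ hM i j k).trans (q_basic (h i) (h j) hβ hM hM k).2

lemma qC_sub_le {ε : ℝ} {c d : Fin 3 → Lat → ℂ} (hM : 0 ≤ M) (hε : 0 ≤ ε) (hc : ∀ j, HB 0 M (c j))
    (hd : ∀ j, HB 0 M (d j)) (he : ∀ j, HB 0 ε (c j - d j)) (i j : Fin 3) (k : Lat) :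
    ‖qC c i j k - qC d i j k‖ ≤ 2 * M * ε := by
  have a1 := q_basic (he i) (hc j) le_rfl hε hM k
  have a2 := q_basic (hd i) (he j) le_rfl hM hε k
  have s : ∀ {c d : Fin 3 → Lat → ℂ} {i j}, (Summable fun m => ‖c i m‖ * ‖d j (k - m)‖) →
      Summable fun m => c i m * d j (k - m) := by
    intro c d i j h
    exact Summable.of_norm (by simpa only [norm_mul] using h)
  have s1 := s (q_basic (hc i) (hc j) le_rfl hM hM k).1
  have s2 := s (q_basic (hd i) (hd j) le_rfl hM hM k).1
  unfold qC
  rw [← s1.tsum_sub s2]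
  have b : ∀ m, ‖c i m * c j (k - m) - d i m * d j (k - m)‖ ≤
      ‖(c i - d i) m‖ * ‖c j (k - m)‖ + ‖d i m‖ * ‖(c j - d j) (k - m)‖ := by
    intro m
    rw [← norm_mul, ← norm_mul]
    refine le_trans (le_of_eq ?_) (norm_add_le _ _)
    congr 1
    simp only [Pi.sub_apply]
    ring
  refine (tsum_of_norm_bounded (a1.1.add a2.1).hasSum b).trans ?_
  rw [a1.1.tsum_add a2.1]
  linarith [a1.2, a2.2]

lemma HB.zero' (h : 1/2 < β) {c : Lat → ℂ} (hc : HB β M c) : HB 0 M c := hc.mono (by linarith)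

lemma Lim.qC_tendsto (h : Lim T α β M B ν u v c) {t : ℝ} (ht : t ∈ Set.Ioo 0 T) (i j : Fin 3)
    (k : Lat) : Tendsto (fun n => qC (fcV (u n t)) i j k) atTop (𝓝 (qC (c t) i j k)) := by
  rw [Metric.tendsto_atTop]
  intro ε hε
  have hM := h.dat.hM
  have hβ := h.dat.hβ
  obtain ⟨N, hN⟩ := h.hs_unif (θ := β) (by linarith) (ε := ε / (2 * M + 1)) (by positivity)
  refine ⟨N, fun n hn => ?_⟩
  rw [dist_eq_norm]
  have h1 := hN n hn t ht
  rw [sub_self] at h1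
  refine (qC_sub_le hM (by positivity) (fun j => (h.dat.hb n t ht j).zero' hβ)
    (fun j => (h.hb ht j).zero' hβ) h1 i j k).trans_lt ?_
  rw [mul_div_assoc', div_lt_iff₀ (by positivity)]
  nlinarith

lemma Lim.PC_tendsto (h : Lim T α β M B ν u v c) {t : ℝ} (ht : t ∈ Set.Ioo 0 T) (j : Fin 3)
    (k : Lat) : Tendsto (fun n => PC (fcV (u n t)) j k) atTop (𝓝 (PC (c t) j k)) := by
  have hN : ∀ j, Tendsto (fun n => NC (fcV (u n t)) j k) atTop (𝓝 (NC (c t) j k)) := fun j =>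
    (tendsto_finsetSum _ fun i _ => (h.qC_tendsto ht i j k).const_mul _).neg
  exact (hN j).sub (((tendsto_finsetSum _ fun i _ => (hN i).const_mul _).const_mul _).div_const _)

lemma Zf_le {c p pt : Fin 3 → Lat → ℂ} {D : ℝ} (hβ : 0 ≤ β) (hM : 0 ≤ M) (hD : 0 ≤ D)
    (h : ∀ j, HB β M (c j)) (l : Lat)
    (hp : ∀ j, ‖tpi * crs l (fun i => p i l) j‖ ≤ D * (wt l ^ 3)⁻¹)
    (hpt : ∀ j, ‖tpi * crs l (fun i => pt i l) j‖ ≤ D * (wt l ^ 3)⁻¹) :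
    ‖Zf c p pt l‖ ≤ 3 * (M + 24 * Real.pi * (M * M)) * D * (wt l ^ 2)⁻¹ := by
  have hw := wt_pos l
  have hw1 := one_le_wt l
  have hl : latNorm l ≤ wt l := (latNorm_le_wt_half l).trans
    (Real.rpow_le_self_of_one_le hw1 (by norm_num))
  unfold Zf
  have hj : ∀ j, ‖c j (-l) * (tpi * crs l (fun i => pt i l) j) +
      PC c j (-l) * (tpi * crs l (fun i => p i l) j)‖ ≤
      (M + 24 * Real.pi * (M * M)) * D * (wt l ^ 2)⁻¹ := by
    intro j
    have h1 := (h j).pt0 hβ hM (-l)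
    have h2 := PC_le (fun i j => qC_bd hβ hM h i j (-l)) j
    rw [latNorm_neg] at h2
    refine (norm_add_le _ _).trans ?_
    rw [norm_mul (c j (-l)), norm_mul (PC c j (-l))]
    have h3 := hp j
    have h4 := hpt j
    have e : (wt l ^ 2)⁻¹ = wt l * (wt l ^ 3)⁻¹ := by field_simp
    have h2' : ‖PC c j (-l)‖ ≤ 24 * Real.pi * wt l * (M * M) := h2.trans (by gcongr)
    calc _ ≤ M * (D * (wt l ^ 3)⁻¹) + 24 * Real.pi * wt l * (M * M) * (D * (wt l ^ 3)⁻¹) := by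
          gcongr
      _ ≤ (M * wt l) * (D * (wt l ^ 3)⁻¹) + 24 * Real.pi * wt l * (M * M) * (D * (wt l ^ 3)⁻¹) := by
          gcongr
          exact le_mul_of_one_le_right hM hw1
      _ = _ := by rw [e]; ring
  refine (norm_sum_le _ _).trans ((Finset.sum_le_sum fun j _ => hj j).trans ?_)
  simp only [Finset.sum_const, Finset.card_univ, Fintype.card_fin, nsmul_eq_mul]
  exact le_of_eq (by push_cast; ring)

lemma crs_hasDeriv (h : ∀ j, TS T (F j)) (l : Lat) (j : Fin 3) (t : ℝ) :
    HasDerivAt (fun s => tpi * crs l (fun i => fc (F i s) l) j)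
      (tpi * crs l (fun i => fc (tderiv (F i) t) l) j) t :=
  ((((h _).hasDeriv l t).const_mul _).sub (((h _).hasDeriv l t).const_mul _)).const_mul _

lemma Lim.int_Zf (h : Lim T α β M B ν u v c) (hF : ∀ j, TS T (F j)) (l : Lat) :
    AEStronglyMeasurable (fun t => Zf (c t) (fun j => fc (F j t)) (fun j => fc (tderiv (F j) t)) l)
      (tIoo T) ∧
    ∫ t, Zf (c t) (fun j => fc (F j t)) (fun j => fc (tderiv (F j) t)) l ∂tIoo T = 0 := by
  have hM := h.dat.hM
  have hβ := h.dat.hβ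
  have hd1 := fun j => (TS.curl hF j).decay 3
  have hd2 := fun j => (TS.curl (fun j => (hF j).td) j).decay 3
  choose D1 hD1 hD1b using hd1
  choose D2 hD2 hD2b using hd2
  set D := ∑ j, (D1 j + D2 j) with hDdef
  have hD : 0 ≤ D := Finset.sum_nonneg fun j _ => add_nonneg (hD1 j) (hD2 j)
  have hDj : ∀ j, D1 j + D2 j ≤ D := fun j =>
    Finset.single_le_sum (f := fun j => D1 j + D2 j) (fun j _ => add_nonneg (hD1 j) (hD2 j))
      (Finset.mem_univ j)
  have hw := wt_pos l
  have hp : ∀ t j, ‖tpi * crs l (fun i => fc (F i t) l) j‖ ≤ D * (wt l ^ 3)⁻¹ := by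
    intro t j
    rw [← fc_curlS (fun i => (hF i).sm t)]
    refine (hD1b j t l).trans ?_
    have := hDj j; have := hD2 j
    gcongr; linarith
  have hpt : ∀ t j, ‖tpi * crs l (fun i => fc (tderiv (F i) t) l) j‖ ≤ D * (wt l ^ 3)⁻¹ := by
    intro t j
    rw [← fc_curlS (fun i => (hF i).td.sm t)]
    refine (hD2b j t l).trans ?_
    have := hDj j; have := hD1 j
    gcongr; linarith
  clear_value D
  obtain ⟨C, hC⟩ : ∃ C, C = 3 * (M + 24 * Real.pi * (M * M)) * D * (wt l ^ 2)⁻¹ +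
      3 * ((4 * Real.pi ^ 2 * B * latSq l) * M * (D * (wt l ^ 3)⁻¹)) := ⟨_, rfl⟩
  have hlq : 0 ≤ latSq l := by rw [latSq_eq]; positivity
  set Y : ℕ → ℝ → ℂ := fun n t => ∑ j, (fcV (u n t) j (-l) *
      (tpi * crs l (fun i => fc (tderiv (F i) t) l) j) +
    FC (ν n) (fcV (u n t)) j (-l) * (tpi * crs l (fun i => fc (F i t) l) j)) with hY
  have hYZ : ∀ n t, Y n t = Zf (fcV (u n t)) (fun j => fc (F j t)) (fun j => fc (tderiv (F j) t)) l +
      ∑ j, -((4 * Real.pi ^ 2 * ν n * latSq l : ℝ) : ℂ) * (fcV (u n t) j (-l) *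
        (tpi * crs l (fun i => fc (F i t) l) j)) := by
    intro n t
    simp only [hY, Zf, ← Finset.sum_add_distrib, FC_eq, latSq_eq, latNorm_neg]
    refine Finset.sum_congr rfl fun j _ => ?_
    ring
  have hYb : ∀ n, ∀ t ∈ Set.Ioo 0 T, ‖Y n t‖ ≤ C := by
    intro n t ht
    rw [hYZ, hC]
    refine (norm_add_le _ _).trans (add_le_add (Zf_le (by linarith) hM hD (h.dat.hb n t ht) l
      (hp t) (hpt t)) ?_)
    refine (norm_sum_le _ _).trans ?_
    have : ∀ j ∈ (Finset.univ : Finset (Fin 3)), ‖-((4 * Real.pi ^ 2 * ν n * latSq l : ℝ) : ℂ) *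
        (fcV (u n t) j (-l) * (tpi * crs l (fun i => fc (F i t) l) j))‖ ≤
        (4 * Real.pi ^ 2 * B * latSq l) * M * (D * (wt l ^ 3)⁻¹) := by
      intro j _
      have hn := h.dat.hν n
      rw [norm_mul, norm_neg, norm_mul (fcV _ _ _), Complex.norm_real,
        Real.norm_of_nonneg (by positivity), mul_assoc _ M]
      have h1 := (h.dat.hb n t ht j).pt0 (by linarith) hM (-l)
      have h2 := hp t j
      have h3 := h.dat.hν1 n
      have hB := h.dat.hB
      have : 0 ≤ 4 * Real.pi ^ 2 * B * latSq l := by positivity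
      gcongr
    refine (Finset.sum_le_sum this).trans ?_
    simp only [Finset.sum_const, Finset.card_univ, Fintype.card_fin, nsmul_eq_mul]
    exact le_of_eq (by push_cast; ring)
  have hsupp : ∃ a b : ℝ, 0 < a ∧ b < T ∧ ∀ t, t ∉ Set.Icc a b → ∀ j,
      tpi * crs l (fun i => fc (F i t) l) j = 0 ∧
      tpi * crs l (fun i => fc (tderiv (F i) t) l) j = 0 := by
    have hs := fun j => (hF j).supp
    choose a b ha hb hab using hs
    have hz : ∀ t, (∀ j, t ∉ Set.Icc (a j) (b j)) → ∀ j, fc (F j t) l = 0 := by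
      intro t ht j
      rw [hab j t (ht j)]; simp [fc]
    have hs2 := fun j => (hF j).td.supp
    choose a2 b2 ha2 hb2 hab2 using hs2
    have hz2 : ∀ t, (∀ j, t ∉ Set.Icc (a2 j) (b2 j)) → ∀ j, fc (tderiv (F j) t) l = 0 := by
      intro t ht j
      rw [hab2 j t (ht j)]; simp [fc]
    refine ⟨Finset.univ.inf' Finset.univ_nonempty (fun j => min (a j) (a2 j)),
      Finset.univ.sup' Finset.univ_nonempty (fun j => max (b j) (b2 j)), ?_, ?_, ?_⟩
    · simp only [Finset.lt_inf'_iff]; exact fun j _ => lt_min (ha j) (ha2 j)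
    · simp only [Finset.sup'_lt_iff]; exact fun j _ => max_lt (hb j) (hb2 j)
    · intro t ht j
      have hlo : ∀ j, Finset.univ.inf' Finset.univ_nonempty (fun j => min (a j) (a2 j)) ≤
        min (a j) (a2 j) := fun j => Finset.inf'_le _ (Finset.mem_univ j)
      have hhi : ∀ j, max (b j) (b2 j) ≤
        Finset.univ.sup' Finset.univ_nonempty (fun j => max (b j) (b2 j)) :=
        fun j => Finset.le_sup' (fun j => max (b j) (b2 j)) (Finset.mem_univ j)
      have n1 : ∀ j, t ∉ Set.Icc (a j) (b j) := fun j hh => ht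
        ⟨(hlo j).trans ((min_le_left _ _).trans hh.1), hh.2.trans ((le_max_left _ _).trans (hhi j))⟩
      have n2 : ∀ j, t ∉ Set.Icc (a2 j) (b2 j) := fun j hh => ht
        ⟨(hlo j).trans ((min_le_right _ _).trans hh.1), hh.2.trans ((le_max_right _ _).trans (hhi j))⟩
      simp [crs, hz t n1, hz2 t n2]
  obtain ⟨a, b, ha, hb, hab⟩ := hsupp
  have hYab : ∀ n t, t ∉ Set.Icc a b → Y n t = 0 := by
    intro n t ht
    simp only [hY]
    exact Finset.sum_eq_zero fun j _ => by rw [(hab t ht j).1, (hab t ht j).2]; simp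
  have hder : ∀ n t, HasDerivAt (fun s => ∑ j, fcV (u n s) j (-l) *
      (tpi * crs l (fun i => fc (F i s) l) j)) (Y n t) t := by
    intro n t
    by_cases ht : t ∈ Set.Icc a b
    · have ht' : t ∈ Set.Ioo 0 T := ⟨ha.trans_le ht.1, ht.2.trans_lt hb⟩
      refine HasDerivAt.fun_sum fun j _ => ?_
      have := (h.dat.der n t ht' j (-l)).mul (crs_hasDeriv hF l j t)
      rw [add_comm] at this
      exact this
    · rw [hYab n t ht]
      refine (hasDerivAt_const t (0:ℂ)).congr_of_eventuallyEq ?_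
      filter_upwards [isClosed_Icc.isOpen_compl.mem_nhds ht] with s hs
      exact Finset.sum_eq_zero fun j _ => by rw [(hab s hs j).1]; simp
  have hYm : ∀ n, StronglyMeasurable (Y n) := by
    intro n
    have : Y n = deriv (fun s => ∑ j, fcV (u n s) j (-l) *
      (tpi * crs l (fun i => fc (F i s) l) j)) := by
      funext t; exact (hder n t).deriv.symm
    rw [this]
    exact (measurable_deriv _).stronglyMeasurable
  have hsub : Set.Icc a b ⊆ Set.Ioo 0 T := fun t ht => ⟨ha.trans_le ht.1, ht.2.trans_lt hb⟩
  have hYi : ∀ n, ∫ t, Y n t ∂tIoo T = 0 := by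
    intro n
    have hi : IntegrableOn (Y n) (Set.Icc a b) := by
      refine Measure.integrableOn_of_bounded (M := C) (by simp) (hYm n).aestronglyMeasurable ?_
      exact (ae_restrict_iff' measurableSet_Icc).2 (Eventually.of_forall fun t ht => hYb n t (hsub ht))
    have hi' : Integrable (Y n) :=
      (integrableOn_iff_integrable_of_support_subset (fun t ht => by
        by_contra hh; exact ht (hYab n t hh))).1 hi
    have hcont : Continuous (fun s => ∑ j, fcV (u n s) j (-l) *
      (tpi * crs l (fun i => fc (F i s) l) j)) :=
      continuous_iff_continuousAt.2 fun t => (hder n t).continuousAt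
    have hi2 : Integrable (fun s => ∑ j, fcV (u n s) j (-l) *
      (tpi * crs l (fun i => fc (F i s) l) j)) :=
      (integrableOn_iff_integrable_of_support_subset (s := Set.Icc a b) (fun t ht => by
        by_contra hh
        exact ht (Finset.sum_eq_zero fun j _ => by rw [(hab t hh j).1]; simp))).1
        hcont.continuousOn.integrableOn_Icc
    rw [tIoo, setIntegral_eq_integral_of_forall_compl_eq_zero]
    · exact integral_eq_zero_of_hasDerivAt_of_integrable (hder n) hi' hi2
    · intro t ht
      exact hYab n t fun hh => ht (hsub hh)
  have hae : ∀ᵐ t ∂tIoo T, t ∈ Set.Ioo 0 T := ae_restrict_mem measurableSet_Ioo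
  have hlim : ∀ᵐ t ∂tIoo T, Tendsto (fun n => Y n t) atTop
      (𝓝 (Zf (c t) (fun j => fc (F j t)) (fun j => fc (tderiv (F j) t)) l)) := by
    filter_upwards [hae] with t ht
    have h1 : Tendsto (fun n => Zf (fcV (u n t)) (fun j => fc (F j t))
        (fun j => fc (tderiv (F j) t)) l) atTop
        (𝓝 (Zf (c t) (fun j => fc (F j t)) (fun j => fc (tderiv (F j) t)) l)) :=
      tendsto_finsetSum _ fun j _ => ((h.tendsto ht j (-l)).mul_const _).add
        ((h.PC_tendsto ht j (-l)).mul_const _)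
    have h2 : Tendsto (fun n => ∑ j, -((4 * Real.pi ^ 2 * ν n * latSq l : ℝ) : ℂ) *
        (fcV (u n t) j (-l) * (tpi * crs l (fun i => fc (F i t) l) j))) atTop (𝓝 0) := by
      have h3 : Tendsto (fun n => -((4 * Real.pi ^ 2 * ν n * latSq l : ℝ) : ℂ)) atTop (𝓝 0) := by
        have := ((h.dat.hν0.const_mul (4 * Real.pi ^ 2)).mul_const (latSq l))
        have := (Complex.continuous_ofReal.tendsto _).comp this
        simpa using this.neg
      have := tendsto_finsetSum (Finset.univ : Finset (Fin 3)) fun j _ =>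
        h3.mul ((h.tendsto ht j (-l)).mul_const (tpi * crs l (fun i => fc (F i t) l) j))
      simpa using this
    have := h1.add h2
    rw [add_zero] at this
    exact this.congr fun n => (hYZ n t).symm
  refine ⟨aestronglyMeasurable_of_tendsto_ae atTop (fun n => (hYm n).aestronglyMeasurable) hlim, ?_⟩
  have := tendsto_integral_of_dominated_convergence (fun _ => C)
    (fun n => (hYm n).aestronglyMeasurable) (integrable_const C) (fun n => by
      filter_upwards [hae] with t ht using hYb n t ht) hlim
  simp only [hYi] at this
  exact tendsto_nhds_unique this tendsto_const_nhds

end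

end

section

section
variable {T α β M B : ℝ} {ν : ℕ → ℝ} {u : ℕ → ℝ → Vec → Vec} {v : ℝ → Vec → Vec}
  {c : ℝ → Fin 3 → Lat → ℂ} {F : Fin 3 → ℝ → Vec → ℂ}

lemma crs_unif (hF : ∀ j, TS T (F j)) : ∃ D, 0 ≤ D ∧ ∀ t l j,
    ‖tpi * crs l (fun i => fc (F i t) l) j‖ ≤ D * (wt l ^ 3)⁻¹ := by
  have hd1 := fun j => (TS.curl hF j).decay 3
  choose D1 hD1 hD1b using hd1
  refine ⟨∑ j, D1 j, Finset.sum_nonneg fun j _ => hD1 j, fun t l j => ?_⟩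
  have hw := wt_pos l
  rw [← fc_curlS (fun i => (hF i).sm t)]
  refine (hD1b j t l).trans ?_
  gcongr
  exact Finset.single_le_sum (f := D1) (fun j _ => hD1 j) (Finset.mem_univ j)

lemma Lim.vort (h : Lim T α β M B ν u v c) : VortWeak T v := by
  intro ψ
  have hM := h.dat.hM
  have hβ := h.dat.hβ
  have hF : ∀ j, TS T (fun t x => (ψ.f t x j : ℂ)) := fun j => ψ.ts j
  obtain ⟨D1, hD1, hp⟩ := crs_unif hF
  obtain ⟨D2, hD2, hpt⟩ := crs_unif fun j => (hF j).td
  set Z : Lat → ℝ → ℂ := fun l t => Zf (c t) (fun j => fc (fun x => (ψ.f t x j : ℂ)))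
    (fun j => fc (tderiv (fun t x => (ψ.f t x j : ℂ)) t)) l with hZ
  have hbd : ∀ l, ∀ t ∈ Set.Ioo 0 T, ‖Z l t‖ ≤
      3 * (M + 24 * Real.pi * (M * M)) * (D1 + D2) * (wt l ^ 2)⁻¹ := by
    intro l t ht
    have hw := wt_pos l
    refine Zf_le (by linarith) hM (by positivity) (fun j => h.hb ht j) l
      (fun j => (hp t l j).trans ?_) (fun j => (hpt t l j).trans ?_)
    · gcongr; linarith
    · gcongr; linarith
  have hae : ∀ᵐ t ∂tIoo T, t ∈ Set.Ioo 0 T := ae_restrict_mem measurableSet_Ioo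
  have hitg : ∀ l, Integrable (Z l) (tIoo T) := fun l =>
    Integrable.of_bound (h.int_Zf hF l).1 _ (by filter_upwards [hae] with t ht using hbd l t ht)
  have e : ∀ᵐ t ∂tIoo T, vortIntegrand (v t) (ψ.f t) (tderiv ψ.f t) = ∑' l, Z l t := by
    filter_upwards [hae, h.ae] with t ht hv
    have hs := vort_hasSum hM hv.1 (fun j => by rw [hv.2]; exact (h.hb ht j).mono hβ.le)
      (fun k => by rw [hv.2]; exact h.div ht k) (ψ := ψ.f t) (ψt := tderiv ψ.f t)
      (ψ.smooth.comp (contDiff_const.prodMk contDiff_id)) (ψ.periodic t)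
      (fun j => by
        have : uC (tderiv ψ.f t) j = tderiv (fun t x => (ψ.f t x j : ℂ)) t := ψ.td j t
        rw [this]; exact (hF j).td.sm t)
    rw [← hs.tsum_eq]
    have e2 : fcV (tderiv ψ.f t) = fun j => fc (tderiv (fun t x => (ψ.f t x j : ℂ)) t) := by
      funext j; rw [← ψ.td j t]; rfl
    rw [e2, hv.2]
    rfl
  change ∫ t, vortIntegrand (v t) (ψ.f t) (tderiv ψ.f t) ∂tIoo T = 0
  rw [integral_congr_ae e]
  have hsm : Summable fun l => ∫ t, ‖Z l t‖ ∂tIoo T := by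
    refine Summable.of_nonneg_of_le (fun l => integral_nonneg fun t => norm_nonneg _) (fun l => ?_)
      (((summable_wt_nat le_rfl).mul_left (3 * (M + 24 * Real.pi * (M * M)) * (D1 + D2))).mul_left
        ((tIoo T).real Set.univ))
    have := integral_mono_ae (hitg l).norm (integrable_const _)
      (show ∀ᵐ t ∂tIoo T, ‖Z l t‖ ≤ _ by filter_upwards [hae] with t ht using hbd l t ht)
    simpa only [integral_const, smul_eq_mul] using this
  have := hasSum_integral_of_summable_integral_norm hitg hsm
  rw [← this.tsum_eq]
  simp only [hZ]
  simp only [(h.int_Zf hF _).2, tsum_zero]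

lemma Lim.wdf (h : Lim T α β M B ν u v c) : WeakDivFree T v := by
  intro φ
  change ∫ t, _ ∂tIoo T = 0
  have hae : ∀ᵐ t ∂tIoo T, t ∈ Set.Ioo 0 T := ae_restrict_mem measurableSet_Ioo
  refine integral_eq_zero_of_ae ?_
  filter_upwards [hae, h.ae] with t ht hv
  have hS := φ.tsR.sm t
  have hd : Differentiable ℝ (φ.f t) :=
    diffble (φ.smooth.comp (contDiff_const.prodMk contDiff_id))
  have hvi : ∀ i, Integrable (uC (v t) i) μT := fun i =>
    (PaperHelicity.MemLp.coordC hv.1 i).integrable (by norm_num)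
  have h1 : ∀ i, HasSum (fun l => tpi * (l i : ℂ) * fc (fun x => (φ.f t x : ℂ)) l * c t i (-l))
      (∫ x, pd i (fun x => (φ.f t x : ℂ)) x * uC (v t) i x ∂μT) := by
    intro i
    have := hasSum_parseval (hS.pd i) (hvi i)
    simp only [fc_pd' hS] at this
    rw [← hv.2]
    exact this
  have h2 := hasSum_sum (s := (Finset.univ : Finset (Fin 3))) fun i _ => h1 i
  have h3 : (fun l => ∑ i, tpi * (l i : ℂ) * fc (fun x => (φ.f t x : ℂ)) l * c t i (-l)) = fun _ => 0 := by
    funext l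
    have := h.div ht (-l)
    simp only [Fin.sum_univ_three, Pi.neg_apply, Int.cast_neg] at this ⊢
    linear_combination -(tpi * fc (fun x => (φ.f t x : ℂ)) l) * this
  rw [h3] at h2
  have h4 := h2.unique hasSum_zero
  have hbd : ∀ i, Integrable (fun x => pd i (fun x => (φ.f t x : ℂ)) x * uC (v t) i x) μT := by
    intro i
    obtain ⟨C, hC, hb⟩ := per_bounded (hS.pd i).continuous (hS.pd i).per
    exact (hvi i).bdd_mul (hS.pd i).continuous.aestronglyMeasurable (Eventually.of_forall hb)
  rw [← integral_finsetSum _ fun i _ => hbd i] at h4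
  have h5 : ∫ x, ((∑ i, v t x i * pd i (φ.f t) x : ℝ) : ℂ) ∂μT = 0 := by
    rw [← h4]
    refine integral_congr_ae (Eventually.of_forall fun x => ?_)
    simp only [pd_ofReal (hd x), uC]
    push_cast
    exact Finset.sum_congr rfl fun i _ => by ring
  have h6 : ((∫ x, (∑ i, v t x i * pd i (φ.f t) x) ∂μT : ℝ) : ℂ) = 0 := by
    rw [← h5]
    exact integral_complex_ofReal.symm
  change ∫ x, (∑ i, v t x i * pd i (φ.f t) x) ∂μT = 0
  exact_mod_cast h6

lemma Lim.fvs (h : Lim T α β M B ν u v c) : IsFVS T v := by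
  refine ⟨h.meas, h.per, ⟨β - 1/2, by linarith [h.dat.hβ], ?_⟩, h.wdf, h.vort⟩
  rw [timeNorm, if_pos rfl]
  refine lt_of_le_of_lt (essSup_le_of_ae_le (3 * ENNReal.ofReal M) ?_)
    (ENNReal.mul_lt_top (by norm_num) ENNReal.ofReal_lt_top)
  have hae : ∀ᵐ t ∂tIoo T, t ∈ Set.Ioo 0 T := ae_restrict_mem measurableSet_Ioo
  filter_upwards [hae, h.ae] with t ht hv
  refine Hs_of_HBV h.dat.hM fun j => ?_
  rw [hv.2, show 1/2 + (β - 1/2) = β by ring]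
  exact h.hb ht j

end

end

section

section

lemma int_chr (n : Lat) : ∫ x, chr n x ∂μT = if n = 0 then 1 else 0 := by
  split_ifs with h
  · subst h; simp [chr_zero]
  · obtain ⟨i, hi⟩ : ∃ i, n i ≠ 0 := by
      by_contra hc; push Not at hc; exact h (funext hc)
    have h1 : ∫ x in cube, pd i (chr n) x = 0 := integral_pd (Sm.chr n) i
    have h2 : ∀ x, pd i (chr n) x = 2 * Real.pi * Complex.I * (n i : ℂ) * chr n x := fun x => pd_chr n i x
    simp only [h2] at h1
    rw [integral_const_mul] at h1
    rcases mul_eq_zero.1 h1 with h3 | h3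
    · exfalso
      have : (n i : ℂ) ≠ 0 := by exact_mod_cast hi
      have hp : (Real.pi : ℂ) ≠ 0 := by exact_mod_cast Real.pi_ne_zero
      simp [this, hp] at h3
    · exact h3

/-- A squared trigonometric polynomial, normalised. -/
def Kr (s : Finset Lat) (a : Lat → ℝ) (y : Vec) : ℝ :=
  ‖∑ p ∈ s, (a p : ℂ) * chr p y‖ ^ 2 / ∑ p ∈ s, a p ^ 2

lemma Kr_expand (s : Finset Lat) (a : Lat → ℝ) (y : Vec) :
    (Kr s a y : ℂ) = ∑ p ∈ s, ∑ q ∈ s, ((a p * a q / ∑ p ∈ s, a p ^ 2 : ℝ) : ℂ) * chr (p - q) y := by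
  rw [Kr]
  push_cast
  rw [← Complex.mul_conj', map_sum, Finset.sum_mul_sum, Finset.sum_div]
  refine Finset.sum_congr rfl fun p _ => ?_
  rw [Finset.sum_div]
  refine Finset.sum_congr rfl fun q _ => ?_
  rw [map_mul, chr_conj, Complex.conj_ofReal, sub_eq_add_neg, chr_add]
  ring

lemma Kr_Sm (s : Finset Lat) (a : Lat → ℝ) : Sm (fun y => (Kr s a y : ℂ)) := by
  have e : (fun y => (Kr s a y : ℂ)) = fun y => ∑ p ∈ s, ∑ q ∈ s,
      ((a p * a q / ∑ p ∈ s, a p ^ 2 : ℝ) : ℂ) * chr (p - q) y := funext (Kr_expand s a)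
  rw [e]
  exact Sm.sum _ fun p _ => Sm.sum _ fun q _ => (Sm.chr _).const_mul _

/-- Fourier multiplier of a kernel. -/
def mm (K : Vec → ℝ) (k : Lat) : ℂ := ∫ y, (K y : ℂ) * chr k y ∂μT

lemma Kr_mm {s : Finset Lat} {a : Lat → ℝ} (ha : ∀ p, p ∉ s → a p = 0) (k : Lat) :
    mm (Kr s a) k = (((∑ p ∈ s, a p * a (p + k)) / ∑ p ∈ s, a p ^ 2 : ℝ) : ℂ) := by
  have h1 : ∀ y, (Kr s a y : ℂ) * chr k y =
      ∑ p ∈ s, ∑ q ∈ s, ((a p * a q / ∑ p ∈ s, a p ^ 2 : ℝ) : ℂ) * chr (p - q + k) y := by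
    intro y
    rw [Kr_expand, Finset.sum_mul]
    refine Finset.sum_congr rfl fun p _ => ?_
    rw [Finset.sum_mul]
    refine Finset.sum_congr rfl fun q _ => ?_
    rw [chr_add, mul_assoc]
  rw [mm]
  simp only [h1]
  rw [integral_finsetSum _ fun p _ => (Sm.sum _ fun q _ => (Sm.chr _).const_mul _).integrable]
  rw [Finset.sum_div]
  push_cast
  refine Finset.sum_congr rfl fun p hp => ?_
  rw [integral_finsetSum _ fun q _ => ((Sm.chr _).const_mul _).integrable]
  simp only [integral_const_mul, int_chr]
  have : ∀ q, (p - q + k = 0) ↔ (q = p + k) := fun q => by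
    constructor
    · intro h; linear_combination (exp := 1) -h
    · rintro rfl; abel
  simp only [this, mul_ite, mul_one, mul_zero, Finset.sum_ite_eq']
  split_ifs with h
  · push_cast; ring
  · rw [ha _ h]; simp

structure PK (K : Vec → ℝ) : Prop where
  nn : ∀ y, 0 ≤ K y
  sm : Sm (fun y => (K y : ℂ))
  one : ∫ y, K y ∂μT = 1

lemma PK.cont {K : Vec → ℝ} (h : PK K) : Continuous K := by
  have := Complex.continuous_re.comp h.sm.continuous
  simpa [Function.comp_def] using this

lemma PK.per {K : Vec → ℝ} (h : PK K) : Per K := fun x n => by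
  exact_mod_cast h.sm.per x n

lemma mm_zero {K : Vec → ℝ} (h : PK K) : mm K 0 = 1 := by
  rw [mm]; simp only [chr_zero, mul_one]
  rw [integral_complex_ofReal, h.one]; simp

lemma Kr_PK {s : Finset Lat} {a : Lat → ℝ} (ha : ∀ p, p ∉ s → a p = 0)
    (hA : 0 < ∑ p ∈ s, a p ^ 2) : PK (Kr s a) where
  nn y := by unfold Kr; positivity
  sm := Kr_Sm s a
  one := by
    have h := Kr_mm ha 0
    rw [mm] at h
    simp only [chr_zero, mul_one, add_zero, ← sq] at h
    rw [div_self hA.ne', integral_complex_ofReal] at h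
    exact_mod_cast h

/-- The probability measure with density `K`. -/
def PP (K : Vec → ℝ) : Measure Vec := μT.withDensity fun y => ENNReal.ofReal (K y)

lemma PK.prob {K : Vec → ℝ} (h : PK K) : IsProbabilityMeasure (PP K) := by
  constructor
  rw [PP, withDensity_apply _ MeasurableSet.univ, Measure.restrict_univ,
    ← ofReal_integral_eq_lintegral_ofReal (per_integrable h.cont h.per) (Eventually.of_forall h.nn), h.one]
  simp

lemma PK.integral {K : Vec → ℝ} (h : PK K) (g : Vec → ℂ) :
    ∫ y, g y ∂PP K = ∫ y, (K y : ℂ) * g y ∂μT := by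
  rw [PP, integral_withDensity_eq_integral_toReal_smul
    (h.cont.measurable.ennreal_ofReal) (Eventually.of_forall fun _ => ENNReal.ofReal_lt_top)]
  refine integral_congr_ae (Eventually.of_forall fun y => ?_)
  simp [ENNReal.toReal_ofReal (h.nn y)]

lemma PK.mm_eq {K : Vec → ℝ} (h : PK K) (k : Lat) : mm K k = ∫ y, chr k y ∂PP K :=
  (h.integral _).symm

lemma PK.mm_le {K : Vec → ℝ} (h : PK K) (k : Lat) : ‖mm K k‖ ≤ 1 := by
  have := h.prob
  rw [h.mm_eq]
  have := norm_integral_le_of_norm_le_const (μ := PP K) (f := fun y => chr k y) (C := 1)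
    (ae_of_all _ fun x => (chr_norm k x).le)
  simpa using this

lemma PK.int_bdd {K : Vec → ℝ} (h : PK K) {E : Type*} [NormedAddCommGroup E] {g : Vec → E}
    (hc : Continuous g) (hp : Per g) : Integrable g (PP K) := by
  have := h.prob
  obtain ⟨C, -, hC⟩ := per_bounded hc hp
  exact Integrable.of_bound hc.aestronglyMeasurable C (ae_of_all _ hC)

/-- Distance of a character to one. -/
def Dk (k : Lat) (y : Vec) : ℝ := ‖1 - chr k y‖

lemma Dk_nonneg (k : Lat) (y : Vec) : 0 ≤ Dk k y := norm_nonneg _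

lemma Dk_le (k : Lat) (y : Vec) : Dk k y ≤ 2 := by
  refine (norm_sub_le _ _).trans ?_
  rw [chr_norm]; norm_num

lemma Dk_cont (k : Lat) : Continuous (Dk k) := (continuous_const.sub (chr_continuous k)).norm

lemma Dk_per (k : Lat) : Per (Dk k) := fun x n => by rw [Dk, chr_per, Dk]

lemma Dk_add (k l : Lat) (y : Vec) : Dk (k + l) y ≤ Dk k y + Dk l y := by
  have e : 1 - chr (k + l) y = (1 - chr k y) + chr k y * (1 - chr l y) := by rw [chr_add]; ring
  rw [Dk, e]
  refine (norm_add_le _ _).trans ?_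
  rw [norm_mul, chr_norm, one_mul]; rfl

lemma Dk_neg (k : Lat) (y : Vec) : Dk (-k) y = Dk k y := by
  rw [Dk, Dk, ← chr_conj, ← Complex.norm_conj]; simp

lemma Dk_sq (k : Lat) (y : Vec) : ((Dk k y ^ 2 : ℝ) : ℂ) = 2 - chr k y - chr (-k) y := by
  rw [Dk]; push_cast
  rw [← Complex.mul_conj', map_sub, chr_conj, map_one]
  have : chr k y * chr (-k) y = 1 := by rw [← chr_add]; simp [chr_zero]
  linear_combination this

/-- Second moment of the kernel. -/
def mom (K : Vec → ℝ) (k : Lat) : ℝ := ∫ y, Dk k y ^ 2 ∂PP K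

lemma PK.mom_int {K : Vec → ℝ} (h : PK K) (k : Lat) : Integrable (fun y => Dk k y ^ 2) (PP K) :=
  h.int_bdd ((Dk_cont k).pow 2) fun x n => by rw [Dk_per]

lemma PK.mom_eq {K : Vec → ℝ} (h : PK K) (k : Lat) : ((mom K k : ℝ) : ℂ) = 2 - mm K k - mm K (-k) := by
  have hp := h.prob
  rw [mom, ← integral_complex_ofReal]
  simp only [Dk_sq]
  have i1 : ∀ l, Integrable (fun y => chr l y) (PP K) := fun l =>
    h.int_bdd (chr_continuous l) (chr_per l)
  have i2 : Integrable (fun y => 2 - chr k y) (PP K) := (integrable_const _).sub (i1 k)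
  rw [integral_sub i2 (i1 (-k)), integral_sub (integrable_const _) (i1 k),
    h.mm_eq, h.mm_eq]
  simp

lemma PK.mom_nonneg {K : Vec → ℝ} (k : Lat) : 0 ≤ mom K k := integral_nonneg fun y => sq_nonneg _

lemma PK.mom_add {K : Vec → ℝ} (h : PK K) (k l : Lat) : mom K (k + l) ≤ 2 * mom K k + 2 * mom K l := by
  rw [mom, mom, mom, ← integral_const_mul, ← integral_const_mul,
    ← integral_add ((h.mom_int k).const_mul _) ((h.mom_int l).const_mul _)]
  refine integral_mono (h.mom_int _) (((h.mom_int k).const_mul _).add ((h.mom_int l).const_mul _)) fun y => ?_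
  have h1 := Dk_add k l y
  have h2 := Dk_nonneg (k + l) y
  show Dk (k + l) y ^ 2 ≤ 2 * Dk k y ^ 2 + 2 * Dk l y ^ 2
  nlinarith [sq_nonneg (Dk k y - Dk l y), Dk_nonneg k y, Dk_nonneg l y]

lemma mom_neg {K : Vec → ℝ} (k : Lat) : mom K (-k) = mom K k := by
  simp only [mom, Dk_neg]

lemma PK.mm_sub_one {K : Vec → ℝ} (h : PK K) (k : Lat) : ‖1 - mm K k‖ ^ 2 ≤ mom K k := by
  have hp := h.prob
  have i1 : Integrable (fun y => chr k y) (PP K) := h.int_bdd (chr_continuous k) (chr_per k)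
  have e : 1 - mm K k = ∫ y, (1 - chr k y) ∂PP K := by
    rw [integral_sub (integrable_const _) i1, h.mm_eq]; simp
  have hi : Integrable (Dk k) (PP K) := h.int_bdd (Dk_cont k) (Dk_per k)
  have h1 : ‖1 - mm K k‖ ≤ ∫ y, Dk k y ∂PP K := by
    rw [e]; exact norm_integral_le_integral_norm _
  have h0 : 0 ≤ ∫ y, Dk k y ∂PP K := integral_nonneg fun y => Dk_nonneg k y
  set I := ∫ y, Dk k y ∂PP K with hI
  have h2 : 0 ≤ ∫ y, (Dk k y - I) ^ 2 ∂PP K := integral_nonneg fun y => sq_nonneg _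
  have h3 : ∫ y, (Dk k y - I) ^ 2 ∂PP K = mom K k - I ^ 2 := by
    have e2 : (fun y => (Dk k y - I) ^ 2) = fun y => (Dk k y ^ 2 - (2 * I) * Dk k y) + I ^ 2 := by
      funext y; ring
    have i2 : Integrable (fun y => Dk k y ^ 2 - (2 * I) * Dk k y) (PP K) :=
      (h.mom_int k).sub (hi.const_mul _)
    rw [e2, integral_add i2 (integrable_const _),
      integral_sub (h.mom_int k) (hi.const_mul _), integral_const_mul, ← hI, mom]
    simp; ring
  have : ‖1 - mm K k‖ ^ 2 ≤ I ^ 2 := by gcongr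
  linarith

/-- The unit lattice vectors. -/
def eL (i : Fin 3) : Lat := Pi.single i 1

lemma PK.mm_tendsto {K : ℕ → Vec → ℝ} (h : ∀ N, PK (K N))
    (he : ∀ i, Tendsto (fun N => mom (K N) (eL i)) atTop (𝓝 0)) (k : Lat) :
    Tendsto (fun N => mm (K N) k) atTop (𝓝 1) := by
  let S : AddSubgroup Lat :=
    { carrier := {k | Tendsto (fun N => mom (K N) k) atTop (𝓝 0)}
      zero_mem' := by
        have : ∀ N, mom (K N) 0 = 0 := fun N => by simp [mom, Dk, chr_zero]
        show Tendsto (fun N => mom (K N) 0) atTop (𝓝 0)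
        simp only [this]; exact tendsto_const_nhds
      add_mem' := by
        intro a b ha hb
        have ha' : Tendsto (fun N => mom (K N) a) atTop (𝓝 0) := ha
        have hb' : Tendsto (fun N => mom (K N) b) atTop (𝓝 0) := hb
        show Tendsto (fun N => mom (K N) (a + b)) atTop (𝓝 0)
        refine squeeze_zero (fun N => PK.mom_nonneg _) (fun N => (h N).mom_add a b) ?_
        simpa using (ha'.const_mul 2).add (hb'.const_mul 2)
      neg_mem' := by
        intro a ha
        have ha' : Tendsto (fun N => mom (K N) a) atTop (𝓝 0) := ha
        show Tendsto (fun N => mom (K N) (-a)) atTop (𝓝 0)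
        simpa only [mom_neg] using ha' }
  have hk : k ∈ S := by
    have e : k = ∑ i, k i • eL i := by
      funext j; simp [eL, Finset.sum_apply, Pi.single_apply]
    rw [e]
    exact S.sum_mem fun i _ => S.zsmul_mem (he i) _
  have hk' : Tendsto (fun N => mom (K N) k) atTop (𝓝 0) := hk
  have h1 : Tendsto (fun N => ‖1 - mm (K N) k‖ ^ 2) atTop (𝓝 0) :=
    squeeze_zero (fun N => sq_nonneg _) (fun N => (h N).mm_sub_one k) hk'
  have h2 : Tendsto (fun N => ‖1 - mm (K N) k‖) atTop (𝓝 0) := by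
    have := (Real.continuous_sqrt.tendsto 0).comp h1
    simpa [Function.comp_def, Real.sqrt_sq] using this
  have h3 := tendsto_zero_iff_norm_tendsto_zero.2 h2
  simpa using (tendsto_const_nhds (x := (1:ℂ))).sub h3

end

end

section

section

lemma avg_eLp {Ω : Type*} [MeasurableSpace Ω] (P : Measure Ω) [IsProbabilityMeasure P] {Y : Ω → Vec}
    (hY : Measurable Y) {w : Ω → ℂ} {C : ℝ} (hw : ∀ ω, ‖w ω‖ ≤ C) {f : Vec → ℂ}
    (hf : Continuous f) (hp : Per f) :
    eLpNorm (fun x => ∫ ω, w ω * f (x + Y ω) ∂P) 3 μT ≤ ENNReal.ofReal C * eLpNorm f 3 μT := by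
  rw [← ENNReal.rpow_le_rpow_iff (show (0:ℝ) < 3 by norm_num), ENNReal.mul_rpow_of_nonneg _ _ (by norm_num),
    eLp3_cube, eLp3_cube]
  have hm : ∀ x, Measurable fun ω => f (x + Y ω) := fun x =>
    hf.measurable.comp (hY.const_add x)
  have h1 : ∀ x, ‖∫ ω, w ω * f (x + Y ω) ∂P‖ₑ ^ (3:ℝ) ≤
      ENNReal.ofReal C ^ (3:ℝ) * ∫⁻ ω, ‖f (x + Y ω)‖ₑ ^ (3:ℝ) ∂P := by
    intro x
    have h2 : ‖∫ ω, w ω * f (x + Y ω) ∂P‖ₑ ≤ ENNReal.ofReal C * ∫⁻ ω, ‖f (x + Y ω)‖ₑ ∂P := by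
      refine (enorm_integral_le_lintegral_enorm _).trans ?_
      rw [← lintegral_const_mul _ (hm x).enorm]
      refine lintegral_mono fun ω => ?_
      rw [enorm_mul]
      gcongr
      rw [← ofReal_norm]
      exact ENNReal.ofReal_le_ofReal (hw ω)
    have h3 := eLpNorm_le_eLpNorm_of_exponent_le (μ := P) (p := 1) (q := 3) (f := fun ω => f (x + Y ω))
      (by norm_num) (hm x).aestronglyMeasurable
    rw [eLpNorm_one_eq_lintegral_enorm] at h3
    have h4 : eLpNorm (fun ω => f (x + Y ω)) 3 P ^ (3:ℝ) = ∫⁻ ω, ‖f (x + Y ω)‖ₑ ^ (3:ℝ) ∂P := by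
      rw [eLpNorm_eq_lintegral_rpow_enorm_toReal (by norm_num) (by norm_num), ← ENNReal.rpow_mul]
      norm_num
    rw [← h4, ← ENNReal.mul_rpow_of_nonneg _ _ (by norm_num)]
    refine ENNReal.rpow_le_rpow (h2.trans ?_) (by norm_num)
    gcongr
  refine (lintegral_mono h1).trans ?_
  have hmm : Measurable fun z : Vec × Ω => ‖f (z.1 + Y z.2)‖ₑ ^ (3:ℝ) :=
    ((hf.measurable.comp (measurable_fst.add (hY.comp measurable_snd))).enorm).pow_const _
  rw [lintegral_const_mul _ hmm.lintegral_prod_right', lintegral_lintegral_swap hmm.aemeasurable]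
  gcongr
  have : ∀ ω, ∫⁻ x, ‖f (x + Y ω)‖ₑ ^ (3:ℝ) ∂μT = ∫⁻ x, ‖f x‖ₑ ^ (3:ℝ) ∂μT := fun ω =>
    lintegral_cube_shift (f := fun x => ‖f x‖ₑ ^ (3:ℝ)) (fun x n => by simp only [hp x n]) (Y ω)
  calc ∫⁻ ω, ∫⁻ x, ‖f (x + Y ω)‖ₑ ^ (3:ℝ) ∂μT ∂P = ∫⁻ ω, ∫⁻ x, ‖f x‖ₑ ^ (3:ℝ) ∂μT ∂P :=
        lintegral_congr this
    _ ≤ _ := by rw [lintegral_const, measure_univ, mul_one]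

/-- One-dimensional Fejer kernel in direction `i`. -/
def fjS (i : Fin 3) (N : ℕ) : Finset Lat :=
  (Finset.Ico (0:ℤ) (2 * N)).image (fun p => (Pi.single i p : Lat))

open Classical in
def fjA (i : Fin 3) (N : ℕ) (p : Lat) : ℝ := if p ∈ fjS i N then 1 else 0

lemma mem_fjS {i : Fin 3} {N : ℕ} {p : ℤ} : (Pi.single i p : Lat) ∈ fjS i N ↔ 0 ≤ p ∧ p < 2 * N := by
  rw [fjS, Finset.mem_image]
  constructor
  · rintro ⟨q, hq, e⟩
    have := Pi.single_injective i e
    subst this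
    exact Finset.mem_Ico.1 hq
  · intro h; exact ⟨p, Finset.mem_Ico.2 h, rfl⟩

lemma fjA_sum (i : Fin 3) (N : ℕ) (g : Lat → ℝ) : ∑ p ∈ fjS i N, fjA i N p * g p =
    ∑ p ∈ Finset.Ico (0:ℤ) (2 * N), g (Pi.single i p) := by
  have : ∑ p ∈ fjS i N, fjA i N p * g p = ∑ p ∈ fjS i N, g p :=
    Finset.sum_congr rfl fun p hp => by simp [fjA, hp]
  rw [this, fjS, Finset.sum_image fun a _ b _ h => Pi.single_injective i h]

lemma fj_sq (i : Fin 3) (N : ℕ) : ∑ p ∈ fjS i N, fjA i N p ^ 2 = 2 * N := by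
  simp only [sq]
  rw [fjA_sum]
  have : ∀ p ∈ Finset.Ico (0:ℤ) (2 * N), fjA i N (Pi.single i p) = 1 := fun p hp => by
    rw [fjA, if_pos (mem_fjS.2 (Finset.mem_Ico.1 hp))]
  rw [Finset.sum_congr rfl this]
  simp
  have : ((2 * (N:ℤ)).toNat) = 2 * N := by omega
  rw [this]; push_cast; ring

lemma fj_PK (i : Fin 3) {N : ℕ} (hN : 0 < N) : PK (Kr (fjS i N) (fjA i N)) :=
  Kr_PK (fun p hp => by simp [fjA, hp]) (by rw [fj_sq]; positivity)

lemma fj_mm (i : Fin 3) {N : ℕ} (hN : 0 < N) {l : ℤ} (hl : |l| ≤ 2 * N) :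
    mm (Kr (fjS i N) (fjA i N)) (Pi.single i l) = (((2 * N - |(l:ℝ)|) / (2 * N) : ℝ) : ℂ) := by
  rw [Kr_mm (fun p hp => by simp [fjA, hp]), fj_sq, fjA_sum]
  congr 2
  have h1 : ∀ p : ℤ, fjA i N (Pi.single i p + Pi.single i l) = if (0 ≤ p + l ∧ p + l < 2 * N) then 1 else 0 := by
    intro p
    rw [← Pi.single_add, fjA]
    simp only [mem_fjS]
  simp only [h1]
  rw [← Finset.sum_filter]
  have h2 : (Finset.Ico (0:ℤ) (2 * N)).filter (fun p => 0 ≤ p + l ∧ p + l < 2 * N) =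
      Finset.Ico (max 0 (-l)) (min (2 * N) (2 * N - l)) := by
    ext p; simp only [Finset.mem_filter, Finset.mem_Ico]; omega
  rw [h2, Finset.sum_const, Int.card_Ico, nsmul_eq_mul, mul_one]
  have h3 : ((min (2 * (N:ℤ)) (2 * N - l) - max 0 (-l)).toNat : ℤ) = 2 * N - |l| := by
    rcases abs_cases l with ⟨h, h'⟩ | ⟨h, h'⟩
    · rw [min_eq_right (by omega), max_eq_left (by omega)]; omega
    · rw [min_eq_left (by omega), max_eq_right (by omega)]; omega
  have h4 : (((min (2 * (N:ℤ)) (2 * N - l) - max 0 (-l)).toNat : ℤ) : ℝ) = 2 * N - |(l:ℝ)| := by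
    rw [h3]; push_cast; ring
  rw [← h4, Int.cast_natCast]

lemma chr_line (k : Lat) (i : Fin 3) (r : ℝ) : chr k (EuclideanSpace.single i r) =
    Complex.exp (2 * Real.pi * Complex.I * ((k i : ℂ) * (r : ℂ))) := by
  rw [chr]
  congr 2
  rw [Finset.sum_eq_single i]
  · simp
  · intro j _ hj; simp [hj]
  · simp

lemma chr_single (i : Fin 3) (l : ℤ) (y : Vec) : chr (Pi.single i l) y =
    Complex.exp (2 * Real.pi * Complex.I * ((l : ℂ) * (y i : ℂ))) := by
  rw [chr]
  congr 2
  rw [Finset.sum_eq_single i]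
  · simp
  · intro j _ hj; simp [hj]
  · simp

lemma meas_line (i : Fin 3) : Measurable fun y : Vec => (EuclideanSpace.single i (y i) : Vec) := by
  have : Continuous fun y : Vec => (EuclideanSpace.single i (y i) : Vec) := by
    have e : (fun y : Vec => (EuclideanSpace.single i (y i) : Vec)) =
        fun y => y i • EuclideanSpace.single i (1:ℝ) := by
      funext y; ext j; simp [Pi.single_apply]
    rw [e]
    fun_prop
  exact this.measurable

/-- Bernstein inequality for trigonometric polynomials. -/
lemma bernstein (i : Fin 3) {N : ℕ} (hN : 0 < N) (s : Finset Lat) (c : Lat → ℂ)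
    (hs : ∀ k ∈ s, |k i| ≤ N) :
    eLpNorm (pd i fun x => ∑ k ∈ s, c k * chr k x) 3 μT ≤
      ENNReal.ofReal (4 * Real.pi * N) * eLpNorm (fun x => ∑ k ∈ s, c k * chr k x) 3 μT := by
  set f : Vec → ℂ := fun x => ∑ k ∈ s, c k * chr k x with hf
  have hfS : Sm f := trig_Sm s c
  have hK := fj_PK i hN
  have hP := hK.prob
  set K := Kr (fjS i N) (fjA i N) with hKd
  let w : Vec → ℂ := fun y => tpi * N * (chr (Pi.single i (-(N:ℤ))) y - chr (Pi.single i (N:ℤ)) y)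
  have hw : ∀ y, ‖w y‖ ≤ 4 * Real.pi * N := by
    intro y
    simp only [w]
    rw [norm_mul, norm_mul, norm_tpi, Complex.norm_natCast]
    have : ‖chr (Pi.single i (-(N:ℤ))) y - chr (Pi.single i (N:ℤ)) y‖ ≤ 2 := by
      refine (norm_sub_le _ _).trans ?_
      rw [chr_norm, chr_norm]; norm_num
    calc 2 * Real.pi * N * ‖chr (Pi.single i (-(N:ℤ))) y - chr (Pi.single i (N:ℤ)) y‖
        ≤ 2 * Real.pi * N * 2 := by gcongr
      _ = _ := by ring
  have key : ∀ x, pd i f x = ∫ y, w y * f (x + EuclideanSpace.single i (y i)) ∂PP K := by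
    intro x
    have e1 : ∀ y, w y * f (x + EuclideanSpace.single i (y i)) =
        ∑ k ∈ s, (tpi * N * c k * chr k x) * (chr (Pi.single i (k i - N)) y - chr (Pi.single i (k i + N)) y) := by
      intro y
      simp only [w, hf, Finset.mul_sum]
      refine Finset.sum_congr rfl fun k _ => ?_
      rw [chr_shift, sub_eq_neg_add (k i), add_comm (k i), Pi.single_add, Pi.single_add, chr_add, chr_add,
        chr_line k i, ← chr_single i (k i) y]
      ring
    simp only [e1]
    have i1 : ∀ l, Integrable (fun y => chr l y) (PP K) := fun l =>
      hK.int_bdd (chr_continuous l) (chr_per l)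
    have i2 : ∀ k l, Integrable (fun y => chr k y - chr l y) (PP K) := fun k l => (i1 k).sub (i1 l)
    rw [integral_finsetSum _ fun k _ => ((i2 _ _).const_mul _)]
    have e2 : pd i f x = ∑ k ∈ s, c k * (2 * Real.pi * Complex.I * (k i : ℂ) * chr k x) := by
      simp only [hf, pd]
      rw [fderiv_fun_sum fun k _ => (((Sm.chr k).const_mul _).differentiable x)]
      rw [ContinuousLinearMap.sum_apply]
      refine Finset.sum_congr rfl fun k _ => ?_
      rw [fderiv_const_mul ((Sm.chr k).differentiable x), smul_apply, smul_eq_mul]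
      congr 1
      exact pd_chr k i x
    rw [e2]
    refine Finset.sum_congr rfl fun k hk => ?_
    have hk' := hs k hk
    rw [abs_le] at hk'
    rw [integral_const_mul, integral_sub (i1 _) (i1 _), ← hK.mm_eq, ← hK.mm_eq,
      fj_mm i hN (by rw [abs_le]; omega), fj_mm i hN (by rw [abs_le]; omega)]
    have a1 : |((k i - N : ℤ) : ℝ)| = N - k i := by
      rw [abs_of_nonpos (by exact_mod_cast (by omega : k i - N ≤ 0))]; push_cast; ring
    have a2 : |((k i + N : ℤ) : ℝ)| = N + k i := by
      rw [abs_of_nonneg (by exact_mod_cast (by omega : 0 ≤ k i + N))]; push_cast; ring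
    rw [a1, a2]
    have hN' : (N:ℂ) ≠ 0 := by exact_mod_cast hN.ne'
    push_cast
    rw [tpi]
    field_simp
    ring
  have := avg_eLp (PP K) (meas_line i) hw hfS.continuous hfS.per
  have e : pd i f = fun x => ∫ y, w y * f (x + EuclideanSpace.single i (y i)) ∂PP K := funext key
  rw [e]
  exact this

end

end

section

section

/-- `L³` size of an increment. -/
def dl (y : Vec) (f : Vec → ℂ) : ℝ≥0∞ := eLpNorm (fun x => f (x + y) - f x) 3 μT

lemma eLp_shift {g : Vec → ℂ} (hp : Per g) (y : Vec) :
    eLpNorm (fun x => g (x + y)) 3 μT = eLpNorm g 3 μT := by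
  rw [eLp3, eLp3]
  congr 1
  exact lintegral_cube_shift (f := fun x => ‖g x‖ₑ ^ (3:ℝ)) (fun x n => by simp only [hp x n]) y

lemma per_shift {g : Vec → ℂ} (hp : Per g) (y : Vec) : Per (fun x => g (x + y)) := fun x n => by
  show g (x + latv n + y) = g (x + y)
  rw [add_right_comm, hp]

lemma cont_shift {g : Vec → ℂ} (hp : Continuous g) (y : Vec) : Continuous (fun x => g (x + y)) :=
  hp.comp (continuous_id.add continuous_const)

lemma dl_add {f : Vec → ℂ} (hf : Continuous f) (hp : Per f) (a b : Vec) :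
    dl (a + b) f ≤ dl a f + dl b f := by
  have e : (fun x => f (x + (a + b)) - f x) =
      (fun x => (fun z => f (z + a) - f z) (x + b)) + fun x => f (x + b) - f x := by
    funext x
    simp only [Pi.add_apply]
    rw [add_assoc x b a, add_comm b a]; ring
  have hg : Per (fun z => f (z + a) - f z) := fun x n => by
    have := per_shift hp a x n
    dsimp only at this ⊢
    rw [this, hp]
  have hc : Continuous (fun z => f (z + a) - f z) := (cont_shift hf a).sub hf
  rw [dl, e]
  refine (eLpNorm_add_le (cont_shift hc b).aestronglyMeasurable
    ((cont_shift hf b).sub hf).aestronglyMeasurable (by norm_num)).trans ?_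
  rw [eLp_shift hg]
  rfl

lemma dl_line {f : Vec → ℂ} (hf : Sm f) (i : Fin 3) (r : ℝ) :
    dl (EuclideanSpace.single i r) f ≤ ENNReal.ofReal |r| * eLpNorm (pd i f) 3 μT := by
  set e : Vec := EuclideanSpace.single i (1:ℝ) with he
  have hr : ∀ q : ℝ, (EuclideanSpace.single i q : Vec) = q • e := by
    intro q; ext j; simp [he]
  have hP : IsProbabilityMeasure ((volume : Measure ℝ).restrict (Set.Ioc 0 1)) := ⟨by simp⟩
  have hY : Measurable fun s : ℝ => (s * r) • e := by fun_prop
  have h1 := avg_eLp ((volume : Measure ℝ).restrict (Set.Ioc 0 1)) hY (w := fun _ => (r : ℂ)) (C := |r|)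
    (fun _ => by simp) (hf.pd i).continuous (hf.pd i).per
  refine le_trans (le_of_eq ?_) h1
  rw [dl]
  congr 1
  funext x
  have hd : ∀ s ∈ Set.uIcc (0:ℝ) 1, HasDerivAt (fun s : ℝ => f (x + (s * r) • e))
      ((r:ℂ) * pd i f (x + (s * r) • e)) s := by
    intro s _
    have h2 := hasDerivAt_line (x := x) (v := e) (s := s * r) (hf.differentiable (x + (s * r) • e))
    have h3 : HasDerivAt (fun s : ℝ => s * r) r s := by simpa using (hasDerivAt_id s).mul_const r
    have h4 := h2.scomp s h3
    have h6 : r • (fderiv ℝ f (x + (s * r) • e)) e = (r:ℂ) * pd i f (x + (s * r) • e) := by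
      rw [Complex.real_smul]; rfl
    rw [h6] at h4
    exact h4
  have hc : Continuous fun s : ℝ => (r:ℂ) * pd i f (x + (s * r) • e) :=
    continuous_const.mul ((hf.pd i).continuous.comp (by fun_prop))
  have h5 := intervalIntegral.integral_eq_sub_of_hasDerivAt hd (hc.intervalIntegrable 0 1)
  rw [intervalIntegral.integral_of_le zero_le_one] at h5
  rw [h5, hr]
  simp

lemma dl_D {f : Vec → ℂ} (hf : Sm f) (i : Fin 3) (y : Vec) :
    dl (EuclideanSpace.single i (y i)) f ≤ ENNReal.ofReal (Dk (eL i) y) * eLpNorm (pd i f) 3 μT := by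
  set r := y i with hr
  set q := r - round r with hq
  have e1 : (EuclideanSpace.single i r : Vec) = EuclideanSpace.single i q + latv (Pi.single i (round r)) := by
    ext j
    simp only [PiLp.add_apply, latv_apply, EuclideanSpace.single_apply, Pi.single_apply]
    split_ifs <;> simp [hq]
  have e2 : dl (EuclideanSpace.single i r) f = dl (EuclideanSpace.single i q) f := by
    rw [dl, dl, e1]
    congr 1; funext x
    rw [← add_assoc, hf.per]
  rw [e2]
  refine (dl_line hf i q).trans ?_
  gcongr
  have hq2 : |q| ≤ 1 / 2 := abs_sub_round r
  have h1 : chr (eL i) y = Complex.exp (Complex.I * ((2 * Real.pi * q : ℝ) : ℂ)) := by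
    have h2 : y = (y - latv (Pi.single i (round r))) + latv (Pi.single i (round r)) := by abel
    rw [h2, chr_per, eL, chr_single]
    congr 1
    simp only [PiLp.sub_apply, latv_apply, Pi.single_eq_same]
    rw [← hr, ← hq]; push_cast; ring
  rw [Dk, h1, norm_sub_rev, Complex.norm_exp_I_mul_ofReal_sub_one]
  have hpi := Real.pi_pos
  have h3 : 2 * Real.pi * q / 2 = Real.pi * q := by ring
  rw [h3, norm_mul, Real.norm_eq_abs, Real.norm_eq_abs, Real.abs_sin_eq_sin_abs_of_abs_le_pi, abs_mul, abs_of_pos hpi, abs_two]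
  · have h4 := Real.mul_le_sin (x := Real.pi * |q|) (by positivity) (by nlinarith)
    have h5 : 2 / Real.pi * (Real.pi * |q|) = 2 * |q| := by field_simp
    rw [h5] at h4
    linarith [abs_nonneg q]
  · rw [abs_mul, abs_of_pos hpi]; nlinarith

lemma dl_grad {f : Vec → ℂ} (hf : Sm f) (y : Vec) :
    dl y f ≤ ∑ i, ENNReal.ofReal (Dk (eL i) y) * eLpNorm (pd i f) 3 μT := by
  have e : y = EuclideanSpace.single 0 (y 0) + EuclideanSpace.single 1 (y 1) + EuclideanSpace.single 2 (y 2) := by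
    ext j; fin_cases j <;> simp [EuclideanSpace.single_apply]
  have h1 := dl_add hf.continuous hf.per (EuclideanSpace.single 0 (y 0) + EuclideanSpace.single 1 (y 1))
    (EuclideanSpace.single 2 (y 2))
  have h2 := dl_add hf.continuous hf.per (EuclideanSpace.single 0 (y 0)) (EuclideanSpace.single 1 (y 1))
  rw [← e] at h1
  rw [Fin.sum_univ_three]
  refine h1.trans (add_le_add (h2.trans (add_le_add (dl_D hf 0 y) (dl_D hf 1 y))) (dl_D hf 2 y))

lemma geom_up {σ : ℝ} (hσ : 0 < σ) {A : ℝ} (hA : 0 ≤ A) {b : ℝ≥0∞} {S q : ℕ → ℝ≥0∞} (h0 : S 0 = 0)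
    (hS : ∀ j, S (j + 1) ≤ S j + q j) (hq : ∀ j, q j ≤ ENNReal.ofReal (A * (2:ℝ) ^ (σ * j)) * b) (J : ℕ) :
    S J ≤ ENNReal.ofReal (A * gC σ * (2:ℝ) ^ (σ * J)) * b := by
  induction J with
  | zero => rw [h0]; exact zero_le
  | succ J ih =>
    refine (hS J).trans ((add_le_add ih (hq J)).trans ?_)
    rw [← add_mul, ← ENNReal.ofReal_add (by have := gC_pos hσ; positivity) (by positivity)]
    gcongr
    have h2 : (1:ℝ) < (2:ℝ) ^ σ := Real.one_lt_rpow (by norm_num) hσ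
    have e : (2:ℝ) ^ (σ * ((J + 1 : ℕ) : ℝ)) = (2:ℝ) ^ (σ * J) * (2:ℝ) ^ σ := by
      rw [← Real.rpow_add (by norm_num)]; push_cast; ring_nf
    rw [e]
    have hg : gC σ * ((2:ℝ) ^ σ - 1) = (2:ℝ) ^ σ := by
      rw [gC, Real.rpow_neg (by norm_num)]
      have : (2:ℝ) ^ σ - 1 ≠ 0 := by linarith
      have h3 : (2:ℝ) ^ σ ≠ 0 := by positivity
      have h4 : 1 - ((2:ℝ) ^ σ)⁻¹ = ((2:ℝ) ^ σ - 1) / (2:ℝ) ^ σ := by field_simp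
      rw [h4]; field_simp
    have h5 : 0 ≤ A * (2:ℝ) ^ (σ * J) := by positivity
    nlinarith [mul_nonneg h5 (show 0 ≤ gC σ * ((2:ℝ) ^ σ - 1) - 1 by rw [hg]; linarith)]

lemma pd_trig (s : Finset Lat) (c : Lat → ℂ) (i : Fin 3) :
    pd i (fun x => ∑ k ∈ s, c k * chr k x) = fun x => ∑ k ∈ s, (tpi * (k i : ℂ) * c k) * chr k x := by
  funext x
  simp only [pd]
  rw [fderiv_fun_sum fun k _ => (((Sm.chr k).const_mul _).differentiable x)]
  rw [ContinuousLinearMap.sum_apply]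
  refine Finset.sum_congr rfl fun k _ => ?_
  rw [fderiv_const_mul ((Sm.chr k).differentiable x), smul_apply, smul_eq_mul]
  have := pd_chr k i x
  rw [pd] at this
  rw [this, tpi]; ring

lemma pd_SJ (J : ℕ) (c : Lat → ℂ) (i : Fin 3) : pd i (SJ J c) = SJ J (fun k => tpi * (k i : ℂ) * c k) :=
  pd_trig _ c i

lemma pd_block (j : ℕ) (c : Lat → ℂ) (i : Fin 3) :
    pd i (lpBlockC j c) = lpBlockC j (fun k => tpi * (k i : ℂ) * c k) := by
  rw [lpBlock_fun, lpBlock_fun, pd_trig]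

lemma block_bern (j : ℕ) (c : Lat → ℂ) (i : Fin 3) : eLpNorm (lpBlockC j (fun k => tpi * (k i : ℂ) * c k)) 3 μT ≤
    ENNReal.ofReal (8 * Real.pi * (2:ℝ) ^ (j:ℝ)) * eLpNorm (lpBlockC j c) 3 μT := by
  rw [← pd_block, lpBlock_fun]
  have h := bernstein i (N := 2 ^ (j + 1)) (by positivity) (shF j) c (fun k hk => by
    have h1 := (mem_shF.1 hk).2
    have h2 := (abs_le_latNorm k i).trans h1.le
    exact_mod_cast h2)
  refine h.trans (le_of_eq ?_)
  congr 2
  rw [Real.rpow_natCast]; push_cast; ring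

lemma low_coef (c : Lat → ℂ) (i : Fin 3) : SJ 0 (fun k => tpi * (k i : ℂ) * c k) = fun _ => 0 := by
  funext x; rw [SJ_zero]; simp

lemma SJ_step (J : ℕ) (d : Lat → ℂ) :
    eLpNorm (SJ (J + 1) d) 3 μT ≤ eLpNorm (SJ J d) 3 μT + eLpNorm (lpBlockC J d) 3 μT := by
  have e : SJ (J + 1) d = SJ J d + lpBlockC J d := by funext x; rw [SJ_succ]; rfl
  rw [e]
  exact eLpNorm_add_le (SJ_Sm J d).continuous.aestronglyMeasurable
    (lpBlockC_Sm J d).continuous.aestronglyMeasurable (by norm_num)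

variable {γ : ℝ} {b : ℝ≥0∞} {c : Lat → ℂ}

lemma SJ_pd1 (hγ : γ < 1) (hb : ∀ j : ℕ, eLpNorm (lpBlockC j c) 3 μT ≤ ENNReal.ofReal ((2:ℝ) ^ (-γ * j)) * b)
    (i : Fin 3) (J : ℕ) : eLpNorm (pd i (SJ J c)) 3 μT ≤
      ENNReal.ofReal (8 * Real.pi * gC (1 - γ) * (2:ℝ) ^ ((1 - γ) * J)) * b := by
  rw [pd_SJ]
  refine geom_up (S := fun J => eLpNorm (SJ J (fun k => tpi * (k i : ℂ) * c k)) 3 μT)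
    (by linarith) (by positivity) (by simp [low_coef]) (fun j => SJ_step j _) (fun j => ?_) J
  refine (block_bern j c i).trans ((mul_le_mul_right (hb j) _).trans (le_of_eq ?_))
  rw [← mul_assoc, ← ENNReal.ofReal_mul (by positivity)]
  congr 2
  rw [mul_assoc, ← Real.rpow_add (by norm_num)]
  congr 2; ring

lemma SJ_pd2 (hγ : γ < 1) (hb : ∀ j : ℕ, eLpNorm (lpBlockC j c) 3 μT ≤ ENNReal.ofReal ((2:ℝ) ^ (-γ * j)) * b)
    (i l : Fin 3) (J : ℕ) : eLpNorm (pd l (pd i (SJ J c))) 3 μT ≤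
      ENNReal.ofReal (64 * Real.pi ^ 2 * gC (2 - γ) * (2:ℝ) ^ ((2 - γ) * J)) * b := by
  rw [pd_SJ, pd_SJ]
  refine geom_up (S := fun J => eLpNorm (SJ J (fun k => tpi * (k l : ℂ) * (tpi * (k i : ℂ) * c k))) 3 μT)
    (by linarith) (by positivity) (by simp [low_coef _ l]) (fun j => SJ_step j _) (fun j => ?_) J
  refine (block_bern j _ l).trans ((mul_le_mul_right ((block_bern j c i).trans (mul_le_mul_right (hb j) _)) _).trans
    (le_of_eq ?_))
  rw [← mul_assoc, ← mul_assoc, ← ENNReal.ofReal_mul (by positivity), ← ENNReal.ofReal_mul (by positivity)]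
  congr 2
  have : (2:ℝ) ^ ((2 - γ) * (j:ℝ)) = (2:ℝ) ^ (j:ℝ) * (2:ℝ) ^ (j:ℝ) * (2:ℝ) ^ (-γ * (j:ℝ)) := by
    rw [← Real.rpow_add (by norm_num), ← Real.rpow_add (by norm_num)]; congr 1; ring
  rw [this]; ring

lemma tail_le (hγ : 0 < γ) {f : Vec → ℂ} (hf : Sm f)
    (hb : ∀ j : ℕ, eLpNorm (lpBlockC j (fc f)) 3 μT ≤ ENNReal.ofReal ((2:ℝ) ^ (-γ * j)) * b) (J : ℕ) :
    eLpNorm (fun x => f x - SJ J (fc f) x) 3 μT ≤ ENNReal.ofReal (gC γ * (2:ℝ) ^ (-γ * J)) * b := by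
  set c := fc f with hc
  have h1 : ∀ N, eLpNorm (fun x => SJ (J + N) c x - SJ J c x) 3 μT ≤
      ENNReal.ofReal (gC γ * (2:ℝ) ^ (-γ * J)) * b := by
    intro N
    have e : (fun x => SJ (J + N) c x - SJ J c x) = ∑ j ∈ Finset.range N, lpBlockC (J + j) c := by
      funext x; rw [SJ_add]; simp
    rw [e]
    refine (eLpNorm_sum_le (fun j _ => (lpBlockC_Sm _ c).continuous.aestronglyMeasurable)
      (by norm_num)).trans ?_
    refine (Finset.sum_le_sum fun j _ => hb (J + j)).trans ?_
    rw [← Finset.sum_mul, ← ENNReal.ofReal_sum_of_nonneg fun _ _ => by positivity]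
    gcongr
    have : ∀ j : ℕ, (2:ℝ) ^ (-γ * ((J + j : ℕ):ℝ)) = (2:ℝ) ^ (-γ * j) * (2:ℝ) ^ (-γ * J) := by
      intro j; rw [← Real.rpow_add (by norm_num)]; push_cast; ring_nf
    simp only [this, ← Finset.sum_mul]
    gcongr
    exact geom_bound hγ N
  have hl := Lp.eLpNorm_lim_le_liminf_eLpNorm (p := 3) (μ := μT) (f := fun N x => SJ (J + N) c x - SJ J c x)
    (fun N => ((SJ_Sm _ c).continuous.sub (SJ_Sm _ c).continuous).aestronglyMeasurable)
    (fun x => f x - SJ J c x)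
    (Eventually.of_forall fun x => by
      have := (SJ_tendsto hf x).comp (tendsto_add_atTop_nat J)
      refine Tendsto.sub_const (this.congr fun N => ?_) _
      simp [Function.comp, add_comm, hc])
  refine hl.trans ?_
  exact liminf_le_of_frequently_le' (Frequently.of_forall h1)

/-- Size of increments at scale `2^J`. -/
def rho (γ : ℝ) (J : ℕ) (y : Vec) : ℝ := (2:ℝ) ^ (-γ * J) * ((2:ℝ) ^ J * (∑ i, Dk (eL i) y) + 1)

def Cρ (γ : ℝ) : ℝ := 8 * Real.pi * gC (1 - γ) + 2 * gC γ

lemma dl_bound (hγ : 0 < γ) (hγ1 : γ < 1) {f : Vec → ℂ} (hf : Sm f)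
    (hb : ∀ j : ℕ, eLpNorm (lpBlockC j (fc f)) 3 μT ≤ ENNReal.ofReal ((2:ℝ) ^ (-γ * j)) * b) (J : ℕ) (y : Vec) :
    dl y f ≤ ENNReal.ofReal (Cρ γ * rho γ J y) * b := by
  have hS := SJ_Sm J (fc f)
  set S := SJ J (fc f) with hSd
  have e : (fun x => f (x + y) - f x) = (fun x => S (x + y) - S x) +
      ((fun x => (fun z => f z - S z) (x + y)) - fun x => f x - S x) := by
    funext x; simp only [Pi.add_apply, Pi.sub_apply]; ring
  have hc : Continuous fun z => f z - S z := hf.continuous.sub hS.continuous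
  have hp : Per fun z => f z - S z := fun x n => by dsimp only; rw [hf.per, hS.per]
  have t := tail_le hγ hf hb J
  have h1 : dl y f ≤ dl y S + (eLpNorm (fun z => f z - S z) 3 μT + eLpNorm (fun z => f z - S z) 3 μT) := by
    rw [dl, e]
    refine (eLpNorm_add_le ((cont_shift hS.continuous y).sub hS.continuous).aestronglyMeasurable
      ((cont_shift hc y).sub hc).aestronglyMeasurable (by norm_num)).trans ?_
    refine add_le_add le_rfl ((eLpNorm_sub_le (cont_shift hc y).aestronglyMeasurable
      hc.aestronglyMeasurable (by norm_num)).trans ?_)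
    rw [eLp_shift hp]
  have hg := gC_pos (α := 1 - γ) (by linarith)
  have hg' := gC_pos hγ
  have hD : ∀ i, 0 ≤ Dk (eL i) y := fun i => Dk_nonneg _ _
  have h2 : dl y S ≤ ENNReal.ofReal ((∑ i, Dk (eL i) y) *
      (8 * Real.pi * gC (1 - γ) * (2:ℝ) ^ ((1 - γ) * J))) * b := by
    refine (dl_grad hS y).trans ((Finset.sum_le_sum fun i _ => mul_le_mul_right (SJ_pd1 hγ1 hb i J) _).trans ?_)
    rw [ENNReal.ofReal_mul (Finset.sum_nonneg fun i _ => hD i),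
      ENNReal.ofReal_sum_of_nonneg fun i _ => hD i, Finset.sum_mul, Finset.sum_mul]
    refine Finset.sum_le_sum fun i _ => le_of_eq (by ring)
  refine h1.trans ((add_le_add h2 (add_le_add t t)).trans ?_)
  rw [← add_mul, ← add_mul, ← ENNReal.ofReal_add (by positivity) (by positivity),
    ← ENNReal.ofReal_add (mul_nonneg (Finset.sum_nonneg fun i _ => hD i) (by positivity)) (by positivity)]
  gcongr
  have e2 : (2:ℝ) ^ ((1 - γ) * (J:ℝ)) = (2:ℝ) ^ (-γ * (J:ℝ)) * (2:ℝ) ^ J := by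
    rw [← Real.rpow_natCast, ← Real.rpow_add (by norm_num)]; congr 1; ring
  rw [e2, rho, Cρ]
  have hs : 0 ≤ ∑ i, Dk (eL i) y := Finset.sum_nonneg fun i _ => hD i
  have p1 : 0 < (2:ℝ) ^ (-γ * (J:ℝ)) := by positivity
  have p2 : 0 < (2:ℝ) ^ J := by positivity
  generalize (2:ℝ) ^ (-γ * (J:ℝ)) = X at *
  generalize (2:ℝ) ^ J = Y at *
  generalize ∑ i, Dk (eL i) y = s at *
  have q1 : 0 ≤ 8 * Real.pi * gC (1 - γ) * X := by positivity
  have q2 : 0 ≤ gC γ * (X * Y * s) := by positivity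
  nlinarith

end

end

section

section

def tri (N : ℕ) (p : ℤ) : ℝ := max 0 ((N:ℝ) - |(p:ℝ)|)

lemma tri_zero {N : ℕ} {p : ℤ} (h : (N:ℤ) ≤ |p|) : tri N p = 0 := by
  rw [tri, max_eq_left]
  have : ((N:ℤ):ℝ) ≤ ((|p| : ℤ) : ℝ) := by exact_mod_cast h
  push_cast at this; linarith

lemma tri_eq {N : ℕ} {p : ℤ} (h : |p| ≤ (N:ℤ)) : tri N p = N - |(p:ℝ)| := by
  rw [tri, max_eq_right]
  have : ((|p| : ℤ) : ℝ) ≤ ((N:ℤ):ℝ) := by exact_mod_cast h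
  push_cast at this; linarith

lemma tri_nonneg (N : ℕ) (p : ℤ) : 0 ≤ tri N p := le_max_left _ _

def tS (N : ℕ) : Finset ℤ := Finset.Icc (-(N:ℤ)) N

def ttau (N : ℕ) : ℝ := ∑ p ∈ tS N, tri N p ^ 2

lemma ttau_lb (N : ℕ) : (N:ℝ) ^ 3 / 8 ≤ ttau N := by
  have hsub : Finset.Icc (0:ℤ) ((N / 2 : ℕ) : ℤ) ⊆ tS N := by
    intro p; simp only [tS, Finset.mem_Icc]; omega
  have h2 : ∀ p ∈ Finset.Icc (0:ℤ) ((N / 2 : ℕ) : ℤ), ((N:ℝ)/2) ^ 2 ≤ tri N p ^ 2 := by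
    intro p hp
    rw [Finset.mem_Icc] at hp
    have hp0 : |p| = p := abs_of_nonneg hp.1
    rw [tri_eq (by rw [hp0]; omega), abs_of_nonneg (by exact_mod_cast hp.1)]
    have : ((2 * p : ℤ) : ℝ) ≤ ((N:ℤ) : ℝ) := by exact_mod_cast (by omega)
    push_cast at this
    have h0 : (0:ℝ) ≤ N := by positivity
    gcongr
    linarith
  have h3 := (Finset.sum_le_sum h2).trans
    (Finset.sum_le_sum_of_subset_of_nonneg hsub fun p _ _ => sq_nonneg (tri N p))
  rw [Finset.sum_const, nsmul_eq_mul] at h3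
  refine le_trans ?_ h3
  have hc : ((Finset.Icc (0:ℤ) ((N / 2 : ℕ) : ℤ)).card : ℝ) = ((N / 2 : ℕ) : ℝ) + 1 := by
    rw [Int.card_Icc]
    have : (((N / 2 : ℕ) : ℤ) + 1 - 0).toNat = N / 2 + 1 := by omega
    rw [this]; push_cast; rfl
  rw [hc]
  have h4 : (N:ℝ) / 2 ≤ ((N / 2 : ℕ) : ℝ) + 1 := by
    have : N ≤ 2 * (N / 2) + 2 := by omega
    have : (N:ℝ) ≤ 2 * ((N / 2 : ℕ) : ℝ) + 2 := by exact_mod_cast this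
    linarith
  calc (N:ℝ) ^ 3 / 8 = (N:ℝ) / 2 * ((N:ℝ) / 2) ^ 2 := by ring
    _ ≤ _ := by gcongr

lemma tri_lap {N : ℕ} (hN : 0 < N) : ∑ p ∈ tS N, tri N p * (2 * tri N p - tri N (p + 1) - tri N (p + -1)) = 2 * N := by
  rw [Finset.sum_eq_single 0]
  · rw [tri_eq (by simp), tri_eq (by simp; omega), tri_eq (by simp; omega)]
    simp; ring
  · intro p hp hp0
    rw [tS, Finset.mem_Icc] at hp
    by_cases h : (N:ℤ) ≤ |p|
    · rw [tri_zero h, zero_mul]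
    · push Not at h
      have h' := abs_lt.1 h
      have e1 : |p + 1| ≤ N := by rw [abs_le]; omega
      have e2 : |p + -1| ≤ N := by rw [abs_le]; omega
      rw [tri_eq h.le, tri_eq e1, tri_eq e2]
      rcases lt_or_gt_of_ne hp0 with g | g
      · rw [abs_of_nonpos (by exact_mod_cast g.le), abs_of_nonpos (by exact_mod_cast (by omega : p + 1 ≤ 0)),
          abs_of_nonpos (by exact_mod_cast (by omega : p + -1 ≤ 0))]
        push_cast; ring
      · rw [abs_of_nonneg (by exact_mod_cast g.le), abs_of_nonneg (by exact_mod_cast (by omega : 0 ≤ p + 1)),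
          abs_of_nonneg (by exact_mod_cast (by omega : 0 ≤ p + -1))]
        push_cast; ring
  · intro h; exfalso; apply h; rw [tS, Finset.mem_Icc]; omega

def tB (N : ℕ) : Finset Lat := Fintype.piFinset fun _ => tS N
def tA (N : ℕ) (p : Lat) : ℝ := ∏ i, tri N (p i)

lemma tA_off {N : ℕ} (p : Lat) (hp : p ∉ tB N) : tA N p = 0 := by
  rw [tB, Fintype.mem_piFinset] at hp
  push Not at hp
  obtain ⟨i, hi⟩ := hp
  refine Finset.prod_eq_zero (Finset.mem_univ i) (tri_zero ?_)
  rw [tS, Finset.mem_Icc, ← abs_le] at hi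
  omega

lemma tA_sum (N : ℕ) (k : Lat) : ∑ p ∈ tB N, tA N p * tA N (p + k) = ∏ i, ∑ p ∈ tS N, tri N p * tri N (p + k i) := by
  rw [Finset.prod_univ_sum, tB]
  refine Finset.sum_congr rfl fun p _ => ?_
  rw [tA, tA, ← Finset.prod_mul_distrib]
  rfl

lemma tA_sq (N : ℕ) : ∑ p ∈ tB N, tA N p ^ 2 = ttau N ^ 3 := by
  have := tA_sum N 0
  simp only [add_zero, ← sq, Pi.zero_apply] at this
  rw [this]; simp [ttau]

/-- The Jackson kernel at scale `2^J`. -/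
def KJ (J : ℕ) : Vec → ℝ := Kr (tB (2 ^ J)) (tA (2 ^ J))

lemma ttau_pos (J : ℕ) : 0 < ttau (2 ^ J) :=
  lt_of_lt_of_le (by positivity) (ttau_lb (2 ^ J))

lemma KJ_PK (J : ℕ) : PK (KJ J) := Kr_PK tA_off (by rw [tA_sq]; have := ttau_pos J; positivity)

lemma KJ_mm (J : ℕ) (k : Lat) : mm (KJ J) k =
    (((∏ i, ∑ p ∈ tS (2 ^ J), tri (2 ^ J) p * tri (2 ^ J) (p + k i)) / ttau (2 ^ J) ^ 3 : ℝ) : ℂ) := by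
  rw [KJ, Kr_mm tA_off, tA_sq, tA_sum]

lemma KJ_supp {J : ℕ} {k : Lat} (hk : k ∉ FJ (J + 2)) : mm (KJ J) k = 0 := by
  have : ∃ i, 2 * (2:ℤ) ^ J ≤ |k i| := by
    by_contra hc
    push Not at hc
    apply hk
    rw [mem_FJ]
    have h1 : latNorm k ^ 2 < ((2:ℝ) ^ (J + 2)) ^ 2 := by
      rw [latNorm_sq]
      have h2 : ∀ i, (k i : ℝ) ^ 2 ≤ (2 * (2:ℝ) ^ J) ^ 2 := by
        intro i
        rw [← sq_abs (k i : ℝ)]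
        have h3 : ((|k i| : ℤ) : ℝ) ≤ ((2 * 2 ^ J : ℤ) : ℝ) := by exact_mod_cast (hc i).le
        push_cast at h3
        gcongr
      calc ∑ i, (k i : ℝ) ^ 2 ≤ ∑ _i : Fin 3, (2 * (2:ℝ) ^ J) ^ 2 := Finset.sum_le_sum fun i _ => h2 i
        _ < _ := by
          simp
          have : (0:ℝ) < 2 ^ J := by positivity
          rw [pow_add]; nlinarith
    exact lt_of_pow_lt_pow_left₀ 2 (by positivity) h1
  obtain ⟨i, hi⟩ := this
  rw [KJ_mm, Finset.prod_eq_zero (Finset.mem_univ i)]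
  · simp
  · refine Finset.sum_eq_zero fun p hp => ?_
    rw [tS, Finset.mem_Icc, ← abs_le] at hp
    rw [tri_zero (p := p + k i), mul_zero]
    have h1 : |k i| ≤ |p + k i| + |p| := by
      have := abs_sub (p + k i) p
      simpa using this
    push_cast at hp ⊢
    linarith

lemma KJ_one (J : ℕ) (i : Fin 3) (q : ℤ) : mm (KJ J) (Pi.single i q) =
    (((∑ p ∈ tS (2 ^ J), tri (2 ^ J) p * tri (2 ^ J) (p + q)) / ttau (2 ^ J) : ℝ) : ℂ) := by
  rw [KJ_mm]
  congr 1
  have hτ := (ttau_pos J).ne'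
  have e : ∀ j ∈ Finset.univ.erase i, ∑ p ∈ tS (2 ^ J), tri (2 ^ J) p * tri (2 ^ J) (p + (Pi.single i q : Lat) j) = ttau (2 ^ J) := by
    intro j hj
    rw [Pi.single_eq_of_ne (Finset.ne_of_mem_erase hj)]
    simp only [add_zero, ← sq, ttau]
  rw [← Finset.mul_prod_erase _ _ (Finset.mem_univ i), Finset.prod_congr rfl e, Pi.single_eq_same]
  simp
  field_simp

lemma KJ_mom (J : ℕ) (i : Fin 3) : mom (KJ J) (eL i) ≤ 16 / (2:ℝ) ^ (2 * J) := by
  have h := (KJ_PK J).mom_eq (eL i)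
  have en : -eL i = Pi.single i (-1) := by rw [eL, Pi.single_neg]
  rw [en, eL, KJ_one, KJ_one] at h
  have h' : mom (KJ J) (eL i) = 2 - (∑ p ∈ tS (2 ^ J), tri (2 ^ J) p * tri (2 ^ J) (p + 1)) / ttau (2 ^ J)
     - (∑ p ∈ tS (2 ^ J), tri (2 ^ J) p * tri (2 ^ J) (p + -1)) / ttau (2 ^ J) := by
    exact_mod_cast h
  have hτ := ttau_pos J
  have e : mom (KJ J) (eL i) * ttau (2 ^ J) = 2 * (2 ^ J : ℕ) := by
    rw [← tri_lap (N := 2 ^ J) (by positivity), h']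
    have : ∑ p ∈ tS (2 ^ J), tri (2 ^ J) p * (2 * tri (2 ^ J) p - tri (2 ^ J) (p + 1) - tri (2 ^ J) (p + -1)) =
        2 * ttau (2 ^ J) - ∑ p ∈ tS (2 ^ J), tri (2 ^ J) p * tri (2 ^ J) (p + 1) -
          ∑ p ∈ tS (2 ^ J), tri (2 ^ J) p * tri (2 ^ J) (p + -1) := by
      rw [ttau, Finset.mul_sum, ← Finset.sum_sub_distrib, ← Finset.sum_sub_distrib]
      exact Finset.sum_congr rfl fun p _ => by ring
    rw [this]; field_simp
  have hl := ttau_lb (2 ^ J)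
  have e2 : mom (KJ J) (eL i) = 2 * (2 ^ J : ℕ) / ttau (2 ^ J) := by
    rw [← e]; field_simp
  rw [e2, div_le_div_iff₀ hτ (by positivity)]
  push_cast at hl ⊢
  have : (2:ℝ) ^ (2 * J) = ((2:ℝ) ^ J) ^ 2 := by rw [← pow_mul, mul_comm]
  rw [this]
  nlinarith

lemma KJ_tendsto (k : Lat) : Tendsto (fun J => mm (KJ J) k) atTop (𝓝 1) := by
  refine PK.mm_tendsto KJ_PK (fun i => ?_) k
  refine squeeze_zero (fun N => PK.mom_nonneg _) (fun J => KJ_mom J i) ?_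
  have h1 : Tendsto (fun J : ℕ => 16 * ((1/4:ℝ)) ^ J) atTop (𝓝 (16 * 0)) :=
    (tendsto_pow_atTop_nhds_zero_of_lt_one (by norm_num) (by norm_num)).const_mul _
  rw [mul_zero] at h1
  refine h1.congr fun J => ?_
  rw [pow_mul, one_div, inv_pow]; norm_num; rfl

/-- Second moment of the increment scale. -/
lemma rho_mom (γ : ℝ) (J : ℕ) : ∫⁻ y, ENNReal.ofReal (rho γ J y ^ 2) ∂PP (KJ J) ≤
    ENNReal.ofReal (196 * (2:ℝ) ^ (-(2 * γ) * J)) := by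
  have hK := KJ_PK J
  have hP := hK.prob
  set X := (2:ℝ) ^ (-γ * (J:ℝ)) with hX
  have e0 : (2:ℝ) ^ (-(2 * γ) * (J:ℝ)) = X ^ 2 := by
    rw [hX, sq, ← Real.rpow_add (by norm_num)]; congr 1; ring
  have hb : ∀ y, rho γ J y ^ 2 ≤ X ^ 2 * (4 * ((2:ℝ) ^ J) ^ 2 * (∑ i, Dk (eL i) y ^ 2) + 4) := by
    intro y
    rw [rho, ← hX, mul_pow]
    gcongr
    rw [Fin.sum_univ_three, Fin.sum_univ_three]
    generalize Dk (eL 0) y = a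
    generalize Dk (eL 1) y = b
    generalize Dk (eL 2) y = c
    generalize (2:ℝ) ^ J = N
    nlinarith [sq_nonneg (N * a - N * b), sq_nonneg (N * a - N * c), sq_nonneg (N * b - N * c),
      sq_nonneg (N * a - 1), sq_nonneg (N * b - 1), sq_nonneg (N * c - 1)]
  have hi : Integrable (fun y => X ^ 2 * (4 * ((2:ℝ) ^ J) ^ 2 * (∑ i, Dk (eL i) y ^ 2) + 4)) (PP (KJ J)) :=
    (((integrable_finsetSum _ fun i _ => hK.mom_int (eL i)).const_mul _).add (integrable_const _)).const_mul _
  refine (lintegral_mono fun y => ENNReal.ofReal_le_ofReal (hb y)).trans ?_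
  rw [← ofReal_integral_eq_lintegral_ofReal hi (Eventually.of_forall fun y => by positivity)]
  refine ENNReal.ofReal_le_ofReal ?_
  rw [integral_const_mul, integral_add ((integrable_finsetSum _ fun i _ => hK.mom_int (eL i)).const_mul _) (integrable_const _),
    integral_const_mul, integral_finsetSum _ fun i _ => hK.mom_int (eL i), e0]
  have h3 : ∑ i, ∫ y, Dk (eL i) y ^ 2 ∂PP (KJ J) ≤ ∑ _i : Fin 3, 16 / (2:ℝ) ^ (2 * J) :=
    Finset.sum_le_sum fun i _ => KJ_mom J i
  have e3 : (2:ℝ) ^ (2 * J) = ((2:ℝ) ^ J) ^ 2 := by rw [← pow_mul, mul_comm]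
  have hN : 0 < ((2:ℝ) ^ J) ^ 2 := by positivity
  rw [e3] at h3
  simp only [Finset.sum_const, Finset.card_univ, Fintype.card_fin, nsmul_eq_mul] at h3
  have h4 : ((2:ℝ) ^ J) ^ 2 * ∑ i, ∫ y, Dk (eL i) y ^ 2 ∂PP (KJ J) ≤ 48 := by
    calc _ ≤ ((2:ℝ) ^ J) ^ 2 * ((3:ℕ) * (16 / ((2:ℝ) ^ J) ^ 2)) := by gcongr
      _ = 48 := by field_simp; norm_num
  simp only [integral_const, probReal_univ, one_smul]
  nlinarith [sq_nonneg X]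

end

end

section

section

/-- Smoothing by a kernel. -/
def smK (K : Vec → ℝ) (f : Vec → ℂ) (x : Vec) : ℂ := ∫ y, f (x + y) ∂PP K

lemma smK_hasSum {K : Vec → ℝ} (hK : PK K) {f : Vec → ℂ} (hf : Sm f) (x : Vec) :
    HasSum (fun n => fc f n * chr n x * mm K n) (smK K f x) := by
  have h := hasSum_parseval_series (a := fun n => fc f n * chr n x) (f := fun y => f (x + y))
    (g := fun y => (K y : ℂ)) (by simpa [chr_norm] using fc_summable hf)
    (fun y => by
      have h := hasSum_fourier hf (x + y)
      simp only [chr_shift] at h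
      simpa only [mul_assoc] using h) hK.sm.integrable
  have e1 : ∀ n, fc (fun y => (K y : ℂ)) (-n) = mm K n := fun n => by
    rw [fc_def, neg_neg]; rfl
  simp only [e1] at h
  have e2 : smK K f x = ∫ y, f (x + y) * (K y : ℂ) ∂μT := by
    rw [smK, hK.integral]; simp only [mul_comm]
  rw [e2]; exact h

lemma smK_eq (J : ℕ) {f : Vec → ℂ} (hf : Sm f) :
    smK (KJ J) f = SJ (J + 2) (fun k => mm (KJ J) k * fc f k) := by
  funext x
  have h := smK_hasSum (KJ_PK J) hf x
  have h2 : HasSum (fun n => fc f n * chr n x * mm (KJ J) n)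
      (∑ n ∈ FJ (J + 2), fc f n * chr n x * mm (KJ J) n) :=
    hasSum_sum_of_ne_finset_zero fun n hn => by rw [KJ_supp hn, mul_zero]
  rw [h.unique h2, SJ]
  exact Finset.sum_congr rfl fun k _ => by ring

lemma fc_chr (k n : Lat) : fc (chr k) n = if k = n then 1 else 0 := by
  rw [fc_def]
  simp only [← chr_add]
  rw [int_chr]
  simp only [← sub_eq_add_neg, sub_eq_zero]

lemma fc_trig (s : Finset Lat) (a : Lat → ℂ) (n : Lat) :
    fc (fun x => ∑ k ∈ s, a k * chr k x) n = if n ∈ s then a n else 0 := by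
  rw [fc_sum s fun k _ => ((Sm.chr k).const_mul _).integrable]
  simp only [fc_const_mul]
  have : ∀ k, fc (fun x => chr k x) n = if k = n then 1 else 0 := fun k => fc_chr k n
  simp [this]

lemma fc_SJ (J : ℕ) (a : Lat → ℂ) (n : Lat) : fc (SJ J a) n = if n ∈ FJ J then a n else 0 := fc_trig _ _ _

lemma smK_Sm (J : ℕ) {f : Vec → ℂ} (hf : Sm f) : Sm (smK (KJ J) f) := by
  rw [smK_eq J hf]; exact SJ_Sm _ _

lemma fc_smK (J : ℕ) {f : Vec → ℂ} (hf : Sm f) (n : Lat) :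
    fc (smK (KJ J) f) n = mm (KJ J) n * fc f n := by
  rw [smK_eq J hf, fc_SJ]
  split_ifs with h
  · rfl
  · rw [KJ_supp h, zero_mul]

lemma pd_smK (J : ℕ) {f : Vec → ℂ} (hf : Sm f) (i : Fin 3) :
    pd i (smK (KJ J) f) = smK (KJ J) (pd i f) := by
  rw [smK_eq J hf, smK_eq J (hf.pd i), pd_SJ]
  congr 1; funext k; rw [fc_pd' hf]; ring

lemma smK_SJ (J : ℕ) {f : Vec → ℂ} (hf : Sm f) :
    smK (KJ J) f = smK (KJ J) (SJ (J + 2) (fc f)) := by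
  rw [smK_eq J hf, smK_eq J (SJ_Sm _ _)]
  funext x
  refine Finset.sum_congr rfl fun k hk => ?_
  dsimp only
  rw [fc_SJ, if_pos hk]

lemma smK_eLp {K : Vec → ℝ} (hK : PK K) {f : Vec → ℂ} (hf : Sm f) :
    eLpNorm (smK K f) 3 μT ≤ eLpNorm f 3 μT := by
  have := hK.prob
  have h := avg_eLp (PP K) measurable_id (w := fun _ => 1) (C := 1) (by simp) hf.continuous hf.per
  have e : smK K f = fun x => ∫ y, f (x + y) ∂PP K := rfl
  rw [e]; simpa using h

lemma smK_pd2 {γ : ℝ} {b : ℝ≥0∞} (hγ : γ < 1) {f : Vec → ℂ} (hf : Sm f)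
    (hb : ∀ j : ℕ, eLpNorm (lpBlockC j (fc f)) 3 μT ≤ ENNReal.ofReal ((2:ℝ) ^ (-γ * j)) * b)
    (i l : Fin 3) (J : ℕ) : eLpNorm (pd l (pd i (smK (KJ J) f))) 3 μT ≤
      ENNReal.ofReal (1024 * Real.pi ^ 2 * gC (2 - γ) * (2:ℝ) ^ ((2 - γ) * J) * 2 ^ (-(2*γ))) * b := by
  have hS := SJ_Sm (J + 2) (fc f)
  rw [smK_SJ J hf, pd_smK J hS, pd_smK J (hS.pd i)]
  refine (smK_eLp (KJ_PK J) ((hS.pd i).pd l)).trans ((SJ_pd2 hγ hb i l (J + 2)).trans (le_of_eq ?_))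
  congr 2
  have : (2:ℝ) ^ ((2 - γ) * ((J + 2 : ℕ) : ℝ)) = 2 ^ ((2 - γ) * J) * (16 * 2 ^ (-(2 * γ))) := by
    rw [show (16:ℝ) = 2 ^ (4:ℝ) by norm_num, ← Real.rpow_add two_pos, ← Real.rpow_add two_pos]
    congr 1; push_cast; ring
  rw [this]; ring

lemma cov_id {K : Vec → ℝ} (hK : PK K) {f g : Vec → ℂ} (hf : Sm f) (hg : Sm g) (x : Vec) :
    smK K (fun y => f y * g y) x - smK K f x * smK K g x =
      1 / 2 * ∫ p : Vec × Vec, (f (x + p.1) - f (x + p.2)) * (g (x + p.1) - g (x + p.2))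
        ∂(PP K).prod (PP K) := by
  have hP := hK.prob
  have aux : ∀ {h : Vec → ℂ}, Sm h → Integrable (fun y => h (x + y)) (PP K) := fun {h} hh =>
    hK.int_bdd (hh.continuous.comp (continuous_const.add continuous_id)) fun y n => by
      rw [← add_assoc, hh.per]
  have i1 := aux hf
  have i2 := aux hg
  have i3 := aux (hf.mul hg)
  have i0 : Integrable (fun _ : Vec => (1:ℂ)) (PP K) := integrable_const _
  have j1 : Integrable (fun p : Vec × Vec => f (x + p.1) * g (x + p.1) * 1) ((PP K).prod (PP K)) := i3.mul_prod i0
  have j2 : Integrable (fun p : Vec × Vec => 1 * (f (x + p.2) * g (x + p.2))) ((PP K).prod (PP K)) := i0.mul_prod i3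
  have j3 : Integrable (fun p : Vec × Vec => f (x + p.1) * g (x + p.2)) ((PP K).prod (PP K)) := i1.mul_prod i2
  have j4 : Integrable (fun p : Vec × Vec => g (x + p.1) * f (x + p.2)) ((PP K).prod (PP K)) := i2.mul_prod i1
  have e : ∀ p : Vec × Vec, (f (x + p.1) - f (x + p.2)) * (g (x + p.1) - g (x + p.2)) =
      (f (x + p.1) * g (x + p.1) * 1 + 1 * (f (x + p.2) * g (x + p.2))) - f (x + p.1) * g (x + p.2)
        - g (x + p.1) * f (x + p.2) := fun p => by ring
  simp only [e]
  have j5 : Integrable (fun p : Vec × Vec => f (x + p.1) * g (x + p.1) * 1 + 1 * (f (x + p.2) * g (x + p.2)))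
    ((PP K).prod (PP K)) := j1.add j2
  have j6 : Integrable (fun p : Vec × Vec => f (x + p.1) * g (x + p.1) * 1 + 1 * (f (x + p.2) * g (x + p.2))
    - f (x + p.1) * g (x + p.2)) ((PP K).prod (PP K)) := j5.sub j3
  rw [integral_sub j6 j4, integral_sub j5 j3, integral_add j1 j2]
  rw [integral_prod_mul (fun y => f (x + y) * g (x + y)) (fun _ => (1:ℂ)),
    integral_prod_mul (fun _ => (1:ℂ)) (fun y => f (x + y) * g (x + y)),
    integral_prod_mul (fun y => f (x + y)) (fun y => g (x + y)),
    integral_prod_mul (fun y => g (x + y)) (fun y => f (x + y))]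
  simp only [smK]
  simp
  ring

lemma holder3 {A B C : Vec → ℂ} (hA : Continuous A) (hB : Continuous B) (hC : Continuous C) :
    ∫⁻ x, ‖A x‖ₑ * ‖B x‖ₑ * ‖C x‖ₑ ∂μT ≤ eLpNorm A 3 μT * eLpNorm B 3 μT * eLpNorm C 3 μT := by
  have h := ENNReal.lintegral_prod_norm_pow_le (μ := μT) (Finset.univ : Finset (Fin 3))
    (f := fun i x => (![‖A x‖ₑ, ‖B x‖ₑ, ‖C x‖ₑ] i) ^ (3:ℝ)) (p := fun _ => 1/3)
    (by
      intro i _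
      refine (Measurable.pow_const ?_ _).aemeasurable
      fin_cases i
      · exact hA.measurable.enorm
      · exact hB.measurable.enorm
      · exact hC.measurable.enorm) (by simp) (by intros; norm_num)
  have e : ∀ z : ℝ≥0∞, (z ^ (3:ℝ)) ^ (1/3:ℝ) = z := fun z => by rw [← ENNReal.rpow_mul]; norm_num
  simp only [Fin.prod_univ_three, e] at h
  rw [eLp3, eLp3, eLp3]
  exact h

end

end

section

section

lemma rho_nonneg (γ : ℝ) (J : ℕ) (y : Vec) : 0 ≤ rho γ J y := by
  unfold rho
  have : 0 ≤ ∑ i, Dk (eL i) y := Finset.sum_nonneg fun i _ => Dk_nonneg _ _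
  positivity

lemma rho_cont (γ : ℝ) (J : ℕ) : Continuous (rho γ J) := by
  unfold rho
  have : Continuous fun y => ∑ i, Dk (eL i) y := continuous_finsetSum _ fun i _ => Dk_cont _
  fun_prop

lemma Cρ_nonneg {γ : ℝ} (h0 : 0 < γ) (h1 : γ < 1) : 0 ≤ Cρ γ := by
  have a := gC_pos (α := γ) h0
  have b := gC_pos (α := 1 - γ) (by linarith)
  unfold Cρ; positivity

lemma dl2 {f : Vec → ℂ} (hf : Sm f) (y z : Vec) :
    eLpNorm (fun x => f (x + y) - f (x + z)) 3 μT ≤ dl y f + dl z f := by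
  have e : (fun x => f (x + y) - f (x + z)) = (fun x => f (x + y) - f x) - fun x => f (x + z) - f x := by
    funext x; simp
  rw [e]
  have hc : ∀ y, Continuous fun x => f (x + y) - f x := fun y => (cont_shift hf.continuous y).sub hf.continuous
  exact eLpNorm_sub_le (hc y).aestronglyMeasurable (hc z).aestronglyMeasurable (by norm_num)

lemma trilin {γ : ℝ} {b : ℝ≥0∞} (J : ℕ) (h0 : 0 < γ) (h1 : γ < 1) {f g W : Vec → ℂ} (hf : Sm f) (hg : Sm g) (hW : Sm W)
    (hbf : ∀ j : ℕ, eLpNorm (lpBlockC j (fc f)) 3 μT ≤ ENNReal.ofReal ((2:ℝ) ^ (-γ * j)) * b)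
    (hbg : ∀ j : ℕ, eLpNorm (lpBlockC j (fc g)) 3 μT ≤ ENNReal.ofReal ((2:ℝ) ^ (-γ * j)) * b) :
    ‖∫ x, (smK (KJ J) (fun y => f y * g y) x - smK (KJ J) f x * smK (KJ J) g x) * W x ∂μT‖ₑ ≤
      ENNReal.ofReal (784 * Cρ γ ^ 2 * (2:ℝ) ^ (-(2 * γ) * J)) * b ^ 2 * eLpNorm W 3 μT := by
  have hK := KJ_PK J
  have hP := hK.prob
  set P := PP (KJ J) with hPd
  have hCρ := Cρ_nonneg h0 h1
  have cf := hf.continuous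
  have cg := hg.continuous
  have cW := hW.continuous
  refine (enorm_integral_le_lintegral_enorm _).trans ?_
  have s1 : ∀ x, ‖(smK (KJ J) (fun y => f y * g y) x - smK (KJ J) f x * smK (KJ J) g x) * W x‖ₑ ≤
      ∫⁻ p : Vec × Vec, ‖f (x + p.1) - f (x + p.2)‖ₑ * ‖g (x + p.1) - g (x + p.2)‖ₑ * ‖W x‖ₑ ∂P.prod P := by
    intro x
    rw [cov_id hK hf hg, lintegral_mul_const' _ _ enorm_ne_top, enorm_mul]
    gcongr
    rw [enorm_mul]
    calc ‖(1/2 : ℂ)‖ₑ * _ ≤ 1 * _ := by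
          gcongr
          rw [← ofReal_norm]; norm_num
      _ ≤ _ := by
          rw [one_mul]
          refine (enorm_integral_le_lintegral_enorm _).trans (le_of_eq ?_)
          simp only [enorm_mul]; rfl
  refine (lintegral_mono s1).trans ?_
  rw [lintegral_lintegral_swap (by
    refine Measurable.aemeasurable ?_
    unfold Function.uncurry
    have m1 : Continuous fun q : Vec × (Vec × Vec) => f (q.1 + q.2.1) - f (q.1 + q.2.2) := by fun_prop
    have m2 : Continuous fun q : Vec × (Vec × Vec) => g (q.1 + q.2.1) - g (q.1 + q.2.2) := by fun_prop
    have m3 : Continuous fun q : Vec × (Vec × Vec) => W q.1 := by fun_prop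
    exact (m1.measurable.enorm.mul m2.measurable.enorm).mul m3.measurable.enorm)]
  have s2 : ∀ p : Vec × Vec, ∫⁻ x, ‖f (x + p.1) - f (x + p.2)‖ₑ * ‖g (x + p.1) - g (x + p.2)‖ₑ * ‖W x‖ₑ ∂μT ≤
      (ENNReal.ofReal (rho γ J p.1 ^ 2) + ENNReal.ofReal (rho γ J p.2 ^ 2)) *
        (ENNReal.ofReal (2 * Cρ γ ^ 2) * b ^ 2 * eLpNorm W 3 μT) := by
    intro p
    have r1 := rho_nonneg γ J p.1
    have r2 := rho_nonneg γ J p.2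
    have hd : ∀ {f : Vec → ℂ}, Sm f →
        (∀ j : ℕ, eLpNorm (lpBlockC j (fc f)) 3 μT ≤ ENNReal.ofReal ((2:ℝ) ^ (-γ * j)) * b) →
        eLpNorm (fun x => f (x + p.1) - f (x + p.2)) 3 μT ≤
          ENNReal.ofReal (Cρ γ * (rho γ J p.1 + rho γ J p.2)) * b := by
      intro f hf hb
      refine (dl2 hf _ _).trans ((add_le_add (dl_bound h0 h1 hf hb J _) (dl_bound h0 h1 hf hb J _)).trans (le_of_eq ?_))
      rw [← add_mul, ← ENNReal.ofReal_add (by positivity) (by positivity), mul_add]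
    refine (holder3 ((cont_shift cf _).sub (cont_shift cf _)) ((cont_shift cg _).sub (cont_shift cg _)) cW).trans ?_
    refine (mul_le_mul' (mul_le_mul' (hd hf hbf) (hd hg hbg)) le_rfl).trans ?_
    rw [← ENNReal.ofReal_add (by positivity) (by positivity)]
    calc _ = ENNReal.ofReal ((Cρ γ * (rho γ J p.1 + rho γ J p.2)) ^ 2) * (b ^ 2 * eLpNorm W 3 μT) := by
          rw [ENNReal.ofReal_pow (by positivity)]; ring
      _ ≤ ENNReal.ofReal ((rho γ J p.1 ^ 2 + rho γ J p.2 ^ 2) * (2 * Cρ γ ^ 2)) * (b ^ 2 * eLpNorm W 3 μT) := by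
          gcongr
          have := mul_nonneg (sq_nonneg (Cρ γ)) (sq_nonneg (rho γ J p.1 - rho γ J p.2))
          nlinarith
      _ = _ := by
          rw [ENNReal.ofReal_mul (by positivity)]; ring
  refine (lintegral_mono s2).trans ?_
  have mr : Measurable fun y => ENNReal.ofReal (rho γ J y ^ 2) := ((rho_cont γ J).pow 2).measurable.ennreal_ofReal
  have mr1 : Measurable fun p : Vec × Vec => ENNReal.ofReal (rho γ J p.1 ^ 2) := mr.comp measurable_fst
  have mr2 : Measurable fun p : Vec × Vec => ENNReal.ofReal (rho γ J p.2 ^ 2) := mr.comp measurable_snd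
  have mr3 : Measurable fun p : Vec × Vec => ENNReal.ofReal (rho γ J p.1 ^ 2) + ENNReal.ofReal (rho γ J p.2 ^ 2) :=
    mr1.add mr2
  rw [lintegral_mul_const _ mr3, lintegral_add_left mr1]
  have q1 : ∫⁻ p : Vec × Vec, ENNReal.ofReal (rho γ J p.1 ^ 2) ∂P.prod P = ∫⁻ y, ENNReal.ofReal (rho γ J y ^ 2) ∂P :=
    (measurePreserving_fst (μ := P) (ν := P)).lintegral_comp mr
  have q2 : ∫⁻ p : Vec × Vec, ENNReal.ofReal (rho γ J p.2 ^ 2) ∂P.prod P = ∫⁻ y, ENNReal.ofReal (rho γ J y ^ 2) ∂P :=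
    (measurePreserving_snd (μ := P) (ν := P)).lintegral_comp mr
  rw [q1, q2]
  have hr := rho_mom γ J
  refine (mul_le_mul' (add_le_add hr hr) le_rfl).trans (le_of_eq ?_)
  rw [← ENNReal.ofReal_add (by positivity) (by positivity), ← mul_assoc, ← mul_assoc,
    ← ENNReal.ofReal_mul (by positivity)]
  congr 3; ring

lemma Sm_ext {f g : Vec → ℂ} (hf : Sm f) (hg : Sm g) (h : ∀ n, fc f n = fc g n) : f = g := by
  funext x
  have a := hasSum_fourier hf x
  simp only [h] at a
  exact a.unique (hasSum_fourier hg x)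

lemma pd_comm {f : Vec → ℂ} (hf : Sm f) (i j : Fin 3) : pd i (pd j f) = pd j (pd i f) :=
  Sm_ext ((hf.pd j).pd i) ((hf.pd i).pd j) fun n => by
    rw [fc_pd' (hf.pd j), fc_pd' hf, fc_pd' (hf.pd i), fc_pd' hf]; ring

lemma pd_addS {f g : Vec → ℂ} (hf : Sm f) (hg : Sm g) (i : Fin 3) (x : Vec) :
    pd i (fun y => f y + g y) x = pd i f x + pd i g x := by
  unfold pd; rw [fderiv_fun_add (hf.differentiable x) (hg.differentiable x)]; rfl

lemma pd_subS {f g : Vec → ℂ} (hf : Sm f) (hg : Sm g) (i : Fin 3) (x : Vec) :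
    pd i (fun y => f y - g y) x = pd i f x - pd i g x := by
  unfold pd; rw [fderiv_fun_sub (hf.differentiable x) (hg.differentiable x)]; rfl

lemma pd_mulS {f g : Vec → ℂ} (hf : Sm f) (hg : Sm g) (i : Fin 3) (x : Vec) :
    pd i (fun y => f y * g y) x = pd i f x * g x + f x * pd i g x :=
  pd_mul (hf.differentiable x) (hg.differentiable x) i

lemma div_curlS {U : Fin 3 → Vec → ℂ} (hU : ∀ j, Sm (U j)) (x : Vec) : ∑ i, pd i (curlS U i) x = 0 := by
  have e : ∀ i, pd i (curlS U i) x = pd i (pd (i+1) (U (i+2))) x - pd i (pd (i+2) (U (i+1))) x :=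
    fun i => pd_subS ((hU _).pd _) ((hU _).pd _) i x
  simp only [e, Fin.sum_univ_three, show (0:Fin 3)+1=1 from rfl, show (0:Fin 3)+2=2 from rfl,
    show (1:Fin 3)+1=2 from rfl, show (1:Fin 3)+2=0 from rfl, show (2:Fin 3)+1=0 from rfl,
    show (2:Fin 3)+2=1 from rfl]
  rw [pd_comm (hU 2) 1 0, pd_comm (hU 1) 2 0, pd_comm (hU 0) 2 1]
  ring

lemma curlS_val (U : Fin 3 → Vec → ℂ) (x : Vec) :
    curlS U 0 x = pd 1 (U 2) x - pd 2 (U 1) x ∧ curlS U 1 x = pd 2 (U 0) x - pd 0 (U 2) x ∧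
    curlS U 2 x = pd 0 (U 1) x - pd 1 (U 0) x := ⟨rfl, rfl, rfl⟩

/-- Algebraic vanishing of the smooth helicity flux. -/
lemma flux_zero {U : Fin 3 → Vec → ℂ} (hU : ∀ j, Sm (U j)) (hd : ∀ x, ∑ i, pd i (U i) x = 0) :
    ∑ i, ∑ j, ∫ x, U i x * U j x * pd i (curlS U j) x ∂μT = 0 := by
  have hΩ := curlS_sm hU
  have hdΩ := div_curlS hU
  have hv := curlS_val U
  set Ω := curlS U with hΩd
  clear_value Ω
  have hA : Sm (fun x => U 0 x * Ω 0 x + U 1 x * Ω 1 x + U 2 x * Ω 2 x) :=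
    (((hU 0).mul (hΩ 0)).add ((hU 1).mul (hΩ 1))).add ((hU 2).mul (hΩ 2))
  have hB : Sm (fun x => U 0 x * U 0 x + U 1 x * U 1 x + U 2 x * U 2 x) :=
    (((hU 0).mul (hU 0)).add ((hU 1).mul (hU 1))).add ((hU 2).mul (hU 2))
  have dA : ∀ i x, pd i (fun x => U 0 x * Ω 0 x + U 1 x * Ω 1 x + U 2 x * Ω 2 x) x =
      pd i (U 0) x * Ω 0 x + U 0 x * pd i (Ω 0) x + (pd i (U 1) x * Ω 1 x + U 1 x * pd i (Ω 1) x) +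
      (pd i (U 2) x * Ω 2 x + U 2 x * pd i (Ω 2) x) := by
    intro i x
    rw [pd_addS (((hU 0).mul (hΩ 0)).add ((hU 1).mul (hΩ 1))) ((hU 2).mul (hΩ 2)),
      pd_addS ((hU 0).mul (hΩ 0)) ((hU 1).mul (hΩ 1)), pd_mulS (hU 0) (hΩ 0), pd_mulS (hU 1) (hΩ 1),
      pd_mulS (hU 2) (hΩ 2)]
  have dB : ∀ i x, pd i (fun x => U 0 x * U 0 x + U 1 x * U 1 x + U 2 x * U 2 x) x =
      2 * (U 0 x * pd i (U 0) x + U 1 x * pd i (U 1) x + U 2 x * pd i (U 2) x) := by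
    intro i x
    rw [pd_addS (((hU 0).mul (hU 0)).add ((hU 1).mul (hU 1))) ((hU 2).mul (hU 2)),
      pd_addS ((hU 0).mul (hU 0)) ((hU 1).mul (hU 1)), pd_mulS (hU 0) (hU 0), pd_mulS (hU 1) (hU 1),
      pd_mulS (hU 2) (hU 2)]
    ring
  set A := fun x => U 0 x * Ω 0 x + U 1 x * Ω 1 x + U 2 x * Ω 2 x with hAd
  set B := fun x => U 0 x * U 0 x + U 1 x * U 1 x + U 2 x * U 2 x with hBd
  have hG1 : ∀ i, Sm (fun x => U i x * A x) := fun i => (hU i).mul hA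
  have hG2 : ∀ i, Sm (fun x => B x * Ω i x) := fun i => hB.mul (hΩ i)
  have key : ∀ x, ∑ i, ∑ j, U i x * U j x * pd i (Ω j) x =
      ∑ i, (pd i (fun x => U i x * A x) x - 1/2 * pd i (fun x => B x * Ω i x) x) := by
    intro x
    have e1 : ∀ i, pd i (fun x => U i x * A x) x = _ := fun i => pd_mulS (hU i) hA i x
    have e2 : ∀ i, pd i (fun x => B x * Ω i x) x = _ := fun i => pd_mulS hB (hΩ i) i x
    simp only [e1, e2, dA, dB]
    have h1 := hd x
    have h2 := hdΩ x
    obtain ⟨v0, v1, v2⟩ := hv x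
    simp only [hAd, hBd]
    simp only [Fin.sum_univ_three] at h1 h2 ⊢
    rw [v0, v1, v2]
    linear_combination (-(U 0 x * (pd 1 (U 2) x - pd 2 (U 1) x) + U 1 x * (pd 2 (U 0) x - pd 0 (U 2) x) + U 2 x * (pd 0 (U 1) x - pd 1 (U 0) x))) * h1 +
      (1/2 * (U 0 x * U 0 x + U 1 x * U 1 x + U 2 x * U 2 x)) * h2
  have I : ∀ i j, Integrable (fun x => U i x * U j x * pd i (Ω j) x) μT := fun i j =>
    (((hU i).mul (hU j)).mul ((hΩ j).pd i)).integrable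
  have e3 : ∑ i, ∑ j, ∫ x, U i x * U j x * pd i (Ω j) x ∂μT =
      ∫ x, ∑ i, ∑ j, U i x * U j x * pd i (Ω j) x ∂μT := by
    rw [integral_finsetSum _ fun i _ => integrable_finsetSum _ fun j _ => I i j]
    refine Finset.sum_congr rfl fun i _ => ?_
    rw [integral_finsetSum _ fun j _ => I i j]
  rw [e3]
  simp only [key]
  have J1 : ∀ i, Integrable (fun x => pd i (fun x => U i x * A x) x) μT := fun i => ((hG1 i).pd i).integrable
  have J2 : ∀ i, Integrable (fun x => 1/2 * pd i (fun x => B x * Ω i x) x) μT := fun i =>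
    (((hG2 i).pd i).const_mul _).integrable
  have J3 : ∀ i, Integrable (fun x => pd i (fun x => U i x * A x) x - 1/2 * pd i (fun x => B x * Ω i x) x) μT :=
    fun i => (J1 i).sub (J2 i)
  rw [integral_finsetSum _ fun i _ => J3 i]
  refine Finset.sum_eq_zero fun i _ => ?_
  rw [integral_sub (J1 i) (J2 i), integral_const_mul]
  have k1 : ∫ x, pd i (fun x => U i x * A x) x ∂μT = 0 := integral_pd (hG1 i) i
  have k2 : ∫ x, pd i (fun x => B x * Ω i x) x ∂μT = 0 := integral_pd (hG2 i) i
  rw [k1, k2]; simp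

end

end

section

section

/-- Smoothed velocity. -/
def UU (J : ℕ) (u : Vec → Vec) (j : Fin 3) : Vec → ℂ := smK (KJ J) (uC u j)

lemma UU_Sm (J : ℕ) {u : Vec → Vec} (hu : SmV u) (j : Fin 3) : Sm (UU J u j) := smK_Sm J (hu.comp j)

lemma UU_div (J : ℕ) {u : Vec → Vec} (hu : SmV u) (x : Vec) : ∑ i, pd i (UU J u i) x = 0 := by
  have hP := (KJ_PK J).prob
  have e : ∀ i, pd i (UU J u i) x = ∫ y, pd i (uC u i) (x + y) ∂PP (KJ J) := fun i => by
    rw [UU, pd_smK J (hu.comp i)]; rfl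
  simp only [e]
  have i1 : ∀ i, Integrable (fun y => pd i (uC u i) (x + y)) (PP (KJ J)) := fun i =>
    (KJ_PK J).int_bdd (((hu.comp i).pd i).continuous.comp (continuous_const.add continuous_id)) fun y n => by
      rw [← add_assoc, ((hu.comp i).pd i).per]
  rw [← integral_finsetSum _ fun i _ => i1 i]
  simp [hu.divC]

lemma curl_pd_eLp {γ : ℝ} {b : ℝ≥0∞} (hγ : γ < 1) (J : ℕ) {u : Vec → Vec} (hu : SmV u)
    (hb : ∀ i, ∀ j : ℕ, eLpNorm (lpBlockC j (fcV u i)) 3 μT ≤ ENNReal.ofReal ((2:ℝ) ^ (-γ * j)) * b)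
    (i j : Fin 3) : eLpNorm (pd i (curlS (UU J u) j)) 3 μT ≤
      ENNReal.ofReal (2048 * Real.pi ^ 2 * gC (2 - γ) * (2:ℝ) ^ ((2 - γ) * J) * 2 ^ (-(2*γ))) * b := by
  have hU := UU_Sm J hu
  have hg := gC_pos (α := 2 - γ) (by linarith)
  have e : pd i (curlS (UU J u) j) = pd i (pd (j+1) (UU J u (j+2))) - pd i (pd (j+2) (UU J u (j+1))) :=
    funext fun x => pd_subS ((hU _).pd _) ((hU _).pd _) i x
  rw [e]
  refine (eLpNorm_sub_le (((hU _).pd _).pd _).continuous.aestronglyMeasurable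
    (((hU _).pd _).pd _).continuous.aestronglyMeasurable (by norm_num)).trans ?_
  refine (add_le_add (smK_pd2 hγ (hu.comp _) (hb _) _ _ J) (smK_pd2 hγ (hu.comp _) (hb _) _ _ J)).trans (le_of_eq ?_)
  rw [← add_mul, ← ENNReal.ofReal_add (by positivity) (by positivity)]
  congr 2; ring

def CF (γ : ℝ) : ℝ := 9 * (784 * Cρ γ ^ 2 * (2048 * Real.pi ^ 2 * gC (2 - γ) * 2 ^ (-(2*γ))))

lemma CF_nonneg {γ : ℝ} (h1 : γ < 1) : 0 ≤ CF γ := by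
  have hg := gC_pos (α := 2 - γ) (by linarith)
  unfold CF; positivity

lemma flux_le {γ : ℝ} {b : ℝ≥0∞} (h0 : 0 < γ) (h1 : γ < 1) (J : ℕ) {u : Vec → Vec} (hu : SmV u)
    (hb : ∀ i, ∀ j : ℕ, eLpNorm (lpBlockC j (fcV u i)) 3 μT ≤ ENNReal.ofReal ((2:ℝ) ^ (-γ * j)) * b) :
    ‖∑ i, ∑ j, ∫ x, smK (KJ J) (fun y => uC u i y * uC u j y) x * pd i (curlS (UU J u) j) x ∂μT‖ₑ ≤
      ENNReal.ofReal (CF γ * (2:ℝ) ^ ((2 - 3 * γ) * J)) * b ^ 3 := by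
  have hU := UU_Sm J hu
  have hg := gC_pos (α := 2 - γ) (by linarith)
  have hz := flux_zero hU (UU_div J hu)
  have hW : ∀ i j, Sm (pd i (curlS (UU J u) j)) := fun i j => (curlS_sm hU j).pd i
  have hm : ∀ i j, Sm (fun y => uC u i y * uC u j y) := fun i j => (hu.comp i).mul (hu.comp j)
  have e : ∑ i, ∑ j, ∫ x, smK (KJ J) (fun y => uC u i y * uC u j y) x * pd i (curlS (UU J u) j) x ∂μT =
      ∑ i, ∑ j, ∫ x, (smK (KJ J) (fun y => uC u i y * uC u j y) x - smK (KJ J) (uC u i) x * smK (KJ J) (uC u j) x)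
        * pd i (curlS (UU J u) j) x ∂μT := by
    rw [← sub_zero (∑ i, ∑ j, _), ← hz, ← Finset.sum_sub_distrib]
    refine Finset.sum_congr rfl fun i _ => ?_
    rw [← Finset.sum_sub_distrib]
    refine Finset.sum_congr rfl fun j _ => ?_
    rw [← integral_sub ((smK_Sm J (hm i j)).mul (hW i j)).integrable (((hU i).mul (hU j)).mul (hW i j)).integrable]
    refine integral_congr_ae (Eventually.of_forall fun x => ?_)
    simp only [UU]; ring
  rw [e]
  have key : ∀ i j, ‖∫ x, (smK (KJ J) (fun y => uC u i y * uC u j y) x - smK (KJ J) (uC u i) x * smK (KJ J) (uC u j) x)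
        * pd i (curlS (UU J u) j) x ∂μT‖ₑ ≤ ENNReal.ofReal (CF γ / 9 * (2:ℝ) ^ ((2 - 3 * γ) * J)) * b ^ 3 := by
    intro i j
    refine (trilin J h0 h1 (hu.comp i) (hu.comp j) (hW i j) (hb i) (hb j)).trans ?_
    refine (mul_le_mul_right (curl_pd_eLp h1 J hu hb i j) _).trans (le_of_eq ?_)
    have : CF γ / 9 * (2:ℝ) ^ ((2 - 3 * γ) * J) = (784 * Cρ γ ^ 2 * (2:ℝ) ^ (-(2 * γ) * J)) *
        (2048 * Real.pi ^ 2 * gC (2 - γ) * (2:ℝ) ^ ((2 - γ) * J) * 2 ^ (-(2*γ))) := by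
      rw [show (2 - 3 * γ) * (J:ℝ) = -(2 * γ) * J + (2 - γ) * J by ring, Real.rpow_add two_pos, CF]; ring
    rw [this, ENNReal.ofReal_mul (p := 784 * Cρ γ ^ 2 * (2:ℝ) ^ (-(2 * γ) * J)) (by positivity)]; ring
  refine (enorm_sum_le _ _).trans ?_
  refine (Finset.sum_le_sum fun i _ => (enorm_sum_le _ _).trans (Finset.sum_le_sum fun j _ => key i j)).trans (le_of_eq ?_)
  simp only [Finset.sum_const, Finset.card_univ, Fintype.card_fin, nsmul_eq_mul]
  have : CF γ * (2:ℝ) ^ ((2 - 3 * γ) * J) = 9 * (CF γ / 9 * (2:ℝ) ^ ((2 - 3 * γ) * J)) := by ring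
  rw [this, ENNReal.ofReal_mul (p := 9) (by norm_num), show ENNReal.ofReal 9 = 9 by simp]
  push_cast
  ring

end

end

section

section

lemma ftc_bound {f f' : ℝ → ℂ} {T : ℝ} {g : ℝ → ℝ≥0∞} (hd : ∀ t ∈ Set.Ioo 0 T, HasDerivAt f (f' t) t)
    (hb : ∀ t ∈ Set.Ioo 0 T, ‖f' t‖ₑ ≤ g t) (hg : ∫⁻ t, g t ∂tIoo T ≠ ∞) {t₁ t₂ : ℝ}
    (h₁ : t₁ ∈ Set.Ioo 0 T) (h₂ : t₂ ∈ Set.Ioo 0 T) : ‖f t₁ - f t₂‖ₑ ≤ ∫⁻ t, g t ∂tIoo T := by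
  wlog hle : t₂ ≤ t₁ generalizing t₁ t₂
  · have := this h₂ h₁ (le_of_not_ge hle)
    rwa [← enorm_neg, neg_sub]
  have hsub : Set.Icc t₂ t₁ ⊆ Set.Ioo 0 T := fun s hs => ⟨h₂.1.trans_le hs.1, hs.2.trans_lt h₁.2⟩
  have hsub2 : Set.Ioc t₂ t₁ ⊆ Set.Ioo 0 T := Set.Ioc_subset_Icc_self.trans hsub
  have hfin : ∫⁻ t in Set.Ioc t₂ t₁, ‖deriv f t‖ₑ ≤ ∫⁻ t, g t ∂tIoo T := by
    calc _ ≤ ∫⁻ t in Set.Ioc t₂ t₁, g t := by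
          refine setLIntegral_mono' measurableSet_Ioc fun t ht => ?_
          rw [(hd t (hsub2 ht)).deriv]; exact hb t (hsub2 ht)
      _ ≤ _ := lintegral_mono_set hsub2
  have hi : IntervalIntegrable (deriv f) volume t₂ t₁ := by
    rw [intervalIntegrable_iff_integrableOn_Ioc_of_le hle]
    exact ⟨(measurable_deriv f).aestronglyMeasurable, lt_of_le_of_lt hfin hg.lt_top⟩
  have h := intervalIntegral.integral_eq_sub_of_hasDerivAt (f := f) (f' := deriv f) (a := t₂) (b := t₁)
    (fun s hs => by
      rw [Set.uIcc_of_le hle] at hs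
      exact (hd s (hsub hs)).differentiableAt.hasDerivAt) hi
  rw [← h, intervalIntegral.integral_of_le hle]
  exact (enorm_integral_le_lintegral_enorm _).trans hfin

lemma FJ_neg {J : ℕ} {k : Lat} : -k ∈ FJ J ↔ k ∈ FJ J := by
  rw [mem_FJ, mem_FJ, latNorm_neg]

lemma sum_FJ_neg (J : ℕ) (F : Lat → ℂ) : ∑ k ∈ FJ J, F (-k) = ∑ k ∈ FJ J, F k :=
  Finset.sum_equiv (Equiv.neg _) (fun k => by simp [FJ_neg]) (fun k _ => rfl)

/-- Smoothed helicity. -/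
def HJ (J : ℕ) (c : Fin 3 → Lat → ℂ) : ℂ :=
  ∑ k ∈ FJ (J + 2), mm (KJ J) k * mm (KJ J) (-k) * ∑ j, tpi * crs k (fun i => c i k) j * c j (-k)

lemma HJ_deriv (J : ℕ) {c : ℝ → Fin 3 → Lat → ℂ} {F : Fin 3 → Lat → ℂ} {t : ℝ}
    (h : ∀ j k, HasDerivAt (fun s => c s j k) (F j k) t) :
    HasDerivAt (fun s => HJ J (c s)) (2 * ∑ k ∈ FJ (J + 2), mm (KJ J) k * mm (KJ J) (-k) *
      ∑ j, F j (-k) * (tpi * crs k (fun i => c t i k) j)) t := by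
  have h1 : HasDerivAt (fun s => HJ J (c s)) (∑ k ∈ FJ (J + 2), mm (KJ J) k * mm (KJ J) (-k) *
      ∑ j, (tpi * crs k (fun i => F i k) j * c t j (-k) + tpi * crs k (fun i => c t i k) j * F j (-k))) t := by
    unfold HJ
    refine HasDerivAt.fun_sum fun k _ => HasDerivAt.const_mul _ (HasDerivAt.fun_sum fun j _ => ?_)
    have hc : HasDerivAt (fun s => tpi * crs k (fun i => c s i k) j) (tpi * crs k (fun i => F i k) j) t :=
      (((h _ k).const_mul _).sub ((h _ k).const_mul _)).const_mul _
    exact hc.mul (h j (-k))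
  have e : ∑ k ∈ FJ (J + 2), mm (KJ J) k * mm (KJ J) (-k) *
      ∑ j, (tpi * crs k (fun i => F i k) j * c t j (-k) + tpi * crs k (fun i => c t i k) j * F j (-k)) =
      2 * ∑ k ∈ FJ (J + 2), mm (KJ J) k * mm (KJ J) (-k) *
      ∑ j, F j (-k) * (tpi * crs k (fun i => c t i k) j) := by
    simp only [Finset.sum_add_distrib, mul_add]
    rw [two_mul]
    congr 1
    · rw [← sum_FJ_neg]
      refine Finset.sum_congr rfl fun k _ => ?_
      rw [neg_neg, crs_neg k (fun i => F i (-k)) (fun j => c t j k)]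
      ring
    · refine Finset.sum_congr rfl fun k _ => ?_
      congr 1
      exact Finset.sum_congr rfl fun j _ => by ring
  rw [e] at h1; exact h1

lemma crs_smul (k : Lat) (a : ℂ) (c : Fin 3 → ℂ) (j : Fin 3) : crs k (fun i => a * c i) j = a * crs k c j := by
  unfold crs; ring

lemma NL_eq (J : ℕ) {u : Vec → Vec} (hu : SmV u) :
    ∑ k ∈ FJ (J + 2), mm (KJ J) k * mm (KJ J) (-k) *
      ∑ j, PC (fcV u) j (-k) * (tpi * crs k (fun i => fcV u i k) j) =
    ∑ i, ∑ j, ∫ x, smK (KJ J) (fun y => uC u i y * uC u j y) x * pd i (curlS (UU J u) j) x ∂μT := by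
  have hU := UU_Sm J hu
  have hW : ∀ i j, Sm (pd i (curlS (UU J u) j)) := fun i j => (curlS_sm hU j).pd i
  have hm : ∀ i j, Sm (fun y => uC u i y * uC u j y) := fun i j => (hu.comp i).mul (hu.comp j)
  have fW : ∀ i j k, fc (pd i (curlS (UU J u) j)) k = tpi * (k i : ℂ) * (tpi * (mm (KJ J) k * crs k (fun i => fcV u i k) j)) := by
    intro i j k
    rw [fc_pd' (curlS_sm hU j), fc_curlS hU]
    have : (fun i => fc (UU J u i) k) = fun i => mm (KJ J) k * fcV u i k := by
      funext i; exact fc_smK J (hu.comp i) k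
    rw [this, crs_smul]
  have e : ∀ i j, ∫ x, smK (KJ J) (fun y => uC u i y * uC u j y) x * pd i (curlS (UU J u) j) x ∂μT =
      ∑ k ∈ FJ (J + 2), mm (KJ J) (-k) * qC (fcV u) i j (-k) *
        (tpi * (k i : ℂ) * (tpi * (mm (KJ J) k * crs k (fun i => fcV u i k) j))) := by
    intro i j
    rw [smK_eq J (hm i j)]
    simp only [SJ, Finset.sum_mul]
    rw [integral_finsetSum _ fun k _ => (((Sm.chr k).const_mul _).mul (hW i j)).integrable]
    rw [← sum_FJ_neg]
    refine Finset.sum_congr rfl fun k _ => ?_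
    rw [← fW, hu.q, fc_def, ← integral_const_mul]
    refine integral_congr_ae (Eventually.of_forall fun x => ?_)
    dsimp only; ring
  simp only [e]
  simp only [PC_crs]
  have e2 : ∀ i, ∑ j, ∑ k ∈ FJ (J + 2), mm (KJ J) (-k) * qC (fcV u) i j (-k) *
        (tpi * (k i : ℂ) * (tpi * (mm (KJ J) k * crs k (fun i => fcV u i k) j))) =
      ∑ k ∈ FJ (J + 2), ∑ j, mm (KJ J) (-k) * qC (fcV u) i j (-k) *
        (tpi * (k i : ℂ) * (tpi * (mm (KJ J) k * crs k (fun i => fcV u i k) j))) := fun i => Finset.sum_comm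
  simp only [e2]
  rw [Finset.sum_comm]
  refine Finset.sum_congr rfl fun k _ => ?_
  rw [Finset.mul_sum, Finset.sum_comm]
  refine Finset.sum_congr rfl fun j _ => ?_
  rw [NC, ← Finset.sum_neg_distrib, Finset.sum_mul, Finset.mul_sum]
  refine Finset.sum_congr rfl fun i _ => ?_
  simp only [Pi.neg_apply, Int.cast_neg]
  ring

/-- Constant for the viscous contribution. -/
def VJ (J : ℕ) (M : ℝ) : ℝ :=
  2 * ∑ k ∈ FJ (J + 2), ∑ _j : Fin 3, 4 * Real.pi ^ 2 * latSq k * M * (2 * Real.pi * (wt k ^ (1/2:ℝ) * (M + M)))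

lemma VJ_nonneg (J : ℕ) {M : ℝ} (hM : 0 ≤ M) : 0 ≤ VJ J M := by
  unfold VJ
  refine mul_nonneg two_pos.le (Finset.sum_nonneg fun k _ => Finset.sum_nonneg fun j _ => ?_)
  have := wt_pos k
  rw [latSq_eq]; positivity

lemma visc_le (J : ℕ) {β M ν : ℝ} (hβ : 0 ≤ β) (hM : 0 ≤ M) (hν : 0 ≤ ν) {c : Fin 3 → Lat → ℂ} (h : ∀ j, HB β M (c j)) :
    ‖2 * ∑ k ∈ FJ (J + 2), mm (KJ J) k * mm (KJ J) (-k) *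
      ∑ j, (-((4 * Real.pi ^ 2 * ν * latSq (-k) : ℝ) : ℂ) * c j (-k)) * (tpi * crs k (fun i => c i k) j)‖ ≤ ν * VJ J M := by
  rw [norm_mul, VJ, mul_left_comm ν, Finset.mul_sum]
  simp only [Complex.norm_ofNat]
  gcongr
  refine (norm_sum_le _ _).trans (Finset.sum_le_sum fun k _ => ?_)
  rw [norm_mul, norm_mul, Finset.mul_sum]
  have hk := wt_pos k
  have hs : latSq (-k) = latSq k := by rw [latSq_eq, latSq_eq, latNorm_neg]
  have hs0 : 0 ≤ latSq k := by rw [latSq_eq]; positivity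
  calc _ ≤ 1 * 1 * ‖∑ j, (-((4 * Real.pi ^ 2 * ν * latSq (-k) : ℝ) : ℂ) * c j (-k)) * (tpi * crs k (fun i => c i k) j)‖ := by
        gcongr
        · exact (KJ_PK J).mm_le _
        · exact (KJ_PK J).mm_le _
    _ ≤ _ := by
        rw [one_mul, one_mul]
        refine (norm_sum_le _ _).trans (Finset.sum_le_sum fun j _ => ?_)
        rw [norm_mul, norm_mul, norm_mul, norm_tpi, norm_neg, Complex.norm_real, hs, Real.norm_eq_abs,
          abs_of_nonneg (by positivity)]
        have h1 := (h j).pt0 hβ hM (-k)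
        have h2 := crs_norm k (fun i => c i k) j
        have h3 := (h (j+2)).pt0 hβ hM k
        have h4 := (h (j+1)).pt0 hβ hM k
        calc _ ≤ 4 * Real.pi ^ 2 * ν * latSq k * M * (2 * Real.pi * (wt k ^ (1/2:ℝ) * (M + M))) := by
              gcongr
              exact h2.trans (by gcongr)
          _ = _ := by ring

end

end

section

section

lemma bil_summable {M : ℝ} (hM : 0 ≤ M) {c d : Lat → ℂ} (hc : HB (1/2) M c) (hd : HB (1/2) M d) :
    Summable fun k : Lat => wt k ^ (1/2:ℝ) * ‖c k‖ * ‖d (-k)‖ := by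
  have h2 : ∀ s : Finset Lat, ∑ k ∈ s, (wt (-k) ^ ((1/2:ℝ)/2) * ‖d (-k)‖) ^ 2 ≤ M ^ 2 := by
    intro s
    have := hd.sq (s.map (Equiv.neg Lat).toEmbedding)
    rw [Finset.sum_map] at this
    exact this
  have h := (cs_sum hM hM (fun k => by have := wt_pos k; positivity)
    (fun k => by have := wt_pos (-k); positivity) hc.sq h2).1
  refine h.congr fun k => ?_
  have hk := wt_pos k
  rw [wt_neg]
  have : wt k ^ (1/2:ℝ) = wt k ^ ((1/2:ℝ)/2) * wt k ^ ((1/2:ℝ)/2) := by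
    rw [← Real.rpow_add hk]; norm_num
  rw [this]; ring

lemma hel_bound (k : Lat) (c : Fin 3 → Lat → ℂ) (j : Fin 3) :
    ‖tpi * crs k (fun i => c i k) j * c j (-k)‖ ≤ 2 * Real.pi *
      (wt k ^ (1/2:ℝ) * ‖c (j+2) k‖ * ‖c j (-k)‖ + wt k ^ (1/2:ℝ) * ‖c (j+1) k‖ * ‖c j (-k)‖) := by
  have := crs_norm k (fun i => c i k) j
  rw [norm_mul, norm_mul, norm_tpi]
  calc _ ≤ 2 * Real.pi * (wt k ^ (1/2:ℝ) * (‖c (j+2) k‖ + ‖c (j+1) k‖)) * ‖c j (-k)‖ := by gcongr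
    _ = _ := by ring

lemma HJ_lim {M : ℝ} (hM : 0 ≤ M) {c : Fin 3 → Lat → ℂ} (hc : ∀ j, HB (1/2) M (c j)) :
    Tendsto (fun J => HJ J c) atTop (𝓝 (∑ j, ∑' k, tpi * crs k (fun i => c i k) j * c j (-k))) := by
  have e : ∀ J, HJ J c = ∑ j, ∑' k, mm (KJ J) k * mm (KJ J) (-k) * (tpi * crs k (fun i => c i k) j * c j (-k)) := by
    intro J
    have : ∀ j, ∑' k, mm (KJ J) k * mm (KJ J) (-k) * (tpi * crs k (fun i => c i k) j * c j (-k)) =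
        ∑ k ∈ FJ (J+2), mm (KJ J) k * mm (KJ J) (-k) * (tpi * crs k (fun i => c i k) j * c j (-k)) := by
      intro j
      refine tsum_eq_sum fun k hk => ?_
      rw [KJ_supp hk]; ring
    simp only [this]
    rw [Finset.sum_comm]
    unfold HJ
    refine Finset.sum_congr rfl fun k _ => ?_
    rw [Finset.mul_sum]
  simp only [e]
  refine tendsto_finsetSum _ fun j _ => ?_
  refine tendsto_tsum_of_dominated_convergence
    (((bil_summable hM (hc (j+2)) (hc j)).add (bil_summable hM (hc (j+1)) (hc j))).mul_left (2 * Real.pi))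
    (fun k => ?_) (Eventually.of_forall fun J k => ?_)
  · have := ((KJ_tendsto k).mul (KJ_tendsto (-k))).mul_const (tpi * crs k (fun i => c i k) j * c j (-k))
    simpa using this
  · refine le_trans ?_ (hel_bound k c j)
    rw [norm_mul, norm_mul]
    have h1 := (KJ_PK J).mm_le k
    have h2 := (KJ_PK J).mm_le (-k)
    have h3 : ‖mm (KJ J) k‖ * ‖mm (KJ J) (-k)‖ ≤ 1 := mul_le_one₀ h1 (norm_nonneg _) h2
    exact mul_le_of_le_one_left (norm_nonneg _) h3

lemma HJ_cont (J : ℕ) {c : ℕ → Fin 3 → Lat → ℂ} {d : Fin 3 → Lat → ℂ}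
    (h : ∀ j k, Tendsto (fun n => c n j k) atTop (𝓝 (d j k))) :
    Tendsto (fun n => HJ J (c n)) atTop (𝓝 (HJ J d)) := by
  unfold HJ crs
  refine tendsto_finsetSum _ fun k _ => Tendsto.const_mul _ (tendsto_finsetSum _ fun j _ => ?_)
  exact (((h _ _).const_mul _).sub ((h _ _).const_mul _)).const_mul _ |>.mul (h _ _)

lemma blocks_le {α : ℝ} {u : Vec → Vec} {γ : ℝ} (hγ : γ ≤ α) (i : Fin 3) (j : ℕ) :
    eLpNorm (lpBlockC j (fcV u i)) 3 μT ≤ ENNReal.ofReal (2 ^ (-γ * (j:ℝ))) * besovV α 3 ∞ u := by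
  refine (block_le_bes α (fcV u i) j).trans ?_
  refine mul_le_mul' (ENNReal.ofReal_le_ofReal ?_) ?_
  · refine Real.rpow_le_rpow_of_exponent_le (by norm_num) ?_
    have : (0:ℝ) ≤ j := by positivity
    nlinarith
  · rw [besovV_eq]
    exact Finset.single_le_sum (f := fun j => bes α (fcV u j)) (fun _ _ => zero_le) (Finset.mem_univ i)

lemma Dat.HJ_der_le {T α β M B : ℝ} {ν : ℕ → ℝ} {u : ℕ → ℝ → Vec → Vec} (h : Dat T α β M B ν u)
    {γ : ℝ} (h0 : 0 < γ) (h1 : γ < 1) (hγ : γ ≤ α) (J n : ℕ) {t : ℝ} (ht : t ∈ Set.Ioo 0 T) :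
    ‖2 * ∑ k ∈ FJ (J + 2), mm (KJ J) k * mm (KJ J) (-k) *
      ∑ j, FC (ν n) (fcV (u n t)) j (-k) * (tpi * crs k (fun i => fcV (u n t) i k) j)‖ₑ ≤
    ENNReal.ofReal (ν n * VJ J M) +
      ENNReal.ofReal (2 * (CF γ * 2 ^ ((2 - 3 * γ) * (J:ℝ)))) * besovV α 3 ∞ (u n t) ^ (3:ℝ) := by
  have e : (2 * ∑ k ∈ FJ (J + 2), mm (KJ J) k * mm (KJ J) (-k) *
      ∑ j, FC (ν n) (fcV (u n t)) j (-k) * (tpi * crs k (fun i => fcV (u n t) i k) j)) =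
      2 * (∑ k ∈ FJ (J + 2), mm (KJ J) k * mm (KJ J) (-k) *
      ∑ j, -((4 * Real.pi ^ 2 * ν n * latSq (-k) : ℝ) : ℂ) * fcV (u n t) j (-k) * (tpi * crs k (fun i => fcV (u n t) i k) j)) +
      2 * (∑ k ∈ FJ (J + 2), mm (KJ J) k * mm (KJ J) (-k) *
      ∑ j, PC (fcV (u n t)) j (-k) * (tpi * crs k (fun i => fcV (u n t) i k) j)) := by
    rw [← mul_add, ← Finset.sum_add_distrib]
    congr 1
    refine Finset.sum_congr rfl fun k _ => ?_
    rw [← mul_add, ← Finset.sum_add_distrib]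
    congr 1
    refine Finset.sum_congr rfl fun j _ => ?_
    rw [FC_eq, add_mul]
  rw [e]
  refine (enorm_add_le _ _).trans (add_le_add ?_ ?_)
  · have hv := visc_le J (by linarith [h.hβ] : (0:ℝ) ≤ β) h.hM (h.hν n).le (h.hb n t ht)
    rw [← ofReal_norm]
    exact ENNReal.ofReal_le_ofReal hv
  · rw [NL_eq J (h.sm n t ht), enorm_mul]
    have hf := flux_le h0 h1 J (h.sm n t ht) (blocks_le hγ)
    rw [ENNReal.rpow_ofNat, ENNReal.ofReal_mul (p := 2) (by norm_num), mul_assoc]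
    refine mul_le_mul' (le_of_eq ?_) hf
    rw [← ofReal_norm]; norm_num

lemma Dat.HJ_var {T α β M B : ℝ} {ν : ℕ → ℝ} {u : ℕ → ℝ → Vec → Vec} (h : Dat T α β M B ν u)
    {γ : ℝ} (h0 : 0 < γ) (h1 : γ < 1) (hγ : γ ≤ α) (J n : ℕ) {t₁ t₂ : ℝ}
    (ht₁ : t₁ ∈ Set.Ioo 0 T) (ht₂ : t₂ ∈ Set.Ioo 0 T) :
    ‖HJ J (fcV (u n t₁)) - HJ J (fcV (u n t₂))‖ ≤
      ν n * VJ J M * T + 2 * (CF γ * 2 ^ ((2 - 3 * γ) * (J:ℝ))) * B := by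
  have hV := VJ_nonneg J h.hM
  have hC := CF_nonneg h1
  have hn := (h.hν n).le
  have hB := h.hB
  have hT := h.hT.le
  have hI : ∫⁻ t, (ENNReal.ofReal (ν n * VJ J M) +
      ENNReal.ofReal (2 * (CF γ * 2 ^ ((2 - 3 * γ) * (J:ℝ)))) * besovV α 3 ∞ (u n t) ^ (3:ℝ)) ∂tIoo T ≤
      ENNReal.ofReal (ν n * VJ J M * T + 2 * (CF γ * 2 ^ ((2 - 3 * γ) * (J:ℝ))) * B) := by
    rw [lintegral_add_left measurable_const, lintegral_const_mul' _ _ ENNReal.ofReal_ne_top,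
      ENNReal.ofReal_add (by positivity) (by positivity),
      ENNReal.ofReal_mul (p := ν n * VJ J M) (by positivity),
      ENNReal.ofReal_mul (p := 2 * (CF γ * 2 ^ ((2 - 3 * γ) * (J:ℝ)))) (by positivity)]
    refine add_le_add (le_of_eq ?_) (mul_le_mul' le_rfl (h.bes n))
    rw [lintegral_const, tIoo]
    simp
  have := ftc_bound (f := fun t => HJ J (fcV (u n t))) (fun t ht => HJ_deriv J (h.der n t ht))
    (fun t ht => h.HJ_der_le h0 h1 hγ J n ht) (hI.trans_lt ENNReal.ofReal_lt_top).ne ht₁ ht₂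
  have h2 := this.trans hI
  rw [← ofReal_norm] at h2
  exact (ENNReal.ofReal_le_ofReal_iff (by positivity)).1 h2

lemma Lim.HJ_const {T α β M B : ℝ} {ν : ℕ → ℝ} {u : ℕ → ℝ → Vec → Vec} {v : ℝ → Vec → Vec}
    {c : ℝ → Fin 3 → Lat → ℂ} (h : Lim T α β M B ν u v c) {t₁ t₂ : ℝ}
    (ht₁ : t₁ ∈ Set.Ioo 0 T) (ht₂ : t₂ ∈ Set.Ioo 0 T) :
    ∑ j, ∑' k, tpi * crs k (fun i => c t₁ i k) j * c t₁ j (-k) =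
      ∑ j, ∑' k, tpi * crs k (fun i => c t₂ i k) j * c t₂ j (-k) := by
  obtain ⟨γ, g0, g1, g2⟩ : ∃ γ : ℝ, 2/3 < γ ∧ γ < 1 ∧ γ ≤ α :=
    ⟨min α (3/4), lt_min h.dat.hα (by norm_num), (min_le_right _ _).trans_lt (by norm_num), min_le_left _ _⟩
  have hJ : ∀ J : ℕ, ‖HJ J (c t₁) - HJ J (c t₂)‖ ≤ 2 * (CF γ * 2 ^ ((2 - 3 * γ) * (J:ℝ))) * B := by
    intro J
    have l1 := ((HJ_cont J (h.tendsto ht₁)).sub (HJ_cont J (h.tendsto ht₂))).norm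
    have l2 : Tendsto (fun n => ν n * VJ J M * T + 2 * (CF γ * 2 ^ ((2 - 3 * γ) * (J:ℝ))) * B) atTop
        (𝓝 (2 * (CF γ * 2 ^ ((2 - 3 * γ) * (J:ℝ))) * B)) := by
      have := ((h.dat.hν0.mul_const (VJ J M)).mul_const T).add_const (2 * (CF γ * 2 ^ ((2 - 3 * γ) * (J:ℝ))) * B)
      simpa using this
    exact le_of_tendsto_of_tendsto' l1 l2 fun n => h.dat.HJ_var (by linarith) g1 g2 J n ht₁ ht₂
  have hb : ∀ t ∈ Set.Ioo 0 T, ∀ j, HB (1/2) M (c t j) := fun t ht j => (h.hb ht j).mono h.dat.hβ.le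
  have l1 := ((HJ_lim h.dat.hM (hb t₁ ht₁)).sub (HJ_lim h.dat.hM (hb t₂ ht₂))).norm
  have l2 : Tendsto (fun J : ℕ => 2 * (CF γ * 2 ^ ((2 - 3 * γ) * (J:ℝ))) * B) atTop (𝓝 0) := by
    have e : ∀ J : ℕ, (2:ℝ) ^ ((2 - 3 * γ) * (J:ℝ)) = ((2:ℝ) ^ (2 - 3 * γ)) ^ J := fun J => by
      rw [Real.rpow_mul (by norm_num), Real.rpow_natCast]
    have h3 : (2:ℝ) ^ (2 - 3 * γ) < 1 := Real.rpow_lt_one_of_one_lt_of_neg (by norm_num) (by linarith)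
    have := (((tendsto_pow_atTop_nhds_zero_of_lt_one (by positivity) h3).const_mul (CF γ)).const_mul 2).mul_const B
    simp only [e]
    simpa using this
  have h0 := le_of_tendsto_of_tendsto' l1 l2 hJ
  exact sub_eq_zero.1 (norm_le_zero_iff.1 h0)

lemma Lim.helicity {T α β M B : ℝ} {ν : ℕ → ℝ} {u : ℕ → ℝ → Vec → Vec} {v : ℝ → Vec → Vec}
    {c : ℝ → Fin 3 → Lat → ℂ} (h : Lim T α β M B ν u v c) :
    ∀ᵐ t₁ ∂tIoo T, ∀ᵐ t₂ ∂tIoo T, hel (v t₁) = hel (v t₂) := by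
  have hae : ∀ᵐ t ∂tIoo T, t ∈ Set.Ioo 0 T := ae_restrict_mem measurableSet_Ioo
  have key : ∀ t, fcV (v t) = c t →
      hel (v t) = ∑ j, ∑' k, tpi * crs k (fun i => c t i k) j * c t j (-k) := by
    intro t ht
    rw [← ht]; rfl
  filter_upwards [h.ae, hae] with t₁ a₁ b₁
  filter_upwards [h.ae, hae] with t₂ a₂ b₂
  rw [key _ a₁.2, key _ a₂.2, h.HJ_const b₁ b₂]

end

end

/-- vanishing viscosity limit.  A sequence of strong solutions of the
Navier-Stokes equations, uniformly bounded in
`L³((0,T); B^α_{3,∞}) ∩ L^∞((0,T); H^β)` with `α > 2/3`, `β > 1/2`, has a subsequence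
converging strongly in `L³(𝕋³×(0,T))`; every such limit is in fact a limit in
`L³ B^{α-θ}_{3,∞} ∩ L^∞ H^{β-θ}` for every `θ > 0`, is a functional vorticity solution
of the Euler equations, and conserves the global helicity. -/
theorem vanishing_viscosity_helicity_conservation
    (T α β : ℝ) (hT : 0 < T) (hα : 2/3 < α) (hβ : 1/2 < β)
    (ν : ℕ → ℝ) (hν : ∀ n, 0 < ν n) (hν0 : Tendsto ν atTop (𝓝 0))
    (u : ℕ → ℝ → Vec → Vec)
    (hsol : ∀ n, IsStrongNS (ν n) T (u n))
    (hbd : ∃ M : ℝ≥0∞, M < ∞ ∧ ∀ n,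
      timeNorm 3 T (fun t => besovV α 3 ∞ (u n t)) ≤ M ∧
      timeNorm ∞ T (fun t => HsNormV β (u n t)) ≤ M) :
    (∃ g : ℕ → ℕ, StrictMono g ∧ ∃ v : ℝ → Vec → Vec,
      Measurable (Function.uncurry v) ∧ (∀ t, Per (v t)) ∧ L3conv T (fun j => u (g j)) v) ∧
    ∀ (g : ℕ → ℕ), StrictMono g → ∀ v : ℝ → Vec → Vec,
      Measurable (Function.uncurry v) → (∀ t, Per (v t)) →
      L3conv T (fun j => u (g j)) v →
      (∀ θ : ℝ, 0 < θ →
        Tendsto (fun j => timeNorm 3 T fun t =>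
            besovV (α - θ) 3 ∞ fun x => u (g j) t x - v t x) atTop (𝓝 0) ∧
        Tendsto (fun j => timeNorm ∞ T fun t =>
            HsNormV (β - θ) fun x => u (g j) t x - v t x) atTop (𝓝 0)) ∧
      IsFVS T v ∧
      (∀ᵐ t₁ ∂tIoo T, ∀ᵐ t₂ ∂tIoo T, hel (v t₁) = hel (v t₂)) := by
  obtain ⟨M, B, h⟩ := mk_dat hT hα hβ hν hν0 hsol hbd
  refine ⟨h.part_i, fun g hg v hv hp hL => ?_⟩
  obtain ⟨c, hc⟩ := (h.subseq hg).lim hv hp hL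
  exact ⟨fun θ hθ => ⟨hc.conv_bes hθ, hc.conv_hs hθ⟩, hc.fvs, hc.helicity⟩

end PaperHelicity
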